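/- There exists γ₀ > 0 such that for every 0 < γ < γ₀ there exists α = α(γ) > 0 with the following property: for every κ ∈ (0,1), the probability of the event that, simultaneously for all x, y ∈ V_N with ‖x − y‖ ≥ κN, every path joining x and y inside V_N that attains the minimal Liouville first passage percolation weight contains more than N^{1+α} lattice points, tends to 1 as N → ∞. -/

import Mathlib

open MeasureTheory ProbabilityTheory Real Set Filter

/-- The lattice ℤ². -/
abbrev Z2 := ℤ × ℤ

/-- Nearest-neighbor adjacency on ℤ². -/
def Adj (x y : Z2) : Prop := |x.1 - y.1| + |x.2 - y.2| = 1

/-- The `L^∞` distance on ℤ². -/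
def linf (x y : Z2) : ℤ := max |x.1 - y.1| |x.2 - y.2|

/-- The Euclidean distance on ℤ². -/
noncomputable def eZ (x y : Z2) : ℝ :=
  Real.sqrt (((x.1 - y.1 : ℤ) : ℝ) ^ 2 + ((x.2 - y.2 : ℤ) : ℝ) ^ 2)

/-- Inner boundary `∂B` of a set `B ⊆ ℤ²`: points of `B` having a nearest neighbor
outside `B`. -/
def bdry (B : Set Z2) : Set Z2 := {z | z ∈ B ∧ ∃ w, Adj z w ∧ w ∉ B}

/-- Number of nearest-neighbor paths of length `t` from `x` to `y` avoiding `∂B`. -/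
noncomputable def nWalks (B : Set Z2) (t : ℕ) (x y : Z2) : ℕ :=
  Nat.card {f : Fin (t + 1) → Z2 //
    f 0 = x ∧ f (Fin.last t) = y ∧ (∀ i, f i ∉ bdry B) ∧
    ∀ i : Fin t, Adj (f i.castSucc) (f i.succ)}

/-- The Green function of simple random walk on ℤ² killed upon hitting `∂B`:
`G_B(x,y) = E_x [∑_{t=0}^{τ-1} 1_{S_t = y}]`, where `τ` is the hitting time of `∂B`. -/
noncomputable def greenFn (B : Set Z2) (x y : Z2) : ℝ :=
  ∑' t : ℕ, (1 / 4 : ℝ) ^ t * nWalks B t x y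

/-- A centered (jointly) Gaussian family: every finite linear combination is a
centered Gaussian random variable. -/
def IsCenteredGaussianFamily {Ω : Type*} [MeasureSpace Ω] {ι : Type*} (f : ι → Ω → ℝ) : Prop :=
  ∀ (s : Finset ι) (c : ι → ℝ), ∃ v : NNReal,
    Measure.map (fun ω => ∑ i ∈ s, c i * f i ω) (ℙ : Measure Ω) = gaussianReal 0 v

/-- `η` is a discrete Gaussian free field on `B` with Dirichlet boundary conditions:
a centered Gaussian field, vanishing outside `B`, whose covariance on `B` is the
Green function of simple random walk killed at `∂B`. -/
def IsDGFF {Ω : Type*} [MeasureSpace Ω] (B : Set Z2) (η : Z2 → Ω → ℝ) : Prop :=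
  IsCenteredGaussianFamily (fun z : Z2 => η z) ∧
  (∀ z, z ∉ B → η z = 0) ∧
  (∀ x ∈ B, ∀ y ∈ B, ∫ ω, η x ω * η y ω = greenFn B x y)

/-- `F` is the harmonic extension of `η` from outside `B`: it agrees with `η` on
`B^c ∪ ∂B` and is discrete harmonic on `B ∖ ∂B`. -/
def IsHarmExt {Ω : Type*} [MeasureSpace Ω] (η F : Z2 → Ω → ℝ) (B : Set Z2) : Prop :=
  (∀ z, z ∉ B \ bdry B → F z = η z) ∧
  (∀ z ∈ B \ bdry B, ∀ ω, 4 * F z ω =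
    F (z.1 + 1, z.2) ω + F (z.1 - 1, z.2) ω + F (z.1, z.2 + 1) ω + F (z.1, z.2 - 1) ω)

/-- The box of side length `ℓ` centered at `x`. -/
def boxZ (x : Z2) (ℓ : ℤ) : Set Z2 :=
  {z | x.1 - ℓ / 2 ≤ z.1 ∧ z.1 ≤ x.1 + ℓ / 2 ∧ x.2 - ℓ / 2 ≤ z.2 ∧ z.2 ≤ x.2 + ℓ / 2}

/-- `V_N = [0,N)² ∩ ℤ²`. -/
def VN (N : ℕ) : Set Z2 := {z | 0 ≤ z.1 ∧ z.1 < (N : ℤ) ∧ 0 ≤ z.2 ∧ z.2 < (N : ℤ)}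

/-- `V_{5N} = [-2N, 3N)² ∩ ℤ²`. -/
def V5N (N : ℕ) : Set Z2 :=
  {z | -(2 * (N : ℤ)) ≤ z.1 ∧ z.1 < 3 * (N : ℤ) ∧ -(2 * (N : ℤ)) ≤ z.2 ∧ z.2 < 3 * (N : ℤ)}

/-- The field `η_j`: `η_0 = η^{V_{5N}} - H_K` and `η_j = H_{K^j} - H_{K^{j+1}}` for
`j ≥ 1`, where `H ℓ x` denotes the value at `x` of the harmonic extension of the
field `η` from outside the box of side `ℓ` centered at `x`. -/
def etaJ {Ω : Type*} (η : Z2 → Ω → ℝ) (H : ℤ → Z2 → Ω → ℝ) (K : ℕ) (j : ℕ) (x : Z2) :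
    Ω → ℝ :=
  if j = 0 then fun ω => η x ω - H (K : ℤ) x ω
  else fun ω => H ((K : ℤ) ^ j) x ω - H ((K : ℤ) ^ (j + 1)) x ω

/-- A path in `V` given as a nonempty list of vertices of `V` in which consecutive
vertices are nearest neighbors. -/
def LPathIn (V : Set Z2) (P : List Z2) : Prop :=
  P ≠ [] ∧ P.Chain' Adj ∧ ∀ z ∈ P, z ∈ V

/-- The Liouville FPP weight of a path: `w(P) = ∑_{z ∈ P} exp(γ η(z))`. -/
noncomputable def pWeight {Ω : Type*} (γ : ℝ) (η : Z2 → Ω → ℝ) (ω : Ω) (P : List Z2) : ℝ :=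
  ∑ z ∈ P.toFinset, Real.exp (γ * η z ω)



/-! ### Green function -/

/-- the interior of `V5N` as a finset -/
noncomputable def intr (N : ℕ) : Finset Z2 :=
  Finset.Ioo (-(2 * (N : ℤ))) (3 * (N : ℤ) - 1) ×ˢ Finset.Ioo (-(2 * (N : ℤ))) (3 * (N : ℤ) - 1)

/-- `V5N` as a finset -/
noncomputable def boxF (N : ℕ) : Finset Z2 :=
  Finset.Ico (-(2 * (N : ℤ))) (3 * (N : ℤ)) ×ˢ Finset.Ico (-(2 * (N : ℤ))) (3 * (N : ℤ))

lemma mem_intr {N : ℕ} {z : Z2} : z ∈ intr N ↔ (-(2 * (N : ℤ)) < z.1 ∧ z.1 < 3 * (N : ℤ) - 1) ∧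
    (-(2 * (N : ℤ)) < z.2 ∧ z.2 < 3 * (N : ℤ) - 1) := by
  simp [intr, Finset.mem_product]

lemma mem_boxF {N : ℕ} {z : Z2} : z ∈ boxF N ↔ z ∈ V5N N := by
  simp [boxF, Finset.mem_product, V5N, and_assoc]

lemma intr_sub {N : ℕ} {z : Z2} (h : z ∈ intr N) : z ∈ V5N N := by
  rw [mem_intr] at h; simp only [V5N, Set.mem_ofPred_eq]; omega

lemma adj_iff {y w : Z2} : Adj y w ↔ w = (y.1 + 1, y.2) ∨ w = (y.1 - 1, y.2) ∨
    w = (y.1, y.2 + 1) ∨ w = (y.1, y.2 - 1) := by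
  obtain ⟨a, b⟩ := y; obtain ⟨c, d⟩ := w
  simp only [Adj, Prod.mk.injEq]
  constructor
  · intro h
    rcases abs_cases (a - c) with h1 | h1 <;> rcases abs_cases (b - d) with h2 | h2 <;> omega
  · rintro (h | h | h | h) <;> obtain ⟨rfl, rfl⟩ := h <;> simp

lemma Adj.symm {x y : Z2} (h : Adj x y) : Adj y x := by
  simp only [Adj] at *; rw [abs_sub_comm y.1, abs_sub_comm y.2]; exact h

lemma mem_bdry {N : ℕ} {z : Z2} : z ∈ bdry (V5N N) ↔ z ∈ V5N N ∧ z ∉ intr N := by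
  simp only [bdry, Set.mem_ofPred_eq, and_congr_right_iff]
  intro hz
  rw [mem_intr]
  simp only [V5N, Set.mem_ofPred_eq] at hz ⊢
  constructor
  · rintro ⟨w, hw, h⟩ h2
    rw [adj_iff] at hw
    rcases hw with rfl | rfl | rfl | rfl <;> simp at h <;> omega
  · intro h
    by_cases h1 : z.1 = -(2 * (N : ℤ))
    · exact ⟨(z.1 - 1, z.2), by rw [adj_iff]; simp, by simp; omega⟩
    by_cases h2 : z.1 = 3 * N - 1
    · exact ⟨(z.1 + 1, z.2), by rw [adj_iff]; simp, by simp; omega⟩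
    by_cases h3 : z.2 = -(2 * (N : ℤ))
    · exact ⟨(z.1, z.2 - 1), by rw [adj_iff]; simp, by simp; omega⟩
    · exact ⟨(z.1, z.2 + 1), by rw [adj_iff]; simp, by simp; omega⟩

/-- walks -/
abbrev WalkT (B : Set Z2) (t : ℕ) (x y : Z2) := {f : Fin (t + 1) → Z2 //
    f 0 = x ∧ f (Fin.last t) = y ∧ (∀ i, f i ∉ bdry B) ∧
    ∀ i : Fin t, Adj (f i.castSucc) (f i.succ)}

lemma walk_sigma_ext {B : Set Z2} {t : ℕ} {x y : Z2}
    (a b : Σ w : {w // Adj w y}, WalkT B t x w.1)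
    (h1 : a.1.1 = b.1.1) (h2 : a.2.1 = b.2.1) : a = b := by
  obtain ⟨⟨w, hw⟩, ⟨f, hf⟩⟩ := a
  obtain ⟨⟨w', hw'⟩, ⟨g, hg⟩⟩ := b
  simp only at h1 h2
  subst h1; subst h2; rfl

/-- last-step decomposition -/
def walkEquiv (B : Set Z2) (t : ℕ) (x y : Z2) (hy : y ∉ bdry B) :
    WalkT B (t + 1) x y ≃ Σ w : {w // Adj w y}, WalkT B t x w.1 where
  toFun f := ⟨⟨f.1 (Fin.last t).castSucc, by
      have := f.2.2.2.2 (Fin.last t); rw [Fin.succ_last, f.2.2.1] at this; exact this⟩,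
    ⟨fun i => f.1 i.castSucc, by
      refine ⟨f.2.1, rfl, fun i => f.2.2.2.1 _, fun i => ?_⟩
      have := f.2.2.2.2 i.castSucc
      exact this⟩⟩
  invFun g := ⟨Fin.snoc (α := fun _ => Z2) g.2.1 y, by
      refine ⟨?_, ?_, ?_, ?_⟩
      · have : (0 : Fin (t + 1 + 1)) = (0 : Fin (t + 1)).castSucc := rfl
        rw [this, Fin.snoc_castSucc]; exact g.2.2.1
      · simp
      · intro i
        refine Fin.lastCases ?_ (fun j => ?_) i
        · simpa using hy
        · simpa using g.2.2.2.2.1 j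
      · intro i
        refine Fin.lastCases ?_ (fun j => ?_) i
        · rw [Fin.succ_last, Fin.snoc_last, Fin.snoc_castSucc, g.2.2.2.1]; exact g.1.2
        · rw [Fin.snoc_castSucc, ← Fin.castSucc_succ, Fin.snoc_castSucc]
          exact g.2.2.2.2.2 j⟩
  left_inv f := by
    apply Subtype.ext
    funext i
    refine Fin.lastCases ?_ (fun j => ?_) i
    · simp [f.2.2.1]
    · simp
  right_inv g := by
    refine walk_sigma_ext _ _ ?_ ?_
    · simpa using g.2.2.2.1
    · funext i; simp

noncomputable instance adjFintype (y : Z2) : Fintype {w // Adj w y} :=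
  Fintype.ofFinset {(y.1 + 1, y.2), (y.1 - 1, y.2), (y.1, y.2 + 1), (y.1, y.2 - 1)} (by
    intro w
    simp only [Finset.mem_insert, Finset.mem_singleton]
    rw [← adj_iff]; exact ⟨Adj.symm, Adj.symm⟩)

lemma walk_finite (B : Set Z2) (t : ℕ) (x : Z2) : ∀ y, Finite (WalkT B t x y) := by
  induction t with
  | zero =>
    intro y
    have : Subsingleton (WalkT B 0 x y) := by
      constructor
      rintro ⟨f, hf⟩ ⟨g, hg⟩
      apply Subtype.ext; funext i
      rw [show i = 0 from Fin.fin_one_eq_zero i]; exact hf.1.trans hg.1.symm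
    infer_instance
  | succ t ih =>
    intro y
    by_cases hy : y ∈ bdry B
    · have : IsEmpty (WalkT B (t + 1) x y) := ⟨fun f => f.2.2.2.1 (Fin.last _) (by rw [f.2.2.1]; exact hy)⟩
      infer_instance
    · have := fun w : {w // Adj w y} => ih w.1
      exact Finite.of_equiv _ (walkEquiv B t x y hy).symm

lemma nWalks_succ (B : Set Z2) (t : ℕ) (x y : Z2) (hy : y ∉ bdry B) :
    nWalks B (t + 1) x y = nWalks B t x (y.1 + 1, y.2) + nWalks B t x (y.1 - 1, y.2) +
      nWalks B t x (y.1, y.2 + 1) + nWalks B t x (y.1, y.2 - 1) := by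
  have := fun w : {w // Adj w y} => walk_finite B t x w.1
  have h : nWalks B (t + 1) x y = Nat.card (Σ w : {w // Adj w y}, WalkT B t x w.1) :=
    Nat.card_congr (walkEquiv B t x y hy)
  rw [h, Nat.card_sigma]
  have h2 := Finset.sum_subtype (F := adjFintype y) (p := fun w => Adj w y)
    {(y.1 + 1, y.2), (y.1 - 1, y.2), (y.1, y.2 + 1), (y.1, y.2 - 1)} (by
      intro w
      simp only [Finset.mem_insert, Finset.mem_singleton]
      rw [← adj_iff]; exact ⟨Adj.symm, Adj.symm⟩) (fun w => nWalks B t x w)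
  refine h2.symm.trans ?_
  rw [Finset.sum_insert, Finset.sum_insert, Finset.sum_insert, Finset.sum_singleton]
  · ring
  all_goals simp [Prod.ext_iff]
  all_goals omega

lemma nWalks_bdry (B : Set Z2) (t : ℕ) (x y : Z2) (hy : y ∈ bdry B) : nWalks B t x y = 0 := by
  have : IsEmpty (WalkT B t x y) := ⟨fun f => f.2.2.2.1 (Fin.last _) (by rw [f.2.2.1]; exact hy)⟩
  exact Nat.card_of_isEmpty

lemma nWalks_bdry_left (B : Set Z2) (t : ℕ) (x y : Z2) (hy : x ∈ bdry B) : nWalks B t x y = 0 := by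
  have : IsEmpty (WalkT B t x y) := ⟨fun f => f.2.2.2.1 0 (by rw [f.2.1]; exact hy)⟩
  exact Nat.card_of_isEmpty

lemma nWalks_zero (B : Set Z2) (x y : Z2) (hx : x ∉ bdry B) :
    nWalks B 0 x y = if y = x then 1 else 0 := by
  split_ifs with h
  · subst h
    have : Nonempty (WalkT B 0 y y) := ⟨⟨fun _ => y, rfl, rfl, fun _ => hx, fun i => i.elim0⟩⟩
    have : Subsingleton (WalkT B 0 y y) := by
      constructor
      rintro ⟨f, hf⟩ ⟨g, hg⟩
      apply Subtype.ext; funext i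
      rw [show i = 0 from Fin.fin_one_eq_zero i]; exact hf.1.trans hg.1.symm
    exact Nat.card_unique
  · have : IsEmpty (WalkT B 0 x y) := ⟨fun f => h (f.2.2.1.symm.trans f.2.1)⟩
    exact Nat.card_of_isEmpty

lemma nWalks_out (N t : ℕ) (x : Z2) (hx : x ∈ intr N) :
    ∀ y, y ∉ intr N → nWalks (V5N N) t x y = 0 := by
  induction t with
  | zero =>
    intro y hy
    rw [nWalks_zero _ _ _ (by rw [mem_bdry]; tauto), if_neg]
    rintro rfl; exact hy hx
  | succ t ih =>
    intro y hy
    by_cases hb : y ∈ bdry (V5N N)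
    · exact nWalks_bdry _ _ _ _ hb
    · have hv : y ∉ V5N N := by rw [mem_bdry] at hb; tauto
      rw [nWalks_succ _ _ _ _ hb]
      simp only [V5N, Set.mem_ofPred_eq] at hv
      rw [ih, ih, ih, ih] <;> rw [mem_intr] <;> simp only <;> omega

/-! lattice sums -/

/-- average over the four neighbors -/
noncomputable def avg4 (f : Z2 → ℝ) (z : Z2) : ℝ :=
  (f (z.1 + 1, z.2) + f (z.1 - 1, z.2) + f (z.1, z.2 + 1) + f (z.1, z.2 - 1)) / 4

/-- discrete (negative) Laplacian -/
noncomputable def lap (f : Z2 → ℝ) (z : Z2) : ℝ := f z - avg4 f z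

lemma tsum_shift (F : Z2 → ℝ) (a b : ℤ) : ∑' z : Z2, F (z.1 + a, z.2 + b) = ∑' z, F z := by
  have := Equiv.tsum_eq (Equiv.addRight ((a, b) : Z2)) F
  simpa [Prod.add_def] using this

lemma fs_shift {F : Z2 → ℝ} (h : F.support.Finite) (a b : ℤ) :
    (Function.support fun z : Z2 => F (z.1 + a, z.2 + b)).Finite := by
  have := h.preimage (f := fun z : Z2 => (z.1 + a, z.2 + b)) (by
    intro x _ y _ hxy; simp [Prod.ext_iff] at hxy ⊢; exact hxy)
  exact this.subset (fun z hz => hz)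

lemma sm {F : Z2 → ℝ} (h : F.support.Finite) : Summable F := summable_of_hasFiniteSupport h

lemma fs_mul {F G : Z2 → ℝ} (h : F.support.Finite) : (Function.support fun z => F z * G z).Finite :=
  h.subset (fun z hz => by simp at hz ⊢; tauto)

lemma fs_mul' {F G : Z2 → ℝ} (h : G.support.Finite) : (Function.support fun z => F z * G z).Finite :=
  h.subset (fun z hz => by simp at hz ⊢; tauto)

/-- symmetry of the averaging operator -/
lemma avg_symm {f g : Z2 → ℝ} (hf : f.support.Finite) :
    ∑' z, f z * avg4 g z = ∑' z, avg4 f z * g z := by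
  have key : ∀ a b : ℤ, ∑' z : Z2, f z * g (z.1 + a, z.2 + b) =
      ∑' z : Z2, f (z.1 + -a, z.2 + -b) * g z := by
    intro a b
    rw [← tsum_shift (fun z => f (z.1 + -a, z.2 + -b) * g z) a b]
    simp
  have s1 : ∀ a b : ℤ, Summable fun z : Z2 => f z * g (z.1 + a, z.2 + b) := fun a b =>
    sm (fs_mul hf)
  have s2 : ∀ a b : ℤ, Summable fun z : Z2 => f (z.1 + a, z.2 + b) * g z := fun a b =>
    sm (fs_mul (fs_shift hf a b))
  have e1 : ∀ z : Z2, f z * avg4 g z = (f z * g (z.1 + 1, z.2 + 0) + f z * g (z.1 + -1, z.2 + 0) +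
      f z * g (z.1 + 0, z.2 + 1) + f z * g (z.1 + 0, z.2 + -1)) * (1 / 4) := by
    intro z; simp only [avg4, add_zero, ← sub_eq_add_neg]; ring
  have e2 : ∀ z : Z2, avg4 f z * g z = (f (z.1 + 1, z.2 + 0) * g z + f (z.1 + -1, z.2 + 0) * g z +
      f (z.1 + 0, z.2 + 1) * g z + f (z.1 + 0, z.2 + -1) * g z) * (1 / 4) := by
    intro z; simp only [avg4, add_zero, ← sub_eq_add_neg]; ring
  simp_rw [e1, e2]
  rw [tsum_mul_right, tsum_mul_right]
  congr 1
  rw [Summable.tsum_add (((s1 _ _).add (s1 _ _)).add (s1 _ _)) (s1 _ _),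
    Summable.tsum_add ((s1 _ _).add (s1 _ _)) (s1 _ _), Summable.tsum_add (s1 _ _) (s1 _ _),
    Summable.tsum_add (((s2 _ _).add (s2 _ _)).add (s2 _ _)) (s2 _ _),
    Summable.tsum_add ((s2 _ _).add (s2 _ _)) (s2 _ _), Summable.tsum_add (s2 _ _) (s2 _ _),
    key, key, key, key]
  simp only [neg_neg, neg_zero]
  ring

/-- transition probabilities of the killed walk -/
noncomputable def pT (N t : ℕ) (x y : Z2) : ℝ := (1 / 4 : ℝ) ^ t * nWalks (V5N N) t x y

lemma pT_nonneg (N t : ℕ) (x y : Z2) : 0 ≤ pT N t x y := by unfold pT; positivity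

lemma pT_fs (N t : ℕ) {x : Z2} (hx : x ∈ intr N) : (Function.support (pT N t x)).Finite := by
  refine (Finset.finite_toSet (intr N)).subset (fun y hy => ?_)
  by_contra h
  exact hy (by simp [pT, nWalks_out N t x hx y h])

lemma pT_succ (N t : ℕ) (x y : Z2) (hy : y ∈ intr N) : pT N (t + 1) x y = avg4 (pT N t x) y := by
  have : y ∉ bdry (V5N N) := by rw [mem_bdry]; tauto
  simp only [pT, avg4, nWalks_succ _ _ _ _ this, pow_succ]
  push_cast
  ring

lemma pT_out (N t : ℕ) {x y : Z2} (hx : x ∈ intr N) (hy : y ∉ intr N) : pT N t x y = 0 := by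
  simp [pT, nWalks_out N t x hx y hy]

lemma pT_zero (N : ℕ) {x y : Z2} (hx : x ∈ intr N) : pT N 0 x y = if y = x then 1 else 0 := by
  simp only [pT, nWalks_zero _ _ _ (show x ∉ bdry (V5N N) by rw [mem_bdry]; tauto)]
  simp

/-- one step of the dual semigroup, for functions supported in the interior -/
lemma pT_step (N t : ℕ) {x : Z2} (hx : x ∈ intr N) {f : Z2 → ℝ} (hf : ∀ z, z ∉ intr N → f z = 0) :
    ∑' y, pT N t x y * lap f y = ∑' y, pT N t x y * f y - ∑' y, pT N (t + 1) x y * f y := by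
  have h1 : ∀ y, pT N t x y * lap f y = pT N t x y * f y - pT N t x y * avg4 f y := by
    intro y; simp only [lap]; ring
  simp_rw [h1]
  rw [Summable.tsum_sub (sm (fs_mul (pT_fs N t hx))) (sm (fs_mul (pT_fs N t hx))),
    avg_symm (pT_fs N t hx)]
  congr 1
  refine tsum_congr (fun y => ?_)
  by_cases hy : y ∈ intr N
  · rw [pT_succ N t x y hy]
  · simp [hf y hy]

lemma pT_summable (N : ℕ) {x : Z2} (hx : x ∈ intr N) (y : Z2) : Summable fun t => pT N t x y := by
  classical
  by_cases hy : y ∈ intr N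
  swap
  · simp [pT_out N _ hx hy]
  -- a superharmonic function
  let u : Z2 → ℝ := fun z => (9 * (N : ℝ) ^ 2 - (z.1 : ℝ) ^ 2)
  let u0 : Z2 → ℝ := fun z => if z ∈ intr N then u z else 0
  have hbd : ∀ z : Z2, z ∈ V5N N → 0 ≤ u z := by
    intro z hz
    have : z.1 ^ 2 ≤ 9 * (N : ℤ) ^ 2 := by
      simp only [V5N, Set.mem_ofPred_eq] at hz; nlinarith
    have : ((z.1 ^ 2 : ℤ) : ℝ) ≤ ((9 * (N : ℤ) ^ 2 : ℤ) : ℝ) := by exact_mod_cast this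
    push_cast at this; simp only [u]; linarith
  have h0 : ∀ z, 0 ≤ u0 z := by
    intro z; simp only [u0]; split_ifs with h
    · exact hbd z (intr_sub h)
    · rfl
  have hle : ∀ z : Z2, z ∈ V5N N → u0 z ≤ u z := by
    intro z hz; simp only [u0]; split_ifs with h
    · rfl
    · exact hbd z hz
  have hsup : ∀ z ∈ intr N, 1 / 2 ≤ lap u0 z := by
    intro z hz
    have hz' := mem_intr.1 hz
    have a1 := hle (z.1 + 1, z.2) (by simp only [V5N, Set.mem_ofPred_eq]; omega)
    have a2 := hle (z.1 - 1, z.2) (by simp only [V5N, Set.mem_ofPred_eq]; omega)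
    have a3 := hle (z.1, z.2 + 1) (by simp only [V5N, Set.mem_ofPred_eq]; omega)
    have a4 := hle (z.1, z.2 - 1) (by simp only [V5N, Set.mem_ofPred_eq]; omega)
    have a5 : u0 z = u z := by simp [u0, hz]
    simp only [lap, avg4]
    rw [a5]
    simp only [u] at a1 a2 a3 a4 ⊢
    push_cast at a1 a2 a3 a4
    nlinarith
  have hstep : ∀ t, (1 / 2) * pT N t x y ≤
      ∑' y, pT N t x y * u0 y - ∑' y, pT N (t + 1) x y * u0 y := by
    intro t
    rw [← pT_step N t hx (f := u0) (by intro z hz; simp [u0, hz])]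
    calc (1 / 2) * pT N t x y ≤ pT N t x y * lap u0 y := by
          nlinarith [pT_nonneg N t x y, hsup y hy]
      _ ≤ _ := (sm (fs_mul (pT_fs N t hx))).le_tsum y (fun z _ => by
          by_cases hz : z ∈ intr N
          · have := hsup z hz; have := pT_nonneg N t x z; positivity
          · simp [pT_out N t hx hz])
  refine summable_of_sum_range_le (c := 2 * ∑' y, pT N 0 x y * u0 y) (fun t => pT_nonneg _ _ _ _) ?_
  intro n
  have : ∑ t ∈ Finset.range n, pT N t x y ≤
      2 * (∑' y, pT N 0 x y * u0 y - ∑' y, pT N n x y * u0 y) := by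
    rw [← Finset.sum_range_sub' (fun t => ∑' y, pT N t x y * u0 y), Finset.mul_sum]
    exact Finset.sum_le_sum (fun t _ => by linarith [hstep t])
  have h3 : 0 ≤ ∑' y, pT N n x y * u0 y := tsum_nonneg (fun z => mul_nonneg (pT_nonneg _ _ _ _) (h0 z))
  linarith

lemma greenFn_out (N : ℕ) {x y : Z2} (hx : x ∈ V5N N) (hy : y ∈ V5N N)
    (h : x ∉ intr N ∨ y ∉ intr N) : greenFn (V5N N) x y = 0 := by
  unfold greenFn
  rcases h with h | h
  · simp [nWalks_bdry_left _ _ x y (mem_bdry.2 ⟨hx, h⟩)]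
  · simp [nWalks_bdry _ _ x y (mem_bdry.2 ⟨hy, h⟩)]

/-- the Green function inverts the Laplacian -/
lemma green_lap (N : ℕ) {x : Z2} (hx : x ∈ V5N N) {f : Z2 → ℝ} (hf : ∀ z, z ∉ intr N → f z = 0) :
    ∑ y ∈ boxF N, greenFn (V5N N) x y * lap f y = f x := by
  by_cases hxi : x ∈ intr N
  swap
  · rw [hf x hxi]
    exact Finset.sum_eq_zero (fun y hy => by
      rw [greenFn_out N hx (mem_boxF.1 hy) (Or.inl hxi), zero_mul])
  have hfs : f.support.Finite := (Finset.finite_toSet (intr N)).subset (fun z hz => by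
    by_contra h; exact hz (hf z h))
  have h1 : ∀ t, ∑ y ∈ boxF N, pT N t x y * lap f y =
      ∑' y, pT N t x y * f y - ∑' y, pT N (t + 1) x y * f y := by
    intro t
    rw [← pT_step N t hxi hf]
    refine (tsum_eq_sum (fun y hy => ?_)).symm
    rw [pT_out N t hxi, zero_mul]
    intro h; exact hy (mem_boxF.2 (intr_sub h))
  have h2 : ∀ t, ∑' y, pT N t x y * f y = ∑ y ∈ intr N, pT N t x y * f y := fun t =>
    tsum_eq_sum (fun y hy => by rw [hf y hy, mul_zero])
  have hs : HasSum (fun t => ∑ y ∈ boxF N, pT N t x y * lap f y)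
      (∑ y ∈ boxF N, greenFn (V5N N) x y * lap f y) :=
    hasSum_sum (fun y _ => (pT_summable N hxi y).hasSum.mul_right _)
  have hlim := hs.tendsto_sum_nat
  simp_rw [h1] at hlim
  have hlim2 : Tendsto (fun n => ∑' y, pT N 0 x y * f y - ∑' y, pT N n x y * f y) atTop
      (nhds (∑' y, pT N 0 x y * f y - 0)) := by
    refine tendsto_const_nhds.sub ?_
    simp_rw [h2]
    have : Tendsto (fun n => ∑ y ∈ intr N, pT N n x y * f y) atTop
        (nhds (∑ y ∈ intr N, 0 * f y)) :=
      tendsto_finsetSum _ (fun y _ => (pT_summable N hxi y).tendsto_atTop_zero.mul_const _)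
    simpa using this
  have h3 : ∑' y, pT N 0 x y * f y = f x := by
    rw [tsum_eq_single x]
    · simp [pT_zero N hxi]
    · intro y hy; simp [pT_zero N hxi, hy]
  rw [h3, sub_zero] at hlim2
  refine tendsto_nhds_unique hlim ?_
  convert hlim2 using 2 with n
  rw [Finset.sum_range_sub' (fun t => ∑' y, pT N t x y * f y), h3]

/-- Dirichlet energy -/
noncomputable def dirE (f : Z2 → ℝ) : ℝ :=
  (1 / 4) * ∑' z : Z2, ((f (z.1 + 1, z.2) - f z) ^ 2 + (f (z.1, z.2 + 1) - f z) ^ 2)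

lemma lap_energy {f : Z2 → ℝ} (hf : f.support.Finite) : ∑' z, f z * lap f z = dirE f := by
  have s0 : Summable fun z : Z2 => f z * f z := sm (fs_mul hf)
  have s1 : ∀ a b : ℤ, Summable fun z : Z2 => f z * f (z.1 + a, z.2 + b) := fun a b =>
    sm (fs_mul hf)
  have s2 : ∀ a b : ℤ, Summable fun z : Z2 => f (z.1 + a, z.2 + b) * f (z.1 + a, z.2 + b) :=
    fun a b => sm (fs_mul (fs_shift hf a b))
  have k1 : ∀ a b : ℤ, ∑' z : Z2, f z * f (z.1 + -a, z.2 + -b) = ∑' z : Z2, f z * f (z.1 + a, z.2 + b) := by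
    intro a b
    rw [← tsum_shift (fun z => f z * f (z.1 + -a, z.2 + -b)) a b]
    simp [mul_comm]
  have k2 : ∀ a b : ℤ, ∑' z : Z2, f (z.1 + a, z.2 + b) * f (z.1 + a, z.2 + b) = ∑' z, f z * f z :=
    fun a b => tsum_shift (fun z => f z * f z) a b
  have e1 : ∀ z : Z2, f z * lap f z = f z * f z - (f z * f (z.1 + 1, z.2 + 0) + f z * f (z.1 + -1, z.2 + -0) +
      f z * f (z.1 + 0, z.2 + 1) + f z * f (z.1 + -0, z.2 + -1)) * (1 / 4) := by
    intro z; simp only [lap, avg4, add_zero, neg_zero, ← sub_eq_add_neg]; ring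
  have e2 : ∀ z : Z2, ((f (z.1 + 1, z.2) - f z) ^ 2 + (f (z.1, z.2 + 1) - f z) ^ 2) =
     ((f (z.1 + 1, z.2 + 0) * f (z.1 + 1, z.2 + 0) + f (z.1 + 0, z.2 + 1) * f (z.1 + 0, z.2 + 1)) +
     f z * f z * 2) - (f z * f (z.1 + 1, z.2 + 0) + f z * f (z.1 + 0, z.2 + 1)) * 2 := by
    intro z; simp only [add_zero]; ring
  unfold dirE
  simp_rw [e1, e2]
  rw [Summable.tsum_sub s0 (((((s1 _ _).add (s1 _ _)).add (s1 _ _)).add (s1 _ _)).mul_right _),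
    Summable.tsum_sub (((s2 _ _).add (s2 _ _)).add (s0.mul_right _)) (((s1 _ _).add (s1 _ _)).mul_right _),
    Summable.tsum_add ((s2 _ _).add (s2 _ _)) (s0.mul_right _), Summable.tsum_add (s2 _ _) (s2 _ _),
    tsum_mul_right, tsum_mul_right, tsum_mul_right,
    Summable.tsum_add (((s1 _ _).add (s1 _ _)).add (s1 _ _)) (s1 _ _),
    Summable.tsum_add ((s1 _ _).add (s1 _ _)) (s1 _ _), Summable.tsum_add (s1 _ _) (s1 _ _),
    Summable.tsum_add (s1 _ _) (s1 _ _), k1, k1, k2, k2]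
  ring


/-! ### Gaussian tools -/

/-- centered Gaussian family for a measure -/
def GFam {Ω ι : Type*} [MeasurableSpace Ω] (μ : Measure Ω) (f : ι → Ω → ℝ) : Prop :=
  ∀ (s : Finset ι) (c : ι → ℝ), ∃ v : NNReal,
    μ.map (fun ω => ∑ i ∈ s, c i * f i ω) = gaussianReal 0 v

section GF
variable {Ω ι κ : Type*} [MeasurableSpace Ω] {μ : Measure Ω} {f : ι → Ω → ℝ}

lemma GFam.lin (h : GFam μ f) (s : κ → Finset ι) (c : κ → ι → ℝ) :
    GFam μ (fun k ω => ∑ i ∈ s k, c k i * f i ω) := by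
  classical
  intro t d
  obtain ⟨v, hv⟩ := h (t.biUnion s) (fun i => ∑ k ∈ t, d k * if i ∈ s k then c k i else 0)
  refine ⟨v, ?_⟩
  rw [← hv]
  congr 1
  funext ω
  simp_rw [Finset.sum_mul, Finset.mul_sum]
  rw [Finset.sum_comm]
  refine Finset.sum_congr rfl (fun k hk => ?_)
  rw [← Finset.sum_subset (Finset.subset_biUnion_of_mem s hk) (fun i _ hi => by simp [hi])]
  refine Finset.sum_congr rfl (fun i hi => ?_)
  simp [hi, mul_assoc]

lemma GFam.comp (h : GFam μ f) (e : κ → ι) : GFam μ (fun k => f (e k)) := by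
  have := h.lin (fun k => {e k}) (fun _ _ => 1)
  simpa using this

lemma GFam.aem (h : GFam μ f) (i : ι) : AEMeasurable (f i) μ := by
  obtain ⟨v, hv⟩ := h {i} (fun _ => 1)
  simp only [Finset.sum_singleton, one_mul] at hv
  exact aemeasurable_of_map_neZero (by rw [hv]; infer_instance)

lemma GFam.hg (h : GFam μ f) (i : ι) : HasGaussianLaw (f i) μ := by
  obtain ⟨v, hv⟩ := h {i} (fun _ => 1)
  simp only [Finset.sum_singleton, one_mul] at hv
  exact ⟨by rw [hv]; infer_instance⟩

lemma GFam.memLp (h : GFam μ f) (i : ι) : MemLp (f i) 2 μ := (h.hg i).memLp_two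

lemma GFam.mean (h : GFam μ f) (i : ι) : ∫ ω, f i ω ∂μ = 0 := by
  obtain ⟨v, hv⟩ := h {i} (fun _ => 1)
  simp only [Finset.sum_singleton, one_mul] at hv
  rw [← integral_id_gaussianReal (μ := 0) (v := v), ← hv, integral_map (h.aem i) (by fun_prop)]

lemma GFam.int_mul (h : GFam μ f) (i j : ι) : Integrable (fun ω => f i ω * f j ω) μ :=
  (h.memLp i).integrable_mul (h.memLp j)

lemma GFam.law (h : GFam μ f) (i : ι) :
    μ.map (f i) = gaussianReal 0 (Real.toNNReal (∫ ω, f i ω * f i ω ∂μ)) := by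
  have := (h.hg i).map_eq_gaussianReal
  rw [this, h.mean i, variance_of_integral_eq_zero (h.aem i) (h.mean i)]
  simp [pow_two]

lemma lintegral_exp_gaussian (v : NNReal) (t : ℝ) :
    ∫⁻ x, ENNReal.ofReal (rexp (t * x)) ∂(gaussianReal 0 v) = ENNReal.ofReal (rexp (v * t ^ 2 / 2)) := by
  have h := congrFun (mgf_id_gaussianReal (μ := 0) (v := v)) t
  simp only [mgf, id, zero_mul, zero_add] at h
  rw [← h, ofReal_integral_eq_lintegral_ofReal (integrable_exp_mul_gaussianReal t)
    (ae_of_all _ fun x => (exp_pos _).le)]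

lemma GFam.lexp (h : GFam μ f) (i : ι) (t : ℝ) :
    ∫⁻ ω, ENNReal.ofReal (rexp (t * f i ω)) ∂μ =
      ENNReal.ofReal (rexp (t ^ 2 * (∫ ω, f i ω * f i ω ∂μ) / 2)) := by
  have h1 := lintegral_exp_gaussian (Real.toNNReal (∫ ω, f i ω * f i ω ∂μ)) t
  rw [← h.law i, lintegral_map' (by fun_prop) (h.aem i)] at h1
  rw [h1, Real.coe_toNNReal _ (integral_nonneg fun ω => mul_self_nonneg _)]
  ring_nf

lemma GFam.cov_lin (h : GFam μ f) (s t : Finset ι) (c d : ι → ℝ) :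
    ∫ ω, (∑ i ∈ s, c i * f i ω) * (∑ j ∈ t, d j * f j ω) ∂μ =
      ∑ i ∈ s, ∑ j ∈ t, c i * d j * ∫ ω, f i ω * f j ω ∂μ := by
  simp_rw [Finset.sum_mul_sum]
  have e : ∀ i j ω, c i * f i ω * (d j * f j ω) = c i * d j * (f i ω * f j ω) := fun i j ω => by ring
  simp_rw [e]
  rw [integral_finsetSum _ (fun i _ => integrable_finsetSum _ fun j _ => (h.int_mul i j).const_mul _)]
  refine Finset.sum_congr rfl (fun i _ => ?_)
  rw [integral_finsetSum _ (fun j _ => (h.int_mul i j).const_mul _)]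
  refine Finset.sum_congr rfl (fun j _ => ?_)
  rw [integral_const_mul]

lemma GFam.joint [Fintype ι] (h : GFam μ f) : HasGaussianLaw (fun ω => (f · ω)) μ := by
  classical
  refine ⟨isGaussian_of_map_eq_gaussianReal fun L => ?_⟩
  obtain ⟨v, hv⟩ := h Finset.univ (fun i => L (Pi.single i 1))
  refine ⟨0, v, ?_⟩
  rw [← hv, AEMeasurable.map_map_of_aemeasurable (by fun_prop) (aemeasurable_pi_lambda _ h.aem)]
  congr 1
  funext ω
  simp only [Function.comp]
  conv_lhs => rw [← Finset.univ_sum_single (fun i => f i ω)]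
  rw [map_sum]
  refine Finset.sum_congr rfl (fun i _ => ?_)
  rw [mul_comm, ← smul_eq_mul, ← map_smul]
  congr 1
  ext j; by_cases hj : j = i
  · subst hj; simp
  · simp [hj]

lemma GFam.iIndep [Fintype ι] [IsProbabilityMeasure μ] (h : GFam μ f)
    (h0 : ∀ i j, i ≠ j → ∫ ω, f i ω * f j ω ∂μ = 0) : iIndepFun f μ := by
  refine h.joint.iIndepFun_of_covariance_eq_zero (fun i j hij => ?_)
  rw [covariance_eq_sub (h.memLp i) (h.memLp j), h.mean i]
  simpa using h0 i j hij

end GF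

/-! one dimensional Gaussian estimates -/

lemma gauss_tilt {v : NNReal} (hv : v ≠ 0) (t : ℝ) :
    ∫⁻ x in Iic 0, ENNReal.ofReal (rexp (t * x)) ∂(gaussianReal 0 v) =
      ENNReal.ofReal (rexp (v * t ^ 2 / 2)) * gaussianReal 0 v (Iic (-(t * v))) := by
  have hv' : (v : ℝ) ≠ 0 := by exact_mod_cast hv
  have h1 : gaussianReal 0 v (Iic (-(t * v))) = gaussianReal (t * v) v (Iic 0) := by
    have := gaussianReal_map_add_const (μ := 0) (v := v) (t * v)
    rw [zero_add] at this
    rw [← this, Measure.map_apply (by fun_prop) measurableSet_Iic]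
    congr 1; ext x; simp
  rw [h1, gaussianReal_apply _ hv, gaussianReal_of_var_ne_zero _ hv,
    setLIntegral_withDensity_eq_setLIntegral_mul _ (by fun_prop) (by fun_prop) measurableSet_Iic,
    ← lintegral_const_mul _ (by fun_prop)]
  refine lintegral_congr (fun x => ?_)
  simp only [Pi.mul_apply, gaussianPDF, gaussianPDFReal]
  rw [← ENNReal.ofReal_mul (by positivity), ← ENNReal.ofReal_mul (by positivity)]
  congr 1
  have e1 : rexp (v * t ^ 2 / 2) * ((√(2 * π * v))⁻¹ * rexp (-(x - t * v) ^ 2 / (2 * v))) =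
    (√(2 * π * v))⁻¹ * (rexp (v * t ^ 2 / 2) * rexp (-(x - t * v) ^ 2 / (2 * v))) := by ring
  rw [e1, mul_assoc, ← exp_add, ← exp_add]
  congr 2
  field_simp
  ring

lemma gauss_half {v : NNReal} (hv : v ≠ 0) : gaussianReal 0 v (Iic 0) = 1 / 2 := by
  have := nullSingletonClass_gaussianReal (μ := 0) hv
  have h1 : gaussianReal 0 v (Ici 0) = gaussianReal 0 v (Iic 0) := by
    have := gaussianReal_map_neg (μ := 0) (v := v)
    rw [neg_zero] at this
    conv_lhs => rw [← this]
    rw [Measure.map_apply (by fun_prop) measurableSet_Ici]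
    congr 1; ext x; simp
  have h2 : gaussianReal 0 v (Ici 0) = gaussianReal 0 v (Ioi 0) := measure_congr Ioi_ae_eq_Ici.symm
  have h3 : gaussianReal 0 v (Iic 0) + gaussianReal 0 v (Ioi 0) = 1 := by
    rw [← measure_union (by simp) measurableSet_Ioi, Iic_union_Ioi]; simp
  rw [← h2, h1, ← two_mul] at h3
  rw [ENNReal.eq_div_iff (by simp) (by simp)]; exact h3

/-- lower tail of a Gaussian is a definite amount below one half -/
lemma gauss_tail {v : NNReal} (hv : v ≠ 0) {s : ℝ} (hs : 0 ≤ s) (hs1 : s ≤ √v) :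
    gaussianReal 0 v (Iic (-s)) ≤ ENNReal.ofReal (1 / 2 - s / (5 * √v)) := by
  have hv' : (0 : ℝ) < v := by positivity
  have hlow : ENNReal.ofReal (s / (5 * √v)) ≤ gaussianReal 0 v (Ioc (-s) 0) := by
    rw [gaussianReal_apply _ hv]
    calc ENNReal.ofReal (s / (5 * √v)) = ∫⁻ x in Ioc (-s) 0, ENNReal.ofReal (1 / (5 * √v)) := by
          rw [setLIntegral_const, Real.volume_Ioc, ← ENNReal.ofReal_mul (by positivity)]
          congr 1; ring
      _ ≤ _ := by
          refine setLIntegral_mono' measurableSet_Ioc (fun x hx => ?_)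
          simp only [gaussianPDF, gaussianPDFReal]
          refine ENNReal.ofReal_le_ofReal ?_
          have h1 : -(1 / 2 : ℝ) ≤ -(x - 0) ^ 2 / (2 * v) := by
            rw [neg_div, neg_le_neg_iff, div_le_div_iff₀ (by positivity) (by norm_num)]
            have : x ^ 2 ≤ v := by
              have hh := Real.sq_sqrt hv'.le
              have := hx.1; have := hx.2; nlinarith [Real.sqrt_nonneg (v : ℝ)]
            nlinarith
          have h2 : (2 / 3 : ℝ) * (3 / 4) ≤ rexp (-(1 / 2)) := by
            have := Real.add_one_le_exp (-(1 / 2) : ℝ); linarith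
          have h3 : rexp (-(1 / 2)) ≤ rexp (-(x - 0) ^ 2 / (2 * v)) := exp_le_exp.2 h1
          have h4 : √(2 * π * v) ≤ 5 / 2 * √v + 2 / 100 * √v := by
            rw [Real.sqrt_mul (by positivity)]
            have : √(2 * π) ≤ 2.52 := by
              rw [Real.sqrt_le_left (by norm_num)]
              have := Real.pi_lt_d2; nlinarith
            nlinarith [Real.sqrt_nonneg (v : ℝ)]
          have h5 : (0.58 : ℝ) ≤ rexp (-(1 / 2)) := by
            rw [Real.exp_neg, le_inv_comm₀ (by norm_num) (exp_pos _)]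
            have h7 := Real.exp_one_lt_d9
            have h8 : rexp (1 / 2) ^ 2 = rexp 1 := by rw [← Real.exp_nat_mul]; norm_num
            nlinarith [exp_pos (1 / 2 : ℝ)]
          have h6 : 0 < √(v : ℝ) := by positivity
          rw [div_le_iff₀ (by positivity)]
          have h9 : 0 < √(2 * π * v) := by positivity
          rw [inv_mul_eq_div, div_mul_eq_mul_div, le_div_iff₀ h9]
          nlinarith
  have hsum : gaussianReal 0 v (Iic (-s)) + gaussianReal 0 v (Ioc (-s) 0) = 1 / 2 := by
    rw [← measure_union (by rw [Set.disjoint_left]; intro x hx hx2; simp at hx hx2; linarith) measurableSet_Ioc,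
      Iic_union_Ioc_eq_Iic (by linarith), gauss_half hv]
  have h5 : s / (5 * √v) ≤ 1 / 2 := by
    have h6 : 0 < √(v : ℝ) := by positivity
    rw [div_le_iff₀ (by positivity)]; linarith
  rw [ENNReal.ofReal_sub _ (by positivity)]
  refine ENNReal.le_sub_of_add_le_right (by simp) ?_
  calc _ ≤ gaussianReal 0 v (Iic (-s)) + gaussianReal 0 v (Ioc (-s) 0) := by gcongr
    _ = _ := by rw [hsum]; simp


/-! ### The measurable DGFF and the Girsanov estimate -/

/-- measurable version of a DGFF on `V5N N` -/
structure DG {Ω : Type*} [MeasurableSpace Ω] (μ : Measure Ω) (N : ℕ) (η : Z2 → Ω → ℝ) : Prop where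
  meas : ∀ z, Measurable (η z)
  gf : GFam μ η
  out : ∀ z, z ∉ V5N N → η z = 0
  cov : ∀ x ∈ V5N N, ∀ y ∈ V5N N, ∫ ω, η x ω * η y ω ∂μ = greenFn (V5N N) x y

/-- functions supported in the interior -/
def Supp (N : ℕ) (f : Z2 → ℝ) : Prop := ∀ z, z ∉ intr N → f z = 0

/-- the Gaussian variable conjugate to `f` -/
noncomputable def hF {Ω : Type*} (N : ℕ) (η : Z2 → Ω → ℝ) (f : Z2 → ℝ) (ω : Ω) : ℝ :=
  ∑ z ∈ boxF N, lap f z * η z ω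

lemma Supp.fs {N : ℕ} {f : Z2 → ℝ} (h : Supp N f) : f.support.Finite :=
  (Finset.finite_toSet (intr N)).subset (fun z hz => by by_contra h'; exact hz (h z h'))

lemma Supp.box {N : ℕ} {f : Z2 → ℝ} (h : Supp N f) (z : Z2) (hz : z ∉ boxF N) : f z = 0 :=
  h z (fun h' => hz (mem_boxF.2 (intr_sub h')))

section DGs
variable {Ω : Type*} [MeasurableSpace Ω] {μ : Measure Ω} {N : ℕ} {η : Z2 → Ω → ℝ}

lemma DG.hF_meas (D : DG μ N η) (f : Z2 → ℝ) : Measurable (hF N η f) := by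
  unfold hF
  exact Finset.measurable_sum _ (fun z _ => (D.meas z).const_mul _)

lemma DG.cov_lin (D : DG μ N η) {f : Z2 → ℝ} (hf : Supp N f) (c : Z2 → ℝ) :
    ∫ ω, (∑ w ∈ boxF N, c w * η w ω) * hF N η f ω ∂μ = ∑ w ∈ boxF N, c w * f w := by
  unfold hF
  rw [D.gf.cov_lin]
  refine Finset.sum_congr rfl (fun x hx => ?_)
  rw [← green_lap N (mem_boxF.1 hx) hf, Finset.mul_sum]
  refine Finset.sum_congr rfl (fun y hy => ?_)
  rw [D.cov x (mem_boxF.1 hx) y (mem_boxF.1 hy)]; ring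

lemma DG.cov_hF (D : DG μ N η) {f g : Z2 → ℝ} (hf : Supp N f) (hg : Supp N g) :
    ∫ ω, hF N η f ω * hF N η g ω ∂μ = ∑' z, g z * lap f z := by
  have := D.cov_lin hg (lap f)
  unfold hF at this ⊢
  rw [this, tsum_eq_sum (s := boxF N) (fun z hz => by rw [hg.box z hz, zero_mul])]
  exact Finset.sum_congr rfl (fun z _ => mul_comm _ _)

lemma DG.girsanov [IsProbabilityMeasure μ] (D : DG μ N η) {k : ℕ} (f : Fin k → Z2 → ℝ)
    (hs : ∀ i, Supp N (f i)) (ho : ∀ i j, i ≠ j → ∑' z, f i z * lap (f j) z = 0)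
    (hE : ∀ i, 0 < dirE (f i)) {z : Z2} (hz : z ∈ V5N N) (γ : ℝ) (q : Fin k → ENNReal)
    (hq : ∀ i, ∫⁻ x in Iic 0, ENNReal.ofReal (rexp (γ * f i z / dirE (f i) * x))
        ∂(gaussianReal 0 (Real.toNNReal (dirE (f i)))) ≤
      q i * ∫⁻ x, ENNReal.ofReal (rexp (γ * f i z / dirE (f i) * x))
        ∂(gaussianReal 0 (Real.toNNReal (dirE (f i))))) :
    ∫⁻ ω, (∏ i, (Iic (0 : ℝ)).indicator (fun _ => (1 : ENNReal)) (hF N η (f i) ω)) *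
        ENNReal.ofReal (rexp (γ * η z ω)) ∂μ ≤
      (∏ i, q i) * ∫⁻ ω, ENNReal.ofReal (rexp (γ * η z ω)) ∂μ := by
  classical
  have hzb := mem_boxF.2 hz
  let c : Option (Fin k) → Z2 → ℝ := fun o w => match o with
    | none => (if w = z then 1 else 0) - ∑ i, f i z / dirE (f i) * lap (f i) w
    | some i => lap (f i) w
  let X : Option (Fin k) → Ω → ℝ := fun o ω => ∑ w ∈ boxF N, c o w * η w ω
  have hX : GFam μ X := D.gf.lin (fun _ => boxF N) c
  have hXm : ∀ o, Measurable (X o) := fun o =>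
    Finset.measurable_sum _ (fun z _ => (D.meas z).const_mul _)
  have hXs : ∀ i, X (some i) = hF N η (f i) := fun i => rfl
  have hXn : ∀ ω, X none ω = η z ω - ∑ i, f i z / dirE (f i) * hF N η (f i) ω := by
    intro ω
    simp only [X, c, sub_mul, Finset.sum_sub_distrib, ite_mul, one_mul, zero_mul, Finset.sum_ite_eq',
      hzb, if_true, Finset.sum_mul, hF, Finset.mul_sum]
    rw [Finset.sum_comm]
    simp only [mul_assoc]
  have hee : ∀ i j, ∫ ω, X (some i) ω * X (some j) ω ∂μ = if i = j then dirE (f i) else 0 := by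
    intro i j
    rw [hXs, hXs, D.cov_hF (hs i) (hs j)]
    split_ifs with h
    · subst h; exact lap_energy (hs i).fs
    · exact ho j i (Ne.symm h)
  have hn : ∀ j, ∫ ω, X none ω * X (some j) ω ∂μ = 0 := by
    intro j
    have := D.cov_lin (hs j) (c none)
    rw [← hXs j] at this
    refine this.trans ?_
    simp only [c, sub_mul, Finset.sum_sub_distrib, ite_mul, one_mul, zero_mul, Finset.sum_ite_eq',
      hzb, if_true, Finset.sum_mul]
    rw [Finset.sum_comm]
    have h2 : ∀ i, ∑ w ∈ boxF N, f i z / dirE (f i) * lap (f i) w * f j w =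
        if i = j then f j z else 0 := by
      intro i
      have h3 : ∑ w ∈ boxF N, f i z / dirE (f i) * lap (f i) w * f j w =
        f i z / dirE (f i) * ∑' w, f j w * lap (f i) w := by
        rw [tsum_eq_sum (s := boxF N) (fun z hz => by rw [(hs j).box z hz, zero_mul]), Finset.mul_sum]
        exact Finset.sum_congr rfl (fun w _ => by ring)
      rw [h3]
      split_ifs with h
      · subst h; rw [lap_energy (hs i).fs]; have := (hE i).ne'; field_simp
      · rw [ho j i (Ne.symm h), mul_zero]
    simp [h2]
  have hind : iIndepFun X μ := by
    refine hX.iIndep (fun i j hij => ?_)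
    match i, j with
    | none, none => exact absurd rfl hij
    | none, some j => exact hn j
    | some i, none => rw [← hn i]; exact integral_congr_ae (ae_of_all _ fun ω => mul_comm _ _)
    | some i, some j => rw [hee, if_neg (fun h => hij (by rw [h]))]
  have hlaw : ∀ i, μ.map (X (some i)) = gaussianReal 0 (Real.toNNReal (dirE (f i))) := by
    intro i
    exact (hX.law (some i)).trans (by rw [hee, if_pos rfl])
  let e : Option (Fin k) → ℝ → ENNReal := fun o x => match o with
    | none => ENNReal.ofReal (rexp (γ * x))
    | some i => ENNReal.ofReal (rexp (γ * f i z / dirE (f i) * x))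
  let e' : Option (Fin k) → ℝ → ENNReal := fun o x => match o with
    | none => ENNReal.ofReal (rexp (γ * x))
    | some i => (Iic (0 : ℝ)).indicator (fun x => ENNReal.ofReal (rexp (γ * f i z / dirE (f i) * x))) x
  have hem : ∀ o, Measurable (e o) := by rintro (_ | i) <;> simp only [e] <;> fun_prop
  have hem' : ∀ o, Measurable (e' o) := by
    rintro (_ | i)
    · simp only [e']; fun_prop
    · exact Measurable.indicator (by fun_prop) measurableSet_Iic
  have hprod : ∀ ω, ENNReal.ofReal (rexp (γ * η z ω)) = ∏ o, e o (X o ω) := by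
    intro ω
    rw [Fintype.prod_option]
    simp only [e]
    rw [← ENNReal.ofReal_prod_of_nonneg (fun i _ => (exp_pos _).le), ← exp_sum,
      ← ENNReal.ofReal_mul (exp_pos _).le, ← exp_add, hXn]
    congr 2
    rw [mul_sub, Finset.mul_sum]
    simp only [hXs]
    rw [eq_comm, sub_add_eq_add_sub, sub_eq_iff_eq_add]
    congr 1
    exact Finset.sum_congr rfl (fun i _ => by ring)
  have hprod' : ∀ ω, (∏ i, (Iic (0 : ℝ)).indicator (fun _ => (1 : ENNReal)) (hF N η (f i) ω)) *
        ENNReal.ofReal (rexp (γ * η z ω)) = ∏ o, e' o (X o ω) := by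
    intro ω
    rw [hprod, Fintype.prod_option, Fintype.prod_option, mul_left_comm, ← Finset.prod_mul_distrib]
    simp only [e, e']
    congr 1
    refine Finset.prod_congr rfl (fun i _ => ?_)
    rw [hXs]
    by_cases h : hF N η (f i) ω ∈ Iic 0
    · rw [indicator_of_mem h, indicator_of_mem h, one_mul]
    · rw [indicator_of_notMem h, indicator_of_notMem h, zero_mul]
  simp_rw [hprod', hprod]
  rw [lintegral_prod_eq_prod_lintegral_of_indepFun Finset.univ (fun o ω => e' o (X o ω))
      (hind.comp e' hem') (fun o => (hem' o).comp (hXm o)),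
    lintegral_prod_eq_prod_lintegral_of_indepFun Finset.univ (fun o ω => e o (X o ω))
      (hind.comp e hem) (fun o => (hem o).comp (hXm o)),
    Fintype.prod_option, Fintype.prod_option, mul_left_comm, ← Finset.prod_mul_distrib]
  refine mul_le_mul_right (Finset.prod_le_prod' (fun i _ => ?_)) _
  have hi := hq i
  rw [← hlaw, ← lintegral_indicator measurableSet_Iic] at hi
  have h1 := lintegral_map (μ := μ) (hem' (some i)) (hXm (some i))
  have h2 := lintegral_map (μ := μ) (hem (some i)) (hXm (some i))
  calc _ = ∫⁻ a, e' (some i) a ∂(μ.map (X (some i))) := h1.symm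
    _ ≤ _ := hi
    _ = _ := by congr 1

end DGs

/-- the two admissible values of `q` -/
lemma q_zero {E γ : ℝ} (hE : 0 < E) : ∫⁻ x in Iic 0, ENNReal.ofReal (rexp (γ * 0 / E * x))
        ∂(gaussianReal 0 (Real.toNNReal E)) ≤
      (1 / 2) * ∫⁻ x, ENNReal.ofReal (rexp (γ * 0 / E * x)) ∂(gaussianReal 0 (Real.toNNReal E)) := by
  have : Real.toNNReal E ≠ 0 := by simpa using hE
  simp [gauss_half this]

lemma q_one {E γ b : ℝ} (hE : 0 < E) (hγ : 0 ≤ γ) (hγ1 : γ ≤ √E) (hb : b ≤ γ / (5 * √E)) :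
    ∫⁻ x in Iic 0, ENNReal.ofReal (rexp (γ * 1 / E * x)) ∂(gaussianReal 0 (Real.toNNReal E)) ≤
      ENNReal.ofReal (1 / 2 - b) *
        ∫⁻ x, ENNReal.ofReal (rexp (γ * 1 / E * x)) ∂(gaussianReal 0 (Real.toNNReal E)) := by
  have h0 : Real.toNNReal E ≠ 0 := by simpa using hE
  have h1 : ((Real.toNNReal E : NNReal) : ℝ) = E := Real.coe_toNNReal _ hE.le
  rw [lintegral_exp_gaussian, gauss_tilt h0, mul_comm, h1]
  refine mul_le_mul_left ?_ _
  have h2 : γ * 1 / E * E = γ := by field_simp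
  rw [h2]
  refine (gauss_tail h0 hγ (by rw [h1]; exact hγ1)).trans ?_
  rw [h1]
  exact ENNReal.ofReal_le_ofReal (by linarith)


/-! ### Domination of the Green function by a sum of box averages -/

/-- shift operators -/
noncomputable def shH : Multiplicative Z2 →* Module.End ℝ (Z2 → ℝ) where
  toFun v :=
    { toFun := fun f z => f (z + v.toAdd)
      map_add' := fun f g => rfl
      map_smul' := fun c f => rfl }
  map_one' := by ext f z; simp
  map_mul' v w := by
    refine LinearMap.ext (fun f => funext fun z => ?_)
    simp [Module.End.mul_apply, add_assoc]

noncomputable def act : AddMonoidAlgebra ℝ Z2 →ₐ[ℝ] Module.End ℝ (Z2 → ℝ) :=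
  AddMonoidAlgebra.lift ℝ _ Z2 shH

noncomputable def XX (a b : ℤ) : AddMonoidAlgebra ℝ Z2 := AddMonoidAlgebra.single (a, b) 1

lemma act_XX (a b : ℤ) (f : Z2 → ℝ) (z : Z2) : act (XX a b) f z = f (z.1 + a, z.2 + b) := by
  simp [act, XX, shH, Prod.add_def]

lemma XX_mul (a b c d : ℤ) : XX a b * XX c d = XX (a + c) (b + d) := by
  simp [XX, AddMonoidAlgebra.single_mul_single]

noncomputable def BB (m : ℕ) (a b : ℤ) : AddMonoidAlgebra ℝ Z2 :=
  ∑ i ∈ Finset.range m, XX (i * a) (i * b)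

lemma BB_two (m : ℕ) (a b : ℤ) : BB (2 * m) a b = BB m a b * (1 + XX (m * a) (m * b)) := by
  unfold BB
  rw [two_mul, Finset.sum_range_add, mul_add, mul_one, Finset.sum_mul]
  congr 1
  refine Finset.sum_congr rfl fun i _ => ?_
  rw [XX_mul]; push_cast; congr 1 <;> ring

/-- index set of double box averages -/
abbrev JJ (m : ℕ) : Finset ((ℕ × ℕ) × (ℕ × ℕ)) :=
  (Finset.range m ×ˢ Finset.range m) ×ˢ (Finset.range m ×ˢ Finset.range m)

/-- double box average at scale `m` -/
noncomputable def Qm (m : ℕ) (f : Z2 → ℝ) (z : Z2) : ℝ :=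
  (1 / (m : ℝ) ^ 4) * ∑ p ∈ JJ m, f (z.1 + (p.1.1 - p.1.2), z.2 + (p.2.1 - p.2.2))

noncomputable def QA (m : ℕ) : AddMonoidAlgebra ℝ Z2 :=
  (1 / (m : ℝ) ^ 4) • ((BB m 1 0 * BB m (-1) 0) * (BB m 0 1 * BB m 0 (-1)))

lemma act_QA (m : ℕ) (f : Z2 → ℝ) (z : Z2) : act (QA m) f z = Qm m f z := by
  unfold QA Qm BB
  rw [Finset.sum_mul_sum, Finset.sum_mul_sum, ← Finset.sum_product', ← Finset.sum_product',
    Finset.sum_mul_sum, ← Finset.sum_product']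
  simp only [map_smul, map_sum, LinearMap.smul_apply, LinearMap.sum_apply, Pi.smul_apply,
    Finset.sum_apply, XX_mul, act_XX, smul_eq_mul]
  congr 1
  refine Finset.sum_congr rfl fun p _ => ?_
  congr 2 <;> ring_nf

/-- the refinement operator -/
noncomputable def RR (a b : ℤ) (f : Z2 → ℝ) (z : Z2) : ℝ :=
  (2 * f z + f (z.1 + a, z.2 + b) + f (z.1 + -a, z.2 + -b)) / 4

lemma Qm_two (m : ℕ) (f : Z2 → ℝ) : Qm (2 * m) f = Qm m (RR m 0 (RR 0 m f)) := by
  have h1 : RR m 0 (RR 0 m f) = act ((1 / 16 : ℝ) • (((1 + XX m 0) * (1 + XX (-m) 0)) *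
      ((1 + XX 0 m) * (1 + XX 0 (-m))))) f := by
    funext z
    simp only [mul_add, add_mul, mul_one, one_mul, XX_mul, map_smul, map_add, LinearMap.smul_apply,
      LinearMap.add_apply, Pi.smul_apply, Pi.add_apply, act_XX, map_one, Module.End.one_apply,
      smul_eq_mul, RR, neg_zero]
    ring_nf
  funext z
  rw [← act_QA, h1, ← act_QA, ← Module.End.mul_apply, ← map_mul]
  unfold QA
  simp only [BB_two]
  rw [smul_mul_smul_comm]
  have e1 : 1 / ((2 * m : ℕ) : ℝ) ^ 4 = 1 / (m : ℝ) ^ 4 * (1 / 16) := by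
    push_cast; rw [mul_pow]; ring
  rw [e1]
  simp only [mul_one, mul_zero, mul_neg]
  generalize BB m 1 0 = b1
  generalize BB m (-1) 0 = b2
  generalize BB m 0 1 = b3
  generalize BB m 0 (-1) = b4
  ring

/-- squared `ℓ²` norm -/
noncomputable def ns (f : Z2 → ℝ) : ℝ := ∑' z, f z ^ 2

/-- squared increments -/
noncomputable def dd (a b : ℤ) (f : Z2 → ℝ) : ℝ := ∑' z : Z2, (f (z.1 + a, z.2 + b) - f z) ^ 2

lemma fs_sq {f : Z2 → ℝ} (hf : f.support.Finite) : (Function.support fun z => f z ^ 2).Finite :=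
  hf.subset fun z hz => by simpa using hz

lemma fs_sub {f g : Z2 → ℝ} (hf : f.support.Finite) (hg : g.support.Finite) :
    (Function.support fun z => f z - g z).Finite :=
  (hf.union hg).subset fun z hz => by
    by_contra h; simp at h; exact hz (by simp [h])

lemma fs_add {f g : Z2 → ℝ} (hf : f.support.Finite) (hg : g.support.Finite) :
    (Function.support fun z => f z + g z).Finite :=
  (hf.union hg).subset fun z hz => by
    by_contra h; simp at h; exact hz (by simp [h])

lemma fs_RR {f : Z2 → ℝ} (hf : f.support.Finite) (a b : ℤ) : (RR a b f).support.Finite :=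
  ((hf.union (fs_shift hf a b)).union (fs_shift hf (-a) (-b))).subset fun z hz => by
    by_contra h; simp at h; exact hz (by simp [RR, h])

lemma fs_dd {f : Z2 → ℝ} (hf : f.support.Finite) (a b : ℤ) :
    (Function.support fun z : Z2 => (f (z.1 + a, z.2 + b) - f z) ^ 2).Finite :=
  fs_sq (fs_sub (fs_shift hf a b) hf)

lemma ns_nonneg (f : Z2 → ℝ) : 0 ≤ ns f := tsum_nonneg fun _ => sq_nonneg _
lemma dd_nonneg (a b : ℤ) (f : Z2 → ℝ) : 0 ≤ dd a b f := tsum_nonneg fun _ => sq_nonneg _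

lemma ns_sub_RR {f : Z2 → ℝ} (hf : f.support.Finite) (a b : ℤ) :
    ns (fun z => f z - RR a b f z) = (1 / 16) * (4 * dd a b f - dd (2 * a) (2 * b) f) := by
  have h1 : dd a b f = ∑' z : Z2, (f z - f (z.1 + -a, z.2 + -b)) ^ 2 := by
    rw [dd, ← tsum_shift _ (-a) (-b)]
    refine tsum_congr fun z => ?_
    simp
  have h2 : dd (2 * a) (2 * b) f =
      ∑' z : Z2, (f (z.1 + a, z.2 + b) - f (z.1 + -a, z.2 + -b)) ^ 2 := by
    rw [dd, ← tsum_shift _ (-a) (-b)]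
    refine tsum_congr fun z => ?_
    ring_nf
  have e : ∀ z : Z2, (f z - RR a b f z) ^ 2 = (1 / 16) * (2 * (f (z.1 + a, z.2 + b) - f z) ^ 2 +
      2 * (f z - f (z.1 + -a, z.2 + -b)) ^ 2 -
        (f (z.1 + a, z.2 + b) - f (z.1 + -a, z.2 + -b)) ^ 2) := by
    intro z; simp only [RR]; ring
  have s1 := sm (fs_dd hf a b)
  have s2 := sm (fs_sq (fs_sub hf (fs_shift hf (-a) (-b))))
  have s3 := sm (fs_sq (fs_sub (fs_shift hf a b) (fs_shift hf (-a) (-b))))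
  unfold ns
  simp_rw [e]
  rw [tsum_mul_left, ((s1.mul_left 2).add (s2.mul_left 2)).tsum_sub s3,
    (s1.mul_left 2).tsum_add (s2.mul_left 2), tsum_mul_left, tsum_mul_left, ← h1, ← h2, ← dd]
  ring

lemma ns_RR {f : Z2 → ℝ} (hf : f.support.Finite) (a b : ℤ) : ns (RR a b f) ≤ ns f := by
  have s0 := sm (fs_sq hf)
  have s1 := sm (fs_sq (fs_shift hf a b))
  have s2 := sm (fs_sq (fs_shift hf (-a) (-b)))
  have h1 : ∑' z : Z2, f (z.1 + a, z.2 + b) ^ 2 = ns f := tsum_shift (fun z => f z ^ 2) a b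
  have h2 : ∑' z : Z2, f (z.1 + -a, z.2 + -b) ^ 2 = ns f := tsum_shift (fun z => f z ^ 2) (-a) (-b)
  have key : ns (RR a b f) ≤ ∑' z : Z2, ((1 / 4) * (2 * f z ^ 2 + f (z.1 + a, z.2 + b) ^ 2 +
      f (z.1 + -a, z.2 + -b) ^ 2)) := by
    refine (sm (fs_sq (fs_RR hf a b))).tsum_le_tsum (fun z => ?_)
      ((((s0.mul_left 2).add s1).add s2).mul_left _)
    simp only [RR]
    nlinarith [sq_nonneg (f z - f (z.1 + a, z.2 + b)), sq_nonneg (f z - f (z.1 + -a, z.2 + -b)),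
      sq_nonneg (f (z.1 + a, z.2 + b) - f (z.1 + -a, z.2 + -b))]
  refine key.trans (le_of_eq ?_)
  rw [tsum_mul_left, ((s0.mul_left 2).add s1).tsum_add s2, (s0.mul_left 2).tsum_add s1,
    tsum_mul_left, h1, h2, ← ns]
  ring

/-- the scale `m` component of `f` -/
noncomputable def gg (m : ℕ) (f : Z2 → ℝ) (z : Z2) : ℝ := f z - RR m 0 (RR 0 m f) z

lemma fs_gg {f : Z2 → ℝ} (hf : f.support.Finite) (m : ℕ) : (gg m f).support.Finite :=
  fs_sub hf (fs_RR (fs_RR hf _ _) _ _)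

lemma ns_gg {f : Z2 → ℝ} (hf : f.support.Finite) (m : ℕ) :
    ns (gg m f) ≤ (1 / 8) * (4 * dd m 0 f - dd (2 * m) 0 f) +
      (1 / 8) * (4 * dd 0 m f - dd 0 (2 * m) f) := by
  have hh : (Function.support fun z => f z - RR 0 m f z).Finite := fs_sub hf (fs_RR hf _ _)
  have h1 := ns_sub_RR hf m 0
  have h2 := ns_sub_RR hf 0 m
  have h3 := ns_RR hh m 0
  have h4 : ns (gg m f) ≤ 2 * ns (fun z => f z - RR m 0 f z) +
      2 * ns (RR m 0 fun z => f z - RR 0 m f z) := by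
    have s1 := sm (fs_sq (fs_sub hf (fs_RR hf m 0)))
    have s2 := sm (fs_sq (fs_RR hh m 0))
    unfold ns
    rw [← tsum_mul_left, ← tsum_mul_left, ← (s1.mul_left 2).tsum_add (s2.mul_left 2)]
    refine (sm (fs_sq (fs_gg hf m))).tsum_le_tsum (fun z => ?_)
      ((s1.mul_left 2).add (s2.mul_left 2))
    have e : gg m f z = (f z - RR m 0 f z) + RR m 0 (fun z => f z - RR 0 m f z) z := by
      simp only [gg, RR]; ring
    rw [e]
    nlinarith [sq_nonneg ((f z - RR m 0 f z) - RR m 0 (fun z => f z - RR 0 m f z) z)]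
  rw [mul_zero] at h1 h2
  linarith

lemma sum_gg {f : Z2 → ℝ} (hf : f.support.Finite) (I : ℕ) :
    ∑ i ∈ Finset.range I, (1 / 4 : ℝ) ^ i * ns (gg (2 ^ i) f) ≤ (1 / 2) * (dd 1 0 f + dd 0 1 f) := by
  have h : ∑ i ∈ Finset.range I, (1 / 4 : ℝ) ^ i * ns (gg (2 ^ i) f) ≤ (1 / 2) * (dd 1 0 f + dd 0 1 f)
      - (1 / 2) * (1 / 4) ^ I * (dd (2 ^ I : ℕ) 0 f + dd 0 (2 ^ I : ℕ) f) := by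
    induction I with
    | zero => simp
    | succ I ih =>
      rw [Finset.sum_range_succ]
      have h1 := mul_le_mul_of_nonneg_left (ns_gg hf (2 ^ I)) (show (0 : ℝ) ≤ (1 / 4) ^ I by positivity)
      have e : ((2 ^ (I + 1) : ℕ) : ℤ) = 2 * ((2 ^ I : ℕ) : ℤ) := by push_cast; ring
      rw [e, pow_succ]
      nlinarith
  refine h.trans (sub_le_self _ ?_)
  have := dd_nonneg (2 ^ I : ℕ) 0 f
  have := dd_nonneg 0 (2 ^ I : ℕ) f
  positivity

lemma dd_dirE {f : Z2 → ℝ} (hf : f.support.Finite) : dd 1 0 f + dd 0 1 f = 4 * dirE f := by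
  have h1 := sm (fs_dd hf 1 0)
  have h2 := sm (fs_dd hf 0 1)
  simp only [add_zero] at h1 h2
  simp only [dd, dirE, add_zero]
  rw [h1.tsum_add h2]; ring

lemma dirE_nonneg (f : Z2 → ℝ) : 0 ≤ dirE f :=
  mul_nonneg (by norm_num) (tsum_nonneg fun _ => by positivity)

lemma poincare {N : ℕ} {f : Z2 → ℝ} (hf : Supp N f) : ns f ≤ (5 * N) ^ 2 * dd 1 0 f := by
  have hfs := hf.fs
  have hz : ∀ z : Z2, f z ^ 2 ≤ (5 * N : ℝ) * ∑ u ∈ Finset.range (5 * N),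
      (f (z.1 + (u : ℤ) + 1, z.2 + 0) - f (z.1 + (u : ℤ), z.2 + 0)) ^ 2 := by
    intro z
    by_cases hzz : z ∈ intr N
    swap
    · rw [hf z hzz, zero_pow two_ne_zero]; positivity
    have e : f z = - ∑ u ∈ Finset.range (5 * N),
      (f (z.1 + (u : ℤ) + 1, z.2 + 0) - f (z.1 + (u : ℤ), z.2 + 0)) := by
      have := Finset.sum_range_sub (fun u : ℕ => f (z.1 + (u : ℤ), z.2 + 0)) (5 * N)
      push_cast at this
      simp only [← add_assoc] at this
      rw [this, hf (z.1 + (5 : ℤ) * N, z.2 + 0)]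
      · simp
      · rw [mem_intr] at hzz ⊢; simp only; omega
    rw [e, neg_sq]
    have := sq_sum_le_card_mul_sum_sq (s := Finset.range (5 * N))
      (f := fun u : ℕ => (f (z.1 + (u : ℤ) + 1, z.2 + 0) - f (z.1 + (u : ℤ), z.2 + 0)))
    simpa using this
  have ss : ∀ u : ℕ, Summable fun z : Z2 =>
      (f (z.1 + (u : ℤ) + 1, z.2 + 0) - f (z.1 + (u : ℤ), z.2 + 0)) ^ 2 := by
    intro u
    have := sm (fs_shift (fs_dd hfs 1 0) u 0)
    simpa using this
  have se : ∀ u : ℕ, ∑' z : Z2,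
      (f (z.1 + (u : ℤ) + 1, z.2 + 0) - f (z.1 + (u : ℤ), z.2 + 0)) ^ 2 = dd 1 0 f := by
    intro u
    have := tsum_shift (fun z : Z2 => (f (z.1 + 1, z.2 + 0) - f z) ^ 2) u 0
    simpa [dd] using this
  calc ns f ≤ ∑' z : Z2, (5 * N : ℝ) * ∑ u ∈ Finset.range (5 * N),
      (f (z.1 + (u : ℤ) + 1, z.2 + 0) - f (z.1 + (u : ℤ), z.2 + 0)) ^ 2 :=
        (sm (fs_sq hfs)).tsum_le_tsum hz ((summable_sum fun u _ => ss u).mul_left _)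
    _ = (5 * N) ^ 2 * dd 1 0 f := by
        rw [tsum_mul_left, Summable.tsum_finsetSum fun u _ => ss u]
        simp only [se]; simp; ring

lemma Qm_symm {f g : Z2 → ℝ} (hf : f.support.Finite) (hg : g.support.Finite) (m : ℕ) :
    ∑' z, f z * Qm m g z = ∑' z, Qm m f z * g z := by
  have key : ∀ a b : ℤ, ∑' z : Z2, f z * g (z.1 + a, z.2 + b) =
      ∑' z : Z2, f (z.1 + -a, z.2 + -b) * g z := by
    intro a b
    rw [← tsum_shift (fun z : Z2 => f (z.1 + -a, z.2 + -b) * g z) a b]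
    simp
  have e1 : ∀ z, f z * Qm m g z = (1 / (m : ℝ) ^ 4) * ∑ p ∈ JJ m,
      f z * g (z.1 + (p.1.1 - p.1.2), z.2 + (p.2.1 - p.2.2)) := by
    intro z; simp only [Qm, Finset.mul_sum]; exact Finset.sum_congr rfl fun _ _ => by ring
  have e2 : ∀ z, Qm m f z * g z = (1 / (m : ℝ) ^ 4) * ∑ p ∈ JJ m,
      f (z.1 + (p.1.1 - p.1.2), z.2 + (p.2.1 - p.2.2)) * g z := by
    intro z; simp only [Qm, Finset.mul_sum, Finset.sum_mul]
    exact Finset.sum_congr rfl fun _ _ => by ring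
  simp_rw [e1, e2]
  rw [tsum_mul_left, tsum_mul_left, Summable.tsum_finsetSum fun p _ => sm (fs_mul hf),
    Summable.tsum_finsetSum fun p _ => sm (fs_mul' hg)]
  congr 1
  simp_rw [key]
  refine Finset.sum_nbij' (fun p => ((p.1.2, p.1.1), (p.2.2, p.2.1)))
    (fun p => ((p.1.2, p.1.1), (p.2.2, p.2.1))) ?_ ?_ ?_ ?_ ?_
  · intro p hp; simp only [Finset.mem_product] at hp ⊢; tauto
  · intro p hp; simp only [Finset.mem_product] at hp ⊢; tauto
  · intro p _; rfl
  · intro p _; rfl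
  · intro p _; simp

lemma fs_Qm {f : Z2 → ℝ} (hf : f.support.Finite) (m : ℕ) : (Qm m f).support.Finite := by
  refine ((JJ m).finite_toSet.biUnion fun p _ =>
    fs_shift hf (p.1.1 - p.1.2) (p.2.1 - p.2.2)).subset fun z hz => ?_
  by_contra h
  simp only [mem_iUnion, not_exists, Function.mem_support, not_not] at h
  exact hz (by simp only [Qm]; rw [Finset.sum_eq_zero fun p hp => h p hp, mul_zero])

lemma Qm_decomp (f : Z2 → ℝ) (I : ℕ) (z : Z2) :
    f z = ∑ i ∈ Finset.range I, Qm (2 ^ i) (gg (2 ^ i) f) z + Qm (2 ^ I) f z := by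
  induction I with
  | zero => simp [Qm, JJ, Finset.range_one]
  | succ I ih =>
    rw [ih, Finset.sum_range_succ, pow_succ, mul_comm (2 ^ I), Qm_two, add_assoc]
    congr 1
    have : ∀ g h : Z2 → ℝ, Qm (2 ^ I) (fun z => g z - h z) z = Qm (2 ^ I) g z - Qm (2 ^ I) h z := by
      intro g h; simp only [Qm, Finset.sum_sub_distrib]; ring
    have h2 := this f (RR (2 ^ I : ℕ) 0 (RR 0 (2 ^ I : ℕ) f))
    have h3 : gg (2 ^ I) f = fun z => f z - RR (2 ^ I : ℕ) 0 (RR 0 (2 ^ I : ℕ) f) z := rfl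
    rw [h3, h2]; ring

lemma green_solve (N : ℕ) (ν : Z2 → ℝ) : ∃ f, Supp N f ∧ ∀ z ∈ intr N, lap f z = ν z := by
  classical
  let ex : (↥(intr N) → ℝ) → Z2 → ℝ := fun g z => if h : z ∈ intr N then g ⟨z, h⟩ else 0
  have hex : ∀ g, Supp N (ex g) := fun g z hz => by simp [ex, hz]
  let L : (↥(intr N) → ℝ) →ₗ[ℝ] (↥(intr N) → ℝ) :=
    { toFun := fun g z => lap (ex g) z
      map_add' := fun g h => by
        funext z
        have : ∀ w, ex (g + h) w = ex g w + ex h w := by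
          intro w; simp only [ex]; split_ifs <;> simp
        simp only [lap, avg4, this, Pi.add_apply]; ring
      map_smul' := fun c g => by
        funext z
        have : ∀ w, ex (c • g) w = c * ex g w := by
          intro w; simp only [ex]; split_ifs <;> simp
        simp only [lap, avg4, this, Pi.smul_apply, smul_eq_mul, RingHom.id_apply]; ring }
  have hinj : Function.Injective L := by
    rw [injective_iff_map_eq_zero]
    intro g hg
    funext x
    have h1 := green_lap N (intr_sub x.2) (hex g)
    have h2 : ex g x = g x := by simp [ex]
    rw [← h2, ← h1]
    refine Finset.sum_eq_zero fun y hy => ?_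
    by_cases hyi : y ∈ intr N
    · have := congrFun hg ⟨y, hyi⟩
      simp only [L, LinearMap.coe_mk, AddHom.coe_mk, Pi.zero_apply] at this
      rw [this, mul_zero]
    · rw [greenFn_out N (intr_sub x.2) (mem_boxF.1 hy) (Or.inr hyi), zero_mul]
  obtain ⟨g, hg⟩ := (LinearMap.injective_iff_surjective.1 hinj) (fun z => ν z)
  exact ⟨ex g, hex g, fun z hz => congrFun hg ⟨z, hz⟩⟩

/-- Domination of the Green form by double box averages. -/
lemma green_dom (N I : ℕ) (hI : N ≤ 2 ^ I) (ν : Z2 → ℝ) (hν : ∀ z, z ∉ boxF N → ν z = 0) :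
    ∑ x ∈ boxF N, ∑ y ∈ boxF N, ν x * ν y * greenFn (V5N N) x y ≤
      102 * ∑ i ∈ Finset.range (I + 1), (4 : ℝ) ^ i * ns (Qm (2 ^ i) ν) := by
  obtain ⟨f, hf, hfl⟩ := green_solve N ν
  have hνs : ν.support.Finite := (boxF N).finite_toSet.subset fun z hz => by
    by_contra h; exact hz (hν z h)
  have hG : ∀ x ∈ boxF N, ∑ y ∈ boxF N, greenFn (V5N N) x y * ν y = f x := by
    intro x hx
    rw [← green_lap N (mem_boxF.1 hx) hf]
    refine Finset.sum_congr rfl fun y hy => ?_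
    by_cases hyi : y ∈ intr N
    · rw [hfl y hyi]
    · rw [greenFn_out N (mem_boxF.1 hx) (mem_boxF.1 hy) (Or.inr hyi), zero_mul, zero_mul]
  have hv : ∑ x ∈ boxF N, ∑ y ∈ boxF N, ν x * ν y * greenFn (V5N N) x y = ∑' z, ν z * f z := by
    rw [tsum_eq_sum (s := boxF N) fun z hz => by rw [hν z hz, zero_mul]]
    refine Finset.sum_congr rfl fun x hx => ?_
    rw [← hG x hx, Finset.mul_sum]
    exact Finset.sum_congr rfl fun y _ => by ring
  have hE : ∑' z, ν z * f z = dirE f := by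
    rw [← lap_energy hf.fs]
    refine tsum_congr fun z => ?_
    by_cases hz : z ∈ intr N
    · rw [hfl z hz, mul_comm]
    · rw [hf z hz]; ring
  rw [hv, hE]
  -- decomposition
  let g : ℕ → Z2 → ℝ := fun i => if i < I then gg (2 ^ i) f else f
  have hgs : ∀ i, (g i).support.Finite := fun i => by
    simp only [g]; split_ifs; exacts [fs_gg hf.fs _, hf.fs]
  have hdec : ∀ z, f z = ∑ i ∈ Finset.range (I + 1), Qm (2 ^ i) (g i) z := by
    intro z
    rw [Finset.sum_range_succ, Qm_decomp f I z]
    congr 1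
    · exact Finset.sum_congr rfl fun i hi => by simp [g, Finset.mem_range.1 hi]
    · simp [g]
  have hpair : dirE f = ∑ i ∈ Finset.range (I + 1), ∑' z, Qm (2 ^ i) ν z * g i z := by
    rw [← hE]
    simp_rw [← fun i => Qm_symm hνs (hgs i) (2 ^ i)]
    rw [← Summable.tsum_finsetSum fun i _ => sm (fs_mul hνs)]
    refine tsum_congr fun z => ?_
    rw [← Finset.mul_sum, ← hdec]
  have hgn : ∑ i ∈ Finset.range (I + 1), (1 / 4 : ℝ) ^ i * ns (g i) ≤ 102 * dirE f := by
    rw [Finset.sum_range_succ]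
    have h1 : ∑ i ∈ Finset.range I, (1 / 4 : ℝ) ^ i * ns (g i) =
        ∑ i ∈ Finset.range I, (1 / 4 : ℝ) ^ i * ns (gg (2 ^ i) f) :=
      Finset.sum_congr rfl fun i hi => by simp [g, Finset.mem_range.1 hi]
    have h2 : g I = f := by simp [g]
    have h3 := sum_gg hf.fs I
    have h4 := poincare hf
    have h5 := dd_dirE hf.fs
    have h6 := dd_nonneg 0 1 f
    have h6' := dd_nonneg 1 0 f
    have h7 : (1 / 4 : ℝ) ^ I * (5 * N) ^ 2 ≤ 25 := by
      have : (N : ℝ) ≤ 2 ^ I := by exact_mod_cast hI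
      have h8 : (N : ℝ) ^ 2 ≤ 4 ^ I := by
        calc (N : ℝ) ^ 2 ≤ (2 ^ I) ^ 2 := by gcongr
          _ = 4 ^ I := by rw [← pow_mul, mul_comm, pow_mul]; norm_num
      rw [one_div, inv_pow, inv_mul_le_iff₀ (by positivity)]
      linarith
    have h9 := mul_le_mul_of_nonneg_right h7 h6'
    have h10 := mul_le_mul_of_nonneg_left h4 (show (0 : ℝ) ≤ (1 / 4) ^ I by positivity)
    rw [h1, h2]
    nlinarith
  -- Cauchy–Schwarz, in the form `ab ≤ (102 4^i a² + 102⁻¹ 4^{-i} b²)/2`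
  have hcs : ∀ i, ∑' z, Qm (2 ^ i) ν z * g i z ≤
      51 * ((4 : ℝ) ^ i * ns (Qm (2 ^ i) ν)) + (1 / 204) * ((1 / 4 : ℝ) ^ i * ns (g i)) := by
    intro i
    have s1 := sm (fs_sq (fs_Qm hνs (2 ^ i)))
    have s2 := sm (fs_sq (hgs i))
    unfold ns
    rw [← mul_assoc, ← mul_assoc, ← tsum_mul_left, ← tsum_mul_left,
      ← (s1.mul_left _).tsum_add (s2.mul_left _)]
    refine (sm (fs_mul (fs_Qm hνs _))).tsum_le_tsum (fun z => ?_)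
      ((s1.mul_left _).add (s2.mul_left _))
    have h4 : (0 : ℝ) < 4 ^ i := by positivity
    rw [show (1 / 4 : ℝ) ^ i = ((4 : ℝ) ^ i)⁻¹ by rw [one_div, inv_pow], ← sub_nonneg]
    have : 51 * 4 ^ i * Qm (2 ^ i) ν z ^ 2 + 204⁻¹ * ((4 : ℝ) ^ i)⁻¹ * g i z ^ 2 -
        Qm (2 ^ i) ν z * g i z =
        (102 * 4 ^ i * Qm (2 ^ i) ν z - g i z) ^ 2 * (204⁻¹ * ((4 : ℝ) ^ i)⁻¹) := by
      field_simp; ring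
    rw [show (1 : ℝ) / 204 = 204⁻¹ by norm_num, this]
    positivity
  have hfin : dirE f ≤ 51 * ∑ i ∈ Finset.range (I + 1), ((4 : ℝ) ^ i * ns (Qm (2 ^ i) ν)) +
      (1 / 204) * ∑ i ∈ Finset.range (I + 1), (1 / 4 : ℝ) ^ i * ns (g i) := by
    conv_lhs => rw [hpair]
    rw [Finset.mul_sum, Finset.mul_sum, ← Finset.sum_add_distrib]
    exact Finset.sum_le_sum fun i _ => hcs i
  linarith


/-! ### Variance bounds -/

noncomputable def dlt (x z : Z2) : ℝ := if z = x then 1 else 0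

lemma fs_dlt (x : Z2) : (dlt x).support.Finite :=
  (Set.finite_singleton x).subset fun z hz => by
    by_contra h; exact hz (if_neg h)

lemma Qm_dlt_le (m : ℕ) (x z : Z2) : Qm m (dlt x) z ≤ 1 / (m : ℝ) ^ 4 * (m : ℝ) ^ 2 := by
  classical
  unfold Qm
  refine mul_le_mul_of_nonneg_left ?_ (by positivity)
  simp only [dlt]
  rw [Finset.sum_boole]
  have : (((JJ m).filter fun p => (z.1 + ((p.1.1 : ℤ) - p.1.2), z.2 + ((p.2.1 : ℤ) - p.2.2)) = x).card) ≤
      (Finset.range m ×ˢ Finset.range m).card := by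
    refine Finset.card_le_card_of_injOn (fun p => (p.1.1, p.2.1)) ?_ ?_
    · intro p hp; simp at hp ⊢; tauto
    · intro p hp p' hp' h
      simp only [Finset.coe_filter, Set.mem_ofPred_eq, Prod.ext_iff, Finset.mem_product] at hp hp' h
      obtain ⟨⟨a, b⟩, ⟨c, d⟩⟩ := p
      obtain ⟨⟨a', b'⟩, ⟨c', d'⟩⟩ := p'
      simp only [Prod.mk.injEq] at *
      omega
  rw [Finset.card_product, Finset.card_range] at this
  calc _ ≤ ((m * m : ℕ) : ℝ) := by exact_mod_cast this
    _ = _ := by push_cast; ring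

lemma Qm_dlt_nonneg (m : ℕ) (x z : Z2) : 0 ≤ Qm m (dlt x) z := by
  unfold Qm dlt
  refine mul_nonneg (by positivity) (Finset.sum_nonneg fun p _ => ?_)
  split_ifs <;> norm_num

lemma Qm_dlt_sum (m : ℕ) (x : Z2) : ∑' z, Qm m (dlt x) z ≤ 1 := by
  unfold Qm
  have h : ∀ a b : ℤ, ∑' z : Z2, dlt x (z.1 + a, z.2 + b) = 1 := by
    intro a b
    rw [tsum_shift (dlt x) a b]
    simp only [dlt]
    exact tsum_ite_eq x (fun _ => (1 : ℝ))
  rw [tsum_mul_left, Summable.tsum_finsetSum fun p _ => sm (fs_shift (fs_dlt x) _ _)]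
  simp only [h]
  simp only [Finset.sum_const, Finset.card_product, Finset.card_range, nsmul_eq_mul, mul_one]
  rcases Nat.eq_zero_or_pos m with rfl | hm
  · simp
  · apply le_of_eq; field_simp; push_cast; ring

lemma ns_Qm_dlt (m : ℕ) (hm : 0 < m) (x : Z2) : ns (Qm m (dlt x)) ≤ 1 / (m : ℝ) ^ 2 := by
  have hs := fs_Qm (fs_dlt x) m
  have e : 1 / (m : ℝ) ^ 4 * (m : ℝ) ^ 2 = 1 / (m : ℝ) ^ 2 := by field_simp
  calc ns (Qm m (dlt x)) ≤ ∑' z, (1 / (m : ℝ) ^ 2) * Qm m (dlt x) z := by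
        refine (sm (fs_sq hs)).tsum_le_tsum (fun z => ?_) ((sm hs).mul_left _)
        rw [sq]
        exact mul_le_mul_of_nonneg_right (e ▸ Qm_dlt_le m x z) (Qm_dlt_nonneg m x z)
    _ ≤ _ := by
        rw [tsum_mul_left]
        exact mul_le_of_le_one_right (by positivity) (Qm_dlt_sum m x)

lemma sum_dlt_le (I : ℕ) (x : Z2) :
    ∑ i ∈ Finset.range (I + 1), (4 : ℝ) ^ i * ns (Qm (2 ^ i) (dlt x)) ≤ I + 1 := by
  calc _ ≤ ∑ i ∈ Finset.range (I + 1), (1 : ℝ) := by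
        refine Finset.sum_le_sum fun i _ => ?_
        have := ns_Qm_dlt (2 ^ i) (by positivity) x
        push_cast at this
        rw [← pow_mul, mul_comm i, pow_mul] at this
        calc _ ≤ (4 : ℝ) ^ i * (1 / (2 ^ 2) ^ i) := by gcongr
          _ = 1 := by norm_num
    _ = _ := by simp

lemma green_diag {N I : ℕ} (hI : N ≤ 2 ^ I) {z : Z2} (hz : z ∈ V5N N) :
    greenFn (V5N N) z z ≤ 102 * (I + 1) := by
  have h := green_dom N I hI (dlt z) (fun w hw => if_neg (fun h : w = z => hw (by rw [h]; exact mem_boxF.2 hz)))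
  have h2 := sum_dlt_le I z
  simp only [dlt, ite_mul, mul_ite, one_mul, zero_mul, mul_zero, mul_one, Finset.sum_ite_eq',
    mem_boxF.2 hz, if_true] at h
  have e : dlt z = fun w => if w = z then 1 else 0 := rfl
  rw [e] at h2
  have h3 : greenFn (V5N N) z z ≤ 102 * ∑ i ∈ Finset.range (I + 1), (4 : ℝ) ^ i *
      ns (Qm (2 ^ i) (fun w => if w = z then 1 else 0)) := by
    refine le_trans (le_of_eq ?_) h
    simp
  linarith

lemma DG.gbound {Ω : Type*} [MeasurableSpace Ω] {μ : Measure Ω} {N : ℕ} {η : Z2 → Ω → ℝ}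
    (D : DG μ N η) {I : ℕ} (hI : N ≤ 2 ^ I) {z : Z2} (hz : z ∈ V5N N) (t : ℝ) :
    ∫⁻ ω, ENNReal.ofReal (rexp (t * η z ω)) ∂μ ≤ ENNReal.ofReal (rexp (51 * t ^ 2 * (I + 1))) := by
  rw [D.gf.lexp, D.cov z hz z hz]
  refine ENNReal.ofReal_le_ofReal (exp_le_exp.2 ?_)
  have := mul_le_mul_of_nonneg_left (green_diag hI hz) (sq_nonneg t)
  linarith


/-! ### Geometry of the test functions -/

/-- lattice points as complex numbers -/
noncomputable def cx (z : Z2) : ℂ := ⟨(z.1 : ℝ), (z.2 : ℝ)⟩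

/-- clamp to `[0,1]` -/
noncomputable def cl (t : ℝ) : ℝ := max 0 (min 1 t)

lemma cl_nonneg (t : ℝ) : 0 ≤ cl t := le_max_left _ _
lemma cl_le_one (t : ℝ) : cl t ≤ 1 := max_le zero_le_one (min_le_left _ _)
lemma cl_of_nonpos {t : ℝ} (h : t ≤ 0) : cl t = 0 :=
  max_eq_left ((min_le_right _ _).trans h)
lemma cl_of_one_le {t : ℝ} (h : 1 ≤ t) : cl t = 1 := by
  unfold cl; rw [min_eq_left h]; norm_num
lemma cl_lip (s t : ℝ) : |cl s - cl t| ≤ |s - t| := by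
  unfold cl
  refine (abs_max_sub_max_le_max _ _ _ _).trans ?_
  rw [sub_self, abs_zero]
  refine max_le (abs_nonneg _) ?_
  refine (abs_min_sub_min_le_max _ _ _ _).trans ?_
  rw [sub_self, abs_zero]
  exact max_le (abs_nonneg _) le_rfl

/-- trapezoid profile: `0` outside `[p,q]`, slope `c` -/
noncomputable def trap (p q c x : ℝ) : ℝ := cl (min ((x - p) * c) ((q - x) * c))

lemma trap_nonneg (p q c x : ℝ) : 0 ≤ trap p q c x := cl_nonneg _
lemma trap_le_one (p q c x : ℝ) : trap p q c x ≤ 1 := cl_le_one _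
lemma trap_zero {p q c x : ℝ} (hc : 0 ≤ c) (h : x ≤ p ∨ q ≤ x) : trap p q c x = 0 := by
  apply cl_of_nonpos
  rcases h with h | h
  · exact (min_le_left _ _).trans (mul_nonpos_of_nonpos_of_nonneg (by linarith) hc)
  · exact (min_le_right _ _).trans (mul_nonpos_of_nonpos_of_nonneg (by linarith) hc)
lemma trap_one {p q c x : ℝ} (h1 : 1 ≤ (x - p) * c) (h2 : 1 ≤ (q - x) * c) : trap p q c x = 1 :=
  cl_of_one_le (le_min h1 h2)
lemma trap_lip {p q c : ℝ} (hc : 0 ≤ c) (x y : ℝ) :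
    |trap p q c x - trap p q c y| ≤ c * |x - y| := by
  refine (cl_lip _ _).trans ((abs_min_sub_min_le_max _ _ _ _).trans (max_le ?_ ?_))
  · rw [show (x - p) * c - (y - p) * c = c * (x - y) by ring, abs_mul, abs_of_nonneg hc]
  · rw [show (q - x) * c - (q - y) * c = c * (y - x) by ring, abs_mul, abs_of_nonneg hc, abs_sub_comm]

noncomputable def chi (ε y : ℝ) : ℝ :=
  trap (ε / 4) (7 * ε / 4) (4 / ε) y - trap (ε / 4) (7 * ε / 4) (4 / ε) (-y)

noncomputable def psi (n : ℕ) (x : ℝ) : ℝ := trap (3 / 8) (5 / 8) (16 * n) x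

noncomputable def FF (ε : ℝ) (n : ℕ) (w : ℂ) : ℝ := psi n w.re * chi ε w.im

lemma chi_abs (ε y : ℝ) : |chi ε y| ≤ 1 := by
  unfold chi
  rw [abs_le]
  constructor <;> linarith [trap_nonneg (ε / 4) (7 * ε / 4) (4 / ε) y, trap_le_one (ε / 4) (7 * ε / 4) (4 / ε) y,
    trap_nonneg (ε / 4) (7 * ε / 4) (4 / ε) (-y), trap_le_one (ε / 4) (7 * ε / 4) (4 / ε) (-y)]

lemma chi_zero {ε y : ℝ} (hε : 0 < ε) (h : 7 * ε / 4 ≤ |y|) : chi ε y = 0 := by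
  have hc : 0 ≤ 4 / ε := by positivity
  unfold chi
  rcases le_abs.1 h with h | h
  · rw [trap_zero hc (Or.inr h), trap_zero hc (Or.inl (by linarith)), sub_zero]
  · rw [trap_zero hc (Or.inr h), trap_zero hc (Or.inl (by linarith)), sub_zero]

lemma chi_neg (ε y : ℝ) : chi ε (-y) = - chi ε y := by unfold chi; rw [neg_neg]; ring

lemma chi_one {ε y : ℝ} (hε : 0 < ε) (h1 : ε / 2 ≤ y) (h2 : y ≤ 3 * ε / 2) : chi ε y = 1 := by
  have hc : 0 ≤ 4 / ε := by positivity
  unfold chi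
  rw [trap_one, trap_zero hc (Or.inl (by linarith)), sub_zero]
  · rw [mul_div_assoc', le_div_iff₀ hε]; linarith
  · rw [mul_div_assoc', le_div_iff₀ hε]; linarith

lemma chi_lip {ε : ℝ} (hε : 0 < ε) (x y : ℝ) : |chi ε x - chi ε y| ≤ 8 / ε * |x - y| := by
  have hc : 0 ≤ 4 / ε := by positivity
  have h1 := trap_lip (p := ε / 4) (q := 7 * ε / 4) hc x y
  have h2 := trap_lip (p := ε / 4) (q := 7 * ε / 4) hc (-x) (-y)
  rw [show -x - -y = -(x - y) by ring, abs_neg] at h2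
  have e : 8 / ε = 4 / ε + 4 / ε := by ring
  unfold chi
  rw [e, add_mul]
  refine le_trans (le_of_eq ?_) ((abs_sub _ _).trans (add_le_add h1 h2))
  congr 1; ring

lemma psi_zero {n : ℕ} {x : ℝ} (h : x ≤ 3 / 8 ∨ 5 / 8 ≤ x) : psi n x = 0 := trap_zero (by positivity) h

lemma psi_one {n : ℕ} {x : ℝ} (hn : 0 < n) (h1 : (6 * n + 1) / (16 * n) ≤ x) (h2 : x ≤ (10 * n - 1) / (16 * n)) :
    psi n x = 1 := by
  have hn' : (0 : ℝ) < n := by exact_mod_cast hn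
  rw [div_le_iff₀ (by positivity)] at h1
  rw [le_div_iff₀ (by positivity)] at h2
  exact trap_one (by linarith) (by linarith)

lemma FF_zero {ε : ℝ} {n : ℕ} {w : ℂ} (hε : 0 < ε)
    (h : w.re ≤ 3 / 8 ∨ 5 / 8 ≤ w.re ∨ 7 * ε / 4 ≤ |w.im|) : FF ε n w = 0 := by
  unfold FF
  rcases h with h | h | h
  · rw [psi_zero (Or.inl h), zero_mul]
  · rw [psi_zero (Or.inr h), zero_mul]
  · rw [chi_zero hε h, mul_zero]

/-- waypoints of the two routes, in normalized coordinates -/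
noncomputable def wp (ε s x : ℝ) : ℂ := ⟨x, s * ε * min (2 * x) (2 - 2 * x)⟩

lemma wp_zero (ε s : ℝ) : wp ε s 0 = 0 := by
  apply Complex.ext <;> simp [wp]

lemma wp_one (ε s : ℝ) : wp ε s 1 = 1 := by
  apply Complex.ext <;> simp [wp]

lemma FF_wp_zero {ε s : ℝ} {n j : ℕ} {w : ℂ} (hn : 0 < n) (hε : 0 < ε)
    (hj : j + 3 ≤ 6 * n ∨ 10 * n + 3 ≤ j) (h : ‖w - wp ε s (j / (16 * n))‖ ≤ 3 / (16 * n)) : FF ε n w = 0 := by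
  have hn' : (0 : ℝ) < n := by exact_mod_cast hn
  have h1 := (Complex.abs_re_le_norm _).trans h
  simp only [Complex.sub_re, wp] at h1
  rw [abs_le] at h1
  rcases hj with hj | hj
  · apply FF_zero hε (Or.inl _)
    have : ((j : ℝ) + 3) / (16 * n) ≤ 3 / 8 := by
      rw [div_le_iff₀ (by positivity)]
      have : ((j + 3 : ℕ) : ℝ) ≤ (6 * n : ℕ) := by exact_mod_cast hj
      push_cast at this; linarith
    rw [add_div] at this; linarith
  · apply FF_zero hε (Or.inr (Or.inl _))
    have : 5 / 8 ≤ ((j : ℝ) - 3) / (16 * n) := by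
      rw [le_div_iff₀ (by positivity)]
      have : ((10 * n + 3 : ℕ) : ℝ) ≤ j := by exact_mod_cast hj
      push_cast at this; linarith
    rw [sub_div] at this; linarith

lemma FF_wp_one {ε s : ℝ} {n j : ℕ} {w : ℂ} (hn : 0 < n) (hε : 0 < ε) (hs : s = 1 ∨ s = -1)
    (hnε : 3 / (16 * n) ≤ ε / 8)
    (hj : 6 * n + 4 ≤ j) (hj' : j + 4 ≤ 10 * n) (h : ‖w - wp ε s (j / (16 * n))‖ ≤ 3 / (16 * n)) :
    FF ε n w = s := by
  have hn' : (0 : ℝ) < n := by exact_mod_cast hn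
  have h1 := (Complex.abs_re_le_norm _).trans h
  have h2 := ((Complex.abs_im_le_norm _).trans h).trans hnε
  simp only [Complex.sub_re, Complex.sub_im, wp] at h1 h2
  rw [abs_le] at h1 h2
  have a1 : ((6 * n + 4 : ℕ) : ℝ) ≤ j := by exact_mod_cast hj
  have a2 : ((j + 4 : ℕ) : ℝ) ≤ (10 * n : ℕ) := by exact_mod_cast hj'
  push_cast at a1 a2
  have b1 : (6 * n + 1 : ℝ) / (16 * n) ≤ j / (16 * n) - 3 / (16 * n) := by
    rw [← sub_div]; gcongr; linarith
  have b2 : j / (16 * n) + 3 / (16 * n) ≤ (10 * n - 1 : ℝ) / (16 * n) := by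
    rw [← add_div]; gcongr; linarith
  have c1 : 3 / 8 ≤ (j : ℝ) / (16 * n) := by rw [le_div_iff₀ (by positivity)]; linarith
  have c2 : (j : ℝ) / (16 * n) ≤ 5 / 8 := by rw [div_le_iff₀ (by positivity)]; linarith
  set x := (j : ℝ) / (16 * n)
  unfold FF
  rw [psi_one hn (by linarith) (by linarith), one_mul]
  have d1 : 3 / 4 ≤ min (2 * x) (2 - 2 * x) := le_min (by linarith) (by linarith)
  have d2 : min (2 * x) (2 - 2 * x) ≤ 1 := by
    rcases le_total x (1 / 2) with h | h
    · exact (min_le_left _ _).trans (by linarith)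
    · exact (min_le_right _ _).trans (by linarith)
  set t := min (2 * x) (2 - 2 * x)
  have d3 : ε * (3 / 4) ≤ ε * t := by gcongr
  have d4 : ε * t ≤ ε * 1 := by gcongr
  rcases hs with rfl | rfl
  · exact chi_one hε (by linarith) (by linarith)
  · have := chi_one (y := -w.im) hε (by linarith) (by linarith)
    rw [chi_neg] at this; linarith

lemma wp_norm {ε s x : ℝ} (hε : 0 < ε) (hε1 : ε ≤ 1 / 16) (hs : s = 1 ∨ s = -1) (hx : 0 ≤ x) (hx1 : x ≤ 1) :
    ‖wp ε s x‖ ≤ 17 / 16 := by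
  refine (Complex.norm_le_abs_re_add_abs_im _).trans ?_
  simp only [wp]
  have d2 : min (2 * x) (2 - 2 * x) ≤ 1 := by
    rcases le_total x (1 / 2) with h | h
    · exact (min_le_left _ _).trans (by linarith)
    · exact (min_le_right _ _).trans (by linarith)
  have d1 : 0 ≤ min (2 * x) (2 - 2 * x) := le_min (by linarith) (by linarith)
  have hs' : |s| = 1 := by rcases hs with rfl | rfl <;> simp
  rw [abs_mul, abs_mul, hs', abs_of_nonneg hx, abs_of_nonneg hε.le, abs_of_nonneg d1]
  nlinarith

lemma wp_step {ε s : ℝ} {n j : ℕ} (hn : 0 < n) (hs : s = 1 ∨ s = -1) :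
    ‖wp ε s ((j + 1 : ℕ) / (16 * n)) - wp ε s (j / (16 * n))‖ = √(1 + 4 * ε ^ 2) / (16 * n) := by
  have hn' : (0 : ℝ) < n := by exact_mod_cast hn
  have hs2 : s ^ 2 = 1 := by rcases hs with rfl | rfl <;> norm_num
  rw [Complex.norm_def, Complex.normSq_apply]
  have e : √(1 + 4 * ε ^ 2) / (16 * n) = √((1 + 4 * ε ^ 2) / (16 * n) ^ 2) := by
    rw [Real.sqrt_div' _ (by positivity), Real.sqrt_sq (by positivity)]
  rw [e]
  congr 1
  simp only [wp, Complex.sub_re, Complex.sub_im]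
  have e1 : ((j + 1 : ℕ) : ℝ) / (16 * n) = j / (16 * n) + 1 / (16 * n) := by push_cast; rw [add_div]
  rw [e1]
  have hd : (1 + 4 * ε ^ 2) / (16 * (n : ℝ)) ^ 2 = (1 / (16 * n)) ^ 2 + (2 * ε * (1 / (16 * n))) ^ 2 * s ^ 2 := by
    rw [hs2]; field_simp; ring
  rw [hd]
  rcases Nat.lt_or_ge j (8 * n) with h | h
  · have h' : ((j + 1 : ℕ) : ℝ) ≤ (8 * n : ℕ) := by exact_mod_cast h
    push_cast at h'
    have h3 : (j : ℝ) / (16 * n) + 1 / (16 * n) ≤ 1 / 2 := by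
      rw [← add_div, div_le_iff₀ (by positivity)]; linarith
    have h4 : 0 < 1 / (16 * (n : ℝ)) := by positivity
    rw [min_eq_left (by linarith), min_eq_left (by linarith)]
    ring
  · have h' : ((8 * n : ℕ) : ℝ) ≤ j := by exact_mod_cast h
    push_cast at h'
    have h3 : 1 / 2 ≤ (j : ℝ) / (16 * n) := by
      rw [le_div_iff₀ (by positivity)]; linarith
    have h4 : 0 < 1 / (16 * (n : ℝ)) := by positivity
    rw [min_eq_right (by linarith), min_eq_right (by linarith)]
    ring

/-- the test function of the node `(a,b)` -/
noncomputable def fab (ε : ℝ) (n : ℕ) (a b : ℂ) (z : Z2) : ℝ := FF ε n ((cx z - a) / (b - a))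

/-- way points of the node `(a,b)` -/
noncomputable def cj (ε : ℝ) (n : ℕ) (a b : ℂ) (s : ℝ) (j : ℕ) : ℂ := a + (b - a) * wp ε s (j / (16 * n))

lemma cj_zero (ε : ℝ) (n : ℕ) (a b : ℂ) (s : ℝ) : cj ε n a b s 0 = a := by
  simp [cj, wp_zero]

lemma cj_last (ε : ℝ) {n : ℕ} (hn : 0 < n) (a b : ℂ) (s : ℝ) : cj ε n a b s (16 * n) = b := by
  have hn' : (0 : ℝ) < n := by exact_mod_cast hn
  have : ((16 * n : ℕ) : ℝ) / (16 * n) = 1 := by push_cast; field_simp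
  rw [cj, this, wp_one]; ring

lemma cj_step {ε s : ℝ} {n j : ℕ} (hn : 0 < n) (hs : s = 1 ∨ s = -1) (a b : ℂ) :
    ‖cj ε n a b s (j + 1) - cj ε n a b s j‖ = ‖b - a‖ * (√(1 + 4 * ε ^ 2) / (16 * n)) := by
  rw [← wp_step hn hs (j := j) (ε := ε), ← norm_mul]; congr 1; simp only [cj]; ring

lemma cj_dist {ε s : ℝ} {n j : ℕ} (hε : 0 < ε) (hε1 : ε ≤ 1 / 16) (hn : 0 < n) (hs : s = 1 ∨ s = -1)
    (hj : j ≤ 16 * n) (a b : ℂ) : ‖cj ε n a b s j - a‖ ≤ ‖b - a‖ * (17 / 16) := by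
  have hn' : (0 : ℝ) < n := by exact_mod_cast hn
  have hj' : ((j : ℕ) : ℝ) ≤ (16 * n : ℕ) := by exact_mod_cast hj
  push_cast at hj'
  have := wp_norm (x := (j : ℝ) / (16 * n)) hε hε1 hs (by positivity) ((div_le_one (by positivity)).2 hj')
  simp only [cj, add_sub_cancel_left, norm_mul]
  gcongr

lemma norm_coord {a b z : ℂ} {ε s : ℝ} {n j : ℕ} (hab : 0 < ‖b - a‖)
    (h : ‖z - cj ε n a b s j‖ ≤ 3 / (16 * n) * ‖b - a‖) :
    ‖(z - a) / (b - a) - wp ε s (j / (16 * n))‖ ≤ 3 / (16 * n) := by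
  have h0 : b - a ≠ 0 := norm_pos_iff.1 hab
  have e : (z - a) / (b - a) - wp ε s (j / (16 * n)) = (z - cj ε n a b s j) / (b - a) := by
    rw [eq_div_iff h0, sub_mul, div_mul_cancel₀ _ h0, cj]; ring
  rw [e, norm_div, div_le_iff₀ hab]; exact h

/-- support of the test function -/
lemma fab_supp {a b : ℂ} {ε : ℝ} {n : ℕ} (hε : 0 < ε) (hε1 : ε ≤ 1 / 16) (hab : 0 < ‖b - a‖) {z : Z2}
    (h : ‖b - a‖ ≤ ‖cx z - a‖) : fab ε n a b z = 0 := by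
  unfold fab
  set w := (cx z - a) / (b - a) with hw
  have h1 : 1 ≤ ‖w‖ := by rw [hw, norm_div, le_div_iff₀ hab]; linarith
  by_contra h2
  have h3 : ¬ (w.re ≤ 3 / 8 ∨ 5 / 8 ≤ w.re ∨ 7 * ε / 4 ≤ |w.im|) := fun h => h2 (FF_zero hε h)
  push Not at h3
  have h4 := Complex.norm_le_abs_re_add_abs_im w
  rw [abs_of_pos (by linarith : 0 < w.re)] at h4
  linarith


/-! ### Energy of the test functions -/

lemma q_one' {E γ b : ℝ} (hE : 0 < E) (hγ : 0 ≤ γ) (hb : b ≤ γ / (5 * √E)) (hb' : b ≤ 1 / 5) :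
    ∫⁻ x in Iic 0, ENNReal.ofReal (rexp (γ * 1 / E * x)) ∂(gaussianReal 0 (Real.toNNReal E)) ≤
      ENNReal.ofReal (1 / 2 - b) *
        ∫⁻ x, ENNReal.ofReal (rexp (γ * 1 / E * x)) ∂(gaussianReal 0 (Real.toNNReal E)) := by
  rcases le_total γ (√E) with h | h
  · exact q_one hE hγ h hb
  have h0 : Real.toNNReal E ≠ 0 := by simpa using hE
  have h1 : ((Real.toNNReal E : NNReal) : ℝ) = E := Real.coe_toNNReal _ hE.le
  rw [lintegral_exp_gaussian, gauss_tilt h0, mul_comm, h1]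
  refine mul_le_mul_left ?_ _
  have h2 : γ * 1 / E * E = γ := by field_simp
  rw [h2]
  refine (measure_mono (Iic_subset_Iic.2 (neg_le_neg h))).trans ?_
  refine (gauss_tail h0 (Real.sqrt_nonneg _) (by rw [h1])).trans ?_
  rw [h1]
  have h3 : √E / (5 * √E) = 1 / 5 := by
    have : 0 < √E := Real.sqrt_pos.2 hE
    field_simp
  exact ENNReal.ofReal_le_ofReal (by linarith)

lemma cell_inj {X Y : Z2 → ℝ} (hXY : ∀ z z' : Z2, (X z - X z') ^ 2 + (Y z - Y z') ^ 2 =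
      ((z.1 : ℝ) - z'.1) ^ 2 + ((z.2 : ℝ) - z'.2) ^ 2) {z z' : Z2} (h1 : ⌊X z⌋ = ⌊X z'⌋) (h2 : ⌊Y z⌋ = ⌊Y z'⌋)
    (h3 : z.1 % 2 = z'.1 % 2) (h4 : z.2 % 2 = z'.2 % 2) : z = z' := by
  have e := hXY z z'
  have a1 : |X z - X z'| < 1 := Int.abs_sub_lt_one_of_floor_eq_floor h1
  have a2 : |Y z - Y z'| < 1 := Int.abs_sub_lt_one_of_floor_eq_floor h2
  have b1 : (X z - X z') ^ 2 < 1 := by rw [← sq_abs]; nlinarith [abs_nonneg (X z - X z')]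
  have b2 : (Y z - Y z') ^ 2 < 1 := by rw [← sq_abs]; nlinarith [abs_nonneg (Y z - Y z')]
  have key : (z.1 - z'.1) ^ 2 + (z.2 - z'.2) ^ 2 < 2 := by
    have : (((z.1 - z'.1) ^ 2 + (z.2 - z'.2) ^ 2 : ℤ) : ℝ) < (2 : ℤ) := by push_cast; linarith
    exact_mod_cast this
  have c1 : |z.1 - z'.1| < 2 := by
    apply abs_lt_of_sq_lt_sq _ (by norm_num); nlinarith [sq_nonneg (z.2 - z'.2)]
  have c2 : |z.2 - z'.2| < 2 := by
    apply abs_lt_of_sq_lt_sq _ (by norm_num); nlinarith [sq_nonneg (z.1 - z'.1)]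
  rw [abs_lt] at c1 c2
  ext <;> omega

lemma card_Icc_floor (p l : ℝ) (hl : 0 ≤ l) : ((Finset.Icc ⌊p⌋ ⌊p + l⌋).card : ℝ) ≤ l + 2 := by
  rw [Int.card_Icc]
  have h1 : ⌊p⌋ ≤ ⌊p + l⌋ := Int.floor_le_floor (by linarith)
  have h2 : (((⌊p + l⌋ + 1 - ⌊p⌋).toNat : ℤ) : ℝ) = (⌊p + l⌋ : ℝ) + 1 - ⌊p⌋ := by
    rw [Int.toNat_of_nonneg (by omega)]; push_cast; ring
  have h3 : (((⌊p + l⌋ + 1 - ⌊p⌋).toNat : ℕ) : ℝ) = (⌊p + l⌋ : ℝ) + 1 - ⌊p⌋ := by exact_mod_cast h2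
  rw [h3]
  have := Int.floor_le (p + l)
  have := Int.lt_floor_add_one p
  linarith

lemma rect_count (T : Finset Z2) {X Y : Z2 → ℝ} (hXY : ∀ z z' : Z2, (X z - X z') ^ 2 + (Y z - Y z') ^ 2 =
      ((z.1 : ℝ) - z'.1) ^ 2 + ((z.2 : ℝ) - z'.2) ^ 2) {p l q m : ℝ} (hl : 0 ≤ l) (hm : 0 ≤ m)
    (hT : ∀ z ∈ T, (p ≤ X z ∧ X z ≤ p + l) ∧ (q ≤ Y z ∧ Y z ≤ q + m)) :
    (T.card : ℝ) ≤ 4 * ((l + 2) * (m + 2)) := by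
  have h1 : T.card ≤ ((Finset.Icc ⌊p⌋ ⌊p + l⌋ ×ˢ Finset.Icc ⌊q⌋ ⌊q + m⌋) ×ˢ
      (Finset.Ico (0 : ℤ) 2 ×ˢ Finset.Ico (0 : ℤ) 2)).card := by
    refine Finset.card_le_card_of_injOn (fun z => ((⌊X z⌋, ⌊Y z⌋), (z.1 % 2, z.2 % 2))) ?_ ?_
    · intro z hz
      obtain ⟨⟨a1, a2⟩, a3, a4⟩ := hT z hz
      simp only [Finset.coe_product, Set.mem_prod, Finset.coe_Icc, Finset.coe_Ico, Set.mem_Icc, Set.mem_Ico]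
      refine ⟨⟨⟨Int.floor_le_floor a1, Int.floor_le_floor a2⟩, Int.floor_le_floor a3, Int.floor_le_floor a4⟩, ?_, ?_⟩
      · omega
      · omega
    · intro z _ z' _ h
      simp only [Prod.mk.injEq] at h
      exact cell_inj hXY h.1.1 h.1.2 h.2.1 h.2.2
  rw [Finset.card_product, Finset.card_product, Finset.card_product] at h1
  have e : (Finset.Ico (0 : ℤ) 2).card = 2 := by simp
  rw [e] at h1
  have h2 : (T.card : ℝ) ≤ ((Finset.Icc ⌊p⌋ ⌊p + l⌋).card * (Finset.Icc ⌊q⌋ ⌊q + m⌋).card * (2 * 2) : ℝ) := by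
    exact_mod_cast h1
  have h3 := mul_le_mul (card_Icc_floor p l hl) (card_Icc_floor q m hm) (by positivity) (by linarith)
  linarith

lemma psi_lip (n : ℕ) (x y : ℝ) : |psi n x - psi n y| ≤ 16 * n * |x - y| := trap_lip (by positivity) x y

lemma psi_abs (n : ℕ) (x : ℝ) : |psi n x| ≤ 1 := by
  unfold psi; rw [abs_of_nonneg (trap_nonneg _ _ _ _)]; exact trap_le_one _ _ _ _

/-- one increment of the test function: three possible contributions -/
lemma FF_incr {ε d : ℝ} {n : ℕ} (hε : 0 < ε) (hn : 0 < n) {w w' : ℂ} (hw : ‖w' - w‖ ≤ d) :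
    (FF ε n w' - FF ε n w) ^ 2 ≤
      (if (3 / 8 - d ≤ w.re ∧ w.re ≤ 3 / 8 + 1 / (16 * n) + d) ∧ |w.im| ≤ 7 * ε / 4 + d then 2 * (16 * n * d) ^ 2 else 0) +
      (if (5 / 8 - 1 / (16 * n) - d ≤ w.re ∧ w.re ≤ 5 / 8 + d) ∧ |w.im| ≤ 7 * ε / 4 + d then 2 * (16 * n * d) ^ 2 else 0) +
      (if (3 / 8 ≤ w.re ∧ w.re ≤ 5 / 8) ∧ |w.im| ≤ 7 * ε / 4 + d then 2 * (8 / ε * d) ^ 2 else 0) := by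
  have hn' : (0 : ℝ) < n := by exact_mod_cast hn
  have hd : 0 ≤ d := (norm_nonneg _).trans hw
  have hre := (Complex.abs_re_le_norm _).trans hw
  have him := (Complex.abs_im_le_norm _).trans hw
  simp only [Complex.sub_re, Complex.sub_im] at hre him
  set A := (psi n w'.re - psi n w.re) * chi ε w'.im with hA
  set B := psi n w.re * (chi ε w'.im - chi ε w.im) with hB
  have e : FF ε n w' - FF ε n w = A + B := by simp only [FF, hA, hB]; ring
  have h1 : (A + B) ^ 2 ≤ 2 * A ^ 2 + 2 * B ^ 2 := by nlinarith [sq_nonneg (A - B)]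
  have hA2 : A ^ 2 ≤ (16 * n * d) ^ 2 := by
    rw [← sq_abs]
    refine pow_le_pow_left₀ (abs_nonneg _) ?_ 2
    rw [hA, abs_mul]
    have := psi_lip n w'.re w.re
    have h3 : 16 * n * |w'.re - w.re| ≤ 16 * n * d := by gcongr
    have := chi_abs ε w'.im
    have := mul_le_mul (‹|psi n w'.re - psi n w.re| ≤ _›.trans h3) this (abs_nonneg _) (by positivity)
    linarith
  have hB2 : B ^ 2 ≤ (8 / ε * d) ^ 2 := by
    rw [← sq_abs]
    refine pow_le_pow_left₀ (abs_nonneg _) ?_ 2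
    rw [hB, abs_mul]
    have h2 := chi_lip hε w'.im w.im
    have h3 : 8 / ε * |w'.im - w.im| ≤ 8 / ε * d := by gcongr
    have := mul_le_mul (psi_abs n w.re) (h2.trans h3) (abs_nonneg _) (by positivity)
    linarith
  have hgen : ∀ (p : Prop) [Decidable p] (c : ℝ), 0 ≤ c → 0 ≤ if p then c else 0 := fun p _ c hc => by
    split_ifs <;> [exact hc; exact le_rfl]
  have hB3 : 2 * B ^ 2 ≤ (if (3 / 8 ≤ w.re ∧ w.re ≤ 5 / 8) ∧ |w.im| ≤ 7 * ε / 4 + d then 2 * (8 / ε * d) ^ 2 else 0) := by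
    split_ifs with h
    · linarith
    · suffices B = 0 by rw [this]; norm_num
      rw [hB]
      by_cases h' : (3 / 8 ≤ w.re ∧ w.re ≤ 5 / 8)
      · have h'' : 7 * ε / 4 + d < |w.im| := by
          by_contra h2; exact h ⟨h', not_lt.1 h2⟩
        have := abs_sub_abs_le_abs_sub w.im w'.im
        rw [abs_sub_comm w.im w'.im] at this
        rw [chi_zero hε (by linarith), chi_zero hε (by linarith)]; ring
      · rw [psi_zero, zero_mul]
        by_contra h2; push Not at h2; exact h' ⟨h2.1.le, h2.2.le⟩
  have hA3 : 2 * A ^ 2 ≤ (if (3 / 8 - d ≤ w.re ∧ w.re ≤ 3 / 8 + 1 / (16 * n) + d) ∧ |w.im| ≤ 7 * ε / 4 + d then 2 * (16 * n * d) ^ 2 else 0) +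
      (if (5 / 8 - 1 / (16 * n) - d ≤ w.re ∧ w.re ≤ 5 / 8 + d) ∧ |w.im| ≤ 7 * ε / 4 + d then 2 * (16 * n * d) ^ 2 else 0) := by
    by_cases hA0 : A = 0
    · rw [hA0]
      have := add_nonneg (hgen ((3 / 8 - d ≤ w.re ∧ w.re ≤ 3 / 8 + 1 / (16 * n) + d) ∧ |w.im| ≤ 7 * ε / 4 + d) (2 * (16 * n * d) ^ 2) (by positivity))
        (hgen ((5 / 8 - 1 / (16 * n) - d ≤ w.re ∧ w.re ≤ 5 / 8 + d) ∧ |w.im| ≤ 7 * ε / 4 + d) (2 * (16 * n * d) ^ 2) (by positivity))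
      simpa using this
    · have hy : |w.im| ≤ 7 * ε / 4 + d := by
        by_contra h2
        push Not at h2
        have := abs_sub_abs_le_abs_sub w.im w'.im
        rw [abs_sub_comm w.im w'.im] at this
        exact hA0 (by rw [hA, chi_zero hε (by linarith), mul_zero])
      by_cases c1 : (3 / 8 - d ≤ w.re ∧ w.re ≤ 3 / 8 + 1 / (16 * n) + d)
      · rw [if_pos ⟨c1, hy⟩]
        have := hgen ((5 / 8 - 1 / (16 * n) - d ≤ w.re ∧ w.re ≤ 5 / 8 + d) ∧ |w.im| ≤ 7 * ε / 4 + d) (2 * (16 * n * d) ^ 2) (by positivity)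
        linarith
      by_cases c2 : (5 / 8 - 1 / (16 * n) - d ≤ w.re ∧ w.re ≤ 5 / 8 + d)
      · rw [add_comm, if_pos ⟨c2, hy⟩]
        have := hgen ((3 / 8 - d ≤ w.re ∧ w.re ≤ 3 / 8 + 1 / (16 * n) + d) ∧ |w.im| ≤ 7 * ε / 4 + d) (2 * (16 * n * d) ^ 2) (by positivity)
        linarith
      exfalso
      apply hA0
      rw [hA]
      rw [abs_le] at hre
      have f1 : (6 * n + 1 : ℝ) / (16 * n) = 3 / 8 + 1 / (16 * n) := by field_simp; ring
      have f2 : (10 * n - 1 : ℝ) / (16 * n) = 5 / 8 - 1 / (16 * n) := by field_simp; ring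
      have : psi n w'.re = psi n w.re := by
        rcases lt_or_ge w.re (3 / 8 - d) with g | g
        · rw [psi_zero (Or.inl (by linarith)), psi_zero (Or.inl (by linarith))]
        rcases lt_or_ge (5 / 8 + d) w.re with g' | g'
        · rw [psi_zero (Or.inr (by linarith)), psi_zero (Or.inr (by linarith))]
        have c1' : 3 / 8 + 1 / (16 * n) + d < w.re := by by_contra h; exact c1 ⟨g, not_lt.1 h⟩
        have c2' : w.re < 5 / 8 - 1 / (16 * n) - d := by by_contra h; exact c2 ⟨not_lt.1 h, g'⟩
        rw [psi_one hn (by linarith) (by linarith), psi_one hn (by linarith) (by linarith)]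
      rw [this]; ring
  rw [e]; linarith


lemma cx_normSq (a b : ℂ) (hab : 0 < ‖b - a‖) (z z' : Z2) :
    (((cx z - a) / (b - a)).re * ‖b - a‖ - ((cx z' - a) / (b - a)).re * ‖b - a‖) ^ 2 +
    (((cx z - a) / (b - a)).im * ‖b - a‖ - ((cx z' - a) / (b - a)).im * ‖b - a‖) ^ 2 =
      ((z.1 : ℝ) - z'.1) ^ 2 + ((z.2 : ℝ) - z'.2) ^ 2 := by
  have h0 : b - a ≠ 0 := norm_pos_iff.1 hab
  rw [← sub_mul, ← sub_mul, ← Complex.sub_re, ← Complex.sub_im, ← sub_div, sub_sub_sub_cancel_right]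
  have h1 : Complex.normSq ((cx z - cx z') / (b - a)) * ‖b - a‖ ^ 2 = Complex.normSq (cx z - cx z') := by
    rw [Complex.normSq_div, Complex.normSq_eq_norm_sq (b - a)]; field_simp
  have h2 : Complex.normSq (cx z - cx z') = ((z.1 : ℝ) - z'.1) ^ 2 + ((z.2 : ℝ) - z'.2) ^ 2 := by
    rw [Complex.normSq_apply]; simp [cx]; ring
  rw [← h2, ← h1, Complex.normSq_apply]; ring

lemma dd_fab {ε : ℝ} {n : ℕ} {a b : ℂ} (hε : 0 < ε) (hε1 : ε ≤ 1 / 16) (hn : 1 ≤ n * ε ^ 2) (hn2 : n * ε ^ 2 ≤ 2)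
    (hr : 40 * n ≤ ‖b - a‖) (hfs : (fab ε n a b).support.Finite) (α β : ℤ) (hαβ : α ^ 2 + β ^ 2 = 1) :
    dd α β (fab ε n a b) ≤ 8192 / ε := by
  have hn' : (0 : ℝ) < n := by
    by_contra h; push Not at h; nlinarith [sq_nonneg ε]
  have hnn : 0 < n := by exact_mod_cast hn'
  set r := ‖b - a‖ with hrdef
  have hr0 : 0 < r := by linarith [mul_pos (by norm_num : (0 : ℝ) < 40) hn']
  have h0 : b - a ≠ 0 := norm_pos_iff.1 hr0
  have hfd := fs_dd hfs α β
  set T := hfd.toFinset with hT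
  have hsum : dd α β (fab ε n a b) = ∑ z ∈ T, (fab ε n a b (z.1 + α, z.2 + β) - fab ε n a b z) ^ 2 := by
    unfold dd
    refine tsum_eq_sum fun z hz => ?_
    by_contra h
    exact hz (by rw [hT, Set.Finite.mem_toFinset]; exact h)
  have hεr : 640 ≤ ε * r := by
    have h1 : ε * (40 * n) ≤ ε * r := by gcongr
    have h2 : 1 ≤ (1 / 16) * (ε * n) := by nlinarith
    linarith
  have hrn : 4 ≤ r / (10 * n) := by rw [le_div_iff₀ (by positivity)]; linarith
  have hnr : 1 ≤ (n : ℝ) := by exact_mod_cast hnn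
  set d := 1 / r with hd
  have hdr : d * r = 1 := by rw [hd]; field_simp
  have hinc : ∀ z : Z2, ‖(cx (z.1 + α, z.2 + β) - a) / (b - a) - (cx z - a) / (b - a)‖ ≤ d := by
    intro z
    rw [← sub_div, sub_sub_sub_cancel_right, norm_div, hd]
    refine div_le_div_of_nonneg_right (le_of_eq ?_) hr0.le
    have hc : ((α ^ 2 + β ^ 2 : ℤ) : ℝ) = 1 := by rw [hαβ]; norm_num
    push_cast at hc
    rw [Complex.norm_def, Complex.normSq_apply]
    simp only [cx, Complex.sub_re, Complex.sub_im]
    push_cast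
    rw [Real.sqrt_eq_one, ← hc]; ring
  rw [hsum]
  refine (Finset.sum_le_sum fun z _ => FF_incr (n := n) hε hnn (hinc z)).trans ?_
  rw [Finset.sum_add_distrib, Finset.sum_add_distrib]
  simp only [← Finset.sum_filter, Finset.sum_const, nsmul_eq_mul]
  have hrc : ∀ (p p' : ℝ), p ≤ p' →
      ((T.filter fun z => (p ≤ ((cx z - a) / (b - a)).re ∧ ((cx z - a) / (b - a)).re ≤ p') ∧
        |((cx z - a) / (b - a)).im| ≤ 7 * ε / 4 + d).card : ℝ) ≤ 4 * (((p' - p) * r + 2) * (4 * (ε * r))) := by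
    intro p p' hp
    have := rect_count (T.filter fun z => (p ≤ ((cx z - a) / (b - a)).re ∧ ((cx z - a) / (b - a)).re ≤ p') ∧
        |((cx z - a) / (b - a)).im| ≤ 7 * ε / 4 + d) (cx_normSq a b hr0) (p := p * r) (l := (p' - p) * r)
        (q := -((7 * ε / 4 + d) * r)) (m := 2 * ((7 * ε / 4 + d) * r))
        (mul_nonneg (by linarith) hr0.le) (by positivity) (by
          intro z hz
          rw [Finset.mem_filter, abs_le] at hz
          obtain ⟨_, ⟨h1, h2⟩, h3, h4⟩ := hz
          refine ⟨⟨by gcongr, ?_⟩, ?_, ?_⟩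
          · rw [← add_mul]; gcongr; linarith
          · rw [← neg_mul]; gcongr
          · rw [show -((7 * ε / 4 + d) * r) + 2 * ((7 * ε / 4 + d) * r) = (7 * ε / 4 + d) * r by ring]
            gcongr)
    refine this.trans ?_
    have hpp : 0 ≤ (p' - p) * r := mul_nonneg (by linarith) hr0.le
    have : 2 * ((7 * ε / 4 + d) * r) + 2 ≤ 4 * (ε * r) := by rw [add_mul, hdr]; linarith
    gcongr
  have hd0 : 0 < d := by positivity
  have c1 := hrc (3 / 8 - d) (3 / 8 + 1 / (16 * n) + d) (by have : 0 < 1 / (16 * (n : ℝ)) := by positivity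
                                                            linarith)
  have c2 := hrc (5 / 8 - 1 / (16 * n) - d) (5 / 8 + d) (by have : 0 < 1 / (16 * (n : ℝ)) := by positivity
                                                            linarith)
  have c3 := hrc (3 / 8) (5 / 8) (by norm_num)
  have e1 : (3 / 8 + 1 / (16 * n) + d - (3 / 8 - d)) * r + 2 ≤ r / n / 6 := by
    have : (3 / 8 + 1 / (16 * n) + d - (3 / 8 - d)) * r = r / n / 16 + 2 * (d * r) := by field_simp; ring
    rw [this, hdr]
    have : r / (10 * n) = r / n / 10 := by field_simp
    linarith
  have e2 : (5 / 8 + d - (5 / 8 - 1 / (16 * n) - d)) * r + 2 ≤ r / n / 6 := by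
    have : (5 / 8 + d - (5 / 8 - 1 / (16 * n) - d)) * r = r / n / 16 + 2 * (d * r) := by field_simp; ring
    rw [this, hdr]
    have : r / (10 * n) = r / n / 10 := by field_simp
    linarith
  have e3 : ((5 : ℝ) / 8 - 3 / 8) * r + 2 ≤ r / 2 := by linarith
  have c1' : _ ≤ 4 * (r / n / 6 * (4 * (ε * r))) := c1.trans (by gcongr)
  have c2' : _ ≤ 4 * (r / n / 6 * (4 * (ε * r))) := c2.trans (by gcongr)
  have c3' : _ ≤ 4 * (r / 2 * (4 * (ε * r))) := c3.trans (by gcongr)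
  have g1 := mul_le_mul_of_nonneg_right c1' (by positivity : (0 : ℝ) ≤ 2 * (16 * n * d) ^ 2)
  have g2 := mul_le_mul_of_nonneg_right c2' (by positivity : (0 : ℝ) ≤ 2 * (16 * n * d) ^ 2)
  have g3 := mul_le_mul_of_nonneg_right c3' (by positivity : (0 : ℝ) ≤ 2 * (8 / ε * d) ^ 2)
  have k1 : 4 * (r / n / 6 * (4 * (ε * r))) * (2 * (16 * n * d) ^ 2) = (4096 / 3) * (n * ε ^ 2) / ε := by
    rw [hd]; field_simp; ring
  have k3 : 4 * (r / 2 * (4 * (ε * r))) * (2 * (8 / ε * d) ^ 2) = 1024 / ε := by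
    rw [hd]; field_simp; ring
  rw [k1] at g1 g2
  rw [k3] at g3
  have k4 : (4096 / 3) * (n * ε ^ 2) / ε ≤ (8192 / 3) / ε := by gcongr; linarith
  have k5 : (8192 / 3) / ε + (8192 / 3) / ε + 1024 / ε ≤ 8192 / ε := by
    rw [← add_div, ← add_div]; gcongr; norm_num
  linarith

lemma fab_energy {ε : ℝ} {n : ℕ} {a b : ℂ} (hε : 0 < ε) (hε1 : ε ≤ 1 / 16) (hn : 1 ≤ n * ε ^ 2) (hn2 : n * ε ^ 2 ≤ 2)
    (hr : 40 * n ≤ ‖b - a‖) (hfs : (fab ε n a b).support.Finite) :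
    dirE (fab ε n a b) ≤ 4096 / ε := by
  have h1 := dd_fab hε hε1 hn hn2 hr hfs 1 0 (by norm_num)
  have h2 := dd_fab hε hε1 hn hn2 hr hfs 0 1 (by norm_num)
  have h3 := dd_dirE hfs
  have h4 : 4096 / ε = (8192 / ε + 8192 / ε) / 4 := by ring
  linarith

lemma dirE_pos {N : ℕ} {f : Z2 → ℝ} (hf : Supp N f) {z : Z2} (hz : f z ≠ 0) : 0 < dirE f := by
  have h1 := poincare hf
  have h2 := dd_dirE hf.fs
  have h3 : 0 < ns f := by
    unfold ns
    have := (sm (fs_sq hf.fs)).le_tsum z (fun _ _ => sq_nonneg _)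
    have h4 : 0 < f z ^ 2 := by positivity
    linarith
  have h4 : 0 ≤ dd 0 1 f := tsum_nonneg fun _ => sq_nonneg _
  by_contra h
  have h5 : dd 1 0 f ≤ 0 := by linarith
  nlinarith [mul_nonneg (sq_nonneg (5 * (N : ℝ))) (neg_nonneg.2 h5)]


/-! ### Lattice paths -/

lemma absh {z u v : ℤ} (h : min u v ≤ z ∧ z ≤ max u v) : |z - u| ≤ |v - u| := by
  rcases le_total u v with h1 | h1
  · rw [abs_of_nonneg (by omega : 0 ≤ v - u), abs_le]; omega
  · rw [abs_of_nonpos (by omega : v - u ≤ 0), abs_le]; omega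

lemma exists_lp (m : ℕ) : ∀ u v : Z2, (u.1 - v.1).natAbs + (u.2 - v.2).natAbs = m →
    ∃ P : List Z2, P ≠ [] ∧ P.IsChain Adj ∧ P.head? = some u ∧ P.getLast? = some v ∧ P.length = m + 1 ∧
      ∀ z ∈ P, (min u.1 v.1 ≤ z.1 ∧ z.1 ≤ max u.1 v.1) ∧ (min u.2 v.2 ≤ z.2 ∧ z.2 ≤ max u.2 v.2) := by
  induction m with
  | zero =>
    intro u v h
    have : u = v := by ext <;> omega
    subst this
    exact ⟨[u], by simp, by simp, by simp, by simp, by simp, by simp⟩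
  | succ m ih =>
    intro u v h
    by_cases h1 : u.1 = v.1
    · have h2 : u.2 ≠ v.2 := by intro h2; simp [h1, h2] at h
      obtain ⟨w, hw1, hw⟩ : ∃ w : Z2, w.1 = u.1 ∧
          ((u.2 < v.2 ∧ w.2 = u.2 + 1) ∨ (v.2 < u.2 ∧ w.2 = u.2 - 1)) := by
        rcases lt_or_gt_of_ne h2 with h3 | h3
        · exact ⟨(u.1, u.2 + 1), rfl, Or.inl ⟨h3, rfl⟩⟩
        · exact ⟨(u.1, u.2 - 1), rfl, Or.inr ⟨h3, rfl⟩⟩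
      obtain ⟨P, hP0, hP1, hP2, hP3, hP4, hP5⟩ := ih w v (by omega)
      refine ⟨u :: P, by simp, ?_, rfl, ?_, by simp [hP4], ?_⟩
      · rw [List.isChain_cons]
        refine ⟨fun y hy => ?_, hP1⟩
        rw [hP2] at hy
        obtain rfl := Option.some.inj hy
        unfold Adj
        rw [hw1, sub_self, abs_zero, zero_add]
        rcases hw with ⟨_, hw⟩ | ⟨_, hw⟩ <;> rw [hw] <;> simp
      · rw [List.getLast?_cons, hP3]; rfl
      · intro z hz
        rcases List.mem_cons.1 hz with rfl | hz
        · simp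
        · have := hP5 z hz
          omega
    · obtain ⟨w, hw1, hw⟩ : ∃ w : Z2, w.2 = u.2 ∧
          ((u.1 < v.1 ∧ w.1 = u.1 + 1) ∨ (v.1 < u.1 ∧ w.1 = u.1 - 1)) := by
        rcases lt_or_gt_of_ne h1 with h3 | h3
        · exact ⟨(u.1 + 1, u.2), rfl, Or.inl ⟨h3, rfl⟩⟩
        · exact ⟨(u.1 - 1, u.2), rfl, Or.inr ⟨h3, rfl⟩⟩
      obtain ⟨P, hP0, hP1, hP2, hP3, hP4, hP5⟩ := ih w v (by omega)
      refine ⟨u :: P, by simp, ?_, rfl, ?_, by simp [hP4], ?_⟩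
      · rw [List.isChain_cons]
        refine ⟨fun y hy => ?_, hP1⟩
        rw [hP2] at hy
        obtain rfl := Option.some.inj hy
        unfold Adj
        rw [hw1, sub_self, abs_zero, add_zero]
        rcases hw with ⟨_, hw⟩ | ⟨_, hw⟩ <;> rw [hw] <;> simp
      · rw [List.getLast?_cons, hP3]; rfl
      · intro z hz
        rcases List.mem_cons.1 hz with rfl | hz
        · simp
        · have := hP5 z hz
          omega

/-- a chosen monotone lattice path -/
noncomputable def lpt (u v : Z2) : List Z2 := (exists_lp _ u v rfl).choose

lemma lp_spec (u v : Z2) : lpt u v ≠ [] ∧ (lpt u v).IsChain Adj ∧ (lpt u v).head? = some u ∧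
    (lpt u v).getLast? = some v ∧ (lpt u v).length = (u.1 - v.1).natAbs + (u.2 - v.2).natAbs + 1 ∧
      ∀ z ∈ lpt u v, |z.1 - u.1| ≤ |v.1 - u.1| ∧ |z.2 - u.2| ≤ |v.2 - u.2| :=
  have h := (exists_lp _ u v rfl).choose_spec
  ⟨h.1, h.2.1, h.2.2.1, h.2.2.2.1, h.2.2.2.2.1, fun z hz =>
    ⟨absh (h.2.2.2.2.2 z hz).1, absh (h.2.2.2.2.2 z hz).2⟩⟩

lemma lp_between {u v z : Z2} (hz : z ∈ lpt u v) :
    (min u.1 v.1 ≤ z.1 ∧ z.1 ≤ max u.1 v.1) ∧ (min u.2 v.2 ≤ z.2 ∧ z.2 ≤ max u.2 v.2) :=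
  (exists_lp _ u v rfl).choose_spec.2.2.2.2.2 z hz

/-- `x` and `y` are joined inside `V_N` at cost at most `c` -/
def Reach {Ω : Type*} (N : ℕ) (γ : ℝ) (η : Z2 → Ω → ℝ) (ω : Ω) (x y : Z2) (c : ENNReal) : Prop :=
  ∃ P : List Z2, LPathIn (VN N) P ∧ P.head? = some x ∧ P.getLast? = some y ∧
    ENNReal.ofReal (pWeight γ η ω P) ≤ c

lemma Reach.mono {Ω : Type*} {N : ℕ} {γ : ℝ} {η : Z2 → Ω → ℝ} {ω : Ω} {x y : Z2} {c c' : ENNReal}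
    (h : Reach N γ η ω x y c) (hc : c ≤ c') : Reach N γ η ω x y c' := by
  obtain ⟨P, h1, h2, h3, h4⟩ := h
  exact ⟨P, h1, h2, h3, h4.trans hc⟩

lemma Adj.symm' {x y : Z2} (h : Adj x y) : Adj y x := by
  unfold Adj at *; rw [abs_sub_comm y.1, abs_sub_comm y.2]; exact h

lemma Reach.symm {Ω : Type*} {N : ℕ} {γ : ℝ} {η : Z2 → Ω → ℝ} {ω : Ω} {x y : Z2} {c : ENNReal}
    (h : Reach N γ η ω x y c) : Reach N γ η ω y x c := by
  obtain ⟨P, ⟨h0, h1, h1'⟩, h2, h3, h4⟩ := h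
  refine ⟨P.reverse, ⟨by simpa using h0, ?_, by simpa using h1'⟩, by simpa using h3, by simpa using h2, ?_⟩
  · change P.reverse.IsChain Adj
    rw [List.isChain_reverse]
    exact List.IsChain.imp (fun a b h => Adj.symm' h) h1
  · simpa [pWeight] using h4

lemma Reach.trans {Ω : Type*} {N : ℕ} {γ : ℝ} {η : Z2 → Ω → ℝ} {ω : Ω} {x y z : Z2} {c c' : ENNReal}
    (h : Reach N γ η ω x y c) (h' : Reach N γ η ω y z c') : Reach N γ η ω x z (c + c') := by
  obtain ⟨P, ⟨h0, h1, h1'⟩, h2, h3, h4⟩ := h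
  obtain ⟨Q, ⟨k0, k1, k1'⟩, k2, k3, k4⟩ := h'
  obtain ⟨q, Q, rfl⟩ := List.exists_cons_of_ne_nil k0
  obtain rfl : q = y := by simpa using k2
  have k1 : (q :: Q).IsChain Adj := k1
  rw [List.isChain_cons] at k1
  refine ⟨P ++ Q, ⟨by simp [h0], ?_, ?_⟩, ?_, ?_, ?_⟩
  · change (P ++ Q).IsChain Adj
    rw [List.isChain_append]
    refine ⟨h1, k1.2, fun a ha b hb => ?_⟩
    rw [h3] at ha
    obtain rfl := Option.some.inj ha
    exact k1.1 b hb
  · intro w hw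
    rcases List.mem_append.1 hw with hw | hw
    · exact h1' w hw
    · exact k1' w (List.mem_cons_of_mem _ hw)
  · rw [List.head?_append, h2]; rfl
  · rw [List.getLast?_append]
    rw [List.getLast?_cons] at k3
    cases hQ : Q.getLast? with
    | none => rw [hQ] at k3; simpa [h3] using k3
    | some b => rw [hQ] at k3; simpa using k3
  · refine le_trans ?_ (add_le_add h4 k4)
    rw [← ENNReal.ofReal_add (by unfold pWeight; positivity) (by unfold pWeight; positivity)]
    apply ENNReal.ofReal_le_ofReal
    unfold pWeight
    have hsub : (P ++ Q).toFinset ⊆ P.toFinset ∪ (q :: Q).toFinset := by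
      intro w hw; simp at hw ⊢; tauto
    refine (Finset.sum_le_sum_of_subset_of_nonneg hsub fun _ _ _ => by positivity).trans ?_
    rw [← Finset.sum_union_inter]
    exact le_add_of_nonneg_right (by positivity)

lemma Reach.lpt {Ω : Type*} {N : ℕ} {γ : ℝ} {η : Z2 → Ω → ℝ} {ω : Ω} {x y : Z2}
    (h : ∀ z ∈ lpt x y, z ∈ VN N) :
    Reach N γ η ω x y (∑ z ∈ (lpt x y).toFinset, ENNReal.ofReal (rexp (γ * η z ω))) := by
  obtain ⟨h0, h1, h2, h3, _, _⟩ := lp_spec x y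
  refine ⟨_, ⟨h0, h1, h⟩, h2, h3, ?_⟩
  unfold pWeight
  rw [ENNReal.ofReal_sum_of_nonneg fun _ _ => by positivity]

lemma Reach.sum {Ω : Type*} {N : ℕ} {γ : ℝ} {η : Z2 → Ω → ℝ} {ω : Ω} (p : ℕ → Z2) (c : ℕ → ENNReal) {m : ℕ}
    (hm : 0 < m) (h : ∀ j < m, Reach N γ η ω (p j) (p (j + 1)) (c j)) :
    Reach N γ η ω (p 0) (p m) (∑ j ∈ Finset.range m, c j) := by
  induction m with
  | zero => exact absurd hm (lt_irrefl _)
  | succ m ih =>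
    rcases Nat.eq_zero_or_pos m with rfl | hm'
    · simpa using h 0 (by norm_num)
    · rw [Finset.sum_range_succ]
      exact (ih hm' fun j hj => h j (by omega)).trans (h m (by omega))

/-- rounding to the lattice -/
noncomputable def rd (a : ℂ) : Z2 := (⌊a.re⌋, ⌊a.im⌋)

lemma rd_cx (z : Z2) : rd (cx z) = z := by simp [rd, cx]

lemma rd_dist (a : ℂ) : ‖cx (rd a) - a‖ ≤ 2 := by
  refine (Complex.norm_le_abs_re_add_abs_im _).trans ?_
  simp only [cx, rd, Complex.sub_re, Complex.sub_im]
  have h1 : |(⌊a.re⌋ : ℝ) - a.re| ≤ 1 := by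
    rw [abs_le]; constructor <;> linarith [Int.floor_le a.re, Int.lt_floor_add_one a.re]
  have h2 : |(⌊a.im⌋ : ℝ) - a.im| ≤ 1 := by
    rw [abs_le]; constructor <;> linarith [Int.floor_le a.im, Int.lt_floor_add_one a.im]
  linarith

lemma lp_norm {u v z : Z2} (hz : z ∈ lpt u v) : ‖cx z - cx u‖ ≤ ‖cx v - cx u‖ := by
  obtain ⟨h1, h2⟩ := (lp_spec u v).2.2.2.2.2 z hz
  rw [Complex.norm_def, Complex.norm_def]
  apply Real.sqrt_le_sqrt
  rw [Complex.normSq_apply, Complex.normSq_apply]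
  simp only [cx, Complex.sub_re, Complex.sub_im]
  have k1 := sq_le_sq.2 h1
  have k2 := sq_le_sq.2 h2
  have k1' : (((z.1 - u.1) ^ 2 : ℤ) : ℝ) ≤ ((v.1 - u.1) ^ 2 : ℤ) := by exact_mod_cast k1
  have k2' : (((z.2 - u.2) ^ 2 : ℤ) : ℝ) ≤ ((v.2 - u.2) ^ 2 : ℤ) := by exact_mod_cast k2
  push_cast at k1' k2'
  nlinarith

lemma lp_card (u v : Z2) : ((lpt u v).toFinset.card : ℝ) ≤ 2 * ‖cx v - cx u‖ + 1 := by
  have h := (lp_spec u v).2.2.2.2.1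
  have h1 := List.toFinset_card_le (lpt u v)
  rw [h] at h1
  have h2 : (((u.1 - v.1).natAbs + (u.2 - v.2).natAbs + 1 : ℕ) : ℝ) = |(v.1 : ℝ) - u.1| + |(v.2 : ℝ) - u.2| + 1 := by
    push_cast [Nat.cast_natAbs]
    rw [abs_sub_comm (v.1 : ℝ), abs_sub_comm (v.2 : ℝ)]
  have h3 := Complex.abs_re_le_norm (cx v - cx u)
  have h4 := Complex.abs_im_le_norm (cx v - cx u)
  simp only [cx, Complex.sub_re, Complex.sub_im] at h3 h4 ⊢
  have : ((lpt u v).toFinset.card : ℝ) ≤ (((u.1 - v.1).natAbs + (u.2 - v.2).natAbs + 1 : ℕ) : ℝ) := by exact_mod_cast h1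
  linarith


/-! ### The recursive path construction -/

/-- cost of the recursively constructed path between `a` and `b` -/
noncomputable def WW {Ω : Type*} (γ : ℝ) (η : Z2 → Ω → ℝ) (N : ℕ) (ε : ℝ) (n : ℕ) : ℕ → ℂ → ℂ → Ω → ENNReal
  | 0, a, b, ω => ∑ z ∈ (lpt (rd a) (rd b)).toFinset, ENNReal.ofReal (rexp (γ * η z ω))
  | k + 1, a, b, ω => if hF N η (fab ε n a b) ω ≤ 0 then
      ∑ j ∈ Finset.range (16 * n), WW γ η N ε n k (cj ε n a b 1 j) (cj ε n a b 1 (j + 1)) ω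
    else ∑ j ∈ Finset.range (16 * n), WW γ η N ε n k (cj ε n a b (-1) j) (cj ε n a b (-1) (j + 1)) ω

/-- the scale ratio -/
noncomputable def Th (ε : ℝ) (n : ℕ) : ℝ := 16 * n / √(1 + 4 * ε ^ 2)

section W
variable {Ω : Type*} [MeasurableSpace Ω] {μ : Measure Ω} {N : ℕ} {η : Z2 → Ω → ℝ}

lemma WW_meas (D : DG μ N η) (γ ε : ℝ) (n : ℕ) : ∀ k a b, Measurable (WW γ η N ε n k a b) := by
  intro k
  induction k with
  | zero =>
    intro a b
    refine Finset.measurable_sum _ fun z _ => ?_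
    have := D.meas z
    fun_prop
  | succ k ih =>
    intro a b
    refine Measurable.ite (measurableSet_le (D.hF_meas _) measurable_const) ?_ ?_
    · exact Finset.measurable_sum _ fun j _ => ih _ _
    · exact Finset.measurable_sum _ fun j _ => ih _ _

lemma sqrt_eps {ε : ℝ} (hε : 0 < ε) (hε1 : ε ≤ 1 / 16) : 1 ≤ √(1 + 4 * ε ^ 2) ∧ √(1 + 4 * ε ^ 2) ≤ 101 / 100 := by
  constructor
  · rw [Real.one_le_sqrt]; nlinarith
  · rw [Real.sqrt_le_left (by norm_num)]; nlinarith

lemma Th_ge {ε : ℝ} {n : ℕ} (hε : 0 < ε) (hε1 : ε ≤ 1 / 16) : 15 * n ≤ Th ε n := by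
  obtain ⟨h1, h2⟩ := sqrt_eps hε hε1
  unfold Th
  rw [le_div_iff₀ (by linarith)]
  have : (0 : ℝ) ≤ n := by positivity
  nlinarith

lemma Th_mul {ε : ℝ} {n : ℕ} (hn : 0 < n) (c : ℝ) : c * Th ε n * (√(1 + 4 * ε ^ 2) / (16 * n)) = c := by
  have : 0 < √(1 + 4 * ε ^ 2) := Real.sqrt_pos.2 (by positivity)
  have : (0 : ℝ) < n := by exact_mod_cast hn
  unfold Th; field_simp

/-- geometric facts about a child of a node of size `r ≥ 40 n` -/
lemma child_ball {ε s r : ℝ} {n j : ℕ} (hε : 0 < ε) (hε1 : ε ≤ 1 / 16) (hn : 4 ≤ n) (hs : s = 1 ∨ s = -1)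
    (hj : j ≤ 16 * n) {a b : ℂ} (hr : ‖b - a‖ = r) (hr40 : 40 * n ≤ r) {z : ℂ}
    (hz : ‖z - cj ε n a b s j‖ ≤ 2 * (r * (√(1 + 4 * ε ^ 2) / (16 * n))) + 2) :
    ‖z - a‖ ≤ 2 * r + 2 ∧ ‖z - cj ε n a b s j‖ ≤ 3 / (16 * n) * ‖b - a‖ := by
  obtain ⟨h1, h2⟩ := sqrt_eps hε hε1
  have hn' : (4 : ℝ) ≤ n := by exact_mod_cast hn
  have h3 : 2 * (r * (√(1 + 4 * ε ^ 2) / (16 * n))) + 2 ≤ 3 / (16 * n) * r := by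
    have e : 2 * (r * (√(1 + 4 * ε ^ 2) / (16 * n))) + 2 = (2 * r * √(1 + 4 * ε ^ 2) + 32 * n) / (16 * n) := by
      field_simp; ring
    rw [e, div_mul_eq_mul_div]
    gcongr
    nlinarith
  have h4 : 3 / (16 * n) * r ≤ 3 / 64 * r := by
    gcongr
    · linarith
    · linarith
  have h5 := cj_dist hε hε1 (by omega : 0 < n) hs hj a b
  have h6 := norm_sub_le_norm_sub_add_norm_sub z (cj ε n a b s j) a
  rw [hr] at h5 ⊢
  constructor <;> linarith

lemma WW_reach (γ ε r0 : ℝ) (n : ℕ) (hε : 0 < ε) (hε1 : ε ≤ 1 / 16) (hn : 4 ≤ n) (hr0 : 16 ≤ r0) (ω : Ω) :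
    ∀ (k : ℕ) (a b : ℂ), ‖b - a‖ = r0 * Th ε n ^ k →
      (∀ z, ‖cx z - a‖ ≤ 2 * (r0 * Th ε n ^ k) + 2 → z ∈ VN N) →
      Reach N γ η ω (rd a) (rd b) (WW γ η N ε n k a b ω) := by
  have hn0 : 0 < n := by omega
  have hn1 : (4 : ℝ) ≤ n := by exact_mod_cast hn
  have hTh := Th_ge (n := n) hε hε1
  intro k
  induction k with
  | zero =>
    intro a b hab hball
    rw [pow_zero, mul_one] at hab hball
    refine Reach.lpt fun z hz => hball z ?_
    have h1 := lp_norm hz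
    have h2 := rd_dist a
    have h3 := rd_dist b
    have h4 : ‖cx (rd b) - cx (rd a)‖ ≤ r0 + 4 := by
      have : cx (rd b) - cx (rd a) = (cx (rd b) - b) + (b - a) - (cx (rd a) - a) := by ring
      rw [this]
      refine (norm_sub_le _ _).trans ?_
      have := norm_add_le (cx (rd b) - b) (b - a)
      linarith
    have h5 := norm_sub_le_norm_sub_add_norm_sub (cx z) (cx (rd a)) a
    linarith
  | succ k ih =>
    intro a b hab hball
    have hr40 : 40 * n ≤ r0 * Th ε n ^ (k + 1) := by
      have : (1 : ℝ) ≤ Th ε n ^ k := one_le_pow₀ (by linarith)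
      rw [pow_succ]
      have h1 : 15 * n ≤ Th ε n ^ k * Th ε n := by nlinarith
      nlinarith
    have hstep : ∀ s : ℝ, s = 1 ∨ s = -1 → Reach N γ η ω (rd a) (rd b)
        (∑ j ∈ Finset.range (16 * n), WW γ η N ε n k (cj ε n a b s j) (cj ε n a b s (j + 1)) ω) := by
      intro s hs
      have := Reach.sum (N := N) (γ := γ) (η := η) (ω := ω) (fun j => rd (cj ε n a b s j))
        (fun j => WW γ η N ε n k (cj ε n a b s j) (cj ε n a b s (j + 1)) ω) (m := 16 * n) (by omega) (by
          intro j hj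
          have hl : r0 * Th ε n ^ (k + 1) * (√(1 + 4 * ε ^ 2) / (16 * n)) = r0 * Th ε n ^ k := by
            rw [pow_succ, ← mul_assoc]; exact Th_mul hn0 _
          refine ih _ _ ?_ ?_
          · rw [cj_step hn0 hs, hab, hl]
          · intro z hz
            apply hball
            rw [← hl] at hz
            exact (child_ball hε hε1 hn hs hj.le hab hr40 hz).1)
      simpa only [cj_zero, cj_last ε hn0] using this
    simp only [WW]
    split_ifs
    · exact hstep 1 (Or.inl rfl)
    · exact hstep (-1) (Or.inr rfl)

lemma VN_intr {z : Z2} (h : z ∈ VN N) : z ∈ intr N := by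
  unfold VN at h
  simp only [Set.mem_ofPred_eq] at h
  rw [mem_intr]
  omega

lemma lap_const_ball {f : Z2 → ℝ} {a : ℂ} {ρ v : ℝ} (hv : ∀ z, ‖cx z - a‖ ≤ ρ + 1 → f z = v) {z : Z2}
    (hz : ‖cx z - a‖ ≤ ρ) : lap f z = 0 := by
  have h : ∀ w : Z2, ‖cx w - cx z‖ ≤ 1 → f w = v := fun w hw => hv w (by
    have := norm_sub_le_norm_sub_add_norm_sub (cx w) (cx z) a
    linarith)
  have h0 := h z (by simp)
  have h1 := h (z.1 + 1, z.2) (by simp [cx, Complex.norm_def, Complex.normSq_apply])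
  have h2 := h (z.1 - 1, z.2) (by simp [cx, Complex.norm_def, Complex.normSq_apply])
  have h3 := h (z.1, z.2 + 1) (by simp [cx, Complex.norm_def, Complex.normSq_apply])
  have h4 := h (z.1, z.2 - 1) (by simp [cx, Complex.norm_def, Complex.normSq_apply])
  simp only [lap, avg4, h0, h1, h2, h3, h4]; ring

end W


section W
variable {Ω : Type*} [MeasurableSpace Ω] {μ : Measure Ω} {N : ℕ} {η : Z2 → Ω → ℝ}

lemma lap_smul (s : ℝ) (f : Z2 → ℝ) (z : Z2) : lap (fun w => s * f w) z = s * lap f z := by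
  simp only [lap, avg4]; ring

lemma hF_smul (s : ℝ) (f : Z2 → ℝ) (ω : Ω) : hF N η (fun w => s * f w) ω = s * hF N η f ω := by
  simp only [hF, lap_smul, Finset.mul_sum, mul_assoc]

lemma dirE_sign {s : ℝ} (hs : s = 1 ∨ s = -1) (f : Z2 → ℝ) : dirE (fun w => s * f w) = dirE f := by
  have h2 : s ^ 2 = 1 := by rcases hs with rfl | rfl <;> norm_num
  simp only [dirE, ← mul_sub, mul_pow, h2, one_mul]

lemma lap_symm {f g : Z2 → ℝ} (hf : f.support.Finite) : ∑' z, f z * lap g z = ∑' z, lap f z * g z := by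
  simp only [lap, mul_sub, sub_mul]
  have h1 : Summable fun z => f z * g z := sm (fs_mul hf)
  have h2 : Summable fun z => f z * avg4 g z := sm (fs_mul hf)
  have h3 : Summable fun z => avg4 f z * g z := by
    have : (avg4 f).support.Finite := by
      unfold avg4
      have a1 := fs_shift hf 1 0
      have a2 := fs_shift hf (-1) 0
      have a3 := fs_shift hf 0 1
      have a4 := fs_shift hf 0 (-1)
      refine (((a1.union a2).union a3).union a4).subset fun z hz => ?_
      by_contra h
      simp only [Set.mem_union, Function.mem_support, not_or, not_not, add_zero, ← sub_eq_add_neg] at h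
      exact hz (by simp [h])
    exact sm (fs_mul this)
  rw [h1.tsum_sub h2, h1.tsum_sub h3, avg_symm hf]

/-- cost factor of the child `j` -/
noncomputable def cost (n : ℕ) (b : ℝ) (j : ℕ) : ℝ :=
  1 / 2 + (if 6 * n - 2 ≤ j ∧ j < 6 * n + 4 then 1 / 2 else 0) + (if 10 * n - 3 ≤ j ∧ j < 10 * n + 3 then 1 / 2 else 0)
    - (if 6 * n + 4 ≤ j ∧ j < 10 * n - 3 then b else 0)

lemma card_filt (n p q : ℕ) (hq : q ≤ 16 * n) :
    ((Finset.range (16 * n)).filter fun j => p ≤ j ∧ j < q).card = q - p := by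
  have : (Finset.range (16 * n)).filter (fun j => p ≤ j ∧ j < q) = Finset.Ico p q := by
    ext j; simp; omega
  rw [this, Nat.card_Ico]

lemma cost_sum {n : ℕ} {b : ℝ} (hn : 4 ≤ n) (hb : 0 ≤ b) :
    2 * ∑ j ∈ Finset.range (16 * n), cost n b j ≤ 16 * n + 12 - 4 * b * n := by
  unfold cost
  rw [Finset.sum_sub_distrib, Finset.sum_add_distrib, Finset.sum_add_distrib]
  simp only [← Finset.sum_filter, Finset.sum_const, nsmul_eq_mul]
  rw [card_filt n _ _ (by omega), card_filt n _ _ (by omega), card_filt n _ _ (by omega), Finset.card_range]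
  have h1 : 6 * n + 4 - (6 * n - 2) = 6 := by omega
  have h2 : 10 * n + 3 - (10 * n - 3) = 6 := by omega
  have h3 : 2 * n ≤ 10 * n - 3 - (6 * n + 4) := by omega
  have h3' : ((2 * n : ℕ) : ℝ) ≤ ((10 * n - 3 - (6 * n + 4) : ℕ) : ℝ) := by exact_mod_cast h3
  rw [h1, h2]
  push_cast at h3' ⊢
  nlinarith

lemma WW_bound [IsProbabilityMeasure μ] (D : DG μ N η) {γ ε r0 b : ℝ} {n : ℕ} (hε : 0 < ε) (hε1 : ε ≤ 1 / 16)
    (hγ : 0 < γ) (hb0 : 0 ≤ b) (hb : b ≤ γ * √ε / 320) (hb' : b ≤ 1 / 5)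
    (hn : 4 ≤ n) (hnε : 1 ≤ n * ε ^ 2) (hnε2 : n * ε ^ 2 ≤ 2) (hn3 : 3 / (16 * n) ≤ ε / 8) (hr0 : 16 ≤ r0) (G : ENNReal)
    (hG : ∀ z ∈ VN N, ∫⁻ ω, ENNReal.ofReal (rexp (γ * η z ω)) ∂μ ≤ G) :
    ∀ (k : ℕ) (a c : ℂ), ‖c - a‖ = r0 * Th ε n ^ k →
      (∀ z, ‖cx z - a‖ ≤ 2 * (r0 * Th ε n ^ k) + 2 → z ∈ VN N) →
      ∀ (d : ℕ) (f : Fin d → Z2 → ℝ) (_ : ∀ i, Supp N (f i))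
        (_ : ∀ i j, i ≠ j → ∑' z, f i z * lap (f j) z = 0) (_ : ∀ i, 0 < dirE (f i)) (v : Fin d → ℝ)
        (_ : ∀ i z, ‖cx z - a‖ ≤ 2 * (r0 * Th ε n ^ k) + 2 → f i z = v i) (q : Fin d → ENNReal)
        (_ : ∀ i, ∫⁻ x in Iic 0, ENNReal.ofReal (rexp (γ * v i / dirE (f i) * x))
          ∂(gaussianReal 0 (Real.toNNReal (dirE (f i)))) ≤
        q i * ∫⁻ x, ENNReal.ofReal (rexp (γ * v i / dirE (f i) * x))
          ∂(gaussianReal 0 (Real.toNNReal (dirE (f i))))),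
      ∫⁻ ω, (∏ i, (Iic (0 : ℝ)).indicator (fun _ => (1 : ENNReal)) (hF N η (f i) ω)) * WW γ η N ε n k a c ω ∂μ ≤
        (∏ i, q i) * (ENNReal.ofReal (2 * r0 + 9) * ENNReal.ofReal (16 * n + 12 - 4 * b * n) ^ k * G) := by
  have hn0 : 0 < n := by omega
  have hn1 : (4 : ℝ) ≤ n := by exact_mod_cast hn
  have hTh := Th_ge (n := n) hε hε1
  intro k
  induction k with
  | zero =>
    intro a c hac hball d f hs ho hE v hv q hq
    rw [pow_zero, mul_one] at hac hball hv
    rw [pow_zero, mul_one]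
    have h2 := rd_dist a
    have h3 := rd_dist c
    have h4 : ‖cx (rd c) - cx (rd a)‖ ≤ r0 + 4 := by
      have : cx (rd c) - cx (rd a) = (cx (rd c) - c) + (c - a) - (cx (rd a) - a) := by ring
      rw [this]
      refine (norm_sub_le _ _).trans ?_
      have := norm_add_le (cx (rd c) - c) (c - a)
      linarith
    have hz : ∀ z ∈ (lpt (rd a) (rd c)).toFinset, ‖cx z - a‖ ≤ 2 * r0 + 2 := by
      intro z hz
      have h1 := lp_norm (List.mem_toFinset.1 hz)
      have h5 := norm_sub_le_norm_sub_add_norm_sub (cx z) (cx (rd a)) a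
      linarith
    have hV : ∀ z ∈ VN N, z ∈ V5N N := fun z hz => intr_sub (VN_intr hz)
    simp only [WW, Finset.mul_sum]
    rw [lintegral_finsetSum]
    · have : ∀ z ∈ (lpt (rd a) (rd c)).toFinset,
          ∫⁻ ω, (∏ i, (Iic (0 : ℝ)).indicator (fun _ => (1 : ENNReal)) (hF N η (f i) ω)) *
            ENNReal.ofReal (rexp (γ * η z ω)) ∂μ ≤ (∏ i, q i) * G := by
        intro z hz'
        refine (D.girsanov f hs ho hE (hV z (hball z (hz z hz'))) γ q (fun i => ?_)).trans ?_
        · rw [hv i z (hz z hz')]; exact hq i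
        · gcongr; exact hG z (hball z (hz z hz'))
      refine (Finset.sum_le_sum this).trans ?_
      rw [Finset.sum_const, nsmul_eq_mul]
      rw [mul_left_comm]
      gcongr
      rw [← ENNReal.ofReal_natCast]
      apply ENNReal.ofReal_le_ofReal
      have := lp_card (rd a) (rd c)
      linarith
    · intro z _
      have := D.meas z
      have h1 : ∀ i, Measurable fun ω => (Iic (0 : ℝ)).indicator (fun _ => (1 : ENNReal)) (hF N η (f i) ω) := fun i =>
        (measurable_const.indicator measurableSet_Iic).comp (D.hF_meas (f i))
      refine (Finset.measurable_prod _ fun i _ => h1 i).mul (by fun_prop)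
  | succ k ih =>
    intro a c hac hball d f hs ho hE v hv q hq
    set r := r0 * Th ε n ^ (k + 1) with hr
    have hr40 : 40 * n ≤ r := by
      have : (1 : ℝ) ≤ Th ε n ^ k := one_le_pow₀ (by linarith)
      rw [hr, pow_succ]
      have h1 : 15 * n ≤ Th ε n ^ k * Th ε n := by nlinarith
      nlinarith
    have hac0 : 0 < ‖c - a‖ := by rw [hac]; linarith
    have hl : r * (√(1 + 4 * ε ^ 2) / (16 * n)) = r0 * Th ε n ^ k := by
      rw [hr, pow_succ, ← mul_assoc]; exact Th_mul hn0 _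
    set F := fab ε n a c with hFdef
    have hF0 : ∀ z, F z ≠ 0 → ‖cx z - a‖ ≤ r := by
      intro z hz
      by_contra h
      exact hz (fab_supp hε hε1 hac0 (by rw [hac]; linarith))
    have hFs : Supp N F := by
      intro z hz
      by_contra h
      exact hz (VN_intr (hball z (by linarith [hF0 z h])))
    -- a point where `F` does not vanish
    have hE0 : 0 < dirE F := by
      have h1 := rd_dist (cj ε n a c 1 (8 * n))
      have h2 : ‖cx (rd (cj ε n a c 1 (8 * n))) - cj ε n a c 1 (8 * n)‖ ≤ 3 / (16 * n) * ‖c - a‖ := by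
        refine h1.trans ?_
        rw [hac, div_mul_eq_mul_div, le_div_iff₀ (by positivity)]
        linarith
      have h3 := norm_coord hac0 h2
      have h4 := FF_wp_one hn0 hε (Or.inl rfl) hn3 (by omega) (by omega) h3
      refine dirE_pos hFs (z := rd (cj ε n a c 1 (8 * n))) ?_
      rw [hFdef, fab, h4]; norm_num
    have hE1 : dirE F ≤ 4096 / ε := fab_energy hε hε1 hnε hnε2 (by rw [hac]; exact hr40) hFs.fs
    have hbE : b ≤ γ / (5 * √(dirE F)) := by
      refine hb.trans ?_
      have h1 : √(dirE F) ≤ 64 / √ε := by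
        rw [Real.sqrt_le_left (by positivity), div_pow, Real.sq_sqrt hε.le]
        norm_num; exact hE1
      have h2 : 0 < √(dirE F) := Real.sqrt_pos.2 hE0
      have h3 : 0 < √ε := Real.sqrt_pos.2 hε
      rw [le_div_iff₀ h3] at h1
      rw [div_le_div_iff₀ (by norm_num) (by positivity)]
      nlinarith
    -- contribution of one child
    set PP : Ω → ENNReal := fun ω => ∏ i, (Iic (0 : ℝ)).indicator (fun _ => (1 : ENNReal)) (hF N η (f i) ω) with hPP
    set C := ENNReal.ofReal (2 * r0 + 9) * ENNReal.ofReal (16 * n + 12 - 4 * b * n) ^ k * G with hC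
    have hPPm : Measurable PP := Finset.measurable_prod _ fun i _ =>
      (measurable_const.indicator measurableSet_Iic).comp (D.hF_meas (f i))
    have hlapf : ∀ i z, F z ≠ 0 → lap (f i) z = 0 := by
      intro i z hz
      exact lap_const_ball (ρ := 2 * r + 1) (fun w hw => hv i w (by linarith)) (by linarith [hF0 z hz])
    have child : ∀ s : ℝ, s = 1 ∨ s = -1 → ∀ j ∈ Finset.range (16 * n),
        ∫⁻ ω, PP ω * ((Iic (0 : ℝ)).indicator (fun _ => (1 : ENNReal)) (hF N η (fun z => s * F z) ω) *
          WW γ η N ε n k (cj ε n a c s j) (cj ε n a c s (j + 1)) ω) ∂μ ≤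
          ENNReal.ofReal (cost n b j) * ((∏ i, q i) * C) := by
      intro s hss j hj
      rw [Finset.mem_range] at hj
      have hcb : ∀ z, ‖cx z - cj ε n a c s j‖ ≤ 2 * (r0 * Th ε n ^ k) + 2 →
          ‖cx z - a‖ ≤ 2 * r + 2 ∧ ‖cx z - cj ε n a c s j‖ ≤ 3 / (16 * n) * ‖c - a‖ := by
        intro z hz
        rw [← hl] at hz
        exact child_ball hε hε1 hn hss hj.le hac hr40 hz
      have hstep : ‖cj ε n a c s (j + 1) - cj ε n a c s j‖ = r0 * Th ε n ^ k := by
        rw [cj_step hn0 hss, hac, hl]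
      have IH := ih (cj ε n a c s j) (cj ε n a c s (j + 1)) hstep (fun z hz => hball z (hcb z hz).1)
      -- with the extra function
      have good : ∀ (v0 : ℝ) (q0 : ENNReal), (∀ z, ‖cx z - cj ε n a c s j‖ ≤ 2 * (r0 * Th ε n ^ k) + 2 → s * F z = v0) →
          (∫⁻ x in Iic 0, ENNReal.ofReal (rexp (γ * v0 / dirE F * x)) ∂(gaussianReal 0 (Real.toNNReal (dirE F))) ≤
            q0 * ∫⁻ x, ENNReal.ofReal (rexp (γ * v0 / dirE F * x)) ∂(gaussianReal 0 (Real.toNNReal (dirE F)))) →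
          ∫⁻ ω, PP ω * ((Iic (0 : ℝ)).indicator (fun _ => (1 : ENNReal)) (hF N η (fun z => s * F z) ω) *
          WW γ η N ε n k (cj ε n a c s j) (cj ε n a c s (j + 1)) ω) ∂μ ≤ q0 * ((∏ i, q i) * C) := by
        intro v0 q0 hv0 hq0
        have hgs : Supp N (fun z => s * F z) := fun z hz => by simp only [hFs z hz, mul_zero]
        have o1 : ∀ i, ∑' z, (s * F z) * lap (f i) z = 0 := by
          intro i
          have : ∀ z, (s * F z) * lap (f i) z = 0 := by
            intro z
            by_cases h : F z = 0
            · rw [h]; ring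
            · rw [hlapf i z h]; ring
          simp only [this, tsum_zero]
        have o2 : ∀ i, ∑' z, f i z * lap (fun z => s * F z) z = 0 := by
          intro i
          rw [lap_symm (hs i).fs, ← o1 i]
          exact tsum_congr fun z => mul_comm _ _
        have := IH (d + 1) (Fin.cons (fun z => s * F z) f)
          (by intro i; refine Fin.cases ?_ (fun i => ?_) i
              · exact hgs
              · exact hs i)
          (by intro i j
              refine Fin.cases ?_ (fun i => ?_) i <;> refine Fin.cases ?_ (fun j => ?_) j
              · intro h; exact absurd rfl h
              · intro _; simpa using o1 j
              · intro _; simpa using o2 i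
              · intro h; simpa using ho i j (fun h' => h (by rw [h'])))
          (by intro i; refine Fin.cases ?_ (fun i => ?_) i
              · rw [Fin.cons_zero, dirE_sign hss]; exact hE0
              · exact hE i)
          (Fin.cons v0 v)
          (by intro i; refine Fin.cases ?_ (fun i => ?_) i
              · exact hv0
              · intro z hz; exact hv i z (hcb z hz).1)
          (Fin.cons q0 q)
          (by intro i; refine Fin.cases ?_ (fun i => ?_) i
              · simp only [Fin.cons_zero]; rw [dirE_sign hss]; exact hq0
              · exact hq i)
        simp only [Fin.prod_univ_succ, Fin.cons_zero, Fin.cons_succ] at this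
        calc _ = _ := lintegral_congr fun ω => by simp only [hPP]; ring
          _ ≤ _ := this
          _ = _ := by rw [hC]; ring
      have hcoord : ∀ z, ‖cx z - cj ε n a c s j‖ ≤ 2 * (r0 * Th ε n ^ k) + 2 →
          ‖(cx z - a) / (c - a) - wp ε s (j / (16 * n))‖ ≤ 3 / (16 * n) := fun z hz =>
        norm_coord hac0 (hcb z hz).2
      by_cases h0 : j + 3 ≤ 6 * n ∨ 10 * n + 3 ≤ j
      · have hc : cost n b j = 1 / 2 := by
          unfold cost
          rw [if_neg (by omega), if_neg (by omega), if_neg (by omega)]; ring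
        rw [hc]
        refine good 0 _ (fun z hz => ?_) ?_
        · rw [hFdef, fab, FF_wp_zero hn0 hε h0 (hcoord z hz), mul_zero]
        · have := q_zero (γ := γ) hE0
          rwa [show ENNReal.ofReal (1 / 2) = 1 / 2 by
            rw [ENNReal.ofReal_div_of_pos (by norm_num)]; norm_num]
      by_cases h1 : 6 * n + 4 ≤ j ∧ j < 10 * n - 3
      · have hc : cost n b j = 1 / 2 - b := by
          unfold cost
          rw [if_neg (by omega), if_neg (by omega), if_pos h1]; ring
        rw [hc]
        refine good 1 _ (fun z hz => ?_) (q_one' hE0 hγ.le hbE hb')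
        rw [hFdef, fab, FF_wp_one hn0 hε hss hn3 h1.1 (by omega) (hcoord z hz)]
        rcases hss with rfl | rfl <;> norm_num
      · have hc : 1 ≤ cost n b j := by
          unfold cost
          rw [if_neg h1]
          by_cases h2 : 6 * n - 2 ≤ j ∧ j < 6 * n + 4
          · rw [if_pos h2]; split_ifs <;> norm_num
          · rw [if_neg h2, if_pos (by omega)]; norm_num
        have := IH d f hs ho hE v (fun i z hz => hv i z (hcb z hz).1) q hq
        calc _ ≤ ∫⁻ ω, PP ω * WW γ η N ε n k (cj ε n a c s j) (cj ε n a c s (j + 1)) ω ∂μ := by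
              refine lintegral_mono fun ω => ?_
              dsimp only
              gcongr
              rw [mul_comm]
              refine mul_le_of_le_one_right' ?_
              exact Set.indicator_le_self' (fun _ _ => zero_le_one) _
          _ ≤ 1 * ((∏ i, q i) * C) := by rw [one_mul]; exact this
          _ ≤ _ := by
              gcongr
              rw [← ENNReal.ofReal_one]; exact ENNReal.ofReal_le_ofReal hc
    -- total
    have hW : ∀ ω, PP ω * WW γ η N ε n (k + 1) a c ω ≤
        ∑ j ∈ Finset.range (16 * n), PP ω * ((Iic (0 : ℝ)).indicator (fun _ => (1 : ENNReal)) (hF N η (fun z => 1 * F z) ω) *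
          WW γ η N ε n k (cj ε n a c 1 j) (cj ε n a c 1 (j + 1)) ω) +
        ∑ j ∈ Finset.range (16 * n), PP ω * ((Iic (0 : ℝ)).indicator (fun _ => (1 : ENNReal)) (hF N η (fun z => (-1) * F z) ω) *
          WW γ η N ε n k (cj ε n a c (-1) j) (cj ε n a c (-1) (j + 1)) ω) := by
      intro ω
      simp only [← Finset.mul_sum, hF_smul, WW]
      split_ifs with h
      · have : (Iic (0 : ℝ)).indicator (fun _ => (1 : ENNReal)) (1 * hF N η F ω) = 1 :=
          Set.indicator_of_mem (by rw [one_mul]; exact h) _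
        rw [this, one_mul]; exact le_add_right le_rfl
      · have : (Iic (0 : ℝ)).indicator (fun _ => (1 : ENNReal)) (-1 * hF N η F ω) = 1 :=
          Set.indicator_of_mem (by rw [Set.mem_Iic]; linarith [not_le.1 h]) _
        rw [this, one_mul, one_mul]; exact le_add_left le_rfl
    have hmeas : ∀ s j, Measurable fun ω => PP ω * ((Iic (0 : ℝ)).indicator (fun _ => (1 : ENNReal)) (hF N η (fun z => s * F z) ω) *
          WW γ η N ε n k (cj ε n a c s j) (cj ε n a c s (j + 1)) ω) := fun s j =>
      hPPm.mul (((measurable_const.indicator measurableSet_Iic).comp (D.hF_meas _)).mul (WW_meas D _ _ _ _ _ _))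
    have hcn : ∀ j, 0 ≤ cost n b j := by
      intro j; unfold cost
      have : (if 6 * n + 4 ≤ j ∧ j < 10 * n - 3 then b else 0) ≤ 1 / 5 := by split_ifs <;> linarith
      have h2 : (0 : ℝ) ≤ if 6 * n - 2 ≤ j ∧ j < 6 * n + 4 then 1 / 2 else 0 := by split_ifs <;> norm_num
      have h3 : (0 : ℝ) ≤ if 10 * n - 3 ≤ j ∧ j < 10 * n + 3 then 1 / 2 else 0 := by split_ifs <;> norm_num
      linarith
    refine (lintegral_mono hW).trans ?_
    rw [lintegral_add_left (Finset.measurable_sum _ fun j _ => hmeas 1 j),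
      lintegral_finsetSum _ (fun j _ => hmeas 1 j), lintegral_finsetSum _ (fun j _ => hmeas (-1) j)]
    refine (add_le_add (Finset.sum_le_sum (child 1 (Or.inl rfl))) (Finset.sum_le_sum (child (-1) (Or.inr rfl)))).trans ?_
    rw [← Finset.sum_mul, ← ENNReal.ofReal_sum_of_nonneg (fun j _ => hcn j), ← two_mul, ← mul_assoc]
    have h2 : 2 * ENNReal.ofReal (∑ j ∈ Finset.range (16 * n), cost n b j) ≤ ENNReal.ofReal (16 * n + 12 - 4 * b * n) := by
      rw [show (2 : ENNReal) = ENNReal.ofReal 2 by norm_num, ← ENNReal.ofReal_mul (by norm_num)]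
      exact ENNReal.ofReal_le_ofReal (cost_sum hn hb0)
    calc _ ≤ ENNReal.ofReal (16 * n + 12 - 4 * b * n) * ((∏ i, q i) * C) := by gcongr
      _ = _ := by rw [hC, pow_succ]; ring

end W


/-! ### Optimised paths: the one-pair estimate -/

/-- the exponent gain -/
noncomputable def c1 (γ : ℝ) : ℝ := γ * √γ / (2560 * log (32 / γ ^ 2))

lemma log32 {γ : ℝ} (hγ : 0 < γ) (hγ1 : γ ≤ 1 / 10 ^ 9) : 1 ≤ log (32 / γ ^ 2) := by
  rw [Real.le_log_iff_exp_le (by positivity)]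
  have := Real.exp_one_lt_d9
  have h2 : 32 ≤ 32 / γ ^ 2 := by
    rw [le_div_iff₀ (by positivity)]; nlinarith
  linarith

lemma c1_pos {γ : ℝ} (hγ : 0 < γ) (hγ1 : γ ≤ 1 / 10 ^ 9) : 0 < c1 γ := by
  have := log32 hγ hγ1
  unfold c1; positivity

lemma c1_le {γ : ℝ} (hγ : 0 < γ) (hγ1 : γ ≤ 1 / 10 ^ 9) : c1 γ ≤ 1 / 2560 := by
  have := log32 hγ hγ1
  have h2 : √γ ≤ 1 := by rw [Real.sqrt_le_left (by norm_num)]; linarith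
  unfold c1
  apply div_le_div₀ <;> nlinarith [Real.sqrt_nonneg γ]

lemma R_bound {γ b : ℝ} {n : ℕ} (hγ2 : 0 < γ ^ 2) (hγ2' : γ ^ 2 ≤ 1 / 10 ^ 9) (hb0 : 0 < b) (hb5 : b ≤ 1 / 1000)
    (hγb : 4 * γ ^ 2 ≤ b / 8) (hnγ : 1 ≤ n * γ ^ 2) (s1 : 1 ≤ √(1 + 4 * γ ^ 2)) :
    16 * (n : ℝ) + 12 - 4 * b * n ≤ Th γ n * rexp (-(b / 8)) := by
  have hs3 : √(1 + 4 * γ ^ 2) ≤ 1 + 2 * γ ^ 2 := by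
    rw [Real.sqrt_le_left (by positivity)]
    have : (1 + 2 * γ ^ 2) ^ 2 = 1 + 4 * γ ^ 2 + 4 * (γ ^ 2) ^ 2 := by ring
    rw [this]
    have := sq_nonneg (γ ^ 2)
    linarith
  have h1 : 1 - b / 8 ≤ rexp (-(b / 8)) := by have := Real.add_one_le_exp (-(b / 8)); linarith
  have hT : 0 ≤ Th γ n := by unfold Th; positivity
  refine le_trans ?_ (mul_le_mul_of_nonneg_left h1 hT)
  rw [Th, div_mul_eq_mul_div, le_div_iff₀ (by linarith)]
  have h3 : 16 * (n : ℝ) + 12 - 4 * b * n ≤ 16 * n * (1 + 3 / 4 * γ ^ 2 - b / 4) := by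
    have e : 16 * (n : ℝ) * (1 + 3 / 4 * γ ^ 2 - b / 4) = 16 * n + 12 * (n * γ ^ 2) - 4 * b * n := by ring
    rw [e]; linarith
  have h0 : 0 ≤ 1 + 3 / 4 * γ ^ 2 - b / 4 := by linarith
  calc _ ≤ (16 * n * (1 + 3 / 4 * γ ^ 2 - b / 4)) * (1 + 2 * γ ^ 2) := by
          apply mul_le_mul h3 hs3 (by positivity)
          positivity
    _ = 16 * n * ((1 + 3 / 4 * γ ^ 2 - b / 4) * (1 + 2 * γ ^ 2)) := by ring
    _ ≤ 16 * n * (1 - b / 8) := by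
          gcongr
          have e : (1 + 3 / 4 * γ ^ 2 - b / 4) * (1 + 2 * γ ^ 2) = 1 + 11 / 4 * γ ^ 2 - b / 4 - b * γ ^ 2 / 2
            + 3 / 2 * (γ ^ 2 * γ ^ 2) := by ring
          rw [e]
          have h5 : γ ^ 2 * γ ^ 2 ≤ γ ^ 2 * (1 / 10 ^ 9) := by gcongr
          have h6 : 0 ≤ b * γ ^ 2 := by positivity
          linarith

lemma e32_bound {γ b r L k : ℝ} (hγ : 0 < γ) (hγ1 : γ ≤ 1 / 10 ^ 9) (hb0 : 0 < b) (hb5 : b ≤ 1 / 1000) (hr : 16 ≤ r)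
    (hL1 : 1 ≤ L) (hc1 : c1 γ = b / 8 / L) (h1 : log (r / 16) / L - 1 ≤ k) :
    rexp (-(b / 8) * k) ≤ 32 * r ^ (-(c1 γ)) := by
  have h2 : -(b / 8) * k ≤ -(c1 γ) * log r + c1 γ * log 16 + b / 8 := by
    have h3 : -(b / 8) * k ≤ -(b / 8) * (log (r / 16) / L - 1) := by
      apply mul_le_mul_of_nonpos_left h1; linarith
    rw [Real.log_div (by linarith) (by norm_num)] at h3
    rw [hc1]
    have e : -(b / 8) * ((log r - log 16) / L - 1) = -(b / 8 / L) * log r + b / 8 / L * log 16 + b / 8 := by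
      field_simp; ring
    linarith
  refine (Real.exp_le_exp.2 h2).trans ?_
  rw [add_assoc, Real.exp_add, mul_comm (32 : ℝ), Real.rpow_def_of_pos (by linarith : 0 < r), mul_comm (log r)]
  gcongr
  rw [← Real.le_log_iff_exp_le (by norm_num)]
  have e2 : log 32 = log 16 + log 2 := by rw [← Real.log_mul (by norm_num) (by norm_num)]; norm_num
  have := Real.log_two_gt_d9
  have h4 : 0 ≤ log 16 := Real.log_nonneg (by norm_num)
  have h5 : c1 γ * log 16 ≤ 1 / 2560 * log 16 := mul_le_mul_of_nonneg_right (c1_le hγ hγ1) h4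
  linarith

set_option maxHeartbeats 1000000 in
lemma pair_bound {Ω : Type*} [MeasurableSpace Ω] {μ : Measure Ω} [IsProbabilityMeasure μ] {N : ℕ} {η : Z2 → Ω → ℝ}
    (D : DG μ N η) {γ : ℝ} (hγ : 0 < γ) (hγ1 : γ ≤ 1 / 10 ^ 9) (G : ENNReal)
    (hG : ∀ z ∈ VN N, ∫⁻ ω, ENNReal.ofReal (rexp (γ * η z ω)) ∂μ ≤ G) (a c : ℂ) (hr : 16 ≤ ‖c - a‖)
    (hball : ∀ z, ‖cx z - a‖ ≤ 2 * ‖c - a‖ + 2 → z ∈ VN N) :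
    ∃ W : Ω → ENNReal, Measurable W ∧ (∀ ω, Reach N γ η ω (rd a) (rd c) (W ω)) ∧
      ∫⁻ ω, W ω ∂μ ≤ ENNReal.ofReal (96 * ‖c - a‖ ^ (1 - c1 γ)) * G := by
  set r := ‖c - a‖ with hrd
  set n := ⌈1 / γ ^ 2⌉₊ with hn
  set b := γ * √γ / 320 with hb
  have hsq : 0 < √γ := Real.sqrt_pos.2 hγ
  have hsq2 : √γ * √γ = γ := Real.mul_self_sqrt hγ.le
  have hsq1 : √γ ≤ 1 / 20000 := by
    rw [Real.sqrt_le_left (by norm_num)]; linarith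
  have hγ2 : 0 < γ ^ 2 := by positivity
  have hγ2' : γ ^ 2 ≤ 1 / 10 ^ 9 := by nlinarith
  have hn1 : 1 / γ ^ 2 ≤ n := Nat.le_ceil _
  have hn2 : (n : ℝ) < 1 / γ ^ 2 + 1 := Nat.ceil_lt_add_one (by positivity)
  have hbig : 10 ^ 9 ≤ 1 / γ ^ 2 := by rw [le_div_iff₀ hγ2]; linarith
  have hn4 : (10 : ℝ) ^ 9 ≤ n := hbig.trans hn1
  have hn4' : 4 ≤ n := by
    have : (4 : ℝ) ≤ n := le_trans (by norm_num) hn4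
    exact_mod_cast this
  have hnγ : 1 ≤ n * γ ^ 2 := by rwa [div_le_iff₀ hγ2] at hn1
  have hnγ2 : n * γ ^ 2 ≤ 2 := by
    have : n * γ ^ 2 ≤ (1 / γ ^ 2 + 1) * γ ^ 2 := by gcongr
    rw [add_mul, div_mul_cancel₀ _ hγ2.ne'] at this
    linarith
  have hn0 : (0 : ℝ) < n := by linarith
  have hn3 : 3 / (16 * (n : ℝ)) ≤ γ / 8 := by
    rw [div_le_div_iff₀ (by positivity) (by norm_num)]
    have : 1 ≤ γ * (n * γ) := by nlinarith
    have h3 : 1 ≤ n * γ * (1 / 10 ^ 9) := by nlinarith [mul_pos hn0 hγ]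
    nlinarith
  have hb0 : 0 < b := by positivity
  have hb5 : b ≤ 1 / 1000 := by rw [hb]; nlinarith
  have hγb : 4 * γ ^ 2 ≤ b / 8 := by
    rw [hb]
    have : γ ^ 2 = γ * √γ * √γ := by rw [mul_assoc, hsq2]; ring
    rw [this]
    nlinarith [mul_pos hγ hsq]
  set Θ := Th γ n with hΘ
  have hΘ1 := Th_ge (n := n) hγ (by linarith : γ ≤ 1 / 16)
  obtain ⟨s1, s2⟩ := sqrt_eps hγ (by linarith : γ ≤ 1 / 16)
  have hΘ2 : Θ ≤ 32 / γ ^ 2 := by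
    have h1 : Θ ≤ 16 * n := by
      rw [hΘ, Th]; exact div_le_self (by positivity) s1
    have h2 : (n : ℝ) ≤ 2 / γ ^ 2 := by rwa [le_div_iff₀ hγ2]
    calc Θ ≤ 16 * n := h1
      _ ≤ 16 * (2 / γ ^ 2) := by gcongr
      _ = _ := by ring
  have hΘ0 : 1 < Θ := by linarith
  have hlogΘ : 0 < log Θ := Real.log_pos hΘ0
  set L := log (32 / γ ^ 2) with hL
  have hL1 : 1 ≤ L := log32 hγ hγ1
  have hlogΘL : log Θ ≤ L := Real.log_le_log (by linarith) hΘ2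
  have hlr : 0 ≤ log (r / 16) := Real.log_nonneg (by linarith)
  set k := ⌊log (r / 16) / log Θ⌋₊ with hk
  have hk1 : (k : ℝ) ≤ log (r / 16) / log Θ := Nat.floor_le (by positivity)
  have hk2 : log (r / 16) / log Θ < k + 1 := Nat.lt_floor_add_one _
  have hΘk : 0 < Θ ^ k := by positivity
  set r0 := r / Θ ^ k with hr0
  have hr0Θ : r0 * Θ ^ k = r := by rw [hr0]; field_simp
  have hr016 : 16 ≤ r0 := by
    rw [hr0, le_div_iff₀ hΘk, ← le_div_iff₀' (by norm_num)]
    rw [le_div_iff₀ hlogΘ] at hk1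
    rw [← Real.log_pow] at hk1
    exact (Real.log_le_log_iff hΘk (by linarith)).1 hk1
  have hb' : b ≤ γ * √γ / 320 := le_rfl
  have main := WW_bound D (γ := γ) (ε := γ) (r0 := r0) (b := b) (n := n) hγ (by linarith) hγ hb0.le hb' (by linarith)
    hn4' hnγ hnγ2 hn3 hr016 G hG k a c (by rw [hr0Θ]) (by rw [hr0Θ]; exact hball) 0 Fin.elim0
    (fun i => i.elim0) (fun i => i.elim0) (fun i => i.elim0) Fin.elim0 (fun i => i.elim0) Fin.elim0 (fun i => i.elim0)
  simp only [Finset.univ_eq_empty, Finset.prod_empty, one_mul] at main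
  refine ⟨WW γ η N γ n k a c, WW_meas D _ _ _ _ _ _, fun ω => WW_reach γ γ r0 n hγ (by linarith) hn4' hr016 ω k a c
    (by rw [hr0Θ]) (by rw [hr0Θ]; exact hball), main.trans ?_⟩
  have hR0 : 0 ≤ 16 * (n : ℝ) + 12 - 4 * b * n := by
    have : b * n ≤ 1 / 1000 * n := by gcongr
    linarith
  gcongr
  rw [← ENNReal.ofReal_pow hR0, ← ENNReal.ofReal_mul (by linarith)]
  apply ENNReal.ofReal_le_ofReal
  have hR := R_bound hγ2 hγ2' hb0 hb5 hγb hnγ s1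
  have hRk : (16 * (n : ℝ) + 12 - 4 * b * n) ^ k ≤ Θ ^ k * rexp (-(b / 8) * k) := by
    refine (pow_le_pow_left₀ hR0 hR k).trans (le_of_eq ?_)
    rw [mul_pow, ← Real.exp_nat_mul]; congr 2; ring
  have hc1 : c1 γ = b / 8 / L := by rw [c1, hb, ← hL]; field_simp; norm_num
  have hexp : rexp (-(b / 8) * k) ≤ 32 * r ^ (-(c1 γ)) := by
    have h1 : log (r / 16) / L - 1 ≤ k := by
      have : log (r / 16) / L ≤ log (r / 16) / log Θ := by gcongr
      linarith
    exact e32_bound hγ hγ1 hb0 hb5 hr hL1 hc1 h1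
  have hrr : r ^ (1 - c1 γ) = r * r ^ (-(c1 γ)) := by
    rw [sub_eq_add_neg, Real.rpow_add (by linarith), Real.rpow_one]
  calc (2 * r0 + 9) * (16 * (n : ℝ) + 12 - 4 * b * n) ^ k ≤ (3 * r0) * (Θ ^ k * (32 * r ^ (-(c1 γ)))) := by
        apply mul_le_mul (by linarith) (hRk.trans (by gcongr)) (by positivity) (by linarith)
    _ = 96 * ((r0 * Θ ^ k) * r ^ (-(c1 γ))) := by ring
    _ = _ := by rw [hr0Θ, hrr]


/-! ### Upper bound for all pairs of points -/

lemma sum_tail {Ω : Type*} [MeasurableSpace Ω] {μ : Measure Ω} {N : ℕ} {η : Z2 → Ω → ℝ}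
    (D : DG μ N η) {γ : ℝ} {G4 : ENNReal}
    (hG4 : ∀ z ∈ VN N, ∫⁻ ω, ENNReal.ofReal (rexp (4 * γ * η z ω)) ∂μ ≤ G4) (S : Finset Z2)
    (hS : ∀ z ∈ S, z ∈ VN N) (s : ℕ) (hs : S.card ≤ s) {T : ENNReal} (hT0 : T ≠ 0) (hT : T ≠ ⊤) :
    μ {ω | T ≤ ∑ z ∈ S, ENNReal.ofReal (rexp (γ * η z ω))} ≤ (s : ENNReal) ^ 4 * G4 / T ^ 4 := by
  have hm : ∀ z, Measurable fun ω => ENNReal.ofReal (rexp (γ * η z ω)) := fun z =>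
    ((D.meas z).const_mul γ).exp.ennreal_ofReal
  have hm4 : ∀ z, Measurable fun ω => ENNReal.ofReal (rexp (4 * γ * η z ω)) := fun z =>
    ((D.meas z).const_mul (4 * γ)).exp.ennreal_ofReal
  have hpt : ∀ ω, (∑ z ∈ S, ENNReal.ofReal (rexp (γ * η z ω))) ^ 4 ≤
      (s : ENNReal) ^ 3 * ∑ z ∈ S, ENNReal.ofReal (rexp (4 * γ * η z ω)) := by
    intro ω
    have h := ENNReal.rpow_sum_le_const_mul_sum_rpow (s := S) (f := fun z => ENNReal.ofReal (rexp (γ * η z ω)))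
      (p := 4) (by norm_num)
    have e1 : ∀ x : ENNReal, x ^ (4 : ℝ) = x ^ 4 := fun x => by
      rw [← ENNReal.rpow_natCast]; norm_num
    have e2 : ∀ x : ENNReal, x ^ ((4 : ℝ) - 1) = x ^ 3 := fun x => by
      rw [← ENNReal.rpow_natCast]; norm_num
    simp only [e1, e2] at h
    refine h.trans ?_
    gcongr with z hz
    rw [← ENNReal.ofReal_pow (by positivity), ← Real.exp_nat_mul]
    apply le_of_eq; congr 2; push_cast; ring
  calc μ {ω | T ≤ ∑ z ∈ S, ENNReal.ofReal (rexp (γ * η z ω))}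
      ≤ μ {ω | T ^ 4 ≤ (∑ z ∈ S, ENNReal.ofReal (rexp (γ * η z ω))) ^ 4} := by
        apply measure_mono
        intro ω hω
        exact pow_le_pow_left' (show T ≤ _ from hω) 4
    _ ≤ (∫⁻ ω, (∑ z ∈ S, ENNReal.ofReal (rexp (γ * η z ω))) ^ 4 ∂μ) / T ^ 4 :=
        meas_ge_le_lintegral_div ((Finset.measurable_sum S fun z _ => hm z).pow_const 4).aemeasurable
          (pow_ne_zero 4 hT0) (ENNReal.pow_ne_top hT)
    _ ≤ _ := by
        gcongr
        calc _ ≤ ∫⁻ ω, (s : ENNReal) ^ 3 * ∑ z ∈ S, ENNReal.ofReal (rexp (4 * γ * η z ω)) ∂μ := lintegral_mono hpt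
          _ = (s : ENNReal) ^ 3 * ∑ z ∈ S, ∫⁻ ω, ENNReal.ofReal (rexp (4 * γ * η z ω)) ∂μ := by
              rw [lintegral_const_mul _ (Finset.measurable_sum S fun z _ => hm4 z),
                lintegral_finsetSum _ fun z _ => hm4 z]
          _ ≤ (s : ENNReal) ^ 3 * ((s : ENNReal) * G4) := by
              gcongr
              calc _ ≤ ∑ z ∈ S, G4 := Finset.sum_le_sum fun z hz => hG4 z (hS z hz)
                _ = (S.card : ENNReal) * G4 := by rw [Finset.sum_const, nsmul_eq_mul]
                _ ≤ _ := by gcongr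
          _ = _ := by ring

/-- the coarse-grained point -/
def pk (k : ℕ) (x : Z2) : Z2 := (2 ^ k * (x.1 / 2 ^ k), 2 ^ k * (x.2 / 2 ^ k))

lemma pk_zero (x : Z2) : pk 0 x = x := by simp [pk]

lemma pk_le {a : ℤ} (k : ℕ) (ha : 0 ≤ a) : 0 ≤ 2 ^ k * (a / 2 ^ k) ∧ 2 ^ k * (a / 2 ^ k) ≤ a ∧ a < 2 ^ k * (a / 2 ^ k) + 2 ^ k := by
  have h : (0 : ℤ) < 2 ^ k := by positivity
  refine ⟨by positivity, Int.mul_ediv_self_le h.ne', ?_⟩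
  have := Int.lt_mul_ediv_self_add h (x := a); linarith

lemma pk_succ {a : ℤ} (k : ℕ) : 2 ^ (k + 1) * (a / 2 ^ (k + 1)) = 2 ^ (k + 1) * (a / 2 ^ k / 2) := by
  rw [pow_succ, Int.ediv_ediv_of_nonneg (by positivity)]

/-- target of the connection at scale `k` -/
def tgt (k0 : ℕ) (M : ℤ) (k : ℕ) (u : Z2) : Z2 :=
  if k < k0 then (2 ^ (k + 1) * (u.1 / 2), 2 ^ (k + 1) * (u.2 / 2))
  else (2 ^ k * max 4 (min u.1 (M - 4)), 2 ^ k * max 4 (min u.2 (M - 4)))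

def src (k : ℕ) (u : Z2) : Z2 := (2 ^ k * u.1, 2 ^ k * u.2)

lemma conn_prop {N k0 : ℕ} {M : ℤ} (hM : 8 ≤ M) (hMN : M * 2 ^ k0 ≤ N) (hMN' : N < (M + 1) * 2 ^ k0) {k : ℕ} (hk : k ≤ k0) {u : Z2}
    (hu : src k u ∈ VN N) :
    (∀ z ∈ lpt (src k u) (tgt k0 M k u), z ∈ VN N) ∧ (lpt (src k u) (tgt k0 M k u)).toFinset.card ≤ 9 * 2 ^ k := by
  have hp : (0 : ℤ) < 2 ^ k := by positivity
  obtain ⟨h1, h2, h3, h4⟩ := hu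
  simp only [src] at h1 h2 h3 h4
  have a1 : 0 ≤ u.1 := by by_contra h; push Not at h; nlinarith
  have a2 : 0 ≤ u.2 := by by_contra h; push Not at h; nlinarith
  have key : ∀ a : ℤ, 0 ≤ a → 2 ^ k * a < N → ∃ b : ℤ, (if k < k0 then 2 ^ (k + 1) * (a / 2) else 2 ^ k * max 4 (min a (M - 4))) = 2 ^ k * b ∧
      0 ≤ 2 ^ k * b ∧ 2 ^ k * b < N ∧ |2 ^ k * a - 2 ^ k * b| ≤ 4 * 2 ^ k := by
    intro a ha haN
    split_ifs with hk0
    · refine ⟨2 * (a / 2), by ring, by positivity, ?_, ?_⟩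
      · have : 2 * (a / 2) ≤ a := by omega
        nlinarith
      · rw [← mul_sub, abs_mul, abs_of_pos hp, mul_comm]
        gcongr
        rw [abs_le]; omega
    · have : k = k0 := by omega
      subst this
      have hlt : a < M + 1 := by
        by_contra h; push Not at h; nlinarith
      refine ⟨max 4 (min a (M - 4)), rfl, by positivity, ?_, ?_⟩
      · have : max 4 (min a (M - 4)) < M := by omega
        nlinarith
      · rw [← mul_sub, abs_mul, abs_of_pos hp, mul_comm]
        gcongr
        rw [abs_le]; omega
  obtain ⟨b1, e1, p1, p2, p3⟩ := key u.1 a1 h2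
  obtain ⟨b2, e2, q1, q2, q3⟩ := key u.2 a2 h4
  have et : tgt k0 M k u = (2 ^ k * b1, 2 ^ k * b2) := by
    unfold tgt
    rw [← e1, ← e2]
    split_ifs <;> rfl
  rw [et]
  refine ⟨fun z hz => ?_, ?_⟩
  · obtain ⟨⟨c1, c2⟩, c3, c4⟩ := lp_between hz
    simp only [src] at c1 c2 c3 c4
    exact ⟨by omega, by omega, by omega, by omega⟩
  · refine (List.toFinset_card_le _).trans ?_
    rw [(lp_spec _ _).2.2.2.2.1]
    simp only [src]
    have hp' : (1 : ℤ) ≤ 2 ^ k := hp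
    zify
    linarith

lemma chain_reach {Ω : Type*} {N : ℕ} {γ : ℝ} {η : Z2 → Ω → ℝ} {ω : Ω} {k0 : ℕ} {M : ℤ} {T : ENNReal}
    (hM : 8 ≤ M) (hMN : M * 2 ^ k0 ≤ N) (hMN' : N < (M + 1) * 2 ^ k0)
    (hE : ∀ k ≤ k0, ∀ u, src k u ∈ VN N →
      ∑ z ∈ (lpt (src k u) (tgt k0 M k u)).toFinset, ENNReal.ofReal (rexp (γ * η z ω)) ≤ T)
    {x : Z2} (hx : x ∈ VN N) :
    Reach N γ η ω x (2 ^ k0 * max 4 (min (x.1 / 2 ^ k0) (M - 4)), 2 ^ k0 * max 4 (min (x.2 / 2 ^ k0) (M - 4)))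
      ((k0 + 1 : ℕ) * T) := by
  have hin : ∀ k, src k (x.1 / 2 ^ k, x.2 / 2 ^ k) ∈ VN N := by
    intro k
    obtain ⟨h1, h2, h3, h4⟩ := hx
    have := pk_le k h1
    have := pk_le k h3
    exact ⟨by simp only [src]; omega, by simp only [src]; omega, by simp only [src]; omega, by simp only [src]; omega⟩
  have hstep : ∀ k ≤ k0, Reach N γ η ω (src k (x.1 / 2 ^ k, x.2 / 2 ^ k)) (tgt k0 M k (x.1 / 2 ^ k, x.2 / 2 ^ k)) T := by
    intro k hk
    exact (Reach.lpt (conn_prop hM hMN hMN' hk (hin k)).1).mono (hE k hk _ (hin k))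
  set p : ℕ → Z2 := fun k => if k ≤ k0 then src k (x.1 / 2 ^ k, x.2 / 2 ^ k)
    else (2 ^ k0 * max 4 (min (x.1 / 2 ^ k0) (M - 4)), 2 ^ k0 * max 4 (min (x.2 / 2 ^ k0) (M - 4))) with hp
  have h := Reach.sum (N := N) (γ := γ) (η := η) (ω := ω) p (fun _ => T) (m := k0 + 1) (by omega) ?_
  · have e0 : p 0 = x := by simp [hp, src]
    have e1 : p (k0 + 1) = (2 ^ k0 * max 4 (min (x.1 / 2 ^ k0) (M - 4)), 2 ^ k0 * max 4 (min (x.2 / 2 ^ k0) (M - 4))) := by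
      simp [hp]
    rw [e0, e1] at h
    refine h.mono (le_of_eq ?_)
    rw [Finset.sum_const, Finset.card_range, nsmul_eq_mul]
  · intro j hj
    have := hstep j (by omega)
    have e0 : p j = src j (x.1 / 2 ^ j, x.2 / 2 ^ j) := by simp only [hp]; rw [if_pos (by omega)]
    have e1 : p (j + 1) = tgt k0 M j (x.1 / 2 ^ j, x.2 / 2 ^ j) := by
      simp only [hp, tgt]
      by_cases hj' : j < k0
      · rw [if_pos (by omega), if_pos hj']
        simp only [src]
        rw [pk_succ, pk_succ]
      · have : j = k0 := by omega
        subst this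
        simp
    rw [e0, e1]; exact this

lemma grid_reach {Ω : Type*} {N : ℕ} {γ : ℝ} {η : Z2 → Ω → ℝ} {ω : Ω} {M : ℤ} {D : ℤ} {T : ENNReal}
    (h1 : ∀ i j : ℤ, 4 ≤ i → i + 1 ≤ M - 4 → 4 ≤ j → j ≤ M - 4 → Reach N γ η ω (D * i, D * j) (D * (i + 1), D * j) T)
    (h2 : ∀ i j : ℤ, 4 ≤ i → i ≤ M - 4 → 4 ≤ j → j + 1 ≤ M - 4 → Reach N γ η ω (D * i, D * j) (D * i, D * (j + 1)) T)
    (h0 : ∀ i j : ℤ, 4 ≤ i → i ≤ M - 4 → 4 ≤ j → j ≤ M - 4 → Reach N γ η ω (D * i, D * j) (D * i, D * j) T)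
    {i j i' j' : ℤ} (hi : 4 ≤ i) (hi2 : i ≤ M - 4) (hj : 4 ≤ j) (hj2 : j ≤ M - 4)
    (hi' : 4 ≤ i') (hi2' : i' ≤ M - 4) (hj' : 4 ≤ j') (hj2' : j' ≤ M - 4) :
    Reach N γ η ω (D * i, D * j) (D * i', D * j') ((2 * M.toNat : ℕ) * T) := by
  have mv : ∀ (n : ℕ) (i j : ℤ), 4 ≤ i → i + n ≤ M - 4 → 4 ≤ j → j ≤ M - 4 →
      Reach N γ η ω (D * i, D * j) (D * (i + n), D * j) ((n + 1 : ℕ) * T) := by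
    intro n
    induction n with
    | zero => intro i j a b c d; simpa using h0 i j a (by simpa using b) c d
    | succ n ih =>
      intro i j a b c d
      push_cast at b
      have := (ih i j a (by omega) c d).trans (h1 (i + n) j (by omega) (by omega) c d)
      convert this using 1
      · push_cast; ring_nf
      · push_cast; ring
  have mv2 : ∀ (n : ℕ) (i j : ℤ), 4 ≤ i → i ≤ M - 4 → 4 ≤ j → j + n ≤ M - 4 →
      Reach N γ η ω (D * i, D * j) (D * i, D * (j + n)) ((n + 1 : ℕ) * T) := by
    intro n
    induction n with
    | zero => intro i j a b c d; simpa using h0 i j a b c (by simpa using d)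
    | succ n ih =>
      intro i j a b c d
      push_cast at d
      have := (ih i j a b c (by omega)).trans (h2 i (j + n) a b (by omega) (by omega))
      convert this using 1
      · push_cast; ring_nf
      · push_cast; ring
  have A : Reach N γ η ω (D * i, D * j) (D * i', D * j) ((M.toNat : ℕ) * T) := by
    rcases le_total i i' with h | h
    · have := mv (i' - i).toNat i j hi (by omega) hj hj2
      rw [show i + ((i' - i).toNat : ℤ) = i' by omega] at this
      refine this.mono ?_
      gcongr; omega
    · have := mv (i - i').toNat i' j hi' (by omega) hj hj2
      rw [show i' + ((i - i').toNat : ℤ) = i by omega] at this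
      refine this.symm.mono ?_
      gcongr; omega
  have B : Reach N γ η ω (D * i', D * j) (D * i', D * j') ((M.toNat : ℕ) * T) := by
    rcases le_total j j' with h | h
    · have := mv2 (j' - j).toNat i' j hi' hi2' hj (by omega)
      rw [show j + ((j' - j).toNat : ℤ) = j' by omega] at this
      refine this.mono ?_
      gcongr; omega
    · have := mv2 (j - j').toNat i' j' hi' hi2' hj' (by omega)
      rw [show j' + ((j - j').toNat : ℤ) = j by omega] at this
      refine this.symm.mono ?_
      gcongr; omega
  refine (A.trans B).mono (le_of_eq ?_)
  push_cast; ring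


lemma Reach.self {Ω : Type*} {N : ℕ} {γ : ℝ} {η : Z2 → Ω → ℝ} {ω : Ω} {x y : Z2} {c : ENNReal}
    (h : Reach N γ η ω x y c) : Reach N γ η ω x x c := by
  obtain ⟨P, ⟨h0, h1, h1'⟩, h2, h3, h4⟩ := h
  have hx : x ∈ P := List.mem_of_head? h2
  refine ⟨[x], ⟨by simp, by change [x].IsChain Adj; simp, by simpa using h1' x hx⟩, rfl, rfl, le_trans ?_ h4⟩
  apply ENNReal.ofReal_le_ofReal
  unfold pWeight
  refine Finset.sum_le_sum_of_subset_of_nonneg (by simpa using hx) fun _ _ _ => by positivity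

lemma card_U {N k : ℕ} (hk : 2 ^ k ≤ N) (s : Finset Z2)
    (hs : s ⊆ Finset.Icc (0 : ℤ) (N / 2 ^ k) ×ˢ Finset.Icc (0 : ℤ) (N / 2 ^ k)) :
    (s.card : ℝ) ≤ 4 * (N / 2 ^ k) ^ 2 := by
  have h1 := Finset.card_le_card hs
  rw [Finset.card_product, Int.card_Icc] at h1
  have h2 : (((N / 2 ^ k + 1 - 0 : ℤ).toNat : ℕ) : ℝ) ≤ 2 * (N / 2 ^ k) := by
    have h3 : ((N / 2 ^ k + 1 - 0 : ℤ).toNat : ℕ) = N / 2 ^ k + 1 := by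
      rw [sub_zero]
      have : ((N : ℤ) / 2 ^ k + 1) = ((N / 2 ^ k + 1 : ℕ) : ℤ) := by push_cast; rfl
      rw [this, Int.toNat_natCast]
    rw [h3]
    have h4 : ((N / 2 ^ k : ℕ) : ℝ) ≤ (N : ℝ) / 2 ^ k := by
      have := @Nat.cast_div_le ℝ _ _ _ N (2 ^ k); push_cast at this; exact this
    have h5 : (1 : ℝ) ≤ (N : ℝ) / 2 ^ k := by
      rw [le_div_iff₀ (by positivity), one_mul]; exact_mod_cast hk
    push_cast; linarith
  have h6 : (s.card : ℝ) ≤ (((N / 2 ^ k + 1 - 0 : ℤ).toNat : ℕ) : ℝ) * (((N / 2 ^ k + 1 - 0 : ℤ).toNat : ℕ) : ℝ) := by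
    exact_mod_cast h1
  calc (s.card : ℝ) ≤ _ := h6
    _ ≤ (2 * (N / 2 ^ k)) * (2 * (N / 2 ^ k)) := by gcongr
    _ = _ := by ring

lemma upper_prob {Ω : Type*} [MeasurableSpace Ω] {μ : Measure Ω} [IsProbabilityMeasure μ] {N : ℕ} {η : Z2 → Ω → ℝ}
    (D : DG μ N η) {γ : ℝ} (hγ : 0 < γ) (hγ1 : γ ≤ 1 / 10 ^ 9) {G T : ℝ} (hG0 : 0 ≤ G) (hT : 0 < T)
    (hG : ∀ z ∈ VN N, ∫⁻ ω, ENNReal.ofReal (rexp (γ * η z ω)) ∂μ ≤ ENNReal.ofReal G)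
    (hG4 : ∀ z ∈ VN N, ∫⁻ ω, ENNReal.ofReal (rexp (4 * γ * η z ω)) ∂μ ≤ ENNReal.ofReal G) {k0 M : ℕ}
    (hk0 : 4 ≤ k0) (hM : 9 ≤ M) (hMN : M * 2 ^ k0 ≤ N) (hMN' : N < (M + 1) * 2 ^ k0) :
    μ {ω | ∃ x ∈ VN N, ∃ y ∈ VN N, ¬ Reach N γ η ω x y (ENNReal.ofReal ((2 * k0 + 3) * T))} ≤
      ENNReal.ofReal ((∑ k ∈ Finset.range (k0 + 1), 4 * (N / 2 ^ k : ℝ) ^ 2 * ((9 * 2 ^ k) ^ 4 * G / T ^ 4)) +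
        2 * (M : ℝ) ^ 2 * (96 * (2 ^ k0 : ℝ) ^ (1 - c1 γ) * G / (T / (2 * M)))) := by
  classical
  have hM0 : (0 : ℝ) < M := by exact_mod_cast (by omega : 0 < M)
  have hDN : (M : ℤ) * 2 ^ k0 ≤ N := by exact_mod_cast hMN
  have hDN' : (N : ℤ) < (M + 1) * 2 ^ k0 := by exact_mod_cast hMN'
  have hp : (16 : ℤ) ≤ 2 ^ k0 := by
    calc (16 : ℤ) = 2 ^ 4 := by norm_num
      _ ≤ 2 ^ k0 := by gcongr; norm_num
  have hpR : (16 : ℝ) ≤ 2 ^ k0 := by exact_mod_cast hp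
  -- the edges
  have edge : ∀ (i j : ℤ) (e : Z2), (e = (1, 0) ∨ e = (0, 1)) → ∃ W : Ω → ENNReal, Measurable W ∧
      (4 ≤ i → i ≤ M - 4 → 4 ≤ j → j ≤ M - 4 → (∀ ω, Reach N γ η ω (2 ^ k0 * i, 2 ^ k0 * j)
        (2 ^ k0 * (i + e.1), 2 ^ k0 * (j + e.2)) (W ω)) ∧
      ∫⁻ ω, W ω ∂μ ≤ ENNReal.ofReal (96 * (2 ^ k0 : ℝ) ^ (1 - c1 γ)) * ENNReal.ofReal G) := by
    intro i j e he
    by_cases hij : 4 ≤ i ∧ i ≤ M - 4 ∧ 4 ≤ j ∧ j ≤ M - 4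
    · obtain ⟨i1, i2, j1, j2⟩ := hij
      set a : Z2 := (2 ^ k0 * i, 2 ^ k0 * j) with ha
      set c : Z2 := (2 ^ k0 * (i + e.1), 2 ^ k0 * (j + e.2)) with hc
      have hn : ‖cx c - cx a‖ = 2 ^ k0 := by
        have : cx c - cx a = ((2 ^ k0 : ℝ) : ℂ) * (cx e) := by
          apply Complex.ext
          · simp only [cx, ha, hc, Complex.sub_re, Complex.re_ofReal_mul]; push_cast; ring
          · simp only [cx, ha, hc, Complex.sub_im, Complex.im_ofReal_mul]; push_cast; ring
        rw [this, norm_mul, Complex.norm_of_nonneg (by positivity)]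
        have h1 : ‖cx e‖ = 1 := by
          rcases he with rfl | rfl <;> simp [cx, Complex.norm_def, Complex.normSq_apply]
        rw [h1, mul_one]
      obtain ⟨W, h1, h2, h3⟩ := pair_bound D hγ hγ1 (ENNReal.ofReal G) hG (cx a) (cx c) (by rw [hn]; exact hpR) (by
        rw [hn]
        intro z hz
        have hz1 := (Complex.abs_re_le_norm _).trans hz
        have hz2 := (Complex.abs_im_le_norm _).trans hz
        simp only [cx, ha, Complex.sub_re, Complex.sub_im] at hz1 hz2
        have w1 : |z.1 - 2 ^ k0 * i| ≤ 2 * 2 ^ k0 + 2 := by exact_mod_cast hz1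
        have w2 : |z.2 - 2 ^ k0 * j| ≤ 2 * 2 ^ k0 + 2 := by exact_mod_cast hz2
        rw [abs_le] at w1 w2
        have q1 : 2 ^ k0 * 4 ≤ 2 ^ k0 * i := by gcongr
        have q2 : 2 ^ k0 * i ≤ 2 ^ k0 * (M - 4) := by gcongr
        have q3 : 2 ^ k0 * 4 ≤ 2 ^ k0 * j := by gcongr
        have q4 : 2 ^ k0 * j ≤ 2 ^ k0 * (M - 4) := by gcongr
        exact ⟨by linarith [w1.1], by linarith [w1.2], by linarith [w2.1], by linarith [w2.2]⟩)
      rw [hn] at h3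
      simp only [rd_cx] at h2
      exact ⟨W, h1, fun _ _ _ _ => ⟨h2, h3⟩⟩
    · exact ⟨0, measurable_const, fun a b c d => absurd ⟨a, b, c, d⟩ hij⟩
  choose W1 hW1m hW1 using fun (p : Z2) => edge p.1 p.2 (1, 0) (Or.inl rfl)
  choose W2 hW2m hW2 using fun (p : Z2) => edge p.1 p.2 (0, 1) (Or.inr rfl)
  set J : Finset Z2 := Finset.Icc (4 : ℤ) (M - 4) ×ˢ Finset.Icc (4 : ℤ) (M - 4) with hJ
  set U : ℕ → Finset Z2 := fun k => (Finset.Icc (0 : ℤ) (N / 2 ^ k) ×ˢ Finset.Icc (0 : ℤ) (N / 2 ^ k)).filter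
    (fun u => src k u ∈ VN N) with hU
  set T' := ENNReal.ofReal T with hT'
  set T2 := ENNReal.ofReal (T / (2 * M)) with hT2
  have hT'0 : T' ≠ 0 := by simp [hT', hT]
  have hT20 : T2 ≠ 0 := by
    have : 0 < T / (2 * M) := by positivity
    simp [hT2, this]
  have hsub : {ω | ∃ x ∈ VN N, ∃ y ∈ VN N, ¬ Reach N γ η ω x y (ENNReal.ofReal ((2 * k0 + 3) * T))} ⊆
      (⋃ k ∈ Finset.range (k0 + 1), ⋃ u ∈ U k, {ω | T' ≤ ∑ z ∈ (lpt (src k u) (tgt k0 M k u)).toFinset,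
        ENNReal.ofReal (rexp (γ * η z ω))}) ∪ ((⋃ p ∈ J, {ω | T2 ≤ W1 p ω}) ∪ (⋃ p ∈ J, {ω | T2 ≤ W2 p ω})) := by
    intro ω hω
    by_contra hcon
    simp only [mem_union, mem_iUnion, Finset.mem_range, not_or, not_exists, Set.mem_ofPred_eq, not_le] at hcon
    obtain ⟨c1, c2, c3⟩ := hcon
    obtain ⟨x, hx, y, hy, hxy⟩ := hω
    apply hxy
    have hE : ∀ k ≤ k0, ∀ u, src k u ∈ VN N →
        ∑ z ∈ (lpt (src k u) (tgt k0 M k u)).toFinset, ENNReal.ofReal (rexp (γ * η z ω)) ≤ T' := by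
      intro k hk u hu
      refine (c1 k (by omega) u ?_).le
      simp only [hU, Finset.mem_filter, Finset.mem_product, Finset.mem_Icc]
      have hkp : (0 : ℤ) < 2 ^ k := by positivity
      obtain ⟨u1, u2, u3, u4⟩ := id hu
      simp only [src] at u1 u2 u3 u4
      refine ⟨⟨⟨?_, ?_⟩, ?_, ?_⟩, hu⟩
      · exact nonneg_of_mul_nonneg_right u1 hkp
      · rw [Int.le_ediv_iff_mul_le hkp]; linarith
      · exact nonneg_of_mul_nonneg_right u3 hkp
      · rw [Int.le_ediv_iff_mul_le hkp]; linarith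
    have hMZ : (8 : ℤ) ≤ M := by exact_mod_cast (by omega : 8 ≤ M)
    have r1 := chain_reach hMZ hDN hDN' hE hx
    have r2 := chain_reach hMZ hDN hDN' hE hy
    have memJ : ∀ i j : ℤ, 4 ≤ i → i ≤ M - 4 → 4 ≤ j → j ≤ M - 4 → (i, j) ∈ J := by
      intro i j a b c d
      simp [hJ, a, b, c, d]
    have r3 := grid_reach (N := N) (γ := γ) (η := η) (ω := ω) (M := M) (D := 2 ^ k0) (T := T2)
      (fun i j a b c d => by
        have := ((hW1 (i, j) a (by linarith) c d).1 ω).mono (c2 (i, j) (memJ i j a (by linarith) c d)).le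
        simpa using this)
      (fun i j a b c d => by
        have := ((hW2 (i, j) a b c (by linarith)).1 ω).mono (c3 (i, j) (memJ i j a b c (by linarith))).le
        simpa using this)
      (fun i j a b c d => by
        have := ((hW2 (i, j) a b c (by linarith)).1 ω).mono (c3 (i, j) (memJ i j a b c (by linarith))).le
        exact this.self)
      (i := max 4 (min (x.1 / 2 ^ k0) (M - 4))) (j := max 4 (min (x.2 / 2 ^ k0) (M - 4)))
      (i' := max 4 (min (y.1 / 2 ^ k0) (M - 4))) (j' := max 4 (min (y.2 / 2 ^ k0) (M - 4)))
      (by omega) (by omega) (by omega) (by omega) (by omega) (by omega) (by omega) (by omega)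
    refine ((r1.trans r3).trans r2.symm).mono (le_of_eq ?_)
    rw [Int.toNat_natCast, hT', hT2, ← ENNReal.ofReal_natCast, ← ENNReal.ofReal_natCast,
      ← ENNReal.ofReal_mul (by positivity), ← ENNReal.ofReal_mul (by positivity), ← ENNReal.ofReal_add (by positivity) (by positivity),
      ← ENNReal.ofReal_add (by positivity) (by positivity)]
    congr 1
    push_cast
    field_simp
    ring
  refine (measure_mono hsub).trans ((measure_union_le _ _).trans ?_)
  rw [ENNReal.ofReal_add (Finset.sum_nonneg fun k _ => by positivity) (by positivity)]
  gcongr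
  · refine (measure_biUnion_finset_le _ _).trans ?_
    rw [ENNReal.ofReal_sum_of_nonneg fun k _ => by positivity]
    refine Finset.sum_le_sum fun k hk => ?_
    rw [Finset.mem_range] at hk
    refine (measure_biUnion_finset_le _ _).trans ?_
    have hMZ : (8 : ℤ) ≤ M := by exact_mod_cast (by omega : 8 ≤ M)
    have hb : ∀ u ∈ U k, μ {ω | T' ≤ ∑ z ∈ (lpt (src k u) (tgt k0 M k u)).toFinset,
        ENNReal.ofReal (rexp (γ * η z ω))} ≤ ENNReal.ofReal ((9 * 2 ^ k) ^ 4 * G / T ^ 4) := by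
      intro u hu
      have hu' : src k u ∈ VN N := by simp only [hU, Finset.mem_filter] at hu; exact hu.2
      obtain ⟨g1, g2⟩ := conn_prop hMZ hDN hDN' (by omega : k ≤ k0) hu'
      refine (sum_tail D hG4 _ (by simpa using g1) _ g2 hT'0 ENNReal.ofReal_ne_top).trans (le_of_eq ?_)
      rw [hT', ← ENNReal.ofReal_pow hT.le, ← ENNReal.ofReal_natCast, ← ENNReal.ofReal_pow (by positivity),
        ← ENNReal.ofReal_mul (by positivity), ← ENNReal.ofReal_div_of_pos (by positivity)]
      push_cast; rfl
    refine (Finset.sum_le_sum hb).trans ?_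
    rw [Finset.sum_const, nsmul_eq_mul, ENNReal.ofReal_mul (by positivity)]
    gcongr
    rw [← ENNReal.ofReal_natCast]
    apply ENNReal.ofReal_le_ofReal
    refine card_U ?_ _ (Finset.filter_subset _ _)
    calc 2 ^ k ≤ 2 ^ k0 := by gcongr; · norm_num
                              · omega
      _ ≤ M * 2 ^ k0 := Nat.le_mul_of_pos_left _ (by omega)
      _ ≤ N := hMN
  · have hJc : (J.card : ENNReal) ≤ ENNReal.ofReal ((M : ℝ) ^ 2) := by
      rw [← ENNReal.ofReal_natCast]
      apply ENNReal.ofReal_le_ofReal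
      have : J.card ≤ M ^ 2 := by
        rw [hJ, Finset.card_product, Int.card_Icc, sq]
        gcongr <;> omega
      exact_mod_cast this
    have gen : ∀ W : Z2 → Ω → ENNReal, (∀ p, Measurable (W p)) → (∀ p ∈ J, ∫⁻ ω, W p ω ∂μ ≤
        ENNReal.ofReal (96 * (2 ^ k0 : ℝ) ^ (1 - c1 γ)) * ENNReal.ofReal G) →
        μ (⋃ p ∈ J, {ω | T2 ≤ W p ω}) ≤ ENNReal.ofReal ((M : ℝ) ^ 2 * (96 * (2 ^ k0 : ℝ) ^ (1 - c1 γ) * G / (T / (2 * M)))) := by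
      intro W hm hW
      refine (measure_biUnion_finset_le _ _).trans ?_
      refine (Finset.sum_le_sum (g := fun _ => ENNReal.ofReal (96 * (2 ^ k0 : ℝ) ^ (1 - c1 γ) * G / (T / (2 * M)))) fun p hp => ?_).trans ?_
      · refine (meas_ge_le_lintegral_div (hm p).aemeasurable hT20 ENNReal.ofReal_ne_top).trans ?_
        rw [ENNReal.ofReal_div_of_pos (by positivity), ENNReal.ofReal_mul (by positivity)]
        gcongr
        exact hW p hp
      · rw [Finset.sum_const, nsmul_eq_mul, ENNReal.ofReal_mul (by positivity)]
        gcongr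
    have memJ : ∀ p ∈ J, 4 ≤ p.1 ∧ p.1 ≤ M - 4 ∧ 4 ≤ p.2 ∧ p.2 ≤ M - 4 := by
      intro p hp
      simp only [hJ, Finset.mem_product, Finset.mem_Icc] at hp
      exact ⟨hp.1.1, hp.1.2, hp.2.1, hp.2.2⟩
    refine (measure_union_le _ _).trans ((add_le_add (gen W1 hW1m fun p hp => ?_) (gen W2 hW2m fun p hp => ?_)).trans (le_of_eq ?_))
    · obtain ⟨a, b, c, d⟩ := memJ p hp; exact (hW1 p a b c d).2
    · obtain ⟨a, b, c, d⟩ := memJ p hp; exact (hW2 p a b c d).2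
    · rw [← ENNReal.ofReal_add (by positivity) (by positivity)]
      congr 1; ring


lemma G_bound {γ c' : ℝ} (hγ : 0 < γ) (hγ1 : γ ≤ 1 / 10 ^ 9) (hc : 1184 * γ ^ 2 ≤ c') {N : ℕ} (hN : 1 < N) :
    rexp (51 * (4 * γ) ^ 2 * (Nat.clog 2 N + 1)) ≤ 3 * (N : ℝ) ^ c' := by
  have hN0 : (0 : ℝ) < N := by exact_mod_cast (by omega : 0 < N)
  set I := Nat.clog 2 N with hI
  have h1 : 2 ^ (I - 1) < N := Nat.pow_pred_clog_lt_self one_lt_two hN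
  have h2 : 1 ≤ I := Nat.clog_pos one_lt_two hN
  have h3 : ((I - 1 : ℕ) : ℝ) * log 2 ≤ log N := by
    rw [← Real.log_pow]
    apply Real.log_le_log (by positivity)
    exact_mod_cast h1.le
  rw [Nat.cast_sub h2] at h3
  have hl := Real.log_two_gt_d9
  have hlN : 0 ≤ log N := Real.log_nonneg (by exact_mod_cast (by omega : 1 ≤ N))
  have h4 : 51 * (4 * γ) ^ 2 * (I + 1) ≤ c' * log N + 1 := by
    have h5 : (I : ℝ) + 1 ≤ 1184 / 816 * log N + 2 := by
      push_cast at h3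
      have : ((I : ℝ) - 1) * 0.69313 ≤ log N := by
        have : (0 : ℝ) ≤ (I : ℝ) - 1 := by
          have : (1 : ℝ) ≤ I := by exact_mod_cast h2
          linarith
        nlinarith
      linarith
    have hγ2 : γ ^ 2 ≤ 1 / 10 ^ 9 := by nlinarith
    calc 51 * (4 * γ) ^ 2 * (I + 1) = 816 * γ ^ 2 * (I + 1) := by ring
      _ ≤ 816 * γ ^ 2 * (1184 / 816 * log N + 2) := by gcongr
      _ = 1184 * γ ^ 2 * log N + 1632 * γ ^ 2 := by ring
      _ ≤ c' * log N + 1 := by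
        gcongr
        linarith
  calc _ ≤ rexp (c' * log N + 1) := Real.exp_le_exp.2 h4
    _ = rexp 1 * (N : ℝ) ^ c' := by rw [Real.rpow_def_of_pos hN0, ← Real.exp_add]; ring_nf
    _ ≤ _ := by
      gcongr
      have := Real.exp_one_lt_d9
      linarith

lemma geom4 (k0 : ℕ) : ∑ k ∈ Finset.range (k0 + 1), (4 : ℝ) ^ k ≤ 2 * 4 ^ k0 := by
  rw [geom_sum_eq (by norm_num)]
  rw [div_le_iff₀ (by norm_num), pow_succ]
  have : (0 : ℝ) < 4 ^ k0 := by positivity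
  linarith

lemma num_bound {N m D M c : ℝ} {k0 : ℕ} (hN : 0 < N) (hm : 1 ≤ m) (hD : D = 2 ^ k0) (hDm : D ≤ N / m ^ 6)
    (hDm2 : N / m ^ 6 < 2 * D) (hM : M * D ≤ N) (hM0 : 0 < M) (hDc : D ^ (-c) ≤ (m ^ 20)⁻¹) :
    (∑ k ∈ Finset.range (k0 + 1), 4 * (N / 2 ^ k : ℝ) ^ 2 * ((9 * 2 ^ k) ^ 4 * (3 * m) / (N / m ^ 2) ^ 4)) +
        2 * M ^ 2 * (96 * D ^ (1 - c) * (3 * m) / (N / m ^ 2 / (2 * M))) ≤ 200000 * (m ^ 3)⁻¹ := by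
  have hm0 : 0 < m := by linarith
  have hD0 : 0 < D := by rw [hD]; positivity
  have h1 : (∑ k ∈ Finset.range (k0 + 1), 4 * (N / 2 ^ k : ℝ) ^ 2 * ((9 * 2 ^ k) ^ 4 * (3 * m) / (N / m ^ 2) ^ 4))
      = 78732 * m ^ 9 / N ^ 2 * ∑ k ∈ Finset.range (k0 + 1), (4 : ℝ) ^ k := by
    rw [Finset.mul_sum]
    refine Finset.sum_congr rfl fun k _ => ?_
    have : (4 : ℝ) ^ k = 2 ^ k * 2 ^ k := by rw [← mul_pow]; norm_num
    rw [this]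
    field_simp
    ring
  have h2 : (4 : ℝ) ^ k0 = D ^ 2 := by rw [hD, ← pow_mul, mul_comm, pow_mul]; norm_num
  have h3 : 78732 * m ^ 9 / N ^ 2 * ∑ k ∈ Finset.range (k0 + 1), (4 : ℝ) ^ k ≤ 157464 * (m ^ 3)⁻¹ := by
    calc _ ≤ 78732 * m ^ 9 / N ^ 2 * (2 * (N / m ^ 6) ^ 2) := by
            gcongr
            refine (geom4 k0).trans ?_
            rw [h2]; gcongr
      _ = _ := by field_simp; norm_num
  have hM2 : M ≤ 2 * m ^ 6 := by
    rw [div_lt_iff₀ (by positivity)] at hDm2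
    have : M * D ≤ (2 * m ^ 6) * D := by linarith
    exact le_of_mul_le_mul_right this hD0
  have h4 : 2 * M ^ 2 * (96 * D ^ (1 - c) * (3 * m) / (N / m ^ 2 / (2 * M))) ≤ 4608 * (m ^ 3)⁻¹ := by
    have e : D ^ (1 - c) = D * D ^ (-c) := by rw [sub_eq_add_neg, Real.rpow_add hD0, Real.rpow_one]
    have hDc0 : 0 ≤ D ^ (-c) := by positivity
    rw [e]
    calc 2 * M ^ 2 * (96 * (D * D ^ (-c)) * (3 * m) / (N / m ^ 2 / (2 * M)))
        = 1152 * M ^ 2 * m ^ 3 * D ^ (-c) * ((M * D) / N) := by field_simp; ring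
      _ ≤ 1152 * (2 * m ^ 6) ^ 2 * m ^ 3 * (m ^ 20)⁻¹ * 1 := by
          gcongr
          rw [div_le_one hN]; exact hM
      _ = 4608 * (m ^ 5)⁻¹ := by field_simp; norm_num
      _ ≤ _ := by
          gcongr
          norm_num
  have h5 : 0 ≤ (m ^ 3)⁻¹ := by positivity
  rw [h1]; linarith

lemma upper_all {γ : ℝ} (hγ : 0 < γ) (hγ1 : γ ≤ 1 / 10 ^ 9) (hc : 1184 * γ ^ 2 ≤ c1 γ / 40) :
    ∃ N0 : ℕ, ∀ N ≥ N0, ∀ (Ω : Type) [MeasurableSpace Ω] (μ : Measure Ω) [IsProbabilityMeasure μ] (η : Z2 → Ω → ℝ),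
      DG μ N η → μ {ω | ∃ x ∈ VN N, ∃ y ∈ VN N, ¬ Reach N γ η ω x y (ENNReal.ofReal ((N : ℝ) ^ (1 - c1 γ / 40)))} ≤
        ENNReal.ofReal (200000 * (((N : ℝ) ^ (c1 γ / 40)) ^ 3)⁻¹) := by
  set c' := c1 γ / 40 with hc'
  have hc1 := c1_pos hγ hγ1
  have hc1' := c1_le hγ hγ1
  have hc0 : 0 < c' := by positivity
  have hcs : c' ≤ 1 / 10000 := by rw [hc']; linarith
  have ev1 : ∀ᶠ N : ℕ in atTop, (10 : ℝ) ≤ (N : ℝ) ^ c' :=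
    ((tendsto_rpow_atTop hc0).comp tendsto_natCast_atTop_atTop).eventually_ge_atTop 10
  have ev2 : ∀ᶠ N : ℕ in atTop, (2 : ℝ) ≤ (N : ℝ) ^ (1 / 2 - 6 * c') :=
    ((tendsto_rpow_atTop (by linarith)).comp tendsto_natCast_atTop_atTop).eventually_ge_atTop 2
  have ev3 : ∀ᶠ N : ℕ in atTop, 3 * log (N : ℝ) + 3 ≤ (N : ℝ) ^ c' := by
    have h1 := (isLittleO_log_rpow_atTop hc0).bound (by norm_num : (0 : ℝ) < 1 / 6)
    have h2 := tendsto_natCast_atTop_atTop (R := ℝ) |>.eventually h1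
    filter_upwards [h2, ev1, eventually_ge_atTop 1] with N h2 h3 h4
    rw [Real.norm_of_nonneg (Real.log_nonneg (by exact_mod_cast h4)), Real.norm_of_nonneg (by positivity)] at h2
    linarith
  obtain ⟨N0, hN0⟩ := eventually_atTop.1 (ev1.and (ev2.and (ev3.and (eventually_ge_atTop 1024))))
  refine ⟨N0, fun N hN Ω _ μ _ η D => ?_⟩
  obtain ⟨g1, g2, g3, g4⟩ := hN0 N hN
  set m := (N : ℝ) ^ c' with hm
  have hNp : (0 : ℝ) < N := by exact_mod_cast (by omega : 0 < N)
  have hm0 : 0 < m := by linarith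
  have hm6 : m ^ 6 = (N : ℝ) ^ (6 * c') := by
    rw [hm, ← Real.rpow_natCast, ← Real.rpow_mul hNp.le]; ring_nf
  have hm20 : m ^ 20 = (N : ℝ) ^ (20 * c') := by
    rw [hm, ← Real.rpow_natCast, ← Real.rpow_mul hNp.le]; ring_nf
  have hX : 2 * √(N : ℝ) ≤ N / m ^ 6 := by
    rw [le_div_iff₀ (by positivity), hm6, Real.sqrt_eq_rpow]
    calc 2 * (N : ℝ) ^ (1 / 2 : ℝ) * (N : ℝ) ^ (6 * c') ≤ (N : ℝ) ^ (1 / 2 - 6 * c') * (N : ℝ) ^ (1 / 2 : ℝ) * (N : ℝ) ^ (6 * c') := by gcongr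
      _ = (N : ℝ) ^ (1 : ℝ) := by rw [← Real.rpow_add hNp, ← Real.rpow_add hNp]; congr 1; ring
      _ = N := Real.rpow_one _
  have hsq : 32 ≤ √(N : ℝ) := by
    apply Real.le_sqrt_of_sq_le
    have : (1024 : ℝ) ≤ N := by exact_mod_cast g4
    linarith
  obtain ⟨k0, k1, k2⟩ := exists_nat_pow_near (x := (N : ℝ) / m ^ 6) (y := 2) (by linarith) one_lt_two
  have hDs : √(N : ℝ) ≤ 2 ^ k0 := by rw [pow_succ _ k0] at k2; linarith
  have hk0 : 4 ≤ k0 := by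
    by_contra h
    have : (2 : ℝ) ^ k0 ≤ 2 ^ 4 := by gcongr; · norm_num
                                      · omega
    linarith
  have hDN : (2 : ℝ) ^ k0 ≤ N := by
    refine k1.trans (div_le_self hNp.le (one_le_pow₀ (by linarith)))
  have hkl : (k0 : ℝ) ≤ 3 / 2 * log N := by
    have h1 : (k0 : ℝ) * log 2 ≤ log N := by
      rw [← Real.log_pow]; exact Real.log_le_log (by positivity) hDN
    have := Real.log_two_gt_d9
    have h0 : (0 : ℝ) ≤ k0 := by positivity
    have h2 : (k0 : ℝ) * (2 / 3) ≤ k0 * log 2 := by gcongr; linarith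
    linarith
  set M := N / 2 ^ k0 with hM
  have hMN : M * 2 ^ k0 ≤ N := Nat.div_mul_le_self _ _
  have hMN' : N < (M + 1) * 2 ^ k0 := by
    rw [add_mul, one_mul]; exact Nat.lt_div_mul_add (by positivity)
  have hM9 : 9 ≤ M := by
    rw [hM, Nat.le_div_iff_mul_le (by positivity)]
    have h1 : 9 * (2 : ℝ) ^ k0 ≤ N := by
      rw [le_div_iff₀ (by positivity)] at k1
      have h2 : 9 ≤ m ^ 6 := by
        calc (9 : ℝ) ≤ m := by linarith
          _ ≤ m ^ 6 := le_self_pow₀ (by linarith) (by norm_num)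
      calc 9 * (2 : ℝ) ^ k0 ≤ m ^ 6 * 2 ^ k0 := by gcongr
        _ ≤ N := by linarith
    exact_mod_cast h1
  have hVV : ∀ z ∈ VN N, z ∈ V5N N := by
    rintro z ⟨a, b, c, d⟩
    exact ⟨by omega, by omega, by omega, by omega⟩
  have hGb := G_bound hγ hγ1 hc (N := N) (by omega)
  have hI : N ≤ 2 ^ Nat.clog 2 N := Nat.le_pow_clog one_lt_two N
  have hG4 : ∀ z ∈ VN N, ∫⁻ ω, ENNReal.ofReal (rexp (4 * γ * η z ω)) ∂μ ≤ ENNReal.ofReal (3 * m) := fun z hz =>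
    (D.gbound hI (hVV z hz) _).trans (ENNReal.ofReal_le_ofReal hGb)
  have hG : ∀ z ∈ VN N, ∫⁻ ω, ENNReal.ofReal (rexp (γ * η z ω)) ∂μ ≤ ENNReal.ofReal (3 * m) := fun z hz =>
    (D.gbound hI (hVV z hz) _).trans (ENNReal.ofReal_le_ofReal (le_trans (by gcongr; linarith) hGb))
  have main := upper_prob D hγ hγ1 (G := 3 * m) (T := N / m ^ 2) (by positivity) (by positivity) hG hG4 hk0 hM9 hMN hMN'
  refine le_trans (measure_mono ?_) (main.trans (ENNReal.ofReal_le_ofReal ?_))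
  · rintro ω ⟨x, hx, y, hy, h⟩
    refine ⟨x, hx, y, hy, fun h' => h (h'.mono (ENNReal.ofReal_le_ofReal ?_))⟩
    have e : (N : ℝ) ^ (1 - c') = N / m := by rw [Real.rpow_sub hNp, Real.rpow_one]
    rw [e]
    calc (2 * (k0 : ℝ) + 3) * (N / m ^ 2) ≤ m * (N / m ^ 2) := by gcongr; linarith
      _ = N / m := by field_simp
  · refine num_bound hNp (by linarith) rfl k1 (by rw [pow_succ _ k0] at k2; linarith) (by exact_mod_cast hMN)
      (by exact_mod_cast (by omega : 0 < M)) ?_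
    rw [hm20, ← Real.rpow_neg hNp.le]
    calc ((2 : ℝ) ^ k0) ^ (-(c1 γ)) ≤ (√(N : ℝ)) ^ (-(c1 γ)) :=
          Real.rpow_le_rpow_of_nonpos (by positivity) hDs (by linarith)
      _ = (N : ℝ) ^ (-(20 * c')) := by
          rw [Real.sqrt_eq_rpow, ← Real.rpow_mul hNp.le, hc']; congr 1; ring


/-! ### Multi-scale lower bound: deterministic part -/

/-- a path piece of `ℓ` steps which is stopped when it exits the ball of radius `L` -/
structure Pc (L : ℝ) (p : ℕ → Z2) (ℓ : ℕ) : Prop where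
  st : ∀ t < ℓ, ‖cx (p (t + 1)) - cx (p t)‖ ≤ 1
  ins : ∀ t < ℓ, ‖cx (p t) - cx (p 0)‖ < L
  ex : L ≤ ‖cx (p ℓ) - cx (p 0)‖

/-- weight times a power of the length -/
noncomputable def Ph (γ Λ : ℝ) (Y : Z2 → ℝ) (p : ℕ → Z2) (ℓ : ℕ) : ℝ :=
  (∑ t ∈ Finset.range ℓ, rexp (γ * Y (p t))) * (ℓ : ℝ) ^ Λ

/-- worst piece started near `q` -/
noncomputable def SS (γ Λ ϑ L τ : ℝ) (Y : Z2 → ℝ) (q : ℂ) : ENNReal :=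
  ⨆ (l : List Z2) (ℓ : ℕ) (_ : Pc L (fun t => l.getD t 0) ℓ ∧ ‖cx (l.getD 0 0) - q‖ ≤ 8 * L),
    ENNReal.ofReal ((τ / Ph γ Λ Y (fun t => l.getD t 0) ℓ) ^ ϑ)

lemma SS_meas {Ω : Type*} {m : MeasurableSpace Ω} (γ Λ ϑ L τ : ℝ) (Y : Z2 → Ω → ℝ) (hY : ∀ z, Measurable (Y z)) (q : ℂ) :
    Measurable fun ω => SS γ Λ ϑ L τ (fun z => Y z ω) q := by
  unfold SS
  refine Measurable.iSup fun l => Measurable.iSup fun ℓ => Measurable.iSup fun _ => ?_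
  apply Measurable.ennreal_ofReal
  apply Measurable.pow_const
  apply Measurable.const_div
  unfold Ph
  apply Measurable.mul_const
  exact Finset.measurable_sum _ fun t _ => ((hY _).const_mul γ).exp

lemma Pc.congr {L : ℝ} {p p' : ℕ → Z2} {ℓ : ℕ} (h : Pc L p ℓ) (hp : ∀ t ≤ ℓ, p' t = p t) : Pc L p' ℓ where
  st t ht := by rw [hp t (by omega), hp (t + 1) (by omega)]; exact h.st t ht
  ins t ht := by rw [hp t (by omega), hp 0 (by omega)]; exact h.ins t ht
  ex := by rw [hp ℓ (by omega), hp 0 (by omega)]; exact h.ex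

lemma le_SS {γ Λ ϑ L τ : ℝ} {Y : Z2 → ℝ} {q : ℂ} {p : ℕ → Z2} {ℓ : ℕ} (h : Pc L p ℓ) (hq : ‖cx (p 0) - q‖ ≤ 8 * L) :
    ENNReal.ofReal ((τ / Ph γ Λ Y p ℓ) ^ ϑ) ≤ SS γ Λ ϑ L τ Y q := by
  have key : ∀ t ≤ ℓ, ((List.range (ℓ + 1)).map p).getD t 0 = p t := by
    intro t ht
    rw [List.getD_eq_getElem _ _ (by simpa using by omega)]
    simp
  have e : Ph γ Λ Y p ℓ = Ph γ Λ Y (fun t => ((List.range (ℓ + 1)).map p).getD t 0) ℓ := by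
    unfold Ph
    congr 1
    refine Finset.sum_congr rfl fun t ht => ?_
    show rexp (γ * Y (p t)) = rexp (γ * Y (((List.range (ℓ + 1)).map p).getD t 0))
    rw [key t (Finset.mem_range.1 ht).le]
  rw [e]
  refine le_iSup_of_le ((List.range (ℓ + 1)).map p) (le_iSup_of_le ℓ (le_iSup_of_le ⟨h.congr key, ?_⟩ le_rfl))
  rw [key 0 (by omega)]; exact hq

lemma SS_le {γ Λ ϑ L τ : ℝ} {Y : Z2 → ℝ} {q : ℂ} {B : ENNReal}
    (h : ∀ p ℓ, Pc L p ℓ → ‖cx (p 0) - q‖ ≤ 8 * L → ENNReal.ofReal ((τ / Ph γ Λ Y p ℓ) ^ ϑ) ≤ B) :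
    SS γ Λ ϑ L τ Y q ≤ B :=
  iSup_le fun _ => iSup_le fun _ => iSup_le fun hh => h _ _ hh.1 hh.2

lemma Pc.pos {L : ℝ} {p : ℕ → Z2} {ℓ : ℕ} (h : Pc L p ℓ) (hL : 0 < L) : 0 < ℓ := by
  rcases Nat.eq_zero_or_pos ℓ with h0 | h0
  · subst h0
    have := h.ex
    simp at this; linarith
  · exact h0

lemma Pc.exit_lt {L : ℝ} {p : ℕ → Z2} {ℓ : ℕ} (h : Pc L p ℓ) (hL : 0 < L) : ‖cx (p ℓ) - cx (p 0)‖ < L + 1 := by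
  have h0 := h.pos hL
  obtain ⟨k, rfl⟩ : ∃ k, ℓ = k + 1 := ⟨ℓ - 1, by omega⟩
  have h1 := h.st k (by omega)
  have h2 := h.ins k (by omega)
  calc _ = ‖(cx (p (k + 1)) - cx (p k)) + (cx (p k) - cx (p 0))‖ := by congr 1; ring
    _ ≤ _ := norm_add_le _ _
    _ < _ := by linarith

/-- steps have size at most one, so at least `L` steps are needed -/
lemma Pc.len {L : ℝ} {p : ℕ → Z2} {ℓ : ℕ} (h : Pc L p ℓ) : L ≤ ℓ := by
  have key : ∀ t ≤ ℓ, ‖cx (p t) - cx (p 0)‖ ≤ t := by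
    intro t
    induction t with
    | zero => intro _; simp
    | succ t ih =>
      intro ht
      have h1 := ih (by omega)
      have h2 := h.st t (by omega)
      calc _ = ‖(cx (p (t + 1)) - cx (p t)) + (cx (p t) - cx (p 0))‖ := by congr 1; ring
        _ ≤ _ := norm_add_le _ _
        _ ≤ _ := by push_cast; linarith
  exact h.ex.trans (key ℓ le_rfl)

lemma Ph_pos {γ Λ : ℝ} {Y : Z2 → ℝ} {p : ℕ → Z2} {ℓ : ℕ} (h : 0 < ℓ) : 0 < Ph γ Λ Y p ℓ := by
  unfold Ph
  have : (0 : ℝ) < ℓ := by exact_mod_cast h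
  refine mul_pos (Finset.sum_pos (fun _ _ => by positivity) ⟨0, by simpa using h⟩) (by positivity)

lemma amgm {m : ℕ} (hm : 0 < m) (z : ℕ → ℝ) (hz : ∀ i < m, 0 ≤ z i) :
    m * ∏ i ∈ Finset.range m, z i ^ (1 / m : ℝ) ≤ ∑ i ∈ Finset.range m, z i := by
  have hm0 : (0 : ℝ) < m := by exact_mod_cast hm
  have := Real.geom_mean_le_arith_mean_weighted (Finset.range m) (fun _ => (1 / m : ℝ)) z (fun _ _ => by positivity)
    (by rw [Finset.sum_const, Finset.card_range, nsmul_eq_mul]; field_simp) (fun i hi => hz i (Finset.mem_range.1 hi))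
  rw [← Finset.mul_sum] at this
  calc _ ≤ m * (1 / m * ∑ i ∈ Finset.range m, z i) := by gcongr
    _ = _ := by field_simp

lemma pieces_sum {m ℓ : ℕ} (b e : ℕ → ℕ) (hbe : ∀ i < m, b i + e i ≤ b (i + 1)) (hb : b m ≤ ℓ) (f : ℕ → ℝ) (hf : ∀ t, 0 ≤ f t) :
    ∑ i ∈ Finset.range m, ∑ t ∈ Finset.range (e i), f (b i + t) ≤ ∑ t ∈ Finset.range ℓ, f t := by
  refine le_trans ?_ (Finset.sum_le_sum_of_subset_of_nonneg (Finset.range_mono hb) fun t _ _ => hf t)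
  clear hb
  induction m with
  | zero => simpa using Finset.sum_nonneg fun t _ => hf t
  | succ m ih =>
    rw [Finset.sum_range_succ]
    have h1 := ih fun i hi => hbe i (by omega)
    have h2 := hbe m (by omega)
    calc _ ≤ ∑ t ∈ Finset.range (b m), f t + ∑ t ∈ Finset.range (e m), f (b m + t) := by gcongr
      _ = ∑ t ∈ Finset.range (b m + e m), f t := (Finset.sum_range_add _ _ _).symm
      _ ≤ _ := Finset.sum_le_sum_of_subset_of_nonneg (Finset.range_mono h2) fun t _ _ => hf t

lemma Ph_super {γ Λ : ℝ} (hΛ : 0 ≤ Λ) {Y : Z2 → ℝ} {p : ℕ → Z2} {m ℓ : ℕ} (hm : 0 < m) (b e : ℕ → ℕ)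
    (hbe : ∀ i < m, b i + e i ≤ b (i + 1)) (hb : b m ≤ ℓ) :
    (m : ℝ) ^ (1 + Λ) * ∏ i ∈ Finset.range m, (Ph γ Λ Y (fun t => p (b i + t)) (e i)) ^ (1 / m : ℝ) ≤ Ph γ Λ Y p ℓ := by
  have hm0 : (0 : ℝ) < m := by exact_mod_cast hm
  have h1 := pieces_sum b e hbe hb (fun t => rexp (γ * Y (p t))) fun _ => by positivity
  have h2 := pieces_sum b e hbe hb (fun _ => 1) fun _ => by norm_num
  simp only [Finset.sum_const, Finset.card_range, nsmul_eq_mul, mul_one] at h2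
  have g1 := (amgm hm (fun i => ∑ t ∈ Finset.range (e i), rexp (γ * Y (p (b i + t)))) fun i _ => by positivity).trans h1
  have g2 := (amgm hm (fun i => (e i : ℝ)) fun i _ => by positivity).trans h2
  unfold Ph
  have e1 : ∏ i ∈ Finset.range m, ((∑ t ∈ Finset.range (e i), rexp (γ * Y (p (b i + t)))) * (e i : ℝ) ^ Λ) ^ (1 / m : ℝ)
      = (∏ i ∈ Finset.range m, (∑ t ∈ Finset.range (e i), rexp (γ * Y (p (b i + t)))) ^ (1 / m : ℝ)) *
        (∏ i ∈ Finset.range m, (e i : ℝ) ^ (1 / m : ℝ)) ^ Λ := by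
    rw [← Real.finsetProd_rpow _ _ (fun i _ => by positivity), ← Finset.prod_mul_distrib]
    refine Finset.prod_congr rfl fun i _ => ?_
    rw [Real.mul_rpow (by positivity) (by positivity), ← Real.rpow_mul (by positivity), ← Real.rpow_mul (by positivity), mul_comm Λ]
  rw [e1, Real.rpow_add hm0, Real.rpow_one]
  have hp2 : 0 ≤ ∏ i ∈ Finset.range m, (e i : ℝ) ^ (1 / m : ℝ) := Finset.prod_nonneg fun i _ => by positivity
  calc _ = (m * ∏ i ∈ Finset.range m, (∑ t ∈ Finset.range (e i), rexp (γ * Y (p (b i + t)))) ^ (1 / m : ℝ)) *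
        (m * ∏ i ∈ Finset.range m, (e i : ℝ) ^ (1 / m : ℝ)) ^ Λ := by
        rw [Real.mul_rpow hm0.le hp2]; ring
    _ ≤ _ := by
        apply mul_le_mul g1 (Real.rpow_le_rpow (by positivity) g2 hΛ) (by positivity) (by positivity)

/-- the multi-piece estimate -/
lemma multi {γ Λ ϑ τ τ' : ℝ} (hγ : 0 < γ) (hΛ : 0 ≤ Λ) (hϑ : 0 < ϑ) (hτ : 0 < τ) (hτ' : 0 < τ') {Y Y' : Z2 → ℝ} {p : ℕ → Z2}
    {m ℓ : ℕ} (hm : 0 < m) (b e : ℕ → ℕ)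
    (hbe : ∀ i < m, b i + e i ≤ b (i + 1)) (hb : b m ≤ ℓ) (he : ∀ i < m, 0 < e i) (M : ℕ → ℝ)
    (hM : ∀ i < m, ∀ t < e i, Y (p (b i + t)) - M i ≤ Y' (p (b i + t))) (A : ℕ → ENNReal)
    (hA : ∀ i < m, ENNReal.ofReal ((τ / Ph γ Λ Y (fun t => p (b i + t)) (e i)) ^ ϑ) ≤ A i) :
    ENNReal.ofReal ((τ' / Ph γ Λ Y' p ℓ) ^ ϑ) ≤ ENNReal.ofReal ((τ' / (τ * (m : ℝ) ^ (1 + Λ))) ^ ϑ) *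
      ENNReal.ofReal (rexp (ϑ * γ / m * ∑ i ∈ Finset.range m, M i)) * ∏ i ∈ Finset.range m, A i ^ (1 / m : ℝ) := by
  have hm0 : (0 : ℝ) < m := by exact_mod_cast hm
  set F : ℕ → ℝ := fun i => Ph γ Λ Y (fun t => p (b i + t)) (e i) with hF
  have hF0 : ∀ i < m, 0 < F i := fun i hi => Ph_pos (he i hi)
  have h1 : ∀ i < m, rexp (-(γ * M i)) * F i ≤ Ph γ Λ Y' (fun t => p (b i + t)) (e i) := by
    intro i hi
    simp only [hF, Ph]
    rw [← mul_assoc, Finset.mul_sum]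
    gcongr with t ht
    rw [← Real.exp_add, Real.exp_le_exp]
    have := hM i hi t (Finset.mem_range.1 ht)
    nlinarith
  have h2 := Ph_super (γ := γ) hΛ (Y := Y') (p := p) hm b e hbe hb
  have h3 : (m : ℝ) ^ (1 + Λ) * ∏ i ∈ Finset.range m, (rexp (-(γ * M i)) * F i) ^ (1 / m : ℝ) ≤ Ph γ Λ Y' p ℓ := by
    refine le_trans ?_ h2
    gcongr with i hi
    · intro i hi
      have := hF0 i (Finset.mem_range.1 hi)
      positivity
    · have := hF0 i (Finset.mem_range.1 hi)
      positivity
    · exact h1 i (Finset.mem_range.1 hi)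
  have hpos : 0 < (m : ℝ) ^ (1 + Λ) * ∏ i ∈ Finset.range m, (rexp (-(γ * M i)) * F i) ^ (1 / m : ℝ) := by
    refine mul_pos (by positivity) (Finset.prod_pos fun i hi => ?_)
    have := hF0 i (Finset.mem_range.1 hi)
    positivity
  have h4 : (τ' / Ph γ Λ Y' p ℓ) ^ ϑ ≤ (τ' / (τ * (m : ℝ) ^ (1 + Λ))) ^ ϑ *
      rexp (ϑ * γ / m * ∑ i ∈ Finset.range m, M i) * ∏ i ∈ Finset.range m, ((τ / F i) ^ ϑ) ^ (1 / m : ℝ) := by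
    have hdiv : (τ' / Ph γ Λ Y' p ℓ) ^ ϑ ≤
        (τ' / ((m : ℝ) ^ (1 + Λ) * ∏ i ∈ Finset.range m, (rexp (-(γ * M i)) * F i) ^ (1 / m : ℝ))) ^ ϑ := by
      have := hpos.trans_le h3
      gcongr
    refine hdiv.trans (le_of_eq ?_)
    have e1 : ∏ i ∈ Finset.range m, ((τ / F i) ^ ϑ) ^ (1 / m : ℝ) = τ ^ ϑ * (∏ i ∈ Finset.range m, (F i) ^ (1 / m : ℝ)) ^ (-ϑ) := by
      have : ∀ i ∈ Finset.range m, ((τ / F i) ^ ϑ) ^ (1 / m : ℝ) = τ ^ (ϑ * (1 / m)) * ((F i) ^ (1 / m : ℝ)) ^ (-ϑ) := by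
        intro i hi
        have := hF0 i (Finset.mem_range.1 hi)
        rw [← Real.rpow_mul (by positivity), Real.div_rpow hτ.le this.le, ← Real.rpow_mul this.le, mul_neg, Real.rpow_neg this.le,
          mul_comm (1 / (m : ℝ)) ϑ]
        rfl
      rw [Finset.prod_congr rfl this, Finset.prod_mul_distrib, Finset.prod_const, Finset.card_range, ← Real.rpow_natCast,
        ← Real.rpow_mul hτ.le, Real.finsetProd_rpow _ _ (fun i hi => by
          have := hF0 i (Finset.mem_range.1 hi); positivity)]
      congr 2
      field_simp
    have e2 : ∏ i ∈ Finset.range m, (rexp (-(γ * M i)) * F i) ^ (1 / m : ℝ) =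
        rexp (-(γ / m * ∑ i ∈ Finset.range m, M i)) * ∏ i ∈ Finset.range m, (F i) ^ (1 / m : ℝ) := by
      rw [Finset.mul_sum, ← Finset.sum_neg_distrib, Real.exp_sum, ← Finset.prod_mul_distrib]
      refine Finset.prod_congr rfl fun i hi => ?_
      have := hF0 i (Finset.mem_range.1 hi)
      rw [Real.mul_rpow (by positivity) this.le, ← Real.exp_mul]
      congr 2; ring
    rw [e1, e2]
    set Q := ∏ i ∈ Finset.range m, (F i) ^ (1 / m : ℝ) with hQ
    have hQ0 : 0 < Q := Finset.prod_pos fun i hi => by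
      have := hF0 i (Finset.mem_range.1 hi); positivity
    rw [Real.div_rpow hτ'.le (by positivity), Real.div_rpow hτ'.le (by positivity), Real.mul_rpow (by positivity) (by positivity),
      Real.mul_rpow (by positivity) (by positivity), Real.mul_rpow (by positivity) (by positivity), Real.rpow_neg hQ0.le,
      ← Real.exp_mul]
    have e3 : rexp (ϑ * γ / m * ∑ i ∈ Finset.range m, M i) = (rexp (-(γ / m * ∑ i ∈ Finset.range m, M i) * ϑ))⁻¹ := by
      rw [← Real.exp_neg]; congr 1; ring
    rw [e3]
    have := (Real.rpow_pos_of_pos hτ ϑ).ne'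
    field_simp
  refine (ENNReal.ofReal_le_ofReal h4).trans ?_
  have hnn : ∀ i ∈ Finset.range m, 0 ≤ ((τ / F i) ^ ϑ) ^ (1 / m : ℝ) := fun i hi => by
    have := hF0 i (Finset.mem_range.1 hi); positivity
  rw [ENNReal.ofReal_mul (by positivity), ENNReal.ofReal_mul (by positivity), ENNReal.ofReal_prod_of_nonneg hnn]
  gcongr with i hi
  have := hF0 i (Finset.mem_range.1 hi)
  rw [← ENNReal.ofReal_rpow_of_nonneg (by positivity) (by positivity)]
  exact ENNReal.rpow_le_rpow (hA i (Finset.mem_range.1 hi)) (by positivity)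


/-! ### Straight and non-straight pieces -/

lemma first_hit {f : ℕ → ℝ} {a : ℝ} {ℓ : ℕ} (h : ∃ t ≤ ℓ, a ≤ f t) : ∃ t ≤ ℓ, a ≤ f t ∧ ∀ s < t, f s < a := by
  classical
  obtain ⟨t, ht, hf⟩ := h
  have hex : ∃ t, a ≤ f t := ⟨t, hf⟩
  exact ⟨Nat.find hex, (Nat.find_min' hex hf).trans ht, Nat.find_spec hex, fun s hs => not_le.1 (Nat.find_min hex hs)⟩

lemma nrm_tri (a b c : ℂ) : ‖a - c‖ ≤ ‖a - b‖ + ‖b - c‖ := by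
  have := norm_add_le (a - b) (b - c)
  simpa using this

/-- greedy decomposition into pieces of radius `L` -/
lemma greedy {L : ℝ} (hL : 0 < L) (m : ℕ) : ∀ (p : ℕ → Z2) (ℓ : ℕ), (∀ t < ℓ, ‖cx (p (t + 1)) - cx (p t)‖ ≤ 1) →
    (∃ c e : ℕ → ℕ, (∀ i < m, c i + e i ≤ c (i + 1)) ∧ c m ≤ ℓ ∧ ∀ i < m, Pc L (fun t => p (c i + t)) (e i)) ∨
    (‖cx (p ℓ) - cx (p 0)‖ ≤ m * (L + 1) ∧
      ∀ k ≤ ℓ, ‖cx (p k) - cx (p 0)‖ + ‖cx (p ℓ) - cx (p k)‖ ≤ m * (L + 1) + 2 * L) := by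
  induction m with
  | zero => intro p ℓ _; left; exact ⟨fun _ => 0, fun _ => 0, by simp, by simp, by simp⟩
  | succ m ih =>
    intro p ℓ hst
    by_cases hex : ∃ t ≤ ℓ, L ≤ ‖cx (p t) - cx (p 0)‖
    · obtain ⟨t0, ht0, hge, hlt⟩ := first_hit hex
      have hpc : Pc L p t0 := ⟨fun t ht => hst t (by omega), fun t ht => hlt t ht, hge⟩
      have hel := hpc.exit_lt hL
      rcases ih (fun t => p (t0 + t)) (ℓ - t0) (fun t ht => hst (t0 + t) (by omega)) with ⟨c, e, h1, h2, h3⟩ | ⟨hA, hB⟩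
      · left
        refine ⟨fun i => if i = 0 then 0 else t0 + c (i - 1), fun i => if i = 0 then t0 else e (i - 1), ?_, ?_, ?_⟩
        · intro i hi
          rcases i with _ | i
          · simp
          · have := h1 i (by omega)
            simp; omega
        · simp; omega
        · intro i hi
          rcases i with _ | i
          · simpa using hpc
          · have := h3 i (by omega)
            simpa [add_assoc] using this
      · right
        simp only [add_zero] at hA hB
        rw [show t0 + (ℓ - t0) = ℓ by omega] at hA hB
        have hA' : ‖cx (p ℓ) - cx (p 0)‖ ≤ (m + 1) * (L + 1) := by
          have := nrm_tri (cx (p ℓ)) (cx (p t0)) (cx (p 0))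
          linarith
        refine ⟨by push_cast; exact hA', fun k hk => ?_⟩
        push_cast
        by_cases hkt : t0 ≤ k
        · have h5 := hB (k - t0) (by omega)
          rw [show t0 + (k - t0) = k by omega] at h5
          have := nrm_tri (cx (p k)) (cx (p t0)) (cx (p 0))
          linarith
        · have h5 := hlt k (by omega)
          have h6 := nrm_tri (cx (p ℓ)) (cx (p 0)) (cx (p k))
          rw [norm_sub_rev (cx (p 0))] at h6
          linarith
    · push Not at hex
      right
      have h0 := hex ℓ le_rfl
      have hm : (0 : ℝ) ≤ m * (L + 1) := by positivity
      refine ⟨by push_cast; linarith, fun k hk => ?_⟩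
      have h1 := hex k hk
      have h6 := nrm_tri (cx (p ℓ)) (cx (p 0)) (cx (p k))
      rw [norm_sub_rev (cx (p 0))] at h6
      push_cast
      linarith

lemma ellipse {v w : ℂ} {δ : ℝ} (hw : 0 < ‖w‖) (hv : ‖v‖ ≤ ‖w‖) (hδ : 0 ≤ δ) (h : ‖v‖ + ‖w - v‖ ≤ ‖w‖ + δ) :
    ‖v - ((‖v‖ / ‖w‖ : ℝ) : ℂ) * w‖ ^ 2 ≤ δ ^ 2 + 2 * ‖w‖ * δ := by
  have e1 := norm_sub_sq_real w v
  have e2 := norm_sub_sq_real v (((‖v‖ / ‖w‖ : ℝ)) • w)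
  rw [Complex.real_smul] at e2
  rw [e2, norm_mul, ← Complex.real_smul, inner_smul_right, Complex.norm_real, Real.norm_of_nonneg (by positivity)]
  rw [real_inner_comm] at e1
  set I := inner ℝ v w
  set R := ‖w‖
  set t := ‖v‖
  have ht0 : 0 ≤ t := norm_nonneg _
  have h3 : ‖w - v‖ ^ 2 ≤ (R + δ - t) ^ 2 := by
    have : 0 ≤ ‖w - v‖ := norm_nonneg _
    gcongr; linarith
  have h4 : 2 * (R * t - I) ≤ δ ^ 2 + 2 * R * δ := by nlinarith
  have h5 : t / R * R = t := by field_simp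
  rw [h5]
  have e3 : t ^ 2 - 2 * (t / R * I) + t ^ 2 = t / R * (2 * (R * t - I)) := by field_simp; ring
  rw [e3]
  have h6 : t / R ≤ 1 := by rw [div_le_one hw]; exact hv
  have h7 : 0 ≤ t / R := by positivity
  have h8 : 0 ≤ δ ^ 2 + 2 * R * δ := by positivity
  nlinarith

/-- box of integer points -/
noncomputable def bx (r : ℕ) : Finset Z2 := Finset.Icc (-(r : ℤ)) r ×ˢ Finset.Icc (-(r : ℤ)) r

lemma bx_card (r : ℕ) : (bx r).card = (2 * r + 1) ^ 2 := by
  unfold bx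
  rw [Finset.card_product, Int.card_Icc, pow_two]
  congr 1 <;> omega

lemma rd_bx {a : ℂ} {r : ℕ} (h : ‖a‖ + 2 ≤ r) : rd a ∈ bx r := by
  have h1 := rd_dist a
  have h2 : ‖cx (rd a)‖ ≤ r := by
    have := norm_add_le (cx (rd a) - a) a
    rw [sub_add_cancel] at this; linarith
  have h3 := (Complex.abs_re_le_norm (cx (rd a))).trans h2
  have h4 := (Complex.abs_im_le_norm (cx (rd a))).trans h2
  rw [abs_le] at h3 h4
  simp only [cx] at h3 h4
  unfold bx
  rw [Finset.mem_product, Finset.mem_Icc, Finset.mem_Icc]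
  refine ⟨⟨?_, ?_⟩, ?_, ?_⟩
  · exact_mod_cast h3.1
  · exact_mod_cast h3.2
  · exact_mod_cast h4.1
  · exact_mod_cast h4.2

/-- rounding to the grid of mesh `L` based at `q` -/
lemma rd_grid {L : ℝ} (hL : 0 < L) (q u : ℂ) : ‖u - (q + L * cx (rd ((u - q) / L)))‖ ≤ 2 * L := by
  have h1 := rd_dist ((u - q) / L)
  have hc : (L : ℂ) ≠ 0 := by exact_mod_cast hL.ne'
  have e : u - (q + L * cx (rd ((u - q) / L))) = L * ((u - q) / L - cx (rd ((u - q) / L))) := by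
    rw [mul_sub, mul_div_cancel₀ _ hc]; ring
  rw [e, norm_mul, norm_sub_rev, Complex.norm_real, Real.norm_of_nonneg hL.le]
  nlinarith

lemma rd_grid_bx {L C : ℝ} (hL : 0 < L) {q u : ℂ} (h : ‖u - q‖ ≤ C * L) {r : ℕ} (hr : C + 2 ≤ r) : rd ((u - q) / L) ∈ bx r := by
  apply rd_bx
  rw [norm_div, Complex.norm_real, Real.norm_of_nonneg hL.le]
  have : ‖u - q‖ / L ≤ C := by rw [div_le_iff₀ hL]; exact h
  linarith

/-- the non-straight case -/
lemma nonstraight {γ Λ ϑ τ'' τ' : ℝ} (hγ : 0 < γ) (hΛ : 0 ≤ Λ) (hϑ : 0 < ϑ) (hτ : 0 < τ'') (hτ' : 0 < τ') {Y'' Y' : Z2 → ℝ} {p : ℕ → Z2}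
    {ℓ m r : ℕ} {L D H C : ℝ} {q : ℂ} (hL : 0 < L) (hm : 0 < m) (hp : Pc D p ℓ) (hq : ‖cx (p 0) - q‖ ≤ 8 * D)
    (hD : 9 * D ≤ C * L) (hr : C + 2 ≤ r) (hH : ∀ z, ‖cx z - q‖ ≤ 9 * D → Y'' z - H ≤ Y' z)
    (c e : ℕ → ℕ) (h1 : ∀ i < m, c i + e i ≤ c (i + 1)) (h2 : c m ≤ ℓ) (h3 : ∀ i < m, Pc L (fun t => p (c i + t)) (e i)) :
    ENNReal.ofReal ((τ' / Ph γ Λ Y' p ℓ) ^ ϑ) ≤ ENNReal.ofReal ((τ' / (τ'' * (m : ℝ) ^ (1 + Λ))) ^ ϑ) *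
      ENNReal.ofReal (rexp (ϑ * γ * H)) * ∑ z ∈ bx r, SS γ Λ ϑ L τ'' Y'' (q + L * cx z) := by
  have hm0 : (0 : ℝ) < m := by exact_mod_cast hm
  have hmono : ∀ i < m, c i + e i ≤ ℓ := by
    have : ∀ k ≤ m, ∀ i < k, c i + e i ≤ c k := by
      intro k
      induction k with
      | zero => intro _ i hi; omega
      | succ k ih =>
        intro hk i hi
        have h5 := h1 k (by omega)
        rcases Nat.lt_succ_iff_lt_or_eq.1 hi with h6 | h6
        · have := ih (by omega) i h6; omega
        · rw [h6]; exact h5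
    intro i hi
    exact (this m le_rfl i hi).trans h2
  have hin : ∀ i < m, ∀ t < e i, ‖cx (p (c i + t)) - q‖ ≤ 9 * D := by
    intro i hi t ht
    have h5 := hmono i hi
    have h6 := hp.ins (c i + t) (by omega)
    have := nrm_tri (cx (p (c i + t))) (cx (p 0)) q
    linarith
  have key := multi hγ hΛ hϑ hτ hτ' (Y := Y'') (Y' := Y') (p := p) hm c e h1 h2 (fun i hi => (h3 i hi).pos hL) (fun _ => H)
    (fun i hi t ht => hH _ (hin i hi t ht)) (fun _ => ∑ z ∈ bx r, SS γ Λ ϑ L τ'' Y'' (q + L * cx z)) (fun i hi => by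
      have h7 := hin i hi 0 ((h3 i hi).pos hL)
      rw [add_zero] at h7
      refine (le_SS (h3 i hi) (q := q + L * cx (rd ((cx (p (c i)) - q) / L))) ?_).trans ?_
      · rw [add_zero]
        have := rd_grid hL q (cx (p (c i)))
        linarith
      · exact Finset.single_le_sum (f := fun z => SS γ Λ ϑ L τ'' Y'' (q + L * cx z)) (fun _ _ => zero_le)
          (rd_grid_bx hL (h7.trans hD) hr))
  rw [Finset.sum_const, Finset.card_range, nsmul_eq_mul, Finset.prod_const, Finset.card_range, ← ENNReal.rpow_natCast, ← ENNReal.rpow_mul,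
    one_div, inv_mul_cancel₀ hm0.ne', ENNReal.rpow_one, show ϑ * γ / m * (m * H) = ϑ * γ * H by field_simp] at key
  exact key


/-- points along a tube -/
noncomputable def tq (L : ℝ) (K : ℕ) (q : ℂ) (w : Z2 × Z2) (i : ℕ) : ℂ :=
  q + L * (cx w.1 + ((i / K : ℝ) : ℂ) * (cx w.2 - cx w.1))

/-- the set of tubes -/
noncomputable def TT (K : ℕ) : Finset (Z2 × Z2) :=
  open Classical in (bx (32 * K) ×ˢ bx (32 * K)).filter fun w => (K : ℝ) / 2 ≤ ‖cx w.2 - cx w.1‖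

lemma tube_dist {K : ℕ} (hK : 8 ≤ K) {L' : ℝ} (hL' : 1 ≤ L') {x y u q : ℂ} {i : ℕ} (hi : i < K)
    (hR : K * (K * (L' + 2) + 2) ≤ ‖y - x‖) (hR' : ‖y - x‖ < K * (K * (L' + 2) + 2) + 1)
    (hu : i * (K * (L' + 2) + 2) ≤ ‖u - x‖) (hu' : ‖u - x‖ < i * (K * (L' + 2) + 2) + 1)
    (hs : ‖u - x‖ + ‖y - u‖ ≤ K * (K * (L' + 2) + 2) + 3 * L') :
    ‖u - tq (K * (L' + 2)) K q (rd ((x - q) / (K * (L' + 2) : ℝ)), rd ((y - q) / (K * (L' + 2) : ℝ))) i‖ ≤ 6 * (K * (L' + 2)) := by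
  have hK0 : (8 : ℝ) ≤ K := by exact_mod_cast hK
  set L := (K : ℝ) * (L' + 2) with hL
  have hLK : 8 * L' + 16 ≤ L := by nlinarith
  have hL0 : 0 < L := by linarith
  have hiK : (i : ℝ) + 1 ≤ K := by exact_mod_cast hi
  have hi0 : (0 : ℝ) ≤ i := Nat.cast_nonneg _
  set R := ‖y - x‖ with hRdef
  have hR0 : 0 < R := by nlinarith
  have htR : ‖u - x‖ ≤ R := by nlinarith
  have hE := ellipse (v := u - x) (w := y - x) (δ := 3 * L') hR0 htR (by linarith) (by
    rw [show y - x - (u - x) = y - u by ring]; linarith)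
  set t := ‖u - x‖ with ht
  have h1 : ‖u - x - ((t / R : ℝ) : ℂ) * (y - x)‖ ≤ 3 * L := by
    rw [← abs_of_nonneg (norm_nonneg (u - x - ((t / R : ℝ) : ℂ) * (y - x))), ← abs_of_nonneg (by linarith : 0 ≤ 3 * L)]
    rw [← sq_le_sq]
    refine hE.trans ?_
    have hKL : K * L' ≤ L := by rw [hL]; nlinarith
    have h2 : R * L' ≤ L * (L + 2) + L' := by nlinarith
    nlinarith
  have h2 : ‖((t / R : ℝ) : ℂ) * (y - x) - ((i / K : ℝ) : ℂ) * (y - x)‖ ≤ 1 := by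
    rw [← sub_mul, norm_mul, ← Complex.ofReal_sub, Complex.norm_real, ← hRdef, Real.norm_eq_abs, ← abs_of_pos hR0, ← abs_mul, sub_mul,
      abs_of_pos hR0, div_mul_cancel₀ _ hR0.ne', abs_le]
    have h3 : i * (L + 2) ≤ i / K * R := by
      calc _ = i / K * (K * (L + 2)) := by field_simp
        _ ≤ _ := by gcongr
    have h4 : i / K * R ≤ i * (L + 2) + 1 := by
      calc _ ≤ i / K * (K * (L + 2) + 1) := by gcongr
        _ = i * (L + 2) + i / K := by field_simp
        _ ≤ _ := by
          have : (i : ℝ) / K ≤ 1 := by rw [div_le_one (by linarith)]; linarith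
          linarith
    constructor <;> linarith
  have hx := rd_grid hL0 q x
  have hy := rd_grid hL0 q y
  unfold tq
  simp only
  set X := cx (rd ((x - q) / (L : ℂ)))
  set Y := cx (rd ((y - q) / (L : ℂ)))
  have hs0 : (0 : ℝ) ≤ i / K := by positivity
  have hs1 : (i : ℝ) / K ≤ 1 := by rw [div_le_one (by linarith)]; linarith
  set s := (i : ℝ) / K
  have e : u - (q + L * (X + (s : ℂ) * (Y - X))) = (u - x - ((t / R : ℝ) : ℂ) * (y - x)) +
      ((((t / R : ℝ) : ℂ) * (y - x) - (s : ℂ) * (y - x)) + (((1 - s : ℝ) : ℂ) * (x - (q + L * X)) + (s : ℂ) * (y - (q + L * Y)))) := by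
    push_cast; ring
  rw [e]
  refine (norm_add_le _ _).trans ?_
  have h3 : ‖((1 - s : ℝ) : ℂ) * (x - (q + L * X)) + (s : ℂ) * (y - (q + L * Y))‖ ≤ 2 * L := by
    refine (norm_add_le _ _).trans ?_
    rw [norm_mul, norm_mul, Complex.norm_real, Complex.norm_real, Real.norm_of_nonneg hs0, Real.norm_of_nonneg (by linarith)]
    have h5 : (1 - s) * ‖x - (q + L * X)‖ ≤ (1 - s) * (2 * L) := by gcongr
    have h6 : s * ‖y - (q + L * Y)‖ ≤ s * (2 * L) := by gcongr
    linarith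
  have h4 := norm_add_le (((t / R : ℝ) : ℂ) * (y - x) - (s : ℂ) * (y - x)) (((1 - s : ℝ) : ℂ) * (x - (q + L * X)) + (s : ℂ) * (y - (q + L * Y)))
  linarith

/-- the straight case -/
lemma straight {γ Λ ϑ τ τ' : ℝ} (hγ : 0 < γ) (hΛ : 0 ≤ Λ) (hϑ : 0 < ϑ) (hτ : 0 < τ) (hτ' : 0 < τ') {Y Y' : Z2 → ℝ} {p : ℕ → Z2}
    {ℓ K : ℕ} (hK : 8 ≤ K) {L' L D : ℝ} (hL' : 1 ≤ L') (hL : L = K * (L' + 2)) (hD : D = K * (L + 2)) {q : ℂ} (hp : Pc D p ℓ)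
    (hq : ‖cx (p 0) - q‖ ≤ 8 * D)
    (M : ℂ → ℝ) (hM : ∀ c z, ‖cx z - c‖ ≤ 9 * L → Y z - M c ≤ Y' z)
    (hs : ∀ k ≤ ℓ, ‖cx (p k) - cx (p 0)‖ + ‖cx (p ℓ) - cx (p k)‖ ≤ D + 3 * L') :
    ENNReal.ofReal ((τ' / Ph γ Λ Y' p ℓ) ^ ϑ) ≤ ENNReal.ofReal ((τ' / (τ * (K : ℝ) ^ (1 + Λ))) ^ ϑ) * ∑ w ∈ TT K,
      (ENNReal.ofReal (rexp (ϑ * γ / K * ∑ i ∈ Finset.range K, M (tq L K q w i))) *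
        ∏ i ∈ Finset.range K, SS γ Λ ϑ L τ Y (tq L K q w i) ^ (1 / K : ℝ)) := by
  have hK0 : (8 : ℝ) ≤ K := by exact_mod_cast hK
  have hLK : 8 * L' + 16 ≤ L := by rw [hL]; nlinarith
  have hL0 : 0 < L := by linarith
  have hD0 : 0 < D := by rw [hD]; positivity
  have hex : ∀ i : ℕ, i ≤ K → ∃ t ≤ ℓ, (i * (L + 2) : ℝ) ≤ ‖cx (p t) - cx (p 0)‖ := by
    intro i hi
    refine ⟨ℓ, le_rfl, le_trans ?_ hp.ex⟩
    rw [hD]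
    have : (i : ℝ) ≤ K := by exact_mod_cast hi
    gcongr
  have hex2 : ∀ i : ℕ, ∃ t ≤ ℓ, i ≤ K → (i * (L + 2) : ℝ) ≤ ‖cx (p t) - cx (p 0)‖ ∧ ∀ s < t, ‖cx (p s) - cx (p 0)‖ < i * (L + 2) := by
    intro i
    by_cases hi : i ≤ K
    · obtain ⟨t, h1, h2, h3⟩ := first_hit (f := fun t => ‖cx (p t) - cx (p 0)‖) (hex i hi)
      exact ⟨t, h1, fun _ => ⟨h2, h3⟩⟩
    · exact ⟨0, by omega, fun h => absurd h hi⟩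
  choose b hb1 hb2 using hex2
  have hbup : ∀ i ≤ K, ‖cx (p (b i)) - cx (p 0)‖ < i * (L + 2) + 1 := by
    intro i hi
    rcases Nat.eq_zero_or_pos (b i) with h0 | h0
    · rw [h0]; simp; positivity
    · obtain ⟨k, hk⟩ : ∃ k, b i = k + 1 := ⟨b i - 1, by omega⟩
      have h1 := (hb2 i hi).2 k (by omega)
      have h2 := hp.st k (by have := hb1 i; omega)
      rw [hk]
      have := nrm_tri (cx (p (k + 1))) (cx (p k)) (cx (p 0))
      linarith
  have hbm : ∀ i < K, b i ≤ b (i + 1) := by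
    intro i hi
    by_contra hc
    have h1 := (hb2 i hi.le).2 (b (i + 1)) (by omega)
    have h2 := (hb2 (i + 1) hi).1
    push_cast at h2
    nlinarith
  have hexit : ∀ i, ∃ e : ℕ, i < K → b i + e ≤ b (i + 1) ∧ Pc L (fun t => p (b i + t)) e := by
    intro i
    by_cases hi : i < K
    · have h1 := (hb2 (i + 1) hi).1
      have h2 := hbup i hi.le
      have h3 := nrm_tri (cx (p (b (i + 1)))) (cx (p (b i))) (cx (p 0))
      have h4 := hbm i hi
      push_cast at h1
      obtain ⟨e, h5, h6, h7⟩ := first_hit (f := fun t => ‖cx (p (b i + t)) - cx (p (b i))‖) (a := L) (ℓ := b (i + 1) - b i)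
        ⟨b (i + 1) - b i, le_rfl, by
          rw [show b i + (b (i + 1) - b i) = b (i + 1) by omega]; linarith⟩
      refine ⟨e, fun _ => ⟨by omega, ⟨fun t ht => hp.st (b i + t) (by have := hb1 (i + 1); omega), fun t ht => h7 t ht, h6⟩⟩⟩
    · exact ⟨0, fun h => absurd h hi⟩
  choose e he using hexit
  set w : Z2 × Z2 := (rd ((cx (p 0) - q) / L), rd ((cx (p ℓ) - q) / L)) with hw
  have hexl := hp.exit_lt hD0
  have hdist : ∀ i < K, ‖cx (p (b i)) - tq L K q w i‖ ≤ 6 * L := by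
    intro i hi
    have h1 := (hb2 i hi.le).1
    have h2 := hbup i hi.le
    have h3 := hs (b i) (hb1 i)
    have h4 := hp.ex
    rw [hw]
    rw [hD] at hexl h3 h4
    rw [hL] at hexl h1 h2 h3 h4 ⊢
    exact tube_dist hK hL' hi h4 hexl h1 h2 h3
  have hwT : w ∈ TT K := by
    have hDL : D ≤ 3 * K * L := by rw [hD]; nlinarith
    unfold TT
    rw [Finset.mem_filter, Finset.mem_product]
    refine ⟨⟨rd_grid_bx hL0 (C := 24 * K) (by nlinarith) (by push_cast; linarith), rd_grid_bx hL0 (C := 28 * K) ?_ (by push_cast; linarith)⟩, ?_⟩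
    · have := nrm_tri (cx (p ℓ)) (cx (p 0)) q
      nlinarith
    · have h1 := rd_grid hL0 q (cx (p 0))
      have h2 := rd_grid hL0 q (cx (p ℓ))
      have h3 := hp.ex
      rw [hw]
      simp only
      set X := cx (rd ((cx (p 0) - q) / (L : ℂ)))
      set Z := cx (rd ((cx (p ℓ) - q) / (L : ℂ)))
      have e1 : cx (p ℓ) - cx (p 0) = (cx (p ℓ) - (q + L * Z)) + (L * (Z - X) - (cx (p 0) - (q + L * X))) := by ring
      have h4 := norm_add_le (cx (p ℓ) - (q + L * Z)) (L * (Z - X) - (cx (p 0) - (q + L * X)))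
      have h5 := norm_sub_le (L * (Z - X)) (cx (p 0) - (q + L * X))
      rw [← e1] at h4
      rw [norm_mul, Complex.norm_real, Real.norm_of_nonneg hL0.le] at h5
      have h6 : (K - 4) * L ≤ L * ‖Z - X‖ := by rw [hD] at h3; nlinarith
      have h7 : (K : ℝ) - 4 ≤ ‖Z - X‖ := by
        by_contra hc
        push Not at hc
        nlinarith
      linarith
  have key := multi hγ hΛ hϑ hτ hτ' (Y := Y) (Y' := Y') (p := p) (m := K) (ℓ := ℓ) (by omega) b e (fun i hi => (he i hi).1) (hb1 K)
    (fun i hi => (he i hi).2.pos hL0) (fun i => M (tq L K q w i)) (fun i hi t ht => by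
      apply hM
      have h1 := (he i hi).2.ins t ht
      have h2 := hdist i hi
      rw [add_zero] at h1
      have := nrm_tri (cx (p (b i + t))) (cx (p (b i))) (tq L K q w i)
      linarith) (fun i => SS γ Λ ϑ L τ Y (tq L K q w i)) (fun i hi => le_SS (he i hi).2 (by
        have h2 := hdist i hi
        rw [add_zero]; linarith))
  refine key.trans ?_
  rw [mul_assoc]
  gcongr
  exact Finset.single_le_sum (f := fun w => ENNReal.ofReal (rexp (ϑ * γ / K * ∑ i ∈ Finset.range K, M (tq L K q w i))) *
        ∏ i ∈ Finset.range K, SS γ Λ ϑ L τ Y (tq L K q w i) ^ (1 / K : ℝ)) (fun _ _ => zero_le) hwT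

/-- deterministic recursion -/
lemma SS_step {γ Λ ϑ τ'' τ τ' : ℝ} (hγ : 0 < γ) (hΛ : 0 ≤ Λ) (hϑ : 0 < ϑ) (hτ'' : 0 < τ'') (hτ : 0 < τ) (hτ' : 0 < τ')
    {Y'' Y Y' : Z2 → ℝ} {K : ℕ} (hK : 8 ≤ K) {L' L D H : ℝ} (hL' : 1 ≤ L') (hL : L = K * (L' + 2)) (hD : D = K * (L + 2)) {q : ℂ}
    (M : ℂ → ℝ) (hM : ∀ c z, ‖cx z - c‖ ≤ 9 * L → Y z - M c ≤ Y' z) (hH : ∀ z, ‖cx z - q‖ ≤ 9 * D → Y'' z - H ≤ Y' z) :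
    SS γ Λ ϑ D τ' Y' q ≤ ENNReal.ofReal ((τ' / (τ * (K : ℝ) ^ (1 + Λ))) ^ ϑ) * ∑ w ∈ TT K,
      (ENNReal.ofReal (rexp (ϑ * γ / K * ∑ i ∈ Finset.range K, M (tq L K q w i))) *
        ∏ i ∈ Finset.range K, SS γ Λ ϑ L τ Y (tq L K q w i) ^ (1 / K : ℝ)) +
      ENNReal.ofReal ((τ' / (τ'' * ((K ^ 2 + 1 : ℕ) : ℝ) ^ (1 + Λ))) ^ ϑ) *
      ENNReal.ofReal (rexp (ϑ * γ * H)) * ∑ z ∈ bx (50 * K ^ 2), SS γ Λ ϑ L' τ'' Y'' (q + L' * cx z) := by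
  have hK0 : (8 : ℝ) ≤ K := by exact_mod_cast hK
  refine SS_le fun p ℓ hp hq => ?_
  rcases greedy (L := L') (by linarith) (K ^ 2 + 1) p ℓ hp.st with ⟨c, e, h1, h2, h3⟩ | ⟨hA, hB⟩
  · refine le_trans ?_ le_add_self
    refine nonstraight hγ hΛ hϑ hτ'' hτ' (by linarith) (by positivity) hp hq (C := 45 * K ^ 2) ?_ ?_ hH c e h1 h2 h3
    · rw [hD, hL]; nlinarith
    · push_cast; nlinarith
  · refine le_trans ?_ le_self_add
    refine straight hγ hΛ hϑ hτ hτ' hK hL' hL hD hp hq M hM fun k hk => (hB k hk).trans ?_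
    rw [hD, hL]; push_cast; nlinarith


/-! ### White noise and the fine fields -/

structure WN {Ω : Type*} [MeasurableSpace Ω] (μ : Measure Ω) (W : ℕ × Z2 → Ω → ℝ) : Prop where
  meas : ∀ i, Measurable (W i)
  ind : iIndepFun W μ
  law : ∀ i, μ.map (W i) = gaussianReal 0 1

lemma exists_WN : ∃ (Ω : Type) (_ : MeasurableSpace Ω) (μ : Measure Ω) (W : ℕ × Z2 → Ω → ℝ), IsProbabilityMeasure μ ∧ WN μ W := by
  refine ⟨ℕ × Z2 → ℝ, inferInstance, Measure.infinitePi fun _ => gaussianReal 0 1, fun i ω => ω i, inferInstance, ?_⟩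
  refine ⟨fun i => measurable_pi_apply i, ?_, fun i => ?_⟩
  · exact iIndepFun_infinitePi (X := fun _ x => x) fun _ => measurable_id
  · exact Measure.infinitePi_map_eval (fun _ : ℕ × Z2 => gaussianReal 0 1) i

section
variable {Ω : Type*} [MeasurableSpace Ω] {μ : Measure Ω} {W : ℕ × Z2 → Ω → ℝ}

lemma WN.lexp1 (h : WN μ W) (i : ℕ × Z2) (t : ℝ) : ∫⁻ ω, ENNReal.ofReal (rexp (t * W i ω)) ∂μ = ENNReal.ofReal (rexp (t ^ 2 / 2)) := by
  have h1 := lintegral_exp_gaussian 1 t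
  rw [← h.law i, lintegral_map (by fun_prop) (h.meas i)] at h1
  rw [h1]; simp

lemma WN.map_sum [IsProbabilityMeasure μ] (h : WN μ W) (s : Finset (ℕ × Z2)) (c : ℕ × Z2 → ℝ) :
    μ.map (fun ω => ∑ i ∈ s, c i * W i ω) = gaussianReal 0 (Real.toNNReal (∑ i ∈ s, c i ^ 2)) := by
  classical
  induction s using Finset.induction_on with
  | empty => simp [gaussianReal_zero_var, Measure.map_const]
  | insert a s ha ih =>
    have h1 : μ.map (fun ω => c a * W a ω) = gaussianReal 0 (Real.toNNReal (c a ^ 2)) := by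
      have := gaussianReal_map_const_mul (μ := 0) (v := 1) (c a)
      rw [← h.law a, Measure.map_map (by fun_prop) (h.meas a)] at this
      rw [show (fun ω => c a * W a ω) = (fun x => c a * x) ∘ W a from rfl, this, mul_zero, mul_one]
      congr 1
      ext; simp [sq_nonneg]
    have hm : ∀ i, Measurable fun ω => c i * W i ω := fun i => (h.meas i).const_mul _
    have hind : IndepFun (fun ω => c a * W a ω) (fun ω => ∑ i ∈ s, c i * W i ω) μ := by
      have h2 : iIndepFun (fun i ω => c i * W i ω) μ := h.ind.comp (fun i x => c i * x) fun i => by fun_prop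
      have h3 := (h2.indepFun_finsetSum_of_notMem hm ha).symm
      convert h3 using 1
      ext ω; simp
    have h4 := hind.map_add_eq_map_conv_map (hm a) (Finset.measurable_sum _ fun i _ => hm i)
    rw [h1, ih, gaussianReal_conv_gaussianReal, ← Real.toNNReal_add (sq_nonneg _) (Finset.sum_nonneg fun _ _ => sq_nonneg _)] at h4
    rw [Finset.sum_insert ha, ← zero_add (0 : ℝ), ← h4]
    congr 1
    ext ω
    simp [Finset.sum_insert ha]

lemma WN.lexp [IsProbabilityMeasure μ] (h : WN μ W) (s : Finset (ℕ × Z2)) (c : ℕ × Z2 → ℝ) (t : ℝ) :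
    ∫⁻ ω, ENNReal.ofReal (rexp (t * ∑ i ∈ s, c i * W i ω)) ∂μ = ENNReal.ofReal (rexp ((∑ i ∈ s, c i ^ 2) * t ^ 2 / 2)) := by
  have h1 := lintegral_exp_gaussian (Real.toNNReal (∑ i ∈ s, c i ^ 2)) t
  rw [← h.map_sum s c, lintegral_map (by fun_prop) (Finset.measurable_sum _ fun i _ => (h.meas i).const_mul _)] at h1
  rw [h1, Real.coe_toNNReal _ (Finset.sum_nonneg fun _ _ => sq_nonneg _)]

end

/-- field at level `j` -/
noncomputable def xi (W : ℕ × Z2 → ℝ) (j : ℕ) (x : Z2) : ℝ := √102 * 2 ^ j * Qm (2 ^ j) (fun z => W (j, z)) x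

/-- normalised box sums -/
noncomputable def zt (W : ℕ × Z2 → ℝ) (j : ℕ) (y : Z2) : ℝ :=
  ∑ v ∈ Finset.range (2 ^ j) ×ˢ Finset.range (2 ^ j), (2 ^ j : ℝ)⁻¹ * W (j, (y.1 - v.1, y.2 - v.2))

/-- box with corner `x` -/
noncomputable def Bx (x : Z2) (m : ℕ) : Finset Z2 := Finset.Ico x.1 (x.1 + m) ×ˢ Finset.Ico x.2 (x.2 + m)

lemma sum_Ico_range (a : ℤ) (m : ℕ) (f : ℤ → ℝ) : ∑ y ∈ Finset.Ico a (a + m), f y = ∑ u ∈ Finset.range m, f (a + u) := by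
  symm
  refine Finset.sum_bij (fun u _ => a + (u : ℤ)) ?_ ?_ ?_ ?_
  · intro u hu; simp at hu ⊢; omega
  · intro u _ v _ h; simpa using h
  · intro y hy
    rw [Finset.mem_Ico] at hy
    exact ⟨(y - a).toNat, by rw [Finset.mem_range]; omega, by omega⟩
  · intro u _; rfl

lemma xi_eq (W : ℕ × Z2 → ℝ) (j : ℕ) (x : Z2) : xi W j x = √102 * (4 ^ j : ℝ)⁻¹ * ∑ y ∈ Bx x (2 ^ j), zt W j y := by
  unfold xi Qm zt Bx
  simp only [Finset.sum_product, ← Finset.mul_sum]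
  rw [sum_Ico_range x.1 (2 ^ j)]
  simp_rw [sum_Ico_range x.2 (2 ^ j)]
  have e : ∑ u ∈ Finset.range (2 ^ j), ∑ i ∈ Finset.range (2 ^ j), ∑ a ∈ Finset.range (2 ^ j), ∑ b ∈ Finset.range (2 ^ j),
      W (j, (x.1 + (u : ℤ) - a, x.2 + (i : ℤ) - b)) = ∑ u ∈ Finset.range (2 ^ j), ∑ a ∈ Finset.range (2 ^ j), ∑ i ∈ Finset.range (2 ^ j),
      ∑ b ∈ Finset.range (2 ^ j), W (j, (x.1 + ((u : ℤ) - a), x.2 + ((i : ℤ) - b))) := by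
    refine Finset.sum_congr rfl fun u _ => ?_
    rw [Finset.sum_comm]
    simp only [add_sub_assoc]
  rw [e]
  push_cast
  have h4 : ((2 : ℝ) ^ j) ^ 4 = 4 ^ j * 2 ^ j * 2 ^ j := by
    rw [show (4 : ℝ) = 2 * 2 by norm_num, mul_pow]; ring
  rw [h4]
  field_simp

section
variable {Ω : Type*} [MeasurableSpace Ω] {μ : Measure Ω} {W : ℕ × Z2 → Ω → ℝ}

/-- linear functionals of the fields -/
lemma xi_lin (J : Finset ℕ) (s : Finset Z2) (ν : Z2 → ℝ) (hν : ∀ z ∉ s, ν z = 0) :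
    ∃ (F : Finset (ℕ × Z2)) (c : ℕ × Z2 → ℝ), (∀ W : ℕ × Z2 → ℝ, ∑ j ∈ J, ∑ x ∈ s, ν x * xi W j x = ∑ i ∈ F, c i * W i) ∧
      ∑ i ∈ F, c i ^ 2 = 102 * ∑ j ∈ J, 4 ^ j * ns (Qm (2 ^ j) ν) := by
  classical
  have hfs : ν.support.Finite := s.finite_toSet.subset fun z hz => by
    by_contra h; exact hz (hν z h)
  set F0 : Finset Z2 := J.biUnion (fun j => (fs_Qm hfs (2 ^ j)).toFinset ∪
    s.biUnion fun x => (JJ (2 ^ j)).image fun p => (x.1 + ((p.1.1 : ℤ) - p.1.2), x.2 + ((p.2.1 : ℤ) - p.2.2))) with hF0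
  refine ⟨J ×ˢ F0, fun i => √102 * 2 ^ i.1 * Qm (2 ^ i.1) ν i.2, fun W => ?_, ?_⟩
  · rw [Finset.sum_product]
    refine Finset.sum_congr rfl fun j hj => ?_
    set g : Z2 → ℝ := fun z => if z ∈ F0 then W (j, z) else 0 with hg
    have hgs : g.support.Finite := F0.finite_toSet.subset fun z hz => by
      by_contra h; exact hz (if_neg h)
    have h1 := Qm_symm hfs hgs (2 ^ j)
    rw [tsum_eq_sum (s := s) (fun z hz => by rw [hν z hz, zero_mul]),
      tsum_eq_sum (s := F0) (fun z hz => by simp [hg, hz])] at h1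
    have h2 : ∀ x ∈ s, Qm (2 ^ j) g x = Qm (2 ^ j) (fun z => W (j, z)) x := by
      intro x hx
      unfold Qm
      congr 1
      refine Finset.sum_congr rfl fun p hp => ?_
      simp only [hg]
      rw [if_pos]
      rw [hF0, Finset.mem_biUnion]
      refine ⟨j, hj, Finset.mem_union_right _ ?_⟩
      rw [Finset.mem_biUnion]
      exact ⟨x, hx, Finset.mem_image_of_mem (f := fun p : (ℕ × ℕ) × (ℕ × ℕ) => (x.1 + ((p.1.1 : ℤ) - p.1.2), x.2 + ((p.2.1 : ℤ) - p.2.2))) hp⟩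
    unfold xi
    calc _ = √102 * 2 ^ j * ∑ x ∈ s, ν x * Qm (2 ^ j) g x := by
          rw [Finset.mul_sum]
          refine Finset.sum_congr rfl fun x hx => ?_
          rw [h2 x hx]; ring
      _ = _ := by
          rw [h1, Finset.mul_sum]
          refine Finset.sum_congr rfl fun x hx => ?_
          simp only [hg, hx, if_true]; ring
  · rw [Finset.sum_product, Finset.mul_sum]
    refine Finset.sum_congr rfl fun j hj => ?_
    unfold ns
    rw [tsum_eq_sum (s := F0) (fun z hz => ?_)]
    · rw [Finset.mul_sum, Finset.mul_sum]
      refine Finset.sum_congr rfl fun x hx => ?_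
      simp only
      rw [mul_pow, mul_pow, Real.sq_sqrt (by norm_num), show ((2 : ℝ) ^ j) ^ 2 = 4 ^ j by rw [← pow_mul, mul_comm, pow_mul]; norm_num]
      ring
    · have : z ∉ (fs_Qm hfs (2 ^ j)).toFinset := fun h => hz (by
        rw [hF0, Finset.mem_biUnion]; exact ⟨j, hj, Finset.mem_union_left _ h⟩)
      rw [Set.Finite.mem_toFinset, Function.mem_support, not_not] at this
      rw [this]; norm_num

lemma WN.zt_exp [IsProbabilityMeasure μ] (h : WN μ W) (j : ℕ) (y : Z2) (t : ℝ) :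
    ∫⁻ ω, ENNReal.ofReal (rexp (t * zt (fun i => W i ω) j y)) ∂μ = ENNReal.ofReal (rexp (t ^ 2 / 2)) := by
  classical
  have hinj : Set.InjOn (fun v : ℕ × ℕ => ((j, ((y.1 - v.1 : ℤ), (y.2 - v.2 : ℤ))) : ℕ × Z2)) (Finset.range (2 ^ j) ×ˢ Finset.range (2 ^ j) : Finset (ℕ × ℕ)) := by
    intro a _ b _ hab
    simp only [Prod.mk.injEq] at hab
    ext <;> omega
  have e : ∀ ω, zt (fun i => W i ω) j y = ∑ i ∈ (Finset.range (2 ^ j) ×ˢ Finset.range (2 ^ j)).image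
      (fun v : ℕ × ℕ => ((j, ((y.1 - v.1 : ℤ), (y.2 - v.2 : ℤ))) : ℕ × Z2)), (2 ^ j : ℝ)⁻¹ * W i ω := by
    intro ω
    rw [Finset.sum_image hinj]; rfl
  simp_rw [e]
  rw [h.lexp _ (fun _ => (2 ^ j : ℝ)⁻¹), Finset.sum_const, Finset.card_image_of_injOn hinj, Finset.card_product, Finset.card_range]
  congr 2
  rw [nsmul_eq_mul]
  push_cast
  field_simp

end

lemma zt_meas {Ω : Type*} {W : ℕ × Z2 → Ω → ℝ} {m : MeasurableSpace Ω} (j : ℕ) (hW : ∀ z, Measurable (W (j, z))) (y : Z2) : Measurable fun ω => zt (fun i => W i ω) j y := by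
  unfold zt
  exact Finset.measurable_sum _ fun v _ => (hW _).const_mul _

lemma xi_meas {Ω : Type*} {W : ℕ × Z2 → Ω → ℝ} {m : MeasurableSpace Ω} (j : ℕ) (hW : ∀ z, Measurable (W (j, z))) (y : Z2) : Measurable fun ω => xi (fun i => W i ω) j y := by
  simp_rw [xi_eq]
  exact (Finset.measurable_sum _ fun v _ => zt_meas j hW v).const_mul _



/-! ### Oscillation and exponential moment estimates -/

lemma WN.jens {Ω ι : Type*} [MeasurableSpace Ω] {μ : Measure Ω} [IsProbabilityMeasure μ] {W : ℕ × Z2 → Ω → ℝ} (h : WN μ W)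
    (S : Finset ι) (c : ι → ℝ) (hc : ∀ a ∈ S, 0 ≤ c a) (g : ι → ℕ × Z2) {C : ℝ} (hC : ∑ a ∈ S, c a ≤ C) :
    ∫⁻ ω, ENNReal.ofReal (rexp (∑ a ∈ S, c a * |zt (fun i => W i ω) (g a).1 (g a).2|)) ∂μ ≤ ENNReal.ofReal (2 * rexp (C ^ 2 / 2)) := by
  set C0 := ∑ a ∈ S, c a with hC0
  have hC0n : 0 ≤ C0 := Finset.sum_nonneg hc
  rcases hC0n.eq_or_lt with h0 | h0
  · have hz : ∀ a ∈ S, c a = 0 := (Finset.sum_eq_zero_iff_of_nonneg hc).1 h0.symm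
    have : ∀ ω, ∑ a ∈ S, c a * |zt (fun i => W i ω) (g a).1 (g a).2| = 0 := fun ω =>
      Finset.sum_eq_zero fun a ha => by rw [hz a ha, zero_mul]
    simp_rw [this]
    simp only [Real.exp_zero, lintegral_const, measure_univ, mul_one]
    refine ENNReal.ofReal_le_ofReal ?_
    have := Real.one_le_exp (x := C ^ 2 / 2) (by positivity)
    linarith
  · have hm : ∀ a : ι, Measurable fun ω => zt (fun i => W i ω) (g a).1 (g a).2 := fun a => zt_meas _ (fun z => h.meas _) _
    have hpt : ∀ ω, ENNReal.ofReal (rexp (∑ a ∈ S, c a * |zt (fun i => W i ω) (g a).1 (g a).2|)) ≤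
        ∑ a ∈ S, ENNReal.ofReal (c a / C0) * (ENNReal.ofReal (rexp (C0 * zt (fun i => W i ω) (g a).1 (g a).2)) +
          ENNReal.ofReal (rexp (-C0 * zt (fun i => W i ω) (g a).1 (g a).2))) := by
      intro ω
      set x : ι → ℝ := fun a => zt (fun i => W i ω) (g a).1 (g a).2
      have h1 := convexOn_exp.map_sum_le (t := S) (w := fun a => c a / C0) (p := fun a => C0 * |x a|)
        (fun a ha => div_nonneg (hc a ha) hC0n) (by rw [← Finset.sum_div, div_self h0.ne']) (fun _ _ => Set.mem_univ _)
      simp only [smul_eq_mul] at h1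
      have e : ∑ a ∈ S, c a / C0 * (C0 * |x a|) = ∑ a ∈ S, c a * |x a| :=
        Finset.sum_congr rfl fun a _ => by field_simp
      rw [e] at h1
      have h2 : rexp (∑ a ∈ S, c a * |x a|) ≤ ∑ a ∈ S, c a / C0 * (rexp (C0 * x a) + rexp (-C0 * x a)) := by
        refine h1.trans (Finset.sum_le_sum fun a ha => mul_le_mul_of_nonneg_left ?_ (div_nonneg (hc a ha) hC0n))
        rcases abs_cases (x a) with ⟨h3, _⟩ | ⟨h3, _⟩
        · rw [h3]; have := Real.exp_pos (-C0 * x a); linarith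
        · rw [h3, mul_neg, ← neg_mul]; have := Real.exp_pos (C0 * x a); linarith
      refine (ENNReal.ofReal_le_ofReal h2).trans ?_
      rw [ENNReal.ofReal_sum_of_nonneg fun a ha => mul_nonneg (div_nonneg (hc a ha) hC0n) (by positivity)]
      refine Finset.sum_le_sum fun a ha => ?_
      rw [ENNReal.ofReal_mul (div_nonneg (hc a ha) hC0n), ENNReal.ofReal_add (by positivity) (by positivity)]
    refine (lintegral_mono hpt).trans ?_
    have hme : ∀ (a : ι) (t : ℝ), Measurable fun ω => ENNReal.ofReal (rexp (t * zt (fun i => W i ω) (g a).1 (g a).2)) :=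
      fun a t => ((hm a).const_mul t).exp.ennreal_ofReal
    have hme2 : ∀ a : ι, Measurable fun ω => (ENNReal.ofReal (rexp (C0 * zt (fun i => W i ω) (g a).1 (g a).2)) +
          ENNReal.ofReal (rexp (-C0 * zt (fun i => W i ω) (g a).1 (g a).2))) := fun a => (hme a _).add (hme a _)
    rw [lintegral_finsetSum _ fun a _ => (hme2 a).const_mul _]
    have h3 : ∀ a ∈ S, ∫⁻ ω, ENNReal.ofReal (c a / C0) * (ENNReal.ofReal (rexp (C0 * zt (fun i => W i ω) (g a).1 (g a).2)) +
          ENNReal.ofReal (rexp (-C0 * zt (fun i => W i ω) (g a).1 (g a).2))) ∂μ = ENNReal.ofReal (c a / C0 * (2 * rexp (C0 ^ 2 / 2))) := by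
      intro a ha
      rw [lintegral_const_mul _ (hme2 a), lintegral_add_left (hme a _), h.zt_exp, h.zt_exp, neg_sq, ← ENNReal.ofReal_add (by positivity) (by positivity),
        ← ENNReal.ofReal_mul (div_nonneg (hc a ha) hC0n), two_mul]
    rw [Finset.sum_congr rfl h3, ← ENNReal.ofReal_sum_of_nonneg fun a ha => mul_nonneg (div_nonneg (hc a ha) hC0n) (by positivity),
      ← Finset.sum_mul, ← Finset.sum_div, div_self h0.ne', one_mul]
    refine ENNReal.ofReal_le_ofReal ?_
    gcongr

/-- outer box -/
noncomputable def OB (r : Z2) (ρ m : ℕ) : Finset Z2 := Finset.Ico (r.1 - ρ) (r.1 + m + ρ) ×ˢ Finset.Ico (r.2 - ρ) (r.2 + m + ρ)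
/-- annulus -/
noncomputable def AN (r : Z2) (ρ m : ℕ) : Finset Z2 :=
  OB r ρ m \ (Finset.Ico (r.1 + ρ) (r.1 + m - ρ) ×ˢ Finset.Ico (r.2 + ρ) (r.2 + m - ρ))

lemma OB_card (r : Z2) (ρ m : ℕ) : ((OB r ρ m).card : ℝ) = (m + 2 * ρ) ^ 2 := by
  unfold OB
  rw [Finset.card_product, Int.card_Ico, Int.card_Ico]
  rw [show (r.1 + m + ρ - (r.1 - ρ)).toNat = m + 2 * ρ by omega, show (r.2 + m + ρ - (r.2 - ρ)).toNat = m + 2 * ρ by omega]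
  push_cast; ring

lemma AN_card (r : Z2) (ρ m : ℕ) : ((AN r ρ m).card : ℝ) ≤ 8 * m * ρ + 8 * ρ ^ 2 := by
  have h1 := OB_card r ρ m
  rcases le_total m (2 * ρ) with h | h
  · have h2 : ((AN r ρ m).card : ℝ) ≤ (OB r ρ m).card := by exact_mod_cast Finset.card_le_card Finset.sdiff_subset
    have h3 : (m : ℝ) ≤ 2 * ρ := by exact_mod_cast h
    have h4 : (0 : ℝ) ≤ m := Nat.cast_nonneg _
    nlinarith
  · have hsub : (Finset.Ico (r.1 + ρ) (r.1 + m - ρ) ×ˢ Finset.Ico (r.2 + ρ) (r.2 + m - ρ) : Finset Z2) ⊆ OB r ρ m := by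
      unfold OB
      exact Finset.product_subset_product (Finset.Ico_subset_Ico (by omega) (by omega)) (Finset.Ico_subset_Ico (by omega) (by omega))
    unfold AN
    rw [Finset.cast_card_sdiff hsub, h1, Finset.card_product, Int.card_Ico, Int.card_Ico,
      show (r.1 + m - ρ - (r.1 + ρ)).toNat = m - 2 * ρ by omega, show (r.2 + m - ρ - (r.2 + ρ)).toNat = m - 2 * ρ by omega]
    push_cast [h]
    nlinarith [sq_nonneg (ρ : ℝ)]

lemma xi_osc (W : ℕ × Z2 → ℝ) (j : ℕ) {z r : Z2} {ρ : ℕ} (h1 : |z.1 - r.1| ≤ ρ) (h2 : |z.2 - r.2| ≤ ρ) :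
    |xi W j z - xi W j r| ≤ √102 * (4 ^ j : ℝ)⁻¹ * ∑ y ∈ AN r ρ (2 ^ j), |zt W j y| := by
  classical
  rw [xi_eq, xi_eq, ← mul_sub, abs_mul, abs_of_nonneg (by positivity : 0 ≤ √102 * (4 ^ j : ℝ)⁻¹)]
  refine mul_le_mul_of_nonneg_left ?_ (by positivity)
  rw [abs_le] at h1 h2
  have hA : Bx z (2 ^ j) \ Bx r (2 ^ j) ∪ Bx r (2 ^ j) \ Bx z (2 ^ j) ⊆ AN r ρ (2 ^ j) := by
    intro y hy
    simp only [Bx, AN, OB, Finset.mem_union, Finset.mem_sdiff, Finset.mem_product, Finset.mem_Ico] at hy ⊢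
    omega
  have hd : Disjoint (Bx z (2 ^ j) \ Bx r (2 ^ j)) (Bx r (2 ^ j) \ Bx z (2 ^ j)) := by
    rw [Finset.disjoint_left]
    intro y hy hy'
    rw [Finset.mem_sdiff] at hy hy'
    exact hy.2 hy'.1
  have e : ∑ y ∈ Bx z (2 ^ j), zt W j y - ∑ y ∈ Bx r (2 ^ j), zt W j y =
      ∑ y ∈ Bx z (2 ^ j) \ Bx r (2 ^ j), zt W j y - ∑ y ∈ Bx r (2 ^ j) \ Bx z (2 ^ j), zt W j y := by
    rw [← Finset.sum_sdiff_sub_sum_sdiff]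
  rw [e]
  calc _ ≤ |∑ y ∈ Bx z (2 ^ j) \ Bx r (2 ^ j), zt W j y| + |∑ y ∈ Bx r (2 ^ j) \ Bx z (2 ^ j), zt W j y| := abs_sub _ _
    _ ≤ ∑ y ∈ Bx z (2 ^ j) \ Bx r (2 ^ j), |zt W j y| + ∑ y ∈ Bx r (2 ^ j) \ Bx z (2 ^ j), |zt W j y| :=
        add_le_add (Finset.abs_sum_le_sum_abs _ _) (Finset.abs_sum_le_sum_abs _ _)
    _ = ∑ y ∈ Bx z (2 ^ j) \ Bx r (2 ^ j) ∪ Bx r (2 ^ j) \ Bx z (2 ^ j), |zt W j y| := (Finset.sum_union hd).symm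
    _ ≤ _ := Finset.sum_le_sum_of_subset_of_nonneg hA fun _ _ _ => abs_nonneg _

lemma xi_crude (W : ℕ × Z2 → ℝ) (j : ℕ) {z r : Z2} {ρ : ℕ} (h1 : |z.1 - r.1| ≤ ρ) (h2 : |z.2 - r.2| ≤ ρ) :
    |xi W j z| ≤ √102 * (4 ^ j : ℝ)⁻¹ * ∑ y ∈ OB r ρ (2 ^ j), |zt W j y| := by
  rw [xi_eq, abs_mul, abs_of_nonneg (by positivity : 0 ≤ √102 * (4 ^ j : ℝ)⁻¹)]
  refine mul_le_mul_of_nonneg_left ?_ (by positivity)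
  rw [abs_le] at h1 h2
  refine (Finset.abs_sum_le_sum_abs _ _).trans (Finset.sum_le_sum_of_subset_of_nonneg ?_ fun _ _ _ => abs_nonneg _)
  intro y hy
  simp only [Bx, OB, Finset.mem_product, Finset.mem_Ico] at hy ⊢
  omega

lemma Qm_sum {ι : Type*} (m : ℕ) (s : Finset ι) (f : ι → Z2 → ℝ) (z : Z2) :
    Qm m (fun x => ∑ i ∈ s, f i x) z = ∑ i ∈ s, Qm m (f i) z := by
  unfold Qm
  rw [← Finset.mul_sum, Finset.sum_comm]

lemma Qm_dlt_supp {m : ℕ} {x z : Z2} (h : Qm m (dlt x) z ≠ 0) : |z.1 - x.1| ≤ m ∧ |z.2 - x.2| ≤ m := by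
  by_contra hc
  apply h
  unfold Qm dlt
  rw [Finset.sum_eq_zero, mul_zero]
  intro p hp
  rw [if_neg]
  intro he
  apply hc
  simp only [JJ, Finset.mem_product, Finset.mem_range] at hp
  rw [Prod.ext_iff] at he
  simp only at he
  rw [abs_le, abs_le]
  omega

/-- variance of a field along a tube -/
lemma tube_ns {K j : ℕ} (r : ℕ → Z2) {B : ℝ}
    (hB : ∀ z : Z2, (((Finset.range K).filter fun i => |z.1 - (r i).1| ≤ (2 ^ j : ℕ) ∧ |z.2 - (r i).2| ≤ (2 ^ j : ℕ)).card : ℝ) ≤ B) :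
    4 ^ j * ns (Qm (2 ^ j) fun x => ∑ i ∈ Finset.range K, dlt (r i) x) ≤ B * K := by
  classical
  have h1 : ∀ z, (Qm (2 ^ j) (fun x => ∑ i ∈ Finset.range K, dlt (r i) x) z) ^ 2 ≤ B * ∑ i ∈ Finset.range K, Qm (2 ^ j) (dlt (r i)) z ^ 2 := by
    intro z
    rw [Qm_sum]
    set F := (Finset.range K).filter fun i => |z.1 - (r i).1| ≤ (2 ^ j : ℕ) ∧ |z.2 - (r i).2| ≤ (2 ^ j : ℕ) with hF
    have e : ∑ i ∈ Finset.range K, Qm (2 ^ j) (dlt (r i)) z = ∑ i ∈ F, Qm (2 ^ j) (dlt (r i)) z := by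
      symm
      apply Finset.sum_filter_of_ne
      intro i _ h
      exact Qm_dlt_supp h
    rw [e]
    calc _ ≤ (F.card : ℝ) * ∑ i ∈ F, Qm (2 ^ j) (dlt (r i)) z ^ 2 := sq_sum_le_card_mul_sum_sq
      _ ≤ (F.card : ℝ) * ∑ i ∈ Finset.range K, Qm (2 ^ j) (dlt (r i)) z ^ 2 := by
          gcongr
          exact Finset.filter_subset _ _
      _ ≤ _ := by
          gcongr
          exact hB z
  have hfs : ∀ i, (Qm (2 ^ j) (dlt (r i))).support.Finite := fun i => fs_Qm (fs_dlt _) _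
  have hB0 : 0 ≤ B := (Nat.cast_nonneg _).trans (hB 0)
  have hs1 : Summable fun z => B * ∑ i ∈ Finset.range K, Qm (2 ^ j) (dlt (r i)) z ^ 2 :=
    (summable_sum fun i _ => sm (fs_sq (hfs i))).mul_left _
  have hs2 : Summable fun z => (Qm (2 ^ j) (fun x => ∑ i ∈ Finset.range K, dlt (r i) x) z) ^ 2 :=
    Summable.of_nonneg_of_le (fun z => sq_nonneg _) h1 hs1
  have h2 : ns (Qm (2 ^ j) fun x => ∑ i ∈ Finset.range K, dlt (r i) x) ≤ B * ∑ i ∈ Finset.range K, ns (Qm (2 ^ j) (dlt (r i))) := by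
    refine (hs2.tsum_le_tsum h1 hs1).trans ?_
    rw [tsum_mul_left, Summable.tsum_finsetSum fun i _ => sm (fs_sq (hfs i))]
    rfl
  have h3 : ∑ i ∈ Finset.range K, ns (Qm (2 ^ j) (dlt (r i))) ≤ K * (4 ^ j : ℝ)⁻¹ := by
    calc _ ≤ ∑ i ∈ Finset.range K, (4 ^ j : ℝ)⁻¹ := by
          refine Finset.sum_le_sum fun i _ => ?_
          have := ns_Qm_dlt (2 ^ j) (by positivity) (r i)
          push_cast at this
          rw [← pow_mul, mul_comm j, pow_mul] at this
          norm_num at this ⊢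
          exact this
      _ = _ := by rw [Finset.sum_const, Finset.card_range, nsmul_eq_mul]
  calc _ ≤ (4 ^ j : ℝ) * (B * (K * (4 ^ j : ℝ)⁻¹)) := by
        gcongr
        exact h2.trans (by gcongr)
    _ = _ := by field_simp

lemma WN.tube_exp {Ω : Type*} [MeasurableSpace Ω] {μ : Measure Ω} [IsProbabilityMeasure μ] {W : ℕ × Z2 → Ω → ℝ} (h : WN μ W)
    (J : Finset ℕ) {K : ℕ} (r : ℕ → Z2) (B : ℕ → ℝ)
    (hB : ∀ j ∈ J, ∀ z : Z2, (((Finset.range K).filter fun i => |z.1 - (r i).1| ≤ (2 ^ j : ℕ) ∧ |z.2 - (r i).2| ≤ (2 ^ j : ℕ)).card : ℝ) ≤ B j)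
    (t : ℝ) : ∫⁻ ω, ENNReal.ofReal (rexp (t * ∑ i ∈ Finset.range K, ∑ j ∈ J, xi (fun a => W a ω) j (r i))) ∂μ ≤
      ENNReal.ofReal (rexp (51 * t ^ 2 * K * ∑ j ∈ J, B j)) := by
  classical
  set ν : Z2 → ℝ := fun x => ∑ i ∈ Finset.range K, dlt (r i) x with hν
  obtain ⟨F, c, h1, h2⟩ := xi_lin J ((Finset.range K).image r) ν (by
    intro z hz
    refine Finset.sum_eq_zero fun i hi => if_neg ?_
    rintro rfl
    exact hz (Finset.mem_image_of_mem _ hi))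
  have e : ∀ ω, ∑ i ∈ Finset.range K, ∑ j ∈ J, xi (fun a => W a ω) j (r i) = ∑ i ∈ F, c i * W i ω := by
    intro ω
    rw [← h1 fun a => W a ω, Finset.sum_comm]
    refine Finset.sum_congr rfl fun j _ => ?_
    simp only [hν, Finset.sum_mul]
    rw [Finset.sum_comm]
    refine Finset.sum_congr rfl fun i hi => ?_
    simp only [dlt, ite_mul, one_mul, zero_mul]
    rw [Finset.sum_ite_eq', if_pos (Finset.mem_image_of_mem _ hi)]
  simp_rw [e]
  rw [h.lexp, h2]
  refine ENNReal.ofReal_le_ofReal (Real.exp_le_exp.2 ?_)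
  have h3 : ∑ j ∈ J, 4 ^ j * ns (Qm (2 ^ j) ν) ≤ ∑ j ∈ J, B j * K := Finset.sum_le_sum fun j hj => tube_ns r (hB j hj)
  rw [← Finset.sum_mul] at h3
  have := mul_le_mul_of_nonneg_left h3 (sq_nonneg t)
  nlinarith


/-- partial sums of the levels -/
noncomputable def YY (W : ℕ × Z2 → ℝ) (j : ℕ) (z : Z2) : ℝ := ∑ i ∈ Finset.range j, xi W i z
/-- local upper bound of minus the increment -/
noncomputable def MM (W : ℕ × Z2 → ℝ) (J : Finset ℕ) (ρ : ℕ) (c : ℂ) : ℝ :=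
  -(∑ j ∈ J, xi W j (rd c)) + ∑ j ∈ J, ∑ y ∈ AN (rd c) ρ (2 ^ j), √102 * (4 ^ j : ℝ)⁻¹ * |zt W j y|
/-- crude bound of the increment -/
noncomputable def HH (W : ℕ × Z2 → ℝ) (J : Finset ℕ) (ρ : ℕ) (c : ℂ) : ℝ :=
  ∑ j ∈ J, ∑ y ∈ OB (rd c) ρ (2 ^ j), √102 * (4 ^ j : ℝ)⁻¹ * |zt W j y|

lemma near_rd {z : Z2} {c : ℂ} {R : ℝ} {ρ : ℕ} (h : ‖cx z - c‖ ≤ R) (hρ : R + 2 ≤ ρ) :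
    |z.1 - (rd c).1| ≤ ρ ∧ |z.2 - (rd c).2| ≤ ρ := by
  have h1 := rd_dist c
  rw [norm_sub_rev] at h1
  have h2 := nrm_tri (cx z) c (cx (rd c))
  have h3 : ‖cx z - cx (rd c)‖ ≤ ρ := by linarith
  have h4 := (Complex.abs_re_le_norm _).trans h3
  have h5 := (Complex.abs_im_le_norm _).trans h3
  simp only [cx, Complex.sub_re, Complex.sub_im] at h4 h5
  constructor
  · exact_mod_cast h4
  · exact_mod_cast h5

lemma MM_spec (W : ℕ × Z2 → ℝ) (J : Finset ℕ) {z : Z2} {c : ℂ} {R : ℝ} {ρ : ℕ} (h : ‖cx z - c‖ ≤ R) (hρ : R + 2 ≤ ρ) :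
    -MM W J ρ c ≤ ∑ j ∈ J, xi W j z := by
  unfold MM
  have h1 : ∑ j ∈ J, xi W j (rd c) - ∑ j ∈ J, xi W j z ≤ ∑ j ∈ J, ∑ y ∈ AN (rd c) ρ (2 ^ j), √102 * (4 ^ j : ℝ)⁻¹ * |zt W j y| := by
    rw [← Finset.sum_sub_distrib]
    refine Finset.sum_le_sum fun j _ => ?_
    rw [← Finset.mul_sum]
    have := xi_osc W j (near_rd h hρ).1 (near_rd h hρ).2
    rw [abs_sub_comm] at this
    exact (le_abs_self _).trans this
  linarith

lemma HH_spec (W : ℕ × Z2 → ℝ) (J : Finset ℕ) {z : Z2} {c : ℂ} {R : ℝ} {ρ : ℕ} (h : ‖cx z - c‖ ≤ R) (hρ : R + 2 ≤ ρ) :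
    -HH W J ρ c ≤ ∑ j ∈ J, xi W j z := by
  unfold HH
  rw [← Finset.sum_neg_distrib]
  refine Finset.sum_le_sum fun j _ => ?_
  rw [← Finset.mul_sum]
  have := xi_crude W j (near_rd h hρ).1 (near_rd h hρ).2
  exact (abs_le.1 this).1

lemma sqrt102 : √102 ≤ 11 := by
  rw [Real.sqrt_le_left (by norm_num)]; norm_num

section
variable {Ω : Type*} [MeasurableSpace Ω] {μ : Measure Ω} [IsProbabilityMeasure μ] {W : ℕ × Z2 → Ω → ℝ}

lemma WN.HH_exp (h : WN μ W) (J : Finset ℕ) {ρ : ℕ} (c : ℂ) {b : ℝ} (hb : ∀ j ∈ J, 2 * (ρ : ℝ) ≤ b * 2 ^ j)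
    {θ : ℝ} (hθ : 0 ≤ θ) : ∫⁻ ω, ENNReal.ofReal (rexp (θ * HH (fun i => W i ω) J ρ c)) ∂μ ≤
      ENNReal.ofReal (2 * rexp ((θ * (J.card * (11 * (1 + b) ^ 2))) ^ 2 / 2)) := by
  have e : ∀ ω, θ * HH (fun i => W i ω) J ρ c = ∑ a ∈ J.sigma fun j => OB (rd c) ρ (2 ^ j),
      (θ * (√102 * (4 ^ a.1 : ℝ)⁻¹)) * |zt (fun i => W i ω) a.1 a.2| := by
    intro ω
    rw [Finset.sum_sigma]
    simp only [HH, Finset.mul_sum, mul_assoc]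
  simp_rw [e]
  refine h.jens _ (fun a : (_ : ℕ) × Z2 => θ * (√102 * (4 ^ a.1 : ℝ)⁻¹)) (fun a _ => by positivity) (fun a => (a.1, a.2)) ?_
  rw [Finset.sum_sigma]
  simp only [Finset.sum_const, nsmul_eq_mul]
  calc _ ≤ ∑ j ∈ J, θ * (11 * (1 + b) ^ 2) := by
        refine Finset.sum_le_sum fun j hj => ?_
        rw [OB_card]
        have h1 := hb j hj
        have h2 : ((2 ^ j : ℕ) + 2 * (ρ : ℝ)) ^ 2 ≤ ((1 + b) * 2 ^ j) ^ 2 := by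
          push_cast
          gcongr
          linarith
        have h4 : ((2 : ℝ) ^ j) ^ 2 = 4 ^ j := by rw [← pow_mul, mul_comm, pow_mul]; norm_num
        calc _ ≤ ((1 + b) * 2 ^ j) ^ 2 * (θ * (11 * (4 ^ j : ℝ)⁻¹)) := by
              gcongr
              exact sqrt102
          _ = _ := by rw [mul_pow, h4]; field_simp
    _ = _ := by rw [Finset.sum_const, nsmul_eq_mul]; ring

lemma card_diam (A : Finset ℕ) {d : ℝ} (hd : 0 ≤ d) (h : ∀ i ∈ A, ∀ i' ∈ A, i ≤ i' → (i' : ℝ) - i ≤ d) : (A.card : ℝ) ≤ d + 1 := by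
  rcases A.eq_empty_or_nonempty with rfl | hA
  · simp; linarith
  · have h1 : A ⊆ Finset.Icc (A.min' hA) (A.max' hA) := fun i hi => Finset.mem_Icc.2 ⟨A.min'_le i hi, A.le_max' i hi⟩
    have h2 := Finset.card_le_card h1
    rw [Nat.card_Icc] at h2
    have h3 := h _ (A.min'_mem hA) _ (A.max'_mem hA) (A.min'_le_max' hA)
    have h4 : (A.card : ℝ) ≤ (A.max' hA : ℝ) + 1 - A.min' hA := by
      have h5 := A.min'_le_max' hA
      have : A.card + A.min' hA ≤ A.max' hA + 1 := by omega
      have : (A.card : ℝ) + A.min' hA ≤ A.max' hA + 1 := by exact_mod_cast this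
      linarith
    linarith

lemma tube_count {K : ℕ} (hK : 0 < K) {L : ℝ} (hL : 0 < L) (q : ℂ) {w : Z2 × Z2} (hw : w ∈ TT K) (m : ℕ) (z : Z2) :
    (((Finset.range K).filter fun i => |z.1 - (rd (tq L K q w i)).1| ≤ (m : ℕ) ∧ |z.2 - (rd (tq L K q w i)).2| ≤ (m : ℕ)).card : ℝ)
      ≤ (8 * m + 8) / L + 1 := by
  have hw' : (K : ℝ) / 2 ≤ ‖cx w.2 - cx w.1‖ := (Finset.mem_filter.1 hw).2
  have hK0 : (0 : ℝ) < K := by exact_mod_cast hK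
  have hn : ∀ x y : Z2, |x.1 - y.1| ≤ (m : ℤ) → |x.2 - y.2| ≤ (m : ℤ) → ‖cx x - cx y‖ ≤ 2 * m := by
    intro x y h1 h2
    refine (Complex.norm_le_abs_re_add_abs_im _).trans ?_
    simp only [cx, Complex.sub_re, Complex.sub_im]
    have h3 : |(x.1 : ℝ) - y.1| ≤ m := by exact_mod_cast h1
    have h4 : |(x.2 : ℝ) - y.2| ≤ m := by exact_mod_cast h2
    linarith
  refine card_diam _ (by positivity) fun i hi i' hi' hii => ?_
  rw [Finset.mem_filter] at hi hi'
  have h1 := hn _ _ hi.2.1 hi.2.2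
  have h2 := hn _ _ hi'.2.1 hi'.2.2
  have h3 := rd_dist (tq L K q w i)
  have h4 := rd_dist (tq L K q w i')
  have h5 : ‖tq L K q w i' - tq L K q w i‖ ≤ 4 * m + 4 := by
    have a1 := nrm_tri (tq L K q w i') (cx (rd (tq L K q w i'))) (tq L K q w i)
    have a2 := nrm_tri (cx (rd (tq L K q w i'))) (cx z) (tq L K q w i)
    have a3 := nrm_tri (cx z) (cx (rd (tq L K q w i))) (tq L K q w i)
    rw [norm_sub_rev] at h2 h4
    linarith
  have e : tq L K q w i' - tq L K q w i = ((L * ((i' - i) / K) : ℝ) : ℂ) * (cx w.2 - cx w.1) := by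
    unfold tq; push_cast; ring
  have hii' : (i : ℝ) ≤ i' := by exact_mod_cast hii
  rw [e, norm_mul, Complex.norm_real, Real.norm_of_nonneg (mul_nonneg hL.le (div_nonneg (by linarith) hK0.le))] at h5
  have h6 : L * ((i' - i) / K) * (K / 2) ≤ 4 * m + 4 := by
    refine le_trans ?_ h5
    have : 0 ≤ L * (((i' : ℝ) - i) / K) := mul_nonneg hL.le (div_nonneg (by linarith) hK0.le)
    gcongr
  have h7 : L * ((i' - i) / K) * (K / 2) = L * ((i' : ℝ) - i) / 2 := by field_simp
  rw [le_div_iff₀ hL]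
  linarith

lemma half_sum (j0 k : ℕ) : ∑ j ∈ Finset.Ico j0 (j0 + k), (2 : ℝ) ^ j0 / 2 ^ j ≤ 2 := by
  rw [Finset.sum_Ico_eq_sum_range, show j0 + k - j0 = k by omega]
  have e : ∀ i : ℕ, (2 : ℝ) ^ j0 / 2 ^ (j0 + i) = (1 / 2) ^ i := by
    intro i; rw [pow_add, one_div, inv_pow]; field_simp
  simp_rw [e]
  exact sum_geometric_two_le k

lemma WN.MM_exp (h : WN μ W) {j0 k K : ℕ} (hK : K = 2 ^ k) {L : ℝ} (hL : 2 ^ j0 ≤ L) (q : ℂ) {w : Z2 × Z2} (hw : w ∈ TT K)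
    {θ : ℝ} (hθ : 0 ≤ θ) :
    ∫⁻ ω, ENNReal.ofReal (rexp (θ / K * ∑ i ∈ Finset.range K, MM (fun i => W i ω) (Finset.Ico j0 (j0 + k)) (40 * 2 ^ j0) (tq L K q w i))) ∂μ ≤
      ENNReal.ofReal (2 * rexp (10 ^ 12 * θ ^ 2)) := by
  have hKp : 0 < K := by rw [hK]; positivity
  have hK0 : (0 : ℝ) < K := by exact_mod_cast hKp
  have hL0 : 0 < L := lt_of_lt_of_le (by positivity) hL
  set J := Finset.Ico j0 (j0 + k) with hJ
  set r : ℕ → Z2 := fun i => rd (tq L K q w i) with hr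
  set a : Ω → ℝ := fun ω => -(2 * θ / K) * ∑ i ∈ Finset.range K, ∑ j ∈ J, xi (fun a => W a ω) j (r i) with ha
  set b : Ω → ℝ := fun ω => ∑ x ∈ (Finset.range K ×ˢ J).sigma (fun x => AN (r x.1) (40 * 2 ^ j0) (2 ^ x.2)),
    (2 * θ / K * (√102 * (4 ^ x.1.2 : ℝ)⁻¹)) * |zt (fun i => W i ω) x.1.2 x.2| with hb
  have hpt : ∀ ω, ENNReal.ofReal (rexp (θ / K * ∑ i ∈ Finset.range K, MM (fun i => W i ω) J (40 * 2 ^ j0) (tq L K q w i))) ≤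
      ENNReal.ofReal (1 / 2) * (ENNReal.ofReal (rexp (a ω)) + ENNReal.ofReal (rexp (b ω))) := by
    intro ω
    rw [← ENNReal.ofReal_add (by positivity) (by positivity), ← ENNReal.ofReal_mul (by norm_num)]
    refine ENNReal.ofReal_le_ofReal ?_
    have e : θ / K * ∑ i ∈ Finset.range K, MM (fun i => W i ω) J (40 * 2 ^ j0) (tq L K q w i) = a ω / 2 + b ω / 2 := by
      simp only [ha, hb, MM]
      rw [Finset.sum_sigma, Finset.sum_product, Finset.sum_add_distrib, Finset.sum_neg_distrib, mul_add]
      congr 1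
      · simp only [hr]; ring
      · rw [Finset.mul_sum, Finset.sum_div]
        refine Finset.sum_congr rfl fun i _ => ?_
        rw [Finset.mul_sum, Finset.sum_div]
        refine Finset.sum_congr rfl fun j _ => ?_
        rw [Finset.mul_sum, Finset.sum_div]
        refine Finset.sum_congr rfl fun y _ => ?_
        ring
    rw [e, Real.exp_add]
    have e1 : rexp (a ω) = rexp (a ω / 2) ^ 2 := by rw [← Real.exp_nat_mul]; congr 1; push_cast; ring
    have e2 : rexp (b ω) = rexp (b ω / 2) ^ 2 := by rw [← Real.exp_nat_mul]; congr 1; push_cast; ring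
    rw [e1, e2]
    nlinarith [sq_nonneg (rexp (a ω / 2) - rexp (b ω / 2))]
  have hA : ∫⁻ ω, ENNReal.ofReal (rexp (a ω)) ∂μ ≤ ENNReal.ofReal (rexp (10 ^ 12 * θ ^ 2)) := by
    refine (h.tube_exp J r (fun j => 17 * 2 ^ j / 2 ^ j0) (fun j hj z => ?_) _).trans (ENNReal.ofReal_le_ofReal (Real.exp_le_exp.2 ?_))
    · refine (tube_count hKp hL0 q hw (2 ^ j) z).trans ?_
      rw [hJ, Finset.mem_Ico] at hj
      have h1 : (2 : ℝ) ^ j0 ≤ 2 ^ j := pow_le_pow_right₀ (by norm_num) hj.1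
      have h2 : (1 : ℝ) ≤ 2 ^ j := one_le_pow₀ (by norm_num)
      have h3 : (8 * ((2 ^ j : ℕ) : ℝ) + 8) / L ≤ (16 * 2 ^ j) / 2 ^ j0 := by
        push_cast
        gcongr
        linarith
      have h4 : (1 : ℝ) ≤ 2 ^ j / 2 ^ j0 := by rw [le_div_iff₀ (by positivity)]; linarith
      have e : (17 : ℝ) * 2 ^ j / 2 ^ j0 = 16 * 2 ^ j / 2 ^ j0 + 2 ^ j / 2 ^ j0 := by ring
      rw [e]
      linarith
    · have h1 : ∑ j ∈ J, (17 : ℝ) * 2 ^ j / 2 ^ j0 ≤ 17 * K := by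
        rw [hJ, Finset.sum_Ico_eq_sum_range, show j0 + k - j0 = k by omega]
        have e : ∀ i : ℕ, (17 : ℝ) * 2 ^ (j0 + i) / 2 ^ j0 = 17 * 2 ^ i := by
          intro i; rw [pow_add]; field_simp
        simp_rw [e, ← Finset.mul_sum]
        rw [geom_sum_eq (by norm_num)]
        rw [hK]; push_cast; linarith
      calc _ ≤ 51 * (-(2 * θ / K)) ^ 2 * K * (17 * K) := by gcongr
        _ = 3468 * θ ^ 2 := by field_simp; ring
        _ ≤ _ := by nlinarith [sq_nonneg θ]
  have hB : ∫⁻ ω, ENNReal.ofReal (rexp (b ω)) ∂μ ≤ ENNReal.ofReal (2 * rexp (10 ^ 12 * θ ^ 2)) := by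
    refine (h.jens _ (fun x : (_ : ℕ × ℕ) × Z2 => 2 * θ / K * (√102 * (4 ^ x.1.2 : ℝ)⁻¹)) (fun x _ => by positivity) (fun x => (x.1.2, x.2))
      (C := 2 * θ * 300000) ?_).trans (ENNReal.ofReal_le_ofReal ?_)
    · rw [Finset.sum_sigma, Finset.sum_product]
      simp only [Finset.sum_const, nsmul_eq_mul]
      calc _ ≤ ∑ i ∈ Finset.range K, ∑ j ∈ J, 2 * θ / K * (150000 * (2 ^ j0 / 2 ^ j)) := by
            refine Finset.sum_le_sum fun i _ => Finset.sum_le_sum fun j hj => ?_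
            have h1 := AN_card (r i) (40 * 2 ^ j0) (2 ^ j)
            push_cast at h1
            rw [hJ, Finset.mem_Ico] at hj
            have h0 : (2 : ℝ) ^ j0 ≤ 2 ^ j := pow_le_pow_right₀ (by norm_num) hj.1
            have h00 : (0 : ℝ) < 2 ^ j0 := by positivity
            have h4 : (4 : ℝ) ^ j = 2 ^ j * 2 ^ j := by rw [show (4 : ℝ) = 2 * 2 by norm_num, mul_pow]
            have h2 : ((AN (r i) (40 * 2 ^ j0) (2 ^ j)).card : ℝ) ≤ 13120 * (2 ^ j * 2 ^ j0) := by nlinarith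
            calc _ ≤ 13120 * (2 ^ j * 2 ^ j0) * (2 * θ / K * (11 * (4 ^ j : ℝ)⁻¹)) := by
                  gcongr
                  exact sqrt102
              _ = 2 * θ / K * (144320 * (2 ^ j0 / 2 ^ j)) := by rw [h4]; field_simp; ring
              _ ≤ _ := by gcongr; norm_num
        _ = 2 * θ * 150000 * ∑ j ∈ J, (2 : ℝ) ^ j0 / 2 ^ j := by
            rw [Finset.sum_const, Finset.card_range, nsmul_eq_mul, ← Finset.mul_sum, ← Finset.mul_sum]
            field_simp
        _ ≤ 2 * θ * 150000 * 2 := by gcongr; exact half_sum j0 k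
        _ = _ := by ring
    · gcongr
      nlinarith [sq_nonneg θ]
  have hma : Measurable fun ω => ENNReal.ofReal (rexp (a ω)) := by
    refine Measurable.ennreal_ofReal (Measurable.exp (Measurable.const_mul ?_ _))
    exact Finset.measurable_sum _ fun i _ => Finset.measurable_sum _ fun j _ => xi_meas j (fun z => h.meas _) _
  have hmb : Measurable fun ω => ENNReal.ofReal (rexp (b ω)) := by
    refine Measurable.ennreal_ofReal (Measurable.exp ?_)
    exact Finset.measurable_sum _ fun i _ => ((zt_meas _ (fun z => h.meas _) _).abs).const_mul _
  refine (lintegral_mono hpt).trans ?_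
  have hmab : Measurable fun ω => ENNReal.ofReal (rexp (a ω)) + ENNReal.ofReal (rexp (b ω)) := hma.add hmb
  rw [lintegral_const_mul _ hmab, lintegral_add_left hma]
  calc _ ≤ ENNReal.ofReal (1 / 2) * (ENNReal.ofReal (rexp (10 ^ 12 * θ ^ 2)) + ENNReal.ofReal (2 * rexp (10 ^ 12 * θ ^ 2))) := by gcongr
    _ ≤ _ := by
      rw [← ENNReal.ofReal_add (by positivity) (by positivity), ← ENNReal.ofReal_mul (by norm_num)]
      refine ENNReal.ofReal_le_ofReal ?_
      have := Real.exp_pos (10 ^ 12 * θ ^ 2)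
      generalize rexp (10 ^ 12 * θ ^ 2) = E at this ⊢
      linarith

end


/-- sigma algebra of the levels in `A` -/
@[reducible] def FA {Ω : Type*} (W : ℕ × Z2 → Ω → ℝ) (A : Set ℕ) : MeasurableSpace Ω :=
  ⨆ i ∈ {i : ℕ × Z2 | i.1 ∈ A}, MeasurableSpace.comap (W i) inferInstance

lemma FA_meas {Ω : Type*} (W : ℕ × Z2 → Ω → ℝ) {A : Set ℕ} {j : ℕ} (hj : j ∈ A) (z : Z2) : Measurable[FA W A] (W (j, z)) := by
  refine Measurable.mono (comap_measurable (W (j, z))) ?_ le_rfl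
  exact le_iSup₂_of_le (j, z) hj le_rfl

lemma YY_meas {Ω : Type*} {m : MeasurableSpace Ω} {W : ℕ × Z2 → Ω → ℝ} {j : ℕ} (hW : ∀ i < j, ∀ z, Measurable (W (i, z))) (y : Z2) :
    Measurable fun ω => YY (fun i => W i ω) j y :=
  Finset.measurable_sum _ fun i hi => xi_meas i (hW i (Finset.mem_range.1 hi)) y

lemma HH_meas {Ω : Type*} {m : MeasurableSpace Ω} {W : ℕ × Z2 → Ω → ℝ} {J : Finset ℕ} (hW : ∀ i ∈ J, ∀ z, Measurable (W (i, z))) (ρ : ℕ) (c : ℂ) :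
    Measurable fun ω => HH (fun i => W i ω) J ρ c :=
  Finset.measurable_sum _ fun i hi => Finset.measurable_sum _ fun y _ => ((zt_meas i (hW i hi) y).abs).const_mul _

lemma MM_meas {Ω : Type*} {m : MeasurableSpace Ω} {W : ℕ × Z2 → Ω → ℝ} {J : Finset ℕ} (hW : ∀ i ∈ J, ∀ z, Measurable (W (i, z))) (ρ : ℕ) (c : ℂ) :
    Measurable fun ω => MM (fun i => W i ω) J ρ c :=
  (Finset.measurable_sum _ fun i hi => xi_meas i (hW i hi) _).neg.add
    (Finset.measurable_sum _ fun i hi => Finset.measurable_sum _ fun y _ => ((zt_meas i (hW i hi) y).abs).const_mul _)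

lemma YY_split (W : ℕ × Z2 → ℝ) {a b : ℕ} (hab : a ≤ b) (z : Z2) : YY W b z = YY W a z + ∑ j ∈ Finset.Ico a b, xi W j z :=
  (Finset.sum_range_add_sum_Ico (fun j => xi W j z) hab).symm

/-- scales -/
noncomputable def Ln (K : ℕ) : ℕ → ℝ
  | 0 => 1
  | n + 1 => K * (Ln K n + 2)

lemma Ln_lb (K : ℕ) (n : ℕ) : (K : ℝ) ^ n ≤ Ln K n := by
  induction n with
  | zero => simp [Ln]
  | succ n ih => rw [Ln, pow_succ']; gcongr; linarith

lemma Ln_ub {K : ℕ} (hK : 8 ≤ K) (n : ℕ) : Ln K n + 3 ≤ 4 * (K : ℝ) ^ n := by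
  have hK0 : (8 : ℝ) ≤ K := by exact_mod_cast hK
  induction n with
  | zero => simp [Ln]; norm_num
  | succ n ih => rw [Ln, pow_succ']; nlinarith

/-- the basic random variables -/
noncomputable def SN (γ Λ ϑ s : ℝ) (k : ℕ) (W : ℕ × Z2 → ℝ) (n : ℕ) (q : ℂ) : ENNReal :=
  SS γ Λ ϑ (Ln (2 ^ k) n) (((2 ^ k : ℕ) : ℝ) ^ (n * (1 + Λ - γ * s))) (fun z => YY W (k * n) z) q

lemma SN_meas {Ω : Type*} {m : MeasurableSpace Ω} {W : ℕ × Z2 → Ω → ℝ} (γ Λ ϑ s : ℝ) (k n : ℕ) (hW : ∀ i < k * n, ∀ z, Measurable (W (i, z))) (q : ℂ) :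
    Measurable fun ω => SN γ Λ ϑ s k (fun i => W i ω) n q :=
  SS_meas γ Λ ϑ _ _ (fun z ω => YY (fun i => W i ω) (k * n) z) (fun z => YY_meas hW z) q

lemma SS_base {γ Λ ϑ L τ H : ℝ} {Y : Z2 → ℝ} {q : ℂ} (hγ : 0 < γ) (hΛ : 0 ≤ Λ) (hϑ : 0 < ϑ) (hL : 1 ≤ L) (hτ0 : 0 < τ) (hτ : τ ≤ L ^ (1 + Λ))
    (hY : ∀ z, ‖cx z - q‖ ≤ 9 * L → -H ≤ Y z) : SS γ Λ ϑ L τ Y q ≤ ENNReal.ofReal (rexp (ϑ * γ * H)) := by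
  refine SS_le fun p ℓ hp hq => ENNReal.ofReal_le_ofReal ?_
  have hL0 : 0 < L := by linarith
  have hℓ := hp.pos hL0
  have hℓ0 : (0 : ℝ) < ℓ := by exact_mod_cast hℓ
  have h1 : (ℓ : ℝ) ^ (1 + Λ) * rexp (-(γ * H)) ≤ Ph γ Λ Y p ℓ := by
    unfold Ph
    rw [Real.rpow_add hℓ0, Real.rpow_one]
    have : (ℓ : ℝ) * rexp (-(γ * H)) ≤ ∑ t ∈ Finset.range ℓ, rexp (γ * Y (p t)) := by
      have h2 : ∀ t ∈ Finset.range ℓ, rexp (-(γ * H)) ≤ rexp (γ * Y (p t)) := by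
        intro t ht
        rw [Real.exp_le_exp]
        have h3 := hp.ins t (Finset.mem_range.1 ht)
        have h4 := hY (p t) (by
          have := nrm_tri (cx (p t)) (cx (p 0)) q
          linarith)
        nlinarith
      have := Finset.card_nsmul_le_sum _ _ _ h2
      simpa [nsmul_eq_mul] using this
    calc _ = (ℓ : ℝ) * rexp (-(γ * H)) * (ℓ : ℝ) ^ Λ := by ring
      _ ≤ _ := by gcongr
  have h2 : L ^ (1 + Λ) ≤ (ℓ : ℝ) ^ (1 + Λ) := Real.rpow_le_rpow hL0.le hp.len (by linarith)
  have h3 : τ / Ph γ Λ Y p ℓ ≤ rexp (γ * H) := by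
    rw [div_le_iff₀ (Ph_pos hℓ)]
    calc τ ≤ (ℓ : ℝ) ^ (1 + Λ) := hτ.trans h2
      _ = rexp (γ * H) * ((ℓ : ℝ) ^ (1 + Λ) * rexp (-(γ * H))) := by
        rw [mul_left_comm, ← Real.exp_add]; simp
      _ ≤ _ := by gcongr
  calc (τ / Ph γ Λ Y p ℓ) ^ ϑ ≤ rexp (γ * H) ^ ϑ := Real.rpow_le_rpow (div_nonneg hτ0.le (Ph_pos hℓ).le) h3 hϑ.le
    _ = _ := by rw [← Real.exp_mul]; congr 1; ring

section
variable {Ω : Type*} [mΩ : MeasurableSpace Ω] {μ : Measure Ω} [IsProbabilityMeasure μ] {W : ℕ × Z2 → Ω → ℝ}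

lemma WN.lmul (h : WN μ W) {A B : Set ℕ} (hAB : Disjoint A B) {f g : Ω → ENNReal} (hf : Measurable[FA W A] f) (hg : Measurable[FA W B] g) :
    ∫⁻ ω, f ω * g ω ∂μ = (∫⁻ ω, f ω ∂μ) * ∫⁻ ω, g ω ∂μ := by
  have hle : ∀ i, MeasurableSpace.comap (W i) inferInstance ≤ mΩ := fun i => (h.meas i).comap_le
  have hi := indep_iSup_of_disjoint hle h.ind (S := {i : ℕ × Z2 | i.1 ∈ A}) (T := {i : ℕ × Z2 | i.1 ∈ B})
    (Set.disjoint_left.2 fun i h1 h2 => Set.disjoint_left.1 hAB h1 h2)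
  exact lintegral_mul_eq_lintegral_mul_lintegral_of_independent_measurableSpace (iSup₂_le fun i _ => hle i) (iSup₂_le fun i _ => hle i) hi hf hg

lemma WN.SN_zero (γ Λ ϑ s : ℝ) (hγ : 0 < γ) (hΛ : 0 ≤ Λ) (hϑ : 0 < ϑ) (k : ℕ) (q : ℂ) (W : ℕ × Z2 → ℝ) : SN γ Λ ϑ s k W 0 q ≤ 1 := by
  unfold SN
  refine (SS_base (H := 0) hγ hΛ hϑ (by simp [Ln]) (by simp) (by simp [Ln]) ?_).trans (by simp)
  intro z _
  simp [YY]

lemma WN.SN_one (h : WN μ W) {γ Λ ϑ s : ℝ} (hγ : 0 < γ) (hΛ : 0 ≤ Λ) (hϑ : 0 < ϑ) (hs : 0 < s) {k : ℕ} (hk : 3 ≤ k) (q : ℂ) :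
    ∫⁻ ω, SN γ Λ ϑ s k (fun i => W i ω) 1 q ∂μ ≤
      ENNReal.ofReal (2 * rexp ((ϑ * γ * (k * (11 * (1 + 80 * ((2 ^ k : ℕ) : ℝ)) ^ 2))) ^ 2 / 2)) := by
  have hK : 8 ≤ 2 ^ k := by calc 8 = 2 ^ 3 := by norm_num
    _ ≤ _ := Nat.pow_le_pow_right (by norm_num) hk
  have hK1 : (8 : ℝ) ≤ ((2 ^ k : ℕ) : ℝ) := by exact_mod_cast hK
  have h1 := h.HH_exp (Finset.Ico 0 (k * 1)) (ρ := 40 * 2 ^ k) q (b := 80 * ((2 ^ k : ℕ) : ℝ)) (by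
    intro j _
    have : (1 : ℝ) ≤ 2 ^ j := one_le_pow₀ (by norm_num)
    push_cast
    nlinarith [show (0 : ℝ) < 2 ^ k by positivity]) (θ := ϑ * γ) (by positivity)
  rw [Nat.card_Ico, mul_one, Nat.sub_zero] at h1
  refine le_trans (lintegral_mono fun ω => ?_) h1
  have hub := Ln_ub hK 1
  have hlb := Ln_lb (2 ^ k) 1
  rw [pow_one] at hub hlb
  refine SS_base hγ hΛ hϑ (by linarith) (by positivity) ?_ ?_
  · rw [Nat.cast_one, one_mul]
    calc _ ≤ ((2 ^ k : ℕ) : ℝ) ^ (1 + Λ) := Real.rpow_le_rpow_of_exponent_le (by linarith) (by nlinarith)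
      _ ≤ _ := Real.rpow_le_rpow (by linarith) hlb (by linarith)
  · intro z hz
    have := HH_spec (fun i => W i ω) (Finset.Ico 0 (k * 1)) (ρ := 40 * 2 ^ k) hz (by push_cast at hub hK1 ⊢; linarith)
    rw [YY_split _ (Nat.zero_le _)]
    simpa [YY] using this

lemma WN.prod_int (h : WN μ W) {γ Λ ϑ s : ℝ} {k n : ℕ} {K : ℕ} (hK : 0 < K) (c : ℕ → ℂ) {Z : ENNReal}
    (hZ : ∀ q, ∫⁻ ω, SN γ Λ ϑ s k (fun i => W i ω) n q ∂μ ≤ Z) :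
    ∫⁻ ω, ∏ i ∈ Finset.range K, SN γ Λ ϑ s k (fun i => W i ω) n (c i) ^ (1 / K : ℝ) ∂μ ≤ Z := by
  have hK0 : (0 : ℝ) < K := by exact_mod_cast hK
  have hs1 : ∑ i ∈ Finset.range K, (1 / K : ℝ) = 1 := by
    simp [hK0.ne']
  refine (ENNReal.lintegral_prod_norm_pow_le (Finset.range K) (fun i _ => (SN_meas γ Λ ϑ s k n (fun i _ z => h.meas _) (c i)).aemeasurable)
    (p := fun _ => (1 / K : ℝ)) hs1 (fun i _ => by positivity)).trans ?_
  calc _ ≤ ∏ i ∈ Finset.range K, Z ^ (1 / K : ℝ) := by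
        refine Finset.prod_le_prod' fun i _ => ?_
        exact ENNReal.rpow_le_rpow (hZ _) (by positivity)
    _ = Z := by
      rw [Finset.prod_const, Finset.card_range, ← ENNReal.rpow_natCast, ← ENNReal.rpow_mul]
      rw [one_div, inv_mul_cancel₀ hK0.ne', ENNReal.rpow_one]

lemma WN.step (h : WN μ W) {γ Λ ϑ s : ℝ} (hγ : 0 < γ) (hΛ : 0 ≤ Λ) (hϑ : 0 < ϑ) {k : ℕ} (hk : 3 ≤ k) {n : ℕ} {Z : ENNReal}
    (hZ : ∀ q, ∫⁻ ω, SN γ Λ ϑ s k (fun i => W i ω) n q ∂μ ≤ Z) (hZ1 : ∀ q, ∫⁻ ω, SN γ Λ ϑ s k (fun i => W i ω) (n + 1) q ∂μ ≤ Z) (q : ℂ)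
    {K : ℕ} (hKk : K = 2 ^ k) :
    ∫⁻ ω, SN γ Λ ϑ s k (fun i => W i ω) (n + 2) q ∂μ ≤
      ENNReal.ofReal ((K : ℝ) ^ (-(ϑ * γ * s))) * ((TT K).card * (ENNReal.ofReal (2 * rexp (10 ^ 12 * (ϑ * γ) ^ 2)) * Z)) +
      ENNReal.ofReal (((K : ℝ) ^ (2 * (1 + Λ - γ * s)) / ((K ^ 2 + 1 : ℕ) : ℝ) ^ (1 + Λ)) ^ ϑ) *
        ENNReal.ofReal (2 * rexp ((ϑ * γ * ((2 * k : ℕ) * (11 * (1 + 80 * (K : ℝ) ^ 2) ^ 2))) ^ 2 / 2)) * ((bx (50 * K ^ 2)).card * Z) := by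
  have hK : 8 ≤ K := by
    rw [hKk]
    calc 8 = 2 ^ 3 := by norm_num
      _ ≤ _ := Nat.pow_le_pow_right (by norm_num) hk
  have hK1 : (8 : ℝ) ≤ K := by exact_mod_cast hK
  have hK0 : (0 : ℝ) < K := by linarith
  have hKc : (K : ℝ) = 2 ^ k := by rw [hKk]; push_cast; rfl
  have hpw : ∀ m : ℕ, (K : ℝ) ^ m = 2 ^ (k * m) := fun m => by rw [hKc, ← pow_mul]
  set J1 := Finset.Ico (k * (n + 1)) (k * (n + 1) + k) with hJ1
  set J2 := Finset.Ico (k * n) (k * (n + 2)) with hJ2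
  set ρ1 : ℕ := 40 * 2 ^ (k * (n + 1)) with hρ1
  set ρ2 : ℕ := 40 * 2 ^ (k * (n + 2)) with hρ2
  have hkn : k * (n + 2) = k * (n + 1) + k := by ring
  have u1 := Ln_ub hK (n + 1)
  have u2 := Ln_ub hK (n + 2)
  have l0 := Ln_lb K n
  have l1 := Ln_lb K (n + 1)
  have o1 : (1 : ℝ) ≤ K ^ (n + 1) := one_le_pow₀ (by linarith)
  have o2 : (1 : ℝ) ≤ K ^ (n + 2) := one_le_pow₀ (by linarith)
  have o0 : (1 : ℝ) ≤ K ^ n := one_le_pow₀ (by linarith)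
  have hpt : ∀ ω, SN γ Λ ϑ s k (fun i => W i ω) (n + 2) q ≤
      ENNReal.ofReal ((K : ℝ) ^ (-(ϑ * γ * s))) * ∑ w ∈ TT K,
      (ENNReal.ofReal (rexp (ϑ * γ / K * ∑ i ∈ Finset.range K, MM (fun i => W i ω) J1 ρ1 (tq (Ln K (n + 1)) K q w i))) *
        ∏ i ∈ Finset.range K, SN γ Λ ϑ s k (fun i => W i ω) (n + 1) (tq (Ln K (n + 1)) K q w i) ^ (1 / K : ℝ)) +
      ENNReal.ofReal (((K : ℝ) ^ (2 * (1 + Λ - γ * s)) / ((K ^ 2 + 1 : ℕ) : ℝ) ^ (1 + Λ)) ^ ϑ) *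
      (∑ z ∈ bx (50 * K ^ 2), ENNReal.ofReal (rexp (ϑ * γ * HH (fun i => W i ω) J2 ρ2 q)) *
        SN γ Λ ϑ s k (fun i => W i ω) n (q + Ln K n * cx z)) := by
    intro ω
    have := SS_step (γ := γ) (Λ := Λ) (ϑ := ϑ) (τ'' := (K : ℝ) ^ (n * (1 + Λ - γ * s))) (τ := (K : ℝ) ^ ((n + 1 : ℕ) * (1 + Λ - γ * s)))
      (τ' := (K : ℝ) ^ ((n + 2 : ℕ) * (1 + Λ - γ * s))) hγ hΛ hϑ (by positivity) (by positivity) (by positivity)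
      (Y'' := fun z => YY (fun i => W i ω) (k * n) z) (Y := fun z => YY (fun i => W i ω) (k * (n + 1)) z)
      (Y' := fun z => YY (fun i => W i ω) (k * (n + 2)) z) hK (L' := Ln K n) (L := Ln K (n + 1)) (D := Ln K (n + 2))
      (H := HH (fun i => W i ω) J2 ρ2 q) (by linarith) rfl rfl (q := q) (fun c => MM (fun i => W i ω) J1 ρ1 c) (by
        intro c z hz
        have := MM_spec (fun i => W i ω) J1 (ρ := ρ1) hz (by rw [hρ1]; push_cast; rw [← hpw]; linarith)
        have e := YY_split (fun i => W i ω) (show k * (n + 1) ≤ k * (n + 2) by rw [hkn]; omega) z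
        rw [e, hkn]; linarith) (by
        intro z hz
        have := HH_spec (fun i => W i ω) J2 (ρ := ρ2) hz (by rw [hρ2]; push_cast; rw [← hpw]; linarith)
        have e := YY_split (fun i => W i ω) (show k * n ≤ k * (n + 2) by gcongr; omega) z
        rw [e]; linarith)
    have e1 : ((K : ℝ) ^ ((n + 2 : ℕ) * (1 + Λ - γ * s)) / ((K : ℝ) ^ ((n + 1 : ℕ) * (1 + Λ - γ * s)) * (K : ℝ) ^ (1 + Λ))) ^ ϑ = (K : ℝ) ^ (-(ϑ * γ * s)) := by
      rw [← Real.rpow_add hK0, ← Real.rpow_sub hK0, ← Real.rpow_mul hK0.le]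
      congr 1; push_cast; ring
    have e2 : (K : ℝ) ^ ((n + 2 : ℕ) * (1 + Λ - γ * s)) / ((K : ℝ) ^ (n * (1 + Λ - γ * s)) * ((K ^ 2 + 1 : ℕ) : ℝ) ^ (1 + Λ)) =
        (K : ℝ) ^ (2 * (1 + Λ - γ * s)) / ((K ^ 2 + 1 : ℕ) : ℝ) ^ (1 + Λ) := by
      rw [← div_div, ← Real.rpow_sub hK0]
      congr 2; push_cast; ring
    rw [e1, e2] at this
    simp only [SN, ← hKk]
    refine this.trans (le_of_eq ?_)
    congr 1
    rw [mul_assoc, Finset.mul_sum (bx (50 * K ^ 2))]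
  refine (lintegral_mono hpt).trans ?_
  have mM : ∀ (c : ℕ → ℂ), Measurable[FA W {j | k * (n + 1) ≤ j}] fun ω =>
      ENNReal.ofReal (rexp (ϑ * γ / K * ∑ i ∈ Finset.range K, MM (fun i => W i ω) J1 ρ1 (c i))) := by
    intro c
    refine Measurable.ennreal_ofReal (Measurable.exp (Measurable.const_mul ?_ _))
    exact Finset.measurable_sum _ fun i _ => MM_meas (fun j hj z => FA_meas W (by rw [hJ1, Finset.mem_Ico] at hj; exact hj.1) z) _ _
  have mM' : ∀ (c : ℕ → ℂ), Measurable fun ω =>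
      ENNReal.ofReal (rexp (ϑ * γ / K * ∑ i ∈ Finset.range K, MM (fun i => W i ω) J1 ρ1 (c i))) := by
    intro c
    refine Measurable.ennreal_ofReal (Measurable.exp (Measurable.const_mul ?_ _))
    exact Finset.measurable_sum _ fun i _ => MM_meas (fun j hj z => h.meas _) _ _
  have mP : ∀ (c : ℕ → ℂ), Measurable[FA W {j | j < k * (n + 1)}] fun ω =>
      ∏ i ∈ Finset.range K, SN γ Λ ϑ s k (fun i => W i ω) (n + 1) (c i) ^ (1 / K : ℝ) := by
    intro c
    exact Finset.measurable_prod _ fun i _ => (SN_meas γ Λ ϑ s k (n + 1) (fun j hj z => FA_meas W (j := j) hj z) _).pow_const _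
  have mP' : ∀ (c : ℕ → ℂ), Measurable fun ω =>
      ∏ i ∈ Finset.range K, SN γ Λ ϑ s k (fun i => W i ω) (n + 1) (c i) ^ (1 / K : ℝ) := by
    intro c
    exact Finset.measurable_prod _ fun i _ => (SN_meas γ Λ ϑ s k (n + 1) (fun j hj z => h.meas _) _).pow_const _
  have mH : Measurable[FA W {j | k * n ≤ j}] fun ω => ENNReal.ofReal (rexp (ϑ * γ * HH (fun i => W i ω) J2 ρ2 q)) :=
    Measurable.ennreal_ofReal (Measurable.exp (Measurable.const_mul
      (HH_meas (fun j hj z => FA_meas W (by rw [hJ2, Finset.mem_Ico] at hj; exact hj.1) z) _ _) _))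
  have mH' : Measurable fun ω => ENNReal.ofReal (rexp (ϑ * γ * HH (fun i => W i ω) J2 ρ2 q)) :=
    Measurable.ennreal_ofReal (Measurable.exp (Measurable.const_mul (HH_meas (fun j hj z => h.meas _) _ _) _))
  have mS : ∀ c, Measurable[FA W {j | j < k * n}] fun ω => SN γ Λ ϑ s k (fun i => W i ω) n c :=
    fun c => SN_meas γ Λ ϑ s k n (fun j hj z => FA_meas W (j := j) hj z) _
  have mS' : ∀ c, Measurable fun ω => SN γ Λ ϑ s k (fun i => W i ω) n c :=
    fun c => SN_meas γ Λ ϑ s k n (fun j hj z => h.meas _) _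
  have dj : ∀ m : ℕ, Disjoint {j | m ≤ j} {j | j < m} := fun m => Set.disjoint_left.2 fun j h1 h2 => by
    rw [Set.mem_ofPred_eq] at h1 h2; omega
  have m1 : ∀ w ∈ TT K, Measurable fun ω => ENNReal.ofReal (rexp (ϑ * γ / K * ∑ i ∈ Finset.range K, MM (fun i => W i ω) J1 ρ1 (tq (Ln K (n + 1)) K q w i))) *
        ∏ i ∈ Finset.range K, SN γ Λ ϑ s k (fun i => W i ω) (n + 1) (tq (Ln K (n + 1)) K q w i) ^ (1 / K : ℝ) :=
    fun w _ => (mM' _).mul (mP' _)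
  have m1s := Finset.measurable_sum _ m1
  have m2 : ∀ z ∈ bx (50 * K ^ 2), Measurable fun ω => ENNReal.ofReal (rexp (ϑ * γ * HH (fun i => W i ω) J2 ρ2 q)) *
        SN γ Λ ϑ s k (fun i => W i ω) n (q + Ln K n * cx z) := fun z _ => mH'.mul (mS' _)
  have m2s := Finset.measurable_sum _ m2
  rw [lintegral_add_left (Measurable.const_mul m1s _), lintegral_const_mul _ m1s, lintegral_const_mul _ m2s, lintegral_finsetSum _ m1, lintegral_finsetSum _ m2, mul_assoc (ENNReal.ofReal (((K : ℝ) ^ (2 * (1 + Λ - γ * s)) / ((K ^ 2 + 1 : ℕ) : ℝ) ^ (1 + Λ)) ^ ϑ))]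
  refine add_le_add (mul_le_mul_right ?_ _) (mul_le_mul_right ?_ _)
  · rw [← nsmul_eq_mul]
    refine Finset.sum_le_card_nsmul _ _ _ fun w hw => ?_
    rw [h.lmul (dj _) (mM _) (mP _)]
    refine mul_le_mul' ?_ (h.prod_int (by omega) _ hZ1)
    have := h.MM_exp (j0 := k * (n + 1)) hKk (L := Ln K (n + 1)) (by rw [← hpw]; exact l1) q hw (θ := ϑ * γ) (by positivity)
    exact this
  · rw [mul_left_comm, ← nsmul_eq_mul]
    refine Finset.sum_le_card_nsmul _ _ _ fun z hz => ?_
    rw [h.lmul (dj _) mH (mS _)]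
    refine mul_le_mul' ?_ (hZ _)
    have := h.HH_exp J2 (ρ := ρ2) q (b := 80 * (K : ℝ) ^ 2) (by
      intro j hj
      rw [hJ2, Finset.mem_Ico] at hj
      have h1 : (2 : ℝ) ^ (k * n) ≤ 2 ^ j := pow_le_pow_right₀ (by norm_num) hj.1
      rw [hρ2]; push_cast; rw [← hpw, pow_add]
      rw [← hpw] at h1
      nlinarith [sq_nonneg (K : ℝ)]) (θ := ϑ * γ) (by positivity)
    rw [hJ2, Nat.card_Ico, show k * (n + 2) - k * n = 2 * k by rw [mul_add]; omega] at this
    exact this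

end


lemma TT_card {K : ℕ} (hK : 1 ≤ K) : ((TT K).card : ℝ) ≤ (65 * K) ^ 4 := by
  have h1 : (TT K).card ≤ ((2 * (32 * K) + 1) ^ 2) * ((2 * (32 * K) + 1) ^ 2) := by
    unfold TT
    refine (Finset.card_filter_le _ _).trans ?_
    rw [Finset.card_product, bx_card]
  have h2 : ((2 * (32 * K) + 1) ^ 2) * ((2 * (32 * K) + 1) ^ 2) ≤ (65 * K) ^ 4 := by
    calc _ = (2 * (32 * K) + 1) ^ 4 := by ring
      _ ≤ _ := by gcongr; omega
  exact_mod_cast h1.trans h2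

lemma params {γ s : ℝ} (hγ : 0 < γ) (hs : 0 < s) : ∃ (k : ℕ) (Λ ϑ Z : ℝ), 3 ≤ k ∧ 0 < Λ ∧ 0 < ϑ ∧ 1 ≤ Z ∧
    ∀ (Ω : Type) [MeasurableSpace Ω] (μ : Measure Ω) [IsProbabilityMeasure μ] (W : ℕ × Z2 → Ω → ℝ), WN μ W → ∀ n q,
      ∫⁻ ω, SN γ Λ ϑ s k (fun i => W i ω) n q ∂μ ≤ ENNReal.ofReal Z := by
  set θ : ℝ := 5 / s with hθ
  have hθ0 : 0 < θ := by positivity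
  set ϑ : ℝ := θ / γ with hϑ
  have hϑ0 : 0 < ϑ := by positivity
  have e1 : ϑ * γ = θ := by rw [hϑ]; field_simp
  have e2 : θ * s = 5 := by rw [hθ]; field_simp
  set E : ℝ := 2 * rexp (10 ^ 12 * (ϑ * γ) ^ 2) with hE
  have hE0 : 0 < E := by positivity
  obtain ⟨k0, hk0⟩ := pow_unbounded_of_one_lt (2 * 65 ^ 4 * E) (show (1 : ℝ) < 2 by norm_num)
  set k := k0 + 3 with hk
  obtain ⟨K, hK⟩ : ∃ K : ℕ, K = 2 ^ k := ⟨_, rfl⟩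
  have hK8 : 8 ≤ K := by
    rw [hK]
    calc 8 = 2 ^ 3 := by norm_num
      _ ≤ _ := Nat.pow_le_pow_right (by norm_num) (by omega)
  have hK1 : (8 : ℝ) ≤ K := by exact_mod_cast hK8
  have hK0 : (0 : ℝ) < K := by linarith
  have hKE : 2 * 65 ^ 4 * E ≤ K := by
    rw [hK]; push_cast
    exact hk0.le.trans (pow_le_pow_right₀ (by norm_num) (by omega))
  set B : ℝ := 2 * rexp ((ϑ * γ * ((2 * k : ℕ) * (11 * (1 + 80 * (K : ℝ) ^ 2) ^ 2))) ^ 2 / 2) with hB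
  have hB0 : 0 < B := by positivity
  have hB1 : 2 ≤ B := by
    rw [hB]
    have := Real.one_le_exp (show 0 ≤ (ϑ * γ * ((2 * k : ℕ) * (11 * (1 + 80 * (K : ℝ) ^ 2) ^ 2))) ^ 2 / 2 by positivity)
    linarith
  set C : ℝ := ((bx (50 * K ^ 2)).card : ℝ) with hC
  set r : ℝ := (K : ℝ) ^ 2 / ((K ^ 2 + 1 : ℕ) : ℝ) with hr
  have hr0 : 0 < r := by positivity
  have hr1 : r < 1 := by
    rw [hr, div_lt_one (by positivity)]; push_cast; linarith
  have ht := tendsto_rpow_atTop_of_base_lt_one r (by linarith) hr1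
  have hC0 : 0 ≤ C := by positivity
  have hBC : 0 < 1 / (2 * B * (C + 1)) := by positivity
  obtain ⟨x0, hx0⟩ := (ht.eventually (eventually_le_nhds hBC)).exists_forall_of_atTop
  set Λ : ℝ := max 0 (x0 / ϑ) + 1 with hΛ
  have hΛ0 : 0 < Λ := by rw [hΛ]; positivity
  have hΛx : x0 ≤ (1 + Λ) * ϑ := by
    have : x0 / ϑ ≤ 1 + Λ := by rw [hΛ]; linarith [le_max_right 0 (x0 / ϑ)]
    rwa [div_le_iff₀ hϑ0] at this
  have hrb := hx0 _ hΛx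
  have hA1 : (K : ℝ) ^ (-(ϑ * γ * s)) * ((TT K).card * E) ≤ 1 / 2 := by
    rw [e1, e2, Real.rpow_neg hK0.le, show (5 : ℝ) = ((5 : ℕ) : ℝ) by norm_num, Real.rpow_natCast]
    have := TT_card (K := K) (by omega)
    rw [inv_mul_le_iff₀ (by positivity)]
    calc _ ≤ (65 * (K : ℝ)) ^ 4 * E := by gcongr
      _ = K ^ 4 * (65 ^ 4 * E) := by ring
      _ ≤ K ^ 4 * (K / 2) := by gcongr; linarith
      _ = _ := by ring
  have hA2 : ((K : ℝ) ^ (2 * (1 + Λ - γ * s)) / ((K ^ 2 + 1 : ℕ) : ℝ) ^ (1 + Λ)) ^ ϑ * B * C ≤ 1 / 2 := by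
    have h1 : ((K : ℝ) ^ (2 * (1 + Λ - γ * s)) / ((K ^ 2 + 1 : ℕ) : ℝ) ^ (1 + Λ)) ^ ϑ ≤ r ^ ((1 + Λ) * ϑ) := by
      rw [Real.rpow_mul hr0.le]
      refine Real.rpow_le_rpow (by positivity) ?_ hϑ0.le
      rw [hr, Real.div_rpow (by positivity) (by positivity)]
      gcongr
      rw [← Real.rpow_natCast (K : ℝ) 2, ← Real.rpow_mul hK0.le]
      refine Real.rpow_le_rpow_of_exponent_le (by linarith) ?_
      push_cast
      nlinarith [mul_pos hγ hs]
    calc _ ≤ 1 / (2 * B * (C + 1)) * B * C := by gcongr; exact h1.trans hrb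
      _ = C / (2 * (C + 1)) := by field_simp
      _ ≤ _ := by rw [div_le_div_iff₀ (by positivity) (by positivity)]; linarith
  refine ⟨k, Λ, ϑ, B, by omega, hΛ0, hϑ0, by linarith, ?_⟩
  intro Ω _ μ _ W hW n
  suffices H : (∀ q, ∫⁻ ω, SN γ Λ ϑ s k (fun i => W i ω) n q ∂μ ≤ ENNReal.ofReal B) ∧
      ∀ q, ∫⁻ ω, SN γ Λ ϑ s k (fun i => W i ω) (n + 1) q ∂μ ≤ ENNReal.ofReal B from H.1
  induction n with
  | zero =>
    refine ⟨fun q => ?_, fun q => ?_⟩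
    · refine (lintegral_mono fun ω => WN.SN_zero γ Λ ϑ s hγ hΛ0.le hϑ0 k q _).trans ?_
      rw [lintegral_const, measure_univ, one_mul, ← ENNReal.ofReal_one]
      exact ENNReal.ofReal_le_ofReal (by linarith)
    · refine (hW.SN_one hγ hΛ0.le hϑ0 hs (by omega) q).trans (ENNReal.ofReal_le_ofReal ?_)
      rw [hB, ← hK]
      gcongr
      · push_cast; linarith [(Nat.cast_nonneg k : (0 : ℝ) ≤ k)]
      · nlinarith
  | succ n ih =>
    refine ⟨ih.2, fun q => ?_⟩
    refine (hW.step hγ hΛ0.le hϑ0 (by omega) ih.1 ih.2 q hK).trans ?_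
    rw [← hE, ← hB, ← ENNReal.ofReal_natCast (TT K).card, ← ENNReal.ofReal_natCast (bx (50 * K ^ 2)).card, ← hC]
    rw [← ENNReal.ofReal_mul hE0.le, ← ENNReal.ofReal_mul (by positivity), ← ENNReal.ofReal_mul (by positivity), ← ENNReal.ofReal_mul (by positivity),
      ← ENNReal.ofReal_mul hC0, ← ENNReal.ofReal_mul (by positivity), ← ENNReal.ofReal_add (by positivity) (by positivity)]
    refine ENNReal.ofReal_le_ofReal ?_
    generalize (K : ℝ) ^ (-(ϑ * γ * s)) = a1 at hA1 ⊢
    generalize ((K : ℝ) ^ (2 * (1 + Λ - γ * s)) / ((K ^ 2 + 1 : ℕ) : ℝ) ^ (1 + Λ)) ^ ϑ = a2 at hA2 ⊢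
    have h1 := mul_le_mul_of_nonneg_right hA1 hB0.le
    have h2 := mul_le_mul_of_nonneg_right hA2 hB0.le
    linarith


/-- self-avoiding macroscopic paths -/
def Bad (N : ℕ) (κ : ℝ) : Set (List Z2) :=
  {P | LPathIn (VN N) P ∧ P.Nodup ∧ ∃ x y, P.head? = some x ∧ P.getLast? = some y ∧ κ * N ≤ eZ x y}

lemma eZ_cx (x y : Z2) : eZ x y = ‖cx x - cx y‖ := by
  rw [eZ, Complex.norm_eq_sqrt_sq_add_sq]
  simp [cx]

lemma adj_norm {x y : Z2} (h : Adj x y) : ‖cx x - cx y‖ ≤ 1 := by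
  refine (Complex.norm_le_abs_re_add_abs_im _).trans ?_
  simp only [cx, Complex.sub_re, Complex.sub_im]
  unfold Adj at h
  have : (|(x.1 : ℝ) - y.1| + |(x.2 : ℝ) - y.2|) = 1 := by exact_mod_cast h
  exact this.le

lemma VN_norm {N : ℕ} {z : Z2} (h : z ∈ VN N) : ‖cx z‖ ≤ 2 * N := by
  refine (Complex.norm_le_abs_re_add_abs_im _).trans ?_
  obtain ⟨h1, h2, h3, h4⟩ := h
  simp only [cx]
  have a1 : (0 : ℝ) ≤ z.1 := by exact_mod_cast h1
  have a2 : (z.1 : ℝ) ≤ N := by exact_mod_cast h2.le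
  have a3 : (0 : ℝ) ≤ z.2 := by exact_mod_cast h3
  have a4 : (z.2 : ℝ) ≤ N := by exact_mod_cast h4.le
  rw [abs_of_nonneg a1, abs_of_nonneg a3]
  linarith

lemma bad_piece {N : ℕ} {κ L : ℝ} {P : List Z2} (h : P ∈ Bad N κ) (hL0 : 0 < L) (hL : L ≤ κ * N) :
    ∃ ℓ, Pc L (fun t => P.getD t 0) ℓ ∧ ℓ < P.length := by
  obtain ⟨⟨hne, hch, hin⟩, hnd, x, y, hx, hy, hxy⟩ := h
  have hlen : 0 < P.length := List.length_pos_iff.2 hne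
  have gx : P.getD 0 0 = x := by
    cases P with
    | nil => simp at hx
    | cons a l => simpa using hx
  have gy : P.getD (P.length - 1) 0 = y := by
    rw [List.getLast?_eq_getElem?] at hy
    rw [List.getD_eq_getElem?_getD, hy]; rfl
  have hst : ∀ t, t + 1 < P.length → ‖cx (P.getD (t + 1) 0) - cx (P.getD t 0)‖ ≤ 1 := by
    intro t ht
    rw [List.getD_eq_getElem _ _ ht, List.getD_eq_getElem _ _ (by omega), norm_sub_rev]
    exact adj_norm (List.isChain_iff_getElem.1 hch t ht)
  obtain ⟨ℓ, h1, h2, h3⟩ := first_hit (f := fun t => ‖cx (P.getD t 0) - cx (P.getD 0 0)‖) (a := L) (ℓ := P.length - 1)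
    ⟨P.length - 1, le_rfl, by
      simp only [gx, gy]
      rw [eZ_cx, norm_sub_rev] at hxy
      linarith⟩
  exact ⟨ℓ, ⟨fun t ht => hst t (by omega), h3, h2⟩, by omega⟩

lemma bad_det {N : ℕ} {κ γ Λ ϑ L τ a H : ℝ} {P : List Z2} (h : P ∈ Bad N κ) (hγ : 0 < γ) (hΛ : 0 ≤ Λ) (hϑ : 0 < ϑ) (hτ : 0 < τ) (hL0 : 0 < L) (hL : L ≤ κ * N)
    {C : ℝ} (hC : 2 * N ≤ C * L) {r : ℕ} (hr : C + 2 ≤ r) {X Y : Z2 → ℝ} (hXY : ∀ z, ‖cx z - 0‖ ≤ 2 * N → Y z - H ≤ X z) (ha : 0 < a)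
    (hw : (∑ z ∈ P.toFinset, rexp (γ * X z)) * (P.length : ℝ) ^ Λ ≤ a) :
    ENNReal.ofReal ((τ / a) ^ ϑ) ≤ ∑ z ∈ bx r, ENNReal.ofReal (rexp (ϑ * γ * H)) * SS γ Λ ϑ L τ Y (0 + L * cx z) := by
  obtain ⟨ℓ, hp, hℓ⟩ := bad_piece h hL0 hL
  have hℓ0 := hp.pos hL0
  have hin : ∀ t < P.length, P.getD t 0 ∈ P := fun t ht => by rw [List.getD_eq_getElem _ _ ht]; exact List.getElem_mem ht
  have hn : ∀ t < P.length, ‖cx (P.getD t 0) - 0‖ ≤ 2 * N := fun t ht => by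
    rw [sub_zero]; exact VN_norm (h.1.2.2 _ (hin t ht))
  have hz : rd ((cx (P.getD 0 0) - 0) / L) ∈ bx r := rd_grid_bx hL0 ((hn 0 (by omega)).trans hC) hr
  have hd := rd_grid hL0 0 (cx (P.getD 0 0))
  have h1 : Ph γ Λ Y (fun t => P.getD t 0) ℓ * rexp (-(γ * H)) ≤ a := by
    refine le_trans ?_ hw
    unfold Ph
    have s1 : (∑ t ∈ Finset.range ℓ, rexp (γ * Y (P.getD t 0))) * rexp (-(γ * H)) ≤ ∑ z ∈ P.toFinset, rexp (γ * X z) := by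
      rw [Finset.sum_mul]
      calc _ ≤ ∑ t ∈ Finset.range ℓ, rexp (γ * X (P.getD t 0)) := by
            refine Finset.sum_le_sum fun t ht => ?_
            rw [← Real.exp_add, Real.exp_le_exp]
            have := hXY _ (hn t ((Finset.mem_range.1 ht).trans hℓ))
            nlinarith
        _ = ∑ z ∈ (Finset.range ℓ).image fun t => P.getD t 0, rexp (γ * X z) := by
            rw [Finset.sum_image]
            intro t ht t' ht' e
            have ht := (Finset.mem_range.1 ht).trans hℓ
            have ht' := (Finset.mem_range.1 ht').trans hℓ
            simp only [List.getD_eq_getElem _ _ ht, List.getD_eq_getElem _ _ ht'] at e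
            exact (h.2.1.getElem_inj_iff).1 e
        _ ≤ _ := by
            refine Finset.sum_le_sum_of_subset_of_nonneg ?_ fun _ _ _ => by positivity
            intro z hz
            obtain ⟨t, ht, rfl⟩ := Finset.mem_image.1 hz
            exact List.mem_toFinset.2 (hin t ((Finset.mem_range.1 ht).trans hℓ))
    have s2 : (ℓ : ℝ) ^ Λ ≤ (P.length : ℝ) ^ Λ := Real.rpow_le_rpow (by positivity) (by exact_mod_cast hℓ.le) hΛ
    calc _ = (∑ t ∈ Finset.range ℓ, rexp (γ * Y (P.getD t 0))) * rexp (-(γ * H)) * (ℓ : ℝ) ^ Λ := by ring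
      _ ≤ _ := by gcongr
  have hPh := Ph_pos (γ := γ) (Λ := Λ) (Y := Y) (p := fun t => P.getD t 0) hℓ0
  calc ENNReal.ofReal ((τ / a) ^ ϑ) ≤ ENNReal.ofReal (rexp (ϑ * γ * H) * (τ / Ph γ Λ Y (fun t => P.getD t 0) ℓ) ^ ϑ) := by
        refine ENNReal.ofReal_le_ofReal ?_
        have e : rexp (ϑ * γ * H) = rexp (γ * H) ^ ϑ := by rw [← Real.exp_mul]; congr 1; ring
        rw [e, ← Real.mul_rpow (by positivity) (by positivity)]
        refine Real.rpow_le_rpow (by positivity) ?_ hϑ.le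
        rw [← mul_div_assoc, div_le_div_iff₀ ha hPh]
        rw [Real.exp_neg] at h1
        have h2 : Ph γ Λ Y (fun t => P.getD t 0) ℓ ≤ a * rexp (γ * H) := by
          rwa [← div_eq_mul_inv, div_le_iff₀ (by positivity)] at h1
        nlinarith
    _ ≤ ENNReal.ofReal (rexp (ϑ * γ * H)) * SS γ Λ ϑ L τ Y (0 + L * cx (rd ((cx (P.getD 0 0) - 0) / L))) := by
        rw [ENNReal.ofReal_mul (by positivity)]
        refine mul_le_mul_right ?_ _
        exact le_SS hp (by linarith)
    _ ≤ _ := Finset.single_le_sum (f := fun z => ENNReal.ofReal (rexp (ϑ * γ * H)) * SS γ Λ ϑ L τ Y (0 + L * cx z)) (fun _ _ => zero_le) hz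

lemma scale_exists {K : ℕ} (hK : 8 ≤ K) {x : ℝ} (hx : 1 ≤ x) : ∃ n, Ln K n ≤ x ∧ x < Ln K (n + 1) := by
  classical
  have hex : ∃ n, x < Ln K n := by
    obtain ⟨n, hn⟩ := pow_unbounded_of_one_lt x (show (1 : ℝ) < K by exact_mod_cast (by omega : 1 < K))
    exact ⟨n, hn.trans_le (Ln_lb K n)⟩
  have hp : Nat.find hex ≠ 0 := by
    intro h0
    have := Nat.find_spec hex
    rw [h0] at this
    simp only [Ln] at this; linarith
  obtain ⟨n, hn⟩ := Nat.exists_eq_succ_of_ne_zero hp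
  refine ⟨n, not_lt.1 (Nat.find_min hex (by omega)), ?_⟩
  have := Nat.find_spec hex
  rwa [hn] at this


lemma top_bound {γ s : ℝ} (hγ : 0 < γ) (hs : 0 < s) (hγs : γ * s ≤ 1) : ∃ Λ ϑ : ℝ, 0 < Λ ∧ 0 < ϑ ∧ ∀ κ : ℝ, 0 < κ → κ < 1 → ∃ C : ℝ, 0 < C ∧ ∃ N0 : ℕ, ∀ N ≥ N0,
    ∀ (Ω : Type) [MeasurableSpace Ω] (μ : Measure Ω) [IsProbabilityMeasure μ] (W : ℕ × Z2 → Ω → ℝ), WN μ W → ∀ a : ℝ, 0 < a →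
      μ {ω | ∃ P ∈ Bad N κ, (∑ z ∈ P.toFinset, rexp (γ * YY (fun i => W i ω) (Nat.clog 2 N + 1) z)) * (P.length : ℝ) ^ Λ ≤ a} ≤
        ENNReal.ofReal (C * (a / (N : ℝ) ^ (1 + Λ - γ * s)) ^ ϑ) := by
  obtain ⟨k, Λ, ϑ, Z, hk, hΛ, hϑ, hZ1, hZ⟩ := params hγ hs
  refine ⟨Λ, ϑ, hΛ, hϑ, fun κ hκ hκ1 => ?_⟩
  obtain ⟨K, hK⟩ : ∃ K : ℕ, K = 2 ^ k := ⟨_, rfl⟩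
  have hK8 : 8 ≤ K := by
    rw [hK]
    calc 8 = 2 ^ 3 := by norm_num
      _ ≤ _ := Nat.pow_le_pow_right (by norm_num) (by omega)
  have hK1 : (8 : ℝ) ≤ K := by exact_mod_cast hK8
  have hK0 : (0 : ℝ) < K := by linarith
  have hKc : (K : ℝ) = 2 ^ k := by rw [hK]; push_cast; rfl
  have hpw : ∀ m : ℕ, (K : ℝ) ^ m = 2 ^ (k * m) := fun m => by rw [hKc, ← pow_mul]
  obtain ⟨m0, hm0⟩ := pow_unbounded_of_one_lt (8 * K / κ) (show (1 : ℝ) < 2 by norm_num)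
  set b : ℝ := 32 * K / κ with hb
  have hb0 : 0 < b := by positivity
  set r : ℕ := ⌈8 * K / κ + 2⌉₊ with hr
  have hr1 : 8 * K / κ + 2 ≤ r := Nat.le_ceil _
  set e : ℝ := 1 + Λ - γ * s with he
  have he0 : 0 < e := by linarith
  set B : ℝ := 2 * rexp ((ϑ * γ * ((m0 + 1 : ℕ) * (11 * (1 + b) ^ 2))) ^ 2 / 2) with hB
  set C1 : ℝ := (bx r).card * (B * Z) with hC1
  have hC10 : 0 ≤ C1 := by positivity
  set C2 : ℝ := ((4 * K / κ) ^ e) ^ ϑ with hC2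
  refine ⟨(C1 + 1) * C2, by positivity, ⌈κ⁻¹⌉₊ + 2, fun N hN Ω _ μ _ W hW a ha => ?_⟩
  have hN1 : κ⁻¹ ≤ N := (Nat.le_ceil _).trans (by exact_mod_cast (by omega : ⌈κ⁻¹⌉₊ ≤ N))
  have hN2 : 2 ≤ N := by omega
  have hN0 : (0 : ℝ) < N := by exact_mod_cast (by omega : 0 < N)
  have hκN : 1 ≤ κ * N := by rwa [inv_le_iff_one_le_mul₀' hκ] at hN1
  obtain ⟨n, hn1, hn2⟩ := scale_exists hK8 hκN
  have u1 := Ln_ub hK8 (n + 1)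
  have l0 := Ln_lb K n
  have o0 : (1 : ℝ) ≤ K ^ n := one_le_pow₀ (by linarith)
  have hNK : N ≤ 4 * K / κ * K ^ n := by
    rw [div_mul_eq_mul_div, le_div_iff₀ hκ]
    rw [pow_succ'] at u1
    linarith
  have hKN : (K : ℝ) ^ n ≤ N := by nlinarith
  set I := Nat.clog 2 N with hI
  have hI1 : N ≤ 2 ^ I := Nat.le_pow_clog (by norm_num) N
  have hI2 : 2 ^ I ≤ 2 * N := by
    have h1 := Nat.pow_pred_clog_lt_self (b := 2) (by norm_num) (x := N) (by omega)
    have h2 : 0 < I := Nat.clog_pos (by norm_num) hN2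
    obtain ⟨i, hi⟩ : ∃ i, I = i + 1 := ⟨I - 1, by omega⟩
    rw [← hI, hi] at h1
    rw [hi, pow_succ]
    simp only [Nat.pred_succ, Nat.pred_eq_sub_one, Nat.add_sub_cancel] at h1
    omega
  have hknI : k * n ≤ I := by
    have : (2 : ℝ) ^ (k * n) ≤ 2 ^ I := by rw [← hpw]; exact hKN.trans (by exact_mod_cast hI1)
    exact (pow_le_pow_iff_right₀ (by norm_num)).1 this
  have hIm : I ≤ m0 + k * n := by
    have : (2 : ℝ) ^ I ≤ 2 ^ (m0 + k * n) := by
      rw [pow_add, ← hpw]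
      calc (2 : ℝ) ^ I ≤ 2 * N := by exact_mod_cast hI2
        _ ≤ 8 * K / κ * K ^ n := by
          have : 8 * K / κ * K ^ n = 2 * (4 * K / κ * (K : ℝ) ^ n) := by ring
          rw [this]; linarith
        _ ≤ _ := by gcongr
    exact (pow_le_pow_iff_right₀ (by norm_num)).1 this
  set J := Finset.Ico (k * n) (I + 1) with hJ
  set L := Ln K n with hL
  have hL0 : 0 < L := by linarith
  set τ : ℝ := (K : ℝ) ^ (n * e) with hτ
  have hτ0 : 0 < τ := by positivity
  set F : Ω → ENNReal := fun ω => ∑ z ∈ bx r, ENNReal.ofReal (rexp (ϑ * γ * HH (fun i => W i ω) J (4 * N) 0)) *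
    SN γ Λ ϑ s k (fun i => W i ω) n (0 + L * cx z) with hF
  have hsub : {ω | ∃ P ∈ Bad N κ, (∑ z ∈ P.toFinset, rexp (γ * YY (fun i => W i ω) (I + 1) z)) * (P.length : ℝ) ^ Λ ≤ a} ⊆
      {ω | ENNReal.ofReal ((τ / a) ^ ϑ) ≤ F ω} := by
    rintro ω ⟨P, hP, hw⟩
    have := bad_det (H := HH (fun i => W i ω) J (4 * N) 0) (Y := fun z => YY (fun i => W i ω) (k * n) z) (X := fun z => YY (fun i => W i ω) (I + 1) z)
      hP hγ hΛ.le hϑ hτ0 hL0 hn1 (C := 8 * K / κ) (by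
        have : 8 * K / κ * L = 2 * (4 * K / κ * L) := by ring
        rw [this]
        have : 4 * K / κ * (K : ℝ) ^ n ≤ 4 * K / κ * L := by gcongr
        linarith) hr1 (by
        intro z hz
        have h1 : (2 : ℝ) ≤ N := by exact_mod_cast hN2
        have := HH_spec (fun i => W i ω) J (ρ := 4 * N) hz (by push_cast; linarith)
        have e := YY_split (fun i => W i ω) (show k * n ≤ I + 1 by omega) z
        rw [e]; linarith) ha hw
    rw [Set.mem_ofPred_eq]
    simp only [hF, SN, ← hK]
    exact this
  have mH : Measurable[FA W {j | k * n ≤ j}] fun ω => ENNReal.ofReal (rexp (ϑ * γ * HH (fun i => W i ω) J (4 * N) 0)) :=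
    Measurable.ennreal_ofReal (Measurable.exp (Measurable.const_mul
      (HH_meas (fun j hj z => FA_meas W (by rw [hJ, Finset.mem_Ico] at hj; exact hj.1) z) _ _) _))
  have mH' : Measurable fun ω => ENNReal.ofReal (rexp (ϑ * γ * HH (fun i => W i ω) J (4 * N) 0)) :=
    Measurable.ennreal_ofReal (Measurable.exp (Measurable.const_mul (HH_meas (fun j hj z => hW.meas _) _ _) _))
  have mS : ∀ c, Measurable[FA W {j | j < k * n}] fun ω => SN γ Λ ϑ s k (fun i => W i ω) n c :=
    fun c => SN_meas γ Λ ϑ s k n (fun j hj z => FA_meas W (j := j) hj z) _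
  have mS' : ∀ c, Measurable fun ω => SN γ Λ ϑ s k (fun i => W i ω) n c :=
    fun c => SN_meas γ Λ ϑ s k n (fun j hj z => hW.meas _) _
  have dj : Disjoint {j | k * n ≤ j} {j | j < k * n} := Set.disjoint_left.2 fun j h1 h2 => by
    rw [Set.mem_ofPred_eq] at h1 h2; omega
  have m2 : ∀ z ∈ bx r, Measurable fun ω => ENNReal.ofReal (rexp (ϑ * γ * HH (fun i => W i ω) J (4 * N) 0)) *
    SN γ Λ ϑ s k (fun i => W i ω) n (0 + L * cx z) := fun z _ => mH'.mul (mS' _)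
  have mF : Measurable F := Finset.measurable_sum _ m2
  have hIntB : ∫⁻ ω, F ω ∂μ ≤ ENNReal.ofReal C1 := by
    rw [hF, lintegral_finsetSum _ m2, hC1, ENNReal.ofReal_mul (by positivity), ENNReal.ofReal_natCast, ← nsmul_eq_mul, ENNReal.ofReal_mul (by positivity)]
    refine Finset.sum_le_card_nsmul _ _ _ fun z hz => ?_
    rw [hW.lmul dj mH (mS _)]
    refine mul_le_mul' ?_ (hZ Ω μ W hW n _)
    refine (hW.HH_exp J (ρ := 4 * N) 0 (b := b) (by
      intro j hj
      rw [hJ, Finset.mem_Ico] at hj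
      have h1 : (2 : ℝ) ^ (k * n) ≤ 2 ^ j := pow_le_pow_right₀ (by norm_num) hj.1
      rw [← hpw] at h1
      push_cast
      calc 2 * (4 * (N : ℝ)) ≤ 8 * (4 * K / κ * K ^ n) := by linarith
        _ = b * K ^ n := by rw [hb]; ring
        _ ≤ _ := by gcongr) (θ := ϑ * γ) (by positivity)).trans (ENNReal.ofReal_le_ofReal ?_)
    rw [hB, hJ, Nat.card_Ico]
    have : ((I + 1 - k * n : ℕ) : ℝ) ≤ (m0 + 1 : ℕ) := by exact_mod_cast (by omega : I + 1 - k * n ≤ m0 + 1)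
    gcongr
  have hmk := mul_meas_ge_le_lintegral (μ := μ) mF (ENNReal.ofReal ((τ / a) ^ ϑ))
  refine (measure_mono hsub).trans ?_
  have hc0 : 0 < (τ / a) ^ ϑ := by positivity
  have h1 : μ {ω | ENNReal.ofReal ((τ / a) ^ ϑ) ≤ F ω} ≤ ENNReal.ofReal (C1 / (τ / a) ^ ϑ) := by
    rw [ENNReal.ofReal_div_of_pos hc0, ENNReal.le_div_iff_mul_le (Or.inl (by simpa using hc0)) (Or.inl ENNReal.ofReal_ne_top), mul_comm]
    exact hmk.trans hIntB
  refine h1.trans (ENNReal.ofReal_le_ofReal ?_)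
  have h2 : (N : ℝ) ^ e ≤ (4 * K / κ) ^ e * τ := by
    rw [hτ, Real.rpow_mul hK0.le, Real.rpow_natCast, ← Real.mul_rpow (by positivity) (by positivity)]
    exact Real.rpow_le_rpow hN0.le hNK he0.le
  have h3 : a / τ ≤ (4 * K / κ) ^ e * (a / (N : ℝ) ^ e) := by
    rw [mul_div_assoc', div_le_div_iff₀ hτ0 (by positivity)]
    nlinarith
  have h4 : (a / τ) ^ ϑ ≤ C2 * (a / (N : ℝ) ^ e) ^ ϑ := by
    rw [hC2, ← Real.mul_rpow (by positivity) (by positivity)]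
    exact Real.rpow_le_rpow (by positivity) h3 hϑ.le
  calc C1 / (τ / a) ^ ϑ = C1 * (a / τ) ^ ϑ := by
        rw [div_eq_mul_inv, ← Real.inv_rpow (by positivity), inv_div]
    _ ≤ (C1 + 1) * (C2 * (a / (N : ℝ) ^ e) ^ ϑ) := by gcongr; linarith
    _ = _ := by ring


/-! ### Coupling of the free field and the fine field -/

section
open Matrix

lemma psd_field {ι : Type} [Fintype ι] [DecidableEq ι] {S : Matrix ι ι ℝ} (hS : S.PosSemidef) :
    ∃ (Ω : Type) (_ : MeasurableSpace Ω) (ρ : Measure Ω) (R : ι → Ω → ℝ), IsProbabilityMeasure ρ ∧ (∀ i, Measurable (R i)) ∧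
      ∀ c : ι → ℝ, ρ.map (fun ω => ∑ i, c i * R i ω) = gaussianReal 0 (Real.toNNReal (∑ i, ∑ j, c i * c j * S i j)) := by
  refine ⟨EuclideanSpace ℝ ι, inferInstance, multivariateGaussian 0 S, fun i x => x i, inferInstance, fun i => by fun_prop, fun c => ?_⟩
  have hm : Measurable fun x : EuclideanSpace ℝ ι => ∑ i, c i * x i := by fun_prop
  refine Measure.ext_of_charFun ?_
  ext t
  rw [charFun_gaussianReal, charFun_apply, integral_map hm.aemeasurable (by fun_prop)]
  have h := charFun_multivariateGaussian (μ := 0) hS (WithLp.toLp 2 (t • c))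
  rw [charFun_apply] at h
  have e : ∀ x : EuclideanSpace ℝ ι, inner ℝ (∑ i, c i * x i) t = inner ℝ x (WithLp.toLp 2 (t • c)) := by
    intro x
    simp [PiLp.inner_apply, Finset.mul_sum]
    refine Finset.sum_congr rfl fun i _ => by ring
  simp_rw [e]
  rw [h]
  have e2 : (t • c) ⬝ᵥ S *ᵥ (t • c) = (∑ i, ∑ j, c i * c j * S i j) * t ^ 2 := by
    simp only [dotProduct, mulVec, Pi.smul_apply, smul_eq_mul, Finset.mul_sum, Finset.sum_mul]
    refine Finset.sum_congr rfl fun i _ => Finset.sum_congr rfl fun j _ => by ring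
  have e3 : 0 ≤ ∑ i, ∑ j, c i * c j * S i j := by
    have := hS.dotProduct_mulVec_nonneg c
    have e4 : star c ⬝ᵥ S *ᵥ c = ∑ i, ∑ j, c i * c j * S i j := by
      simp only [dotProduct, mulVec, Finset.mul_sum]
      refine Finset.sum_congr rfl fun i _ => Finset.sum_congr rfl fun j _ => by simp; ring
    rwa [e4] at this
  rw [e2]
  congr 1
  rw [inner_zero_right, Real.coe_toNNReal _ e3]
  push_cast
  ring

lemma law_ext {ι Ω Ω' : Type*} [Fintype ι] [MeasurableSpace Ω] [MeasurableSpace Ω'] {μ : Measure Ω} {ν : Measure Ω'} [IsProbabilityMeasure μ]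
    [IsProbabilityMeasure ν] {f : ι → Ω → ℝ} {g : ι → Ω' → ℝ} (hf : ∀ i, Measurable (f i)) (hg : ∀ i, Measurable (g i))
    (h : ∀ c : ι → ℝ, μ.map (fun ω => ∑ i, c i * f i ω) = ν.map (fun ω => ∑ i, c i * g i ω)) :
    μ.map (fun ω i => f i ω) = ν.map (fun ω i => g i ω) := by
  classical
  have hf' : Measurable (fun ω i => f i ω) := measurable_pi_lambda _ hf
  have hg' : Measurable (fun ω i => g i ω) := measurable_pi_lambda _ hg
  have : IsProbabilityMeasure (μ.map (fun ω i => f i ω)) := Measure.isProbabilityMeasure_map hf'.aemeasurable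
  have : IsProbabilityMeasure (ν.map (fun ω i => g i ω)) := Measure.isProbabilityMeasure_map hg'.aemeasurable
  refine Measure.ext_of_charFunDual ?_
  ext L
  have e : ∀ x : ι → ℝ, L x = ∑ i, L (Pi.single i 1) * x i := by
    intro x
    conv_lhs => rw [← Finset.univ_sum_single x]
    rw [map_sum]
    refine Finset.sum_congr rfl fun i _ => ?_
    rw [mul_comm, ← smul_eq_mul, ← map_smul]
    congr 1
    ext j; by_cases hj : j = i
    · subst hj; simp
    · simp [hj]
  rw [charFunDual_eq_charFun_map_one, charFunDual_eq_charFun_map_one, Measure.map_map (by fun_prop) hf', Measure.map_map (by fun_prop) hg']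
  have h1 := h fun i => L (Pi.single i 1)
  have h2 : ∀ {Ω : Type _} (f : ι → Ω → ℝ), (L ∘ fun ω i => f i ω) = fun ω => ∑ i, L (Pi.single i 1) * f i ω := fun f => funext fun ω => e _
  have h3 : (L ∘ fun ω i => g i ω) = fun ω => ∑ i, L (Pi.single i 1) * g i ω := funext fun ω => e _
  rw [h2, h3, h1]

lemma coupling {ι α Ω Ω' : Type} [Fintype ι] [DecidableEq ι] [Countable α] [MeasurableSpace Ω] [MeasurableSpace Ω'] {μ : Measure Ω} {ν : Measure Ω'} [IsProbabilityMeasure μ]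
    [IsProbabilityMeasure ν] {f : ι → Ω → ℝ} {g : ι → Ω' → ℝ} (hf : ∀ i, Measurable (f i)) (hg : ∀ i, Measurable (g i))
    (Gf : GFam μ f) (Gg : GFam ν g) (hdom : ∀ c : ι → ℝ, ∑ i, ∑ j, c i * c j * ∫ ω, f i ω * f j ω ∂μ ≤ ∑ i, ∑ j, c i * c j * ∫ ω, g i ω * g j ω ∂ν)
    {V : ℝ} (hV : ∀ i, ∫ ω, g i ω * g i ω ∂ν ≤ V) (γ : ℝ) (A : α → Finset ι) (a : α → ℝ) :
    μ {ω | ∃ p, ∑ i ∈ A p, rexp (γ * f i ω) ≤ a p} ≤ 2 * ν {ω | ∃ p, ∑ i ∈ A p, rexp (γ * g i ω) ≤ 2 * rexp (γ ^ 2 * V / 2) * a p} := by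
  set S : Matrix ι ι ℝ := fun i j => ∫ ω, g i ω * g j ω ∂ν - ∫ ω, f i ω * f j ω ∂μ with hS
  have hP : S.PosSemidef := by
    refine Matrix.PosSemidef.of_dotProduct_mulVec_nonneg ?_ fun c => ?_
    · ext i j
      change S j i = S i j
      simp only [hS]
      congr 1 <;> exact integral_congr_ae (ae_of_all _ fun ω => mul_comm _ _)
    · have e4 : star c ⬝ᵥ S *ᵥ c = ∑ i, ∑ j, c i * c j * S i j := by
        simp only [dotProduct, mulVec, Finset.mul_sum]
        refine Finset.sum_congr rfl fun i _ => Finset.sum_congr rfl fun j _ => by simp; ring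
      rw [e4]
      simp only [hS, mul_sub, Finset.sum_sub_distrib]
      linarith [hdom c]
  obtain ⟨Ω₂, _, ρ, R, hρ, hR, hlaw⟩ := psd_field hP
  have hSV : ∀ i, S i i ≤ V := fun i => by
    have : 0 ≤ ∫ ω, f i ω * f i ω ∂μ := integral_nonneg fun ω => mul_self_nonneg _
    have h2 := hV i
    simp only [hS]; linarith
  have hRe : ∀ i, ∫⁻ r, ENNReal.ofReal (rexp (γ * R i r)) ∂ρ ≤ ENNReal.ofReal (rexp (γ ^ 2 * V / 2)) := by
    intro i
    have h1 := hlaw (Pi.single i 1)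
    have e1 : ∀ r, ∑ j, (Pi.single i 1 : ι → ℝ) j * R j r = R i r := fun r => by simp [Pi.single_apply]
    have e2 : ∑ k, ∑ j, (Pi.single i 1 : ι → ℝ) k * (Pi.single i 1 : ι → ℝ) j * S k j = S i i := by simp [Pi.single_apply]
    simp_rw [e1, e2] at h1
    have h2 := lintegral_exp_gaussian (S i i).toNNReal γ
    rw [← h1, lintegral_map (by fun_prop) (hR i)] at h2
    rw [h2]
    refine ENNReal.ofReal_le_ofReal (exp_le_exp.2 ?_)
    rw [Real.coe_toNNReal _ hP.diag_nonneg]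
    nlinarith [hSV i, sq_nonneg γ]
  -- law of the sum
  have hsum : (μ.prod ρ).map (fun p i => f i p.1 + R i p.2) = ν.map (fun ω i => g i ω) := by
    refine law_ext (f := fun i (p : Ω × Ω₂) => f i p.1 + R i p.2) (fun i => ((hf i).comp measurable_fst).add ((hR i).comp measurable_snd)) hg fun c => ?_
    have hfm : Measurable fun ω => ∑ i, c i * f i ω := Finset.measurable_sum _ fun i _ => (hf i).const_mul _
    have hRm : Measurable fun ω => ∑ i, c i * R i ω := Finset.measurable_sum _ fun i _ => (hR i).const_mul _
    have hL1 : ∀ (Ω : Type) [MeasurableSpace Ω] (μ : Measure Ω) (f : ι → Ω → ℝ), GFam μ f →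
        μ.map (fun ω => ∑ i, c i * f i ω) = gaussianReal 0 (Real.toNNReal (∑ i, ∑ j, c i * c j * ∫ ω, f i ω * f j ω ∂μ)) := by
      intro Ω _ μ f Gf
      have := (Gf.lin (κ := Unit) (fun _ => Finset.univ) (fun _ => c)).law ()
      rw [this, Gf.cov_lin]
    rw [hL1 _ ν g Gg]
    have hind : IndepFun (fun p : Ω × Ω₂ => ∑ i, c i * f i p.1) (fun p => ∑ i, c i * R i p.2) (μ.prod ρ) := indepFun_prod hfm hRm
    have hm1 : Measurable fun p : Ω × Ω₂ => ∑ i, c i * f i p.1 := hfm.comp measurable_fst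
    have hm2 : Measurable fun p : Ω × Ω₂ => ∑ i, c i * R i p.2 := hRm.comp measurable_snd
    have h4 := hind.map_add_eq_map_conv_map hm1 hm2
    have e1 : (μ.prod ρ).map (fun p : Ω × Ω₂ => ∑ i, c i * f i p.1) = μ.map (fun ω => ∑ i, c i * f i ω) := by
      rw [show (fun p : Ω × Ω₂ => ∑ i, c i * f i p.1) = (fun ω => ∑ i, c i * f i ω) ∘ Prod.fst from rfl,
        ← Measure.map_map hfm measurable_fst, Measure.map_fst_prod]; simp
    have e2 : (μ.prod ρ).map (fun p : Ω × Ω₂ => ∑ i, c i * R i p.2) = ρ.map (fun ω => ∑ i, c i * R i ω) := by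
      rw [show (fun p : Ω × Ω₂ => ∑ i, c i * R i p.2) = (fun ω => ∑ i, c i * R i ω) ∘ Prod.snd from rfl,
        ← Measure.map_map hRm measurable_snd, Measure.map_snd_prod]; simp
    have hpos1 : 0 ≤ ∑ i, ∑ j, c i * c j * ∫ ω, f i ω * f j ω ∂μ := by
      rw [← Gf.cov_lin]; exact integral_nonneg fun ω => mul_self_nonneg _
    have hpos2 : 0 ≤ ∑ i, ∑ j, c i * c j * S i j := by
      simp only [hS, mul_sub, Finset.sum_sub_distrib]; linarith [hdom c]
    rw [e1, e2, hL1 _ μ f Gf, hlaw c, gaussianReal_conv_gaussianReal, ← Real.toNNReal_add hpos1 hpos2] at h4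
    have e3 : (fun p : Ω × Ω₂ => ∑ i, c i * (f i p.1 + R i p.2)) = (fun p => ∑ i, c i * f i p.1) + (fun p => ∑ i, c i * R i p.2) := by
      ext p; simp [mul_add, Finset.sum_add_distrib]
    rw [e3, h4, zero_add]
    congr 2
    simp only [hS, mul_sub, Finset.sum_sub_distrib]; ring
  set b : ℝ := 2 * rexp (γ ^ 2 * V / 2) with hb
  set E : Set (ι → ℝ) := {x | ∃ p, ∑ i ∈ A p, rexp (γ * x i) ≤ b * a p} with hE
  have hEm : MeasurableSet E := by
    have : E = ⋃ p, {x : ι → ℝ | ∑ i ∈ A p, rexp (γ * x i) ≤ b * a p} := by ext x; simp [hE]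
    rw [this]
    exact MeasurableSet.iUnion fun p => measurableSet_le (by fun_prop) measurable_const
  have hTm : Measurable (fun (p : Ω × Ω₂) i => f i p.1 + R i p.2) :=
    measurable_pi_lambda _ fun i => ((hf i).comp measurable_fst).add ((hR i).comp measurable_snd)
  have h1 : ν {ω | ∃ p, ∑ i ∈ A p, rexp (γ * g i ω) ≤ b * a p} = (μ.prod ρ) ((fun (p : Ω × Ω₂) i => f i p.1 + R i p.2) ⁻¹' E) := by
    rw [← Measure.map_apply hTm hEm, hsum, Measure.map_apply (measurable_pi_lambda _ hg) hEm]; rfl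
  rw [h1, Measure.prod_apply (hTm hEm)]
  have hBm : MeasurableSet {ω | ∃ p, ∑ i ∈ A p, rexp (γ * f i ω) ≤ a p} := by
    have : {ω | ∃ p, ∑ i ∈ A p, rexp (γ * f i ω) ≤ a p} = ⋃ p, {ω | ∑ i ∈ A p, rexp (γ * f i ω) ≤ a p} := by ext x; simp
    rw [this]
    exact MeasurableSet.iUnion fun p => measurableSet_le (Finset.measurable_sum _ fun i _ => ((hf i).const_mul _).exp) measurable_const
  set B := {ω | ∃ p, ∑ i ∈ A p, rexp (γ * f i ω) ≤ a p} with hB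
  have key : ∀ ω ∈ B, 1 / 2 ≤ ρ (Prod.mk ω ⁻¹' ((fun (p : Ω × Ω₂) i => f i p.1 + R i p.2) ⁻¹' E)) := by
    rintro ω ⟨p, hp⟩
    rcases (A p).eq_empty_or_nonempty with hA | hA
    · have : (Prod.mk ω ⁻¹' ((fun (p : Ω × Ω₂) i => f i p.1 + R i p.2) ⁻¹' E)) = univ := by
        ext r
        simp only [mem_preimage, mem_univ, iff_true, hE]
        refine ⟨p, ?_⟩
        simp only [hA, Finset.sum_empty] at hp ⊢
        positivity
      rw [this, measure_univ]; norm_num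
    have hapos : 0 < a p := lt_of_lt_of_le (Finset.sum_pos (fun i _ => exp_pos _) hA) hp
    set w : Ω₂ → ENNReal := fun r => ENNReal.ofReal (∑ i ∈ A p, rexp (γ * (f i ω + R i r))) with hw
    have hwm : Measurable w := ENNReal.measurable_ofReal.comp (Finset.measurable_sum _ fun i _ => (((hR i).const_add _).const_mul _).exp)
    have hIntB : ∫⁻ r, w r ∂ρ ≤ ENNReal.ofReal (rexp (γ ^ 2 * V / 2) * a p) := by
      have e : ∀ r, w r = ∑ i ∈ A p, ENNReal.ofReal (rexp (γ * f i ω)) * ENNReal.ofReal (rexp (γ * R i r)) := by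
        intro r
        simp only [hw]
        rw [ENNReal.ofReal_sum_of_nonneg fun i _ => (exp_pos _).le]
        refine Finset.sum_congr rfl fun i _ => ?_
        rw [← ENNReal.ofReal_mul (exp_pos _).le, ← exp_add, mul_add]
      simp_rw [e]
      have hmi : ∀ i, Measurable fun r => ENNReal.ofReal (rexp (γ * R i r)) := fun i => ENNReal.measurable_ofReal.comp ((hR i).const_mul _).exp
      rw [lintegral_finsetSum _ fun i _ => (hmi i).const_mul _]
      calc _ ≤ ∑ i ∈ A p, ENNReal.ofReal (rexp (γ * f i ω)) * ENNReal.ofReal (rexp (γ ^ 2 * V / 2)) := by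
            refine Finset.sum_le_sum fun i _ => ?_
            rw [lintegral_const_mul _ (hmi i)]
            exact mul_le_mul_right (hRe i) _
        _ = ENNReal.ofReal ((∑ i ∈ A p, rexp (γ * f i ω)) * rexp (γ ^ 2 * V / 2)) := by
            rw [← Finset.sum_mul, ← ENNReal.ofReal_sum_of_nonneg fun i _ => (exp_pos _).le, ← ENNReal.ofReal_mul (Finset.sum_nonneg fun i _ => (exp_pos _).le)]
        _ ≤ _ := by
            refine ENNReal.ofReal_le_ofReal ?_
            rw [mul_comm]
            exact mul_le_mul_of_nonneg_left hp (exp_pos _).le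
    have hq : 0 < rexp (γ ^ 2 * V / 2) * a p := by positivity
    have hmk := meas_ge_le_lintegral_div (μ := ρ) hwm.aemeasurable (ε := ENNReal.ofReal (b * a p)) (by simp; positivity) ENNReal.ofReal_ne_top
    have hmk2 : ρ {r | ENNReal.ofReal (b * a p) ≤ w r} ≤ 1 / 2 := by
      refine hmk.trans ?_
      refine (ENNReal.div_le_div_right hIntB _).trans ?_
      rw [← ENNReal.ofReal_div_of_pos (by positivity), hb]
      rw [show rexp (γ ^ 2 * V / 2) * a p / (2 * rexp (γ ^ 2 * V / 2) * a p) = 1 / 2 by field_simp]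
      rw [ENNReal.ofReal_div_of_pos (by norm_num)]; simp
    have hsub : {r | ENNReal.ofReal (b * a p) ≤ w r}ᶜ ⊆ Prod.mk ω ⁻¹' ((fun (p : Ω × Ω₂) i => f i p.1 + R i p.2) ⁻¹' E) := by
      intro r hr
      simp only [mem_compl_iff, mem_ofPred_eq, not_le] at hr
      refine ⟨p, ?_⟩
      exact ((ENNReal.ofReal_lt_ofReal_iff (by positivity)).1 hr).le
    refine le_trans ?_ (measure_mono hsub)
    rw [prob_compl_eq_one_sub (measurableSet_le measurable_const hwm)]
    calc (1 / 2 : ENNReal) = 1 - 1 / 2 := by simp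
      _ ≤ _ := tsub_le_tsub_left hmk2 _
  calc μ B = 2 * ∫⁻ ω in B, 1 / 2 ∂μ := by
        rw [setLIntegral_const, ← mul_assoc]
        rw [ENNReal.mul_div_cancel (by simp) (by simp), one_mul]
    _ ≤ 2 * ∫⁻ ω in B, ρ (Prod.mk ω ⁻¹' ((fun (p : Ω × Ω₂) i => f i p.1 + R i p.2) ⁻¹' E)) ∂μ :=
        mul_le_mul_right (setLIntegral_mono' hBm key) _
    _ ≤ _ := mul_le_mul_right (setLIntegral_le_lintegral _ _) _

end


lemma GFam.var_of_law {Ω ι : Type*} [MeasurableSpace Ω] {μ : Measure Ω} {f : ι → Ω → ℝ} (h : GFam μ f) (i : ι) {v : ℝ} (hv : 0 ≤ v)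
    (hl : μ.map (f i) = gaussianReal 0 (Real.toNNReal v)) : ∫ ω, f i ω * f i ω ∂μ = v := by
  rw [h.law i, gaussianReal_ext_iff] at hl
  exact (Real.toNNReal_eq_toNNReal_iff (integral_nonneg fun ω => mul_self_nonneg _) hv).1 hl.2

section
variable {Ω : Type*} [MeasurableSpace Ω] {μ : Measure Ω} {W : ℕ × Z2 → Ω → ℝ}

lemma WN.YY_law [IsProbabilityMeasure μ] (h : WN μ W) (n : ℕ) (s : Finset Z2) (ν : Z2 → ℝ) (hν : ∀ z ∉ s, ν z = 0) :
    μ.map (fun ω => ∑ z ∈ s, ν z * YY (fun i => W i ω) n z) =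
      gaussianReal 0 (Real.toNNReal (102 * ∑ j ∈ Finset.range n, (4 : ℝ) ^ j * ns (Qm (2 ^ j) ν))) := by
  obtain ⟨F, c, h1, h2⟩ := xi_lin (Finset.range n) s ν hν
  rw [← h2, ← h.map_sum F c]
  congr 1
  funext ω
  rw [← h1 fun i => W i ω, Finset.sum_comm]
  simp only [YY, Finset.mul_sum]

lemma WN.YY_gf [IsProbabilityMeasure μ] (h : WN μ W) (n : ℕ) : GFam μ fun z ω => YY (fun i => W i ω) n z := by
  classical
  intro s c
  refine ⟨Real.toNNReal (102 * ∑ j ∈ Finset.range n, (4 : ℝ) ^ j * ns (Qm (2 ^ j) fun z => if z ∈ s then c z else 0)), ?_⟩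
  rw [← h.YY_law n s (fun z => if z ∈ s then c z else 0) (fun z hz => if_neg hz)]
  congr 1
  funext ω
  exact Finset.sum_congr rfl fun z hz => by rw [if_pos hz]

lemma WN.YY_var [IsProbabilityMeasure μ] (h : WN μ W) (n : ℕ) (s : Finset Z2) (ν : Z2 → ℝ) (hν : ∀ z ∉ s, ν z = 0) :
    ∑ x ∈ s, ∑ y ∈ s, ν x * ν y * ∫ ω, YY (fun i => W i ω) n x * YY (fun i => W i ω) n y ∂μ =
      102 * ∑ j ∈ Finset.range n, (4 : ℝ) ^ j * ns (Qm (2 ^ j) ν) := by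
  rw [← (h.YY_gf n).cov_lin s s ν ν]
  exact ((h.YY_gf n).lin (κ := Unit) (fun _ => s) (fun _ => ν)).var_of_law ()
    (mul_nonneg (by norm_num) (Finset.sum_nonneg fun j _ => mul_nonneg (by positivity) (tsum_nonneg fun z => sq_nonneg _))) (h.YY_law n s ν hν)

end

lemma dg_couple {Ω Ω' : Type} [MeasurableSpace Ω] [MeasurableSpace Ω'] {μ : Measure Ω} {ν : Measure Ω'} [IsProbabilityMeasure μ]
    [IsProbabilityMeasure ν] {N : ℕ} {η : Z2 → Ω → ℝ} {W : ℕ × Z2 → Ω' → ℝ} (D : DG μ N η) (h : WN ν W) (γ : ℝ) (PP : Set (List Z2))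
    (hPP : ∀ P ∈ PP, ∀ z ∈ P, z ∈ VN N) (a : List Z2 → ℝ) :
    μ {ω | ∃ P ∈ PP, pWeight γ η ω P ≤ a P} ≤ 2 * ν {ω | ∃ P ∈ PP, ∑ z ∈ P.toFinset, rexp (γ * YY (fun i => W i ω) (Nat.clog 2 N + 1) z) ≤
      2 * rexp (51 * γ ^ 2 * (Nat.clog 2 N + 1)) * a P} := by
  classical
  set I := Nat.clog 2 N with hI
  have hNI : N ≤ 2 ^ I := Nat.le_pow_clog (by norm_num) N
  have hVN : ∀ P ∈ PP, ∀ z ∈ P.toFinset, z ∈ boxF N := by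
    intro P hP z hz
    have := hPP P hP z (List.mem_toFinset.1 hz)
    rw [mem_boxF]
    simp only [VN, V5N, mem_ofPred_eq] at this ⊢
    omega
  have hext : ∀ c : ↥(boxF N) → ℝ, ∃ ν : Z2 → ℝ, (∀ z ∉ boxF N, ν z = 0) ∧ ∀ z : ↥(boxF N), ν z = c z := by
    intro c
    refine ⟨fun z => if hz : z ∈ boxF N then c ⟨z, hz⟩ else 0, fun z hz => dif_neg hz, fun z => ?_⟩
    simp
  have hss : ∀ F : Z2 → Z2 → ℝ, ∑ x : ↥(boxF N), ∑ y : ↥(boxF N), F x y = ∑ x ∈ boxF N, ∑ y ∈ boxF N, F x y := by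
    intro F
    rw [Finset.sum_coe_sort (boxF N) (fun x => ∑ y : ↥(boxF N), F x y)]
    exact Finset.sum_congr rfl fun x _ => Finset.sum_coe_sort (boxF N) (fun y => F x y)
  have key := coupling (ι := ↥(boxF N)) (α := ↥PP) (μ := μ) (ν := ν) (f := fun z => η z) (g := fun z ω => YY (fun i => W i ω) (I + 1) z)
    (fun z => D.meas z) (fun z => YY_meas (fun i _ w => h.meas _) _) (D.gf.comp _) ((h.YY_gf (I + 1)).comp _) (fun c => ?_)
    (V := 102 * (I + 1)) (fun z => ?_) γ (fun P => P.1.toFinset.subtype (· ∈ boxF N)) (fun P => a P)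
  · have e1 : {ω | ∃ P ∈ PP, pWeight γ η ω P ≤ a P} = {ω | ∃ p : ↥PP, ∑ i ∈ p.1.toFinset.subtype (· ∈ boxF N), rexp (γ * η i ω) ≤ a p} := by
      ext ω
      simp only [mem_ofPred_eq, Subtype.exists, exists_prop]
      refine exists_congr fun P => and_congr_right fun hP => ?_
      rw [Finset.sum_subtype_of_mem (fun z => rexp (γ * η z ω)) (hVN P hP)]; rfl
    have e2 : {ω | ∃ P ∈ PP, ∑ z ∈ P.toFinset, rexp (γ * YY (fun i => W i ω) (I + 1) z) ≤ 2 * rexp (51 * γ ^ 2 * (I + 1)) * a P} =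
        {ω | ∃ p : ↥PP, ∑ i ∈ p.1.toFinset.subtype (· ∈ boxF N), rexp (γ * YY (fun i => W i ω) (I + 1) i) ≤ 2 * rexp (γ ^ 2 * (102 * (I + 1)) / 2) * a p} := by
      ext ω
      simp only [mem_ofPred_eq, Subtype.exists, exists_prop]
      refine exists_congr fun P => and_congr_right fun hP => ?_
      rw [Finset.sum_subtype_of_mem (fun z => rexp (γ * YY (fun i => W i ω) (I + 1) z)) (hVN P hP),
        show γ ^ 2 * (102 * ((I : ℝ) + 1)) / 2 = 51 * γ ^ 2 * (I + 1) by ring]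
    rw [e1, e2]
    exact key
  · obtain ⟨v, hv, hvc⟩ := hext c
    simp_rw [← hvc]
    rw [hss fun x y => v x * v y * ∫ ω, η x ω * η y ω ∂μ, hss fun x y => v x * v y * ∫ ω, YY (fun i => W i ω) (I + 1) x * YY (fun i => W i ω) (I + 1) y ∂ν,
      h.YY_var (I + 1) _ v hv]
    refine le_trans (le_of_eq ?_) (green_dom N I hNI v hv)
    exact Finset.sum_congr rfl fun x hx => Finset.sum_congr rfl fun y hy => by rw [D.cov x (mem_boxF.1 hx) y (mem_boxF.1 hy)]
  · have h1 := h.YY_var (I + 1) {z.1} (dlt z.1) (fun w hw => if_neg fun h => hw (by simp [h]))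
    have h2 := sum_dlt_le I z.1
    have h3 : dlt z.1 z.1 = 1 := if_pos rfl
    simp only [Finset.sum_singleton, h3, one_mul] at h1
    rw [h1]
    linarith


/-! ### Final assembly -/

lemma g0_exists : ∃ g : ℝ, 0 < g ∧ ∀ γ : ℝ, 0 < γ → γ < g → γ ≤ 1 / 10 ^ 9 ∧ 1184 * γ ^ 2 ≤ c1 γ / 40 := by
  have h1 := tendsto_log_mul_rpow_nhdsGT_zero (r := 1 / 2) (by norm_num)
  have h2 : Tendsto (fun x : ℝ => x ^ (1 / 2 : ℝ)) (nhdsWithin 0 (Ioi 0)) (nhds 0) := by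
    have h3 : ContinuousAt (fun x : ℝ => x ^ (1 / 2 : ℝ)) 0 := Real.continuousAt_rpow_const _ _ (Or.inr (by norm_num))
    have h4 := h3.tendsto.mono_left (nhdsWithin_le_nhds (s := Ioi 0))
    simpa using h4
  have h3 : Tendsto (fun x : ℝ => 121241600 * (log 32 * x ^ (1 / 2 : ℝ) - 2 * (log x * x ^ (1 / 2 : ℝ)))) (nhdsWithin 0 (Ioi 0)) (nhds 0) := by
    have := ((h2.const_mul (log 32)).sub (h1.const_mul 2)).const_mul 121241600
    simpa using this
  have h4 := h3.eventually (eventually_lt_nhds (show (0 : ℝ) < 1 by norm_num))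
  rw [eventually_nhdsWithin_iff, Metric.eventually_nhds_iff] at h4
  obtain ⟨e, he, h5⟩ := h4
  refine ⟨min e (1 / 10 ^ 9), by positivity, fun γ hγ hlt => ?_⟩
  have hγ1 : γ ≤ 1 / 10 ^ 9 := (hlt.trans_le (min_le_right _ _)).le
  refine ⟨hγ1, ?_⟩
  have h6 := h5 (y := γ) (by rw [Real.dist_eq, sub_zero, abs_of_pos hγ]; exact hlt.trans_le (min_le_left _ _)) hγ
  have hl := log32 hγ hγ1
  have hlog : log (32 / γ ^ 2) = log 32 - 2 * log γ := by
    rw [log_div (by norm_num) (by positivity), log_pow]; norm_num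
  rw [← Real.sqrt_eq_rpow] at h6
  have h7 : 121241600 * (√γ * log (32 / γ ^ 2)) < 1 := by rw [hlog]; linarith
  have hs := Real.sq_sqrt hγ.le
  have hs0 := Real.sqrt_pos.2 hγ
  unfold c1
  rw [div_div, le_div_iff₀ (by positivity)]
  have h8 : 1184 * γ ^ 2 * (2560 * log (32 / γ ^ 2) * 40) = γ * √γ * (121241600 * (√γ * log (32 / γ ^ 2))) := by
    have : γ ^ 2 = γ * (√γ * √γ) := by rw [Real.mul_self_sqrt hγ.le, sq]
    rw [show 1184 * γ ^ 2 * (2560 * log (32 / γ ^ 2) * 40) = γ ^ 2 * (121241600 * log (32 / γ ^ 2)) by ring]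
    generalize log (32 / γ ^ 2) = l
    rw [this]; ring
  rw [h8]
  exact mul_le_of_le_one_right (by positivity) h7.le

lemma loop_erase (P : List Z2) : ∀ {x y : Z2}, List.IsChain Adj P → P.head? = some x → P.getLast? = some y →
    ∃ Q : List Z2, List.IsChain Adj Q ∧ Q.head? = some x ∧ Q.getLast? = some y ∧ Q.Nodup ∧ ∀ z ∈ Q, z ∈ P := by
  induction P with
  | nil => intro x y _ h; simp at h
  | cons a l ih =>
    intro x y hc hx hy
    simp only [List.head?_cons, Option.some.injEq] at hx
    subst hx
    cases l with
    | nil =>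
      exact ⟨[a], hc, rfl, hy, by simp, by simp⟩
    | cons b t =>
      rw [List.isChain_cons_cons] at hc
      obtain ⟨Q, hQc, hQx, hQy, hQn, hQs⟩ := ih hc.2 (x := b) (y := y) rfl (by rw [← hy]; simp [List.getLast?_cons_cons])
      by_cases ha : a ∈ Q
      · obtain ⟨s, u, rfl⟩ := List.append_of_mem ha
        refine ⟨a :: u, ?_, rfl, ?_, ?_, fun z hz => ?_⟩
        · exact hQc.right_of_append
        · rw [← hQy, List.getLast?_append]; simp [List.getLast?_cons]
        · exact (List.nodup_append.1 hQn).2.1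
        · exact List.mem_cons_of_mem _ (hQs z (List.mem_append_right _ hz))
      · obtain ⟨q, Q', rfl⟩ : ∃ q Q', Q = q :: Q' := by
          cases Q with
          | nil => simp at hQx
          | cons q Q' => exact ⟨q, Q', rfl⟩
        simp only [List.head?_cons, Option.some.injEq] at hQx
        subst hQx
        refine ⟨a :: q :: Q', ?_, rfl, ?_, ?_, ?_⟩
        · rw [List.isChain_cons_cons]; exact ⟨hc.1, hQc⟩
        · rw [← hQy]; simp [List.getLast?_cons_cons]
        · rw [List.nodup_cons]; exact ⟨ha, hQn⟩
        · intro z hz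
          rw [List.mem_cons] at hz ⊢
          exact hz.imp_right (hQs z)

lemma clog_exp {γ c : ℝ} (h : 1184 * γ ^ 2 ≤ c) {N : ℕ} (hN : 2 ≤ N) :
    rexp (51 * γ ^ 2 * (Nat.clog 2 N + 1)) ≤ rexp (102 * γ ^ 2) * (N : ℝ) ^ (c / 16) := by
  have hN0 : (1 : ℝ) ≤ N := by exact_mod_cast (by omega : 1 ≤ N)
  have h1 : (2 : ℝ) ^ (Nat.clog 2 N - 1) ≤ N := by
    exact_mod_cast (Nat.pow_pred_clog_lt_self (by norm_num : 1 < 2) (by omega : 1 < N)).le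
  have h0 : 1 ≤ Nat.clog 2 N := Nat.clog_pos (by norm_num) hN
  have h2 : ((Nat.clog 2 N : ℝ) - 1) * log 2 ≤ log N := by
    have := Real.log_le_log (by positivity) h1
    rw [Real.log_pow, Nat.cast_sub h0] at this
    simpa using this
  have hl := Real.log_two_gt_d9
  have h3 : (Nat.clog 2 N : ℝ) - 1 ≤ 74 / 51 * log N := by
    have h0' : (0 : ℝ) ≤ (Nat.clog 2 N : ℝ) - 1 := by
      have : (1 : ℝ) ≤ Nat.clog 2 N := by exact_mod_cast h0
      linarith
    nlinarith
  have hlN : 0 ≤ log (N : ℝ) := Real.log_nonneg hN0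
  rw [Real.rpow_def_of_pos (by linarith), ← exp_add]
  refine exp_le_exp.2 ?_
  have h4 : 51 * γ ^ 2 * ((Nat.clog 2 N : ℝ) - 1) ≤ 51 * γ ^ 2 * (74 / 51 * log N) := mul_le_mul_of_nonneg_left h3 (by positivity)
  have h5 : 74 * γ ^ 2 * log N ≤ c / 16 * log N := mul_le_mul_of_nonneg_right (by linarith) hlN
  nlinarith

/-- the good event -/
def GE {Ω : Type*} (N : ℕ) (γ α κ : ℝ) (η : Z2 → Ω → ℝ) : Set Ω := {ω : Ω |
  ∀ x ∈ VN N, ∀ y ∈ VN N, κ * N ≤ eZ x y →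
    ∀ P : List Z2, LPathIn (VN N) P →
      P.head? = some x → P.getLast? = some y →
      (∀ Q : List Z2, LPathIn (VN N) Q →
        Q.head? = some x → Q.getLast? = some y →
        pWeight γ η ω P ≤ pWeight γ η ω Q) →
      (N : ℝ) ^ ((1 : ℝ) + α) < (P.toFinset.card : ℝ)}

lemma bad_event {Ω : Type*} {N : ℕ} {γ α κ c' Λ : ℝ} {η : Z2 → Ω → ℝ} (hΛ : 0 < Λ) (hα : α * Λ = c' / 10) (hN : 2 ≤ N) {ω : Ω} (hω : ω ∉ GE N γ α κ η) :
    (∃ x ∈ VN N, ∃ y ∈ VN N, ¬ Reach N γ η ω x y (ENNReal.ofReal ((N : ℝ) ^ (1 - c')))) ∨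
      ∃ P ∈ Bad N κ, pWeight γ η ω P ≤ (N : ℝ) ^ (1 + Λ - 9 / 10 * c') / (P.length : ℝ) ^ Λ := by
  by_cases hR : ∃ x ∈ VN N, ∃ y ∈ VN N, ¬ Reach N γ η ω x y (ENNReal.ofReal ((N : ℝ) ^ (1 - c')))
  · exact Or.inl hR
  refine Or.inr ?_
  push Not at hR
  simp only [GE, mem_ofPred_eq] at hω
  push Not at hω
  obtain ⟨x, hx, y, hy, hxy, P, hP, hPx, hPy, hmin, hcard⟩ := hω
  obtain ⟨R, hRp, hRx, hRy, hRw⟩ := hR x hx y hy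
  have hN0 : (0 : ℝ) < N := by exact_mod_cast (by omega : 0 < N)
  have hw : pWeight γ η ω P ≤ (N : ℝ) ^ (1 - c') := (hmin R hRp hRx hRy).trans ((ENNReal.ofReal_le_ofReal_iff (by positivity)).1 hRw)
  obtain ⟨Q, hQc, hQx, hQy, hQn, hQs⟩ := loop_erase P hP.2.1 hPx hPy
  have hQne : Q ≠ [] := by rintro rfl; simp at hQx
  have hsub : Q.toFinset ⊆ P.toFinset := fun z hz => List.mem_toFinset.2 (hQs z (List.mem_toFinset.1 hz))
  refine ⟨Q, ⟨⟨hQne, hQc, fun z hz => hP.2.2 z (hQs z hz)⟩, hQn, x, y, hQx, hQy, hxy⟩, ?_⟩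
  have hlen : (Q.length : ℝ) ≤ (N : ℝ) ^ (1 + α) := by
    rw [← List.toFinset_card_of_nodup hQn]
    exact le_trans (by exact_mod_cast Finset.card_le_card hsub) hcard
  have hlen0 : (0 : ℝ) < Q.length := by exact_mod_cast List.length_pos_iff.2 hQne
  rw [le_div_iff₀ (by positivity)]
  have hwQ : pWeight γ η ω Q ≤ (N : ℝ) ^ (1 - c') := (Finset.sum_le_sum_of_subset_of_nonneg hsub fun z _ _ => (exp_pos _).le).trans hw
  calc _ ≤ (N : ℝ) ^ (1 - c') * ((N : ℝ) ^ (1 + α)) ^ Λ :=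
        mul_le_mul hwQ (Real.rpow_le_rpow hlen0.le hlen hΛ.le) (by positivity) (by positivity)
    _ = _ := by
        rw [← Real.rpow_mul hN0.le, ← Real.rpow_add hN0]
        congr 1
        linarith

lemma tendsto_npow {t : ℝ} (ht : 0 < t) : Tendsto (fun N : ℕ => (N : ℝ) ^ t) atTop atTop := (tendsto_rpow_atTop ht).comp tendsto_natCast_atTop_atTop

lemma final_bound {γ : ℝ} (hγ : 0 < γ) (hγ1 : γ ≤ 1 / 10 ^ 9) (hc : 1184 * γ ^ 2 ≤ c1 γ / 40) :
    ∃ α : ℝ, 0 < α ∧ ∀ κ : ℝ, 0 < κ → κ < 1 → ∃ b : ℕ → ℝ, Tendsto b atTop (nhds 0) ∧ ∀ᶠ N : ℕ in atTop,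
      ∀ (Ω : Type) [MeasurableSpace Ω] (μ : Measure Ω) [IsProbabilityMeasure μ] (η : Z2 → Ω → ℝ), DG μ N η → μ (GE N γ α κ η)ᶜ ≤ ENNReal.ofReal (b N) := by
  obtain ⟨N0, hU⟩ := upper_all hγ hγ1 hc
  have hc1 := c1_pos hγ hγ1
  have hc1' := c1_le hγ hγ1
  set c' := c1 γ / 40 with hc'
  have hc0 : 0 < c' := by positivity
  have hs : γ * (c' / (10 * γ)) = c' / 10 := by field_simp
  obtain ⟨Λ, ϑ, hΛ, hϑ, hT⟩ := top_bound hγ (s := c' / (10 * γ)) (by positivity) (by rw [hs, hc']; linarith)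
  rw [hs] at hT
  refine ⟨c' / (10 * Λ), by positivity, fun κ hκ hκ1 => ?_⟩
  obtain ⟨C, hC, N1, hT⟩ := hT κ hκ hκ1
  refine ⟨fun N => 200000 * (((N : ℝ) ^ c') ^ 3)⁻¹ + 2 * (C * ((N : ℝ) ^ (c' / 10 * ϑ))⁻¹), ?_, ?_⟩
  · have h1 := ((tendsto_pow_atTop (three_ne_zero)).comp (tendsto_npow hc0)).inv_tendsto_atTop.const_mul 200000
    have h2 := ((tendsto_npow (show 0 < c' / 10 * ϑ by positivity)).inv_tendsto_atTop.const_mul C).const_mul 2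
    have h3 := h1.add h2
    simp only [mul_zero, add_zero] at h3
    exact h3
  have hbig := (tendsto_npow (show 0 < c' / 2 by positivity)).eventually_ge_atTop (2 * rexp (102 * γ ^ 2))
  filter_upwards [hbig, eventually_ge_atTop N0, eventually_ge_atTop N1, eventually_ge_atTop 2] with N hb hN0 hN1 hN2
  intro Ω _ μ _ η D
  have hNp : (0 : ℝ) < N := by exact_mod_cast (by omega : 0 < N)
  have hN1' : (1 : ℝ) ≤ N := by exact_mod_cast (by omega : 1 ≤ N)
  obtain ⟨Ω', _, ν, W, hν, hW⟩ := exists_WN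
  have h1 : μ (GE N γ (c' / (10 * Λ)) κ η)ᶜ ≤ μ {ω | ∃ x ∈ VN N, ∃ y ∈ VN N, ¬ Reach N γ η ω x y (ENNReal.ofReal ((N : ℝ) ^ (1 - c')))} +
      μ {ω | ∃ P ∈ Bad N κ, pWeight γ η ω P ≤ (N : ℝ) ^ (1 + Λ - 9 / 10 * c') / (P.length : ℝ) ^ Λ} := by
    refine (measure_mono fun ω hω => ?_).trans (measure_union_le _ _)
    exact bad_event hΛ (by field_simp) hN2 hω
  have h2 := dg_couple D hW γ (Bad N κ) (fun P hP z hz => hP.1.2.2 z hz) (fun P => (N : ℝ) ^ (1 + Λ - 9 / 10 * c') / (P.length : ℝ) ^ Λ)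
  have h3 := hT N hN1 Ω' ν W hW ((N : ℝ) ^ (1 + Λ - 2 / 10 * c')) (by positivity)
  have h4 : ν {ω | ∃ P ∈ Bad N κ, ∑ z ∈ P.toFinset, rexp (γ * YY (fun i => W i ω) (Nat.clog 2 N + 1) z) ≤
      2 * rexp (51 * γ ^ 2 * (Nat.clog 2 N + 1)) * ((N : ℝ) ^ (1 + Λ - 9 / 10 * c') / (P.length : ℝ) ^ Λ)} ≤ ENNReal.ofReal (C * ((N : ℝ) ^ (c' / 10 * ϑ))⁻¹) := by
    refine (measure_mono ?_).trans (h3.trans (le_of_eq ?_))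
    · rintro ω ⟨P, hP, hle⟩
      refine ⟨P, hP, ?_⟩
      have hlen0 : (0 : ℝ) < P.length := by exact_mod_cast List.length_pos_iff.2 hP.1.1
      rw [← mul_div_assoc, le_div_iff₀ (by positivity)] at hle
      refine hle.trans ?_
      calc _ ≤ 2 * (rexp (102 * γ ^ 2) * (N : ℝ) ^ (c' / 16)) * (N : ℝ) ^ (1 + Λ - 9 / 10 * c') := by
            gcongr; exact clog_exp hc hN2
        _ = 2 * rexp (102 * γ ^ 2) * ((N : ℝ) ^ (c' / 16) * (N : ℝ) ^ (1 + Λ - 9 / 10 * c')) := by ring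
        _ ≤ (N : ℝ) ^ (c' / 2) * ((N : ℝ) ^ (c' / 16) * (N : ℝ) ^ (1 + Λ - 9 / 10 * c')) := by gcongr
        _ = (N : ℝ) ^ (c' / 2 + (c' / 16 + (1 + Λ - 9 / 10 * c'))) := by rw [← Real.rpow_add hNp, ← Real.rpow_add hNp]
        _ ≤ _ := Real.rpow_le_rpow_of_exponent_le hN1' (by linarith)
    · congr 2
      rw [← Real.rpow_sub hNp, ← Real.rpow_mul hNp.le, ← Real.rpow_neg hNp.le]
      congr 1; ring
  refine h1.trans ((add_le_add (hU N hN0 Ω μ η D) (h2.trans (mul_le_mul_right h4 2))).trans (le_of_eq ?_))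
  rw [ENNReal.ofReal_add (by positivity) (by positivity), ENNReal.ofReal_mul (p := 2) (by norm_num)]
  simp

lemma meas_version {Ω : Type*} [MeasurableSpace Ω] {μ : Measure Ω} {N : ℕ} {η : Z2 → Ω → ℝ} (h : GFam μ η) (h0 : ∀ z, z ∉ V5N N → η z = 0)
    (hcov : ∀ x ∈ V5N N, ∀ y ∈ V5N N, ∫ ω, η x ω * η y ω ∂μ = greenFn (V5N N) x y) :
    ∃ η' : Z2 → Ω → ℝ, DG μ N η' ∧ ∀ᵐ ω ∂μ, ∀ z, η z ω = η' z ω := by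
  classical
  set η' : Z2 → Ω → ℝ := fun z => if z ∈ V5N N then (h.aem z).mk (η z) else 0 with hη'
  have hae : ∀ z, η z =ᵐ[μ] η' z := by
    intro z
    by_cases hz : z ∈ V5N N
    · simp only [hη', if_pos hz]; exact (h.aem z).ae_eq_mk
    · simp only [hη', if_neg hz, h0 z hz]; rfl
  refine ⟨η', ⟨fun z => ?_, fun s c => ?_, fun z hz => if_neg hz, fun x hx y hy => ?_⟩, ae_all_iff.2 hae⟩
  · by_cases hz : z ∈ V5N N
    · simp only [hη', if_pos hz]; exact (h.aem z).measurable_mk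
    · simp only [hη', if_neg hz]; exact measurable_const
  · obtain ⟨v, hv⟩ := h s c
    refine ⟨v, ?_⟩
    rw [← hv]
    refine Measure.map_congr ?_
    filter_upwards [ae_all_iff.2 hae] with ω hω
    simp only [hω]
  · rw [← hcov x hx y hy]
    refine integral_congr_ae ?_
    filter_upwards [ae_all_iff.2 hae] with ω hω
    simp only [hω]

/-- **Geodesic dimension is strictly larger than 1 at high temperatures.**
There is `γ₀ > 0` such that for every `0 < γ < γ₀` there is `α = α(γ) > 0` so that
for every `κ ∈ (0,1)`: with probability tending to `1` as `N → ∞`, simultaneously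
for all `x, y ∈ V_N` with `‖x - y‖ ≥ κ N`, every Liouville-FPP-minimizing path in
`V_N` joining `x` and `y` contains more than `N^{1+α}` lattice points. -/
theorem geodesic_dimension_gt_one :
    ∃ γ₀ : ℝ, 0 < γ₀ ∧ ∀ γ : ℝ, 0 < γ → γ < γ₀ →
      ∃ α : ℝ, 0 < α ∧ ∀ κ : ℝ, 0 < κ → κ < 1 →
        ∀ (Ω : Type) (_ : MeasureSpace Ω), IsProbabilityMeasure (ℙ : Measure Ω) →
          ∀ η : ℕ → Z2 → Ω → ℝ, (∀ N, IsDGFF (V5N N) (η N)) →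
            Tendsto
              (fun N : ℕ => ℙ {ω : Ω |
                ∀ x ∈ VN N, ∀ y ∈ VN N, κ * N ≤ eZ x y →
                  ∀ P : List Z2, LPathIn (VN N) P →
                    P.head? = some x → P.getLast? = some y →
                    (∀ Q : List Z2, LPathIn (VN N) Q →
                      Q.head? = some x → Q.getLast? = some y →
                      pWeight γ (η N) ω P ≤ pWeight γ (η N) ω Q) →
                    (N : ℝ) ^ ((1 : ℝ) + α) < (P.toFinset.card : ℝ)})
              atTop (nhds 1) := by
  obtain ⟨g, hg, hgγ⟩ := g0_exists
  refine ⟨g, hg, fun γ hγ hlt => ?_⟩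
  obtain ⟨hγ1, hc⟩ := hgγ γ hγ hlt
  obtain ⟨α, hα, H⟩ := final_bound hγ hγ1 hc
  refine ⟨α, hα, fun κ hκ hκ1 Ω _ hP η hη => ?_⟩
  obtain ⟨b, hb, hE⟩ := H κ hκ hκ1
  change Tendsto (fun N : ℕ => ℙ (GE N γ α κ (η N))) atTop (nhds 1)
  have hb' : Tendsto (fun N => 1 - ENNReal.ofReal (b N)) atTop (nhds 1) := by
    have h1 := (ENNReal.tendsto_ofReal hb)
    rw [ENNReal.ofReal_zero] at h1
    have h2 := ENNReal.Tendsto.sub (tendsto_const_nhds (x := (1 : ENNReal)) (f := atTop (α := ℕ))) h1 (Or.inl ENNReal.one_ne_top)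
    simpa using h2
  refine tendsto_of_tendsto_of_tendsto_of_le_of_le' hb' tendsto_const_nhds ?_ (Eventually.of_forall fun N => prob_le_one)
  filter_upwards [hE] with N hN
  obtain ⟨η', D, hae⟩ := meas_version (hη N).1 (hη N).2.1 (hη N).2.2
  have h1 : ℙ (GE N γ α κ (η N))ᶜ ≤ ENNReal.ofReal (b N) := by
    refine le_trans (measure_mono_ae ?_) (hN Ω ℙ η' D)
    filter_upwards [hae] with ω hω hmem hmem2
    refine hmem ?_
    have e : ∀ P, pWeight γ (η N) ω P = pWeight γ η' ω P := fun P => by simp only [pWeight, hω]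
    simp only [GE, mem_ofPred_eq] at hmem2 ⊢
    simp only [e]
    exact hmem2
  rw [tsub_le_iff_right]
  calc (1 : ENNReal) = ℙ (univ : Set Ω) := measure_univ.symm
    _ ≤ ℙ (GE N γ α κ (η N)) + ℙ (GE N γ α κ (η N))ᶜ := by
        rw [← union_compl_self (GE N γ α κ (η N))]; exact measure_union_le _ _
    _ ≤ _ := add_le_add le_rfl h1
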